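/- Exceptional character dichotomy for primes in progressions: For every ε > 0 there is a constant C = C(ε) > 0 such that for all natural numbers q ≥ 1, all real x ≥ max(q^{10}, C) with Q = q·log x, and all a with gcd(a,q) = 1, at least one of the following holds: (i) | ∑_{n ≤ x, n ≡ a (mod q)} Λ(n) − x/φ(q) | ≤ C · (x/φ(q)) · ( log(log x/log Q) )^{−1}; or (ii) there is a non-principal real (quadratic) Dirichlet character χ mod q such that ∑ over primes p with Q ≤ p ≤ x of (1+χ(p))/p ≤ 30·log log(log x/log Q) + C, and moreover | ∑_{n ≤ x, n ≡ a (mod q)} Λ(n) − x/φ(q) − (χ(a)/φ(q))·∑_{n ≤ x} Λ(n)·χ(n) | ≤ C · (x/φ(q)) · (log Q/log x)^{1 − 1/√2 − ε}. -/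

import Mathlib

namespace ExcChar

open Finset Real
open scoped ArithmeticFunction.vonMangoldt

lemma sum_vonMangoldt_div_le (N : ℕ) (hN : 1 ≤ N) :
    ∑ n ∈ Ioc 0 N, Λ n / (n : ℝ) ≤ Real.log N + 6 := by
  have hN0 : (0 : ℝ) < N := by exact_mod_cast hN
  have h1 : ∑ n ∈ Ioc 0 N, Real.log n = ∑ n ∈ Ioc 0 N, Λ n * ((N / n : ℕ) : ℝ) := by
    rw [← ArithmeticFunction.sum_Ioc_mul_zeta_eq_sum, ArithmeticFunction.vonMangoldt_mul_zeta]
    rfl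
  have h2 : ∑ n ∈ Ioc 0 N, Real.log n ≤ N * Real.log N := by
    calc ∑ n ∈ Ioc 0 N, Real.log n ≤ ∑ n ∈ Ioc 0 N, Real.log N := by
          refine sum_le_sum fun n hn => ?_
          rw [mem_Ioc] at hn
          exact Real.log_le_log (by exact_mod_cast hn.1) (by exact_mod_cast hn.2)
      _ = _ := by simp
  have h3 : Chebyshev.psi N ≤ (Real.log 4 + 4) * N := Chebyshev.psi_le_const_mul_self hN0.le
  have h4 : Chebyshev.psi N = ∑ n ∈ Ioc 0 N, Λ n := by
    simp [Chebyshev.psi]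
  have h5 : N * ∑ n ∈ Ioc 0 N, Λ n / (n : ℝ) ≤
      ∑ n ∈ Ioc 0 N, Λ n * ((N / n : ℕ) : ℝ) + ∑ n ∈ Ioc 0 N, Λ n := by
    rw [mul_sum, ← sum_add_distrib]
    refine sum_le_sum fun n hn => ?_
    have hn0 : (0 : ℝ) < n := by exact_mod_cast (mem_Ioc.1 hn).1
    have : (N : ℝ) / n ≤ ((N / n : ℕ) : ℝ) + 1 := by
      have := (Nat.lt_floor_add_one ((N : ℝ) / n)).le
      rwa [Nat.floor_div_eq_div] at this
    calc (N : ℝ) * (Λ n / n) = Λ n * (N / n) := by ring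
      _ ≤ Λ n * (((N / n : ℕ) : ℝ) + 1) :=
        mul_le_mul_of_nonneg_left this ArithmeticFunction.vonMangoldt_nonneg
      _ = _ := by ring
  have h6 : Real.log 4 ≤ 2 := by
    have : Real.log 4 = 2 * Real.log 2 := by
      rw [show (4 : ℝ) = 2 ^ 2 by norm_num, Real.log_pow]; norm_num
    have := Real.log_two_lt_d9
    linarith
  have h7 : (N : ℝ) * ∑ n ∈ Ioc 0 N, Λ n / (n : ℝ) ≤ N * (Real.log N + 6) := by
    nlinarith
  exact le_of_mul_le_mul_left h7 hN0

/-- Reciprocals of the primes in `(w, y]`. -/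
lemma sum_prime_inv_le (w : ℝ) (hw : 1 < w) (y : ℕ) (hy : 1 ≤ y) (S : Finset ℕ)
    (hS : ∀ p ∈ S, p.Prime ∧ w ≤ p ∧ p ≤ y) :
    ∑ p ∈ S, (1 : ℝ) / p ≤ (Real.log y + 6) / Real.log w := by
  have hlw : 0 < Real.log w := Real.log_pos hw
  rw [le_div_iff₀ hlw, sum_mul]
  refine le_trans ?_ (sum_vonMangoldt_div_le y hy)
  calc ∑ p ∈ S, (1 : ℝ) / p * Real.log w ≤ ∑ p ∈ S, Λ p / (p : ℝ) := by
        refine sum_le_sum fun p hp => ?_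
        obtain ⟨h1, h2, h3⟩ := hS p hp
        rw [ArithmeticFunction.vonMangoldt_apply_prime h1, div_mul_eq_mul_div, one_mul]
        gcongr
    _ ≤ _ := by
        refine sum_le_sum_of_subset_of_nonneg ?_ fun _ _ _ =>
          div_nonneg ArithmeticFunction.vonMangoldt_nonneg (Nat.cast_nonneg _)
        intro p hp
        obtain ⟨h1, h2, h3⟩ := hS p hp
        exact mem_Ioc.2 ⟨h1.pos, h3⟩

/-- The Mertens product over the primes up to `z`. -/
noncomputable def mert (z : ℕ) : ℝ := ∏ p ∈ z.primesLE, (1 - 1 / (p : ℝ))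

lemma one_sub_inv_pos {p : ℕ} (hp : p.Prime) : (0 : ℝ) < 1 - 1 / (p : ℝ) := by
  have : (1 : ℝ) < p := by exact_mod_cast hp.one_lt
  rw [sub_pos, div_lt_one (by linarith)]
  exact this

lemma one_sub_inv_le_one {p : ℕ} : 1 - 1 / (p : ℝ) ≤ 1 := by
  have : (0 : ℝ) ≤ 1 / (p : ℝ) := by positivity
  linarith

lemma mert_pos (z : ℕ) : 0 < mert z :=
  prod_pos fun _ hp => one_sub_inv_pos (Nat.prime_of_mem_primesLE hp)

lemma mert_le (z : ℕ) (hz : 2 ≤ z) : mert z ≤ 1 / Real.log z := by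
  have hlz : 0 < Real.log z := Real.log_pos (by exact_mod_cast hz)
  let f : ℕ →* ℝ :=
    { toFun := fun n => ((n : ℝ))⁻¹, map_one' := by simp, map_mul' := by intro a b; simp [mul_comm] }
  have hf : ∀ {p : ℕ}, p.Prime → ‖f p‖ < 1 := by
    intro p hp
    simp only [f, MonoidHom.coe_mk, OneHom.coe_mk, norm_inv, Real.norm_natCast]
    exact inv_lt_one_of_one_lt₀ (by exact_mod_cast hp.one_lt)
  obtain ⟨h1, h2⟩ := EulerProduct.summable_and_hasSum_smoothNumbers_prod_primesBelow_geometric hf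
    (z + 1)
  have h3 : ∑ n ∈ Icc 1 z, ((n : ℝ))⁻¹ ≤ ∏ p ∈ (z + 1).primesBelow, (1 - f p)⁻¹ := by
    let g : {x // x ∈ Icc 1 z} → (z + 1).smoothNumbers := fun n =>
      ⟨n.1, Nat.mem_smoothNumbers_of_lt (mem_Icc.1 n.2).1 (Nat.lt_succ_of_le (mem_Icc.1 n.2).2)⟩
    have hg : Function.Injective g := by
      intro a b h
      exact Subtype.ext (show (g a : ℕ) = (g b : ℕ) by rw [h])
    have h4 := sum_le_hasSum (univ.map ⟨g, hg⟩) (fun i _ => by simp [f]) h2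
    rw [sum_map] at h4
    rw [← sum_coe_sort]
    exact h4
  have h5 : Real.log z ≤ ∑ n ∈ Icc 1 z, ((n : ℝ))⁻¹ := by
    have := log_add_one_le_harmonic z
    rw [harmonic_eq_sum_Icc] at this
    push_cast at this
    refine le_trans (Real.log_le_log (by positivity) (by simp)) this
  have h6 : (mert z)⁻¹ = ∏ p ∈ (z + 1).primesBelow, (1 - f p)⁻¹ := by
    rw [mert, ← prod_inv_distrib]
    simp [f, Nat.primesLE]
  rw [one_div]
  rw [le_inv_comm₀ (mert_pos z) hlz, h6]
  exact h5.trans h3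


/-- A convenient product-to-exponential bound. -/
lemma exp_neg_two_mul_le {x : ℝ} (h0 : 0 ≤ x) (h1 : x ≤ 1 / 2) : Real.exp (-2 * x) ≤ 1 - x := by
  have h2 : Real.exp (-2 * x) * Real.exp (2 * x) = 1 := by rw [← Real.exp_add]; simp
  have h3 : 2 * x + 1 ≤ Real.exp (2 * x) := Real.add_one_le_exp _
  have h4 : 0 < Real.exp (-2 * x) := Real.exp_pos _
  nlinarith

lemma prod_one_sub_ge (S : Finset ℕ) (hS : ∀ p ∈ S, p.Prime) :
    Real.exp (-2 * ∑ p ∈ S, (1 : ℝ) / p) ≤ ∏ p ∈ S, (1 - 1 / (p : ℝ)) := by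
  rw [mul_sum, Real.exp_sum]
  refine prod_le_prod (fun _ _ => (Real.exp_pos _).le) fun p hp => ?_
  refine exp_neg_two_mul_le (by positivity) ?_
  have : (2 : ℝ) ≤ p := by exact_mod_cast (hS p hp).two_le
  gcongr

end ExcChar

namespace ExcChar

open Finset Real

/-- Elementary symmetric sums. -/
noncomputable def esum (m : ℕ) (S : Finset ℕ) (x : ℕ → ℝ) : ℝ :=
  ∑ A ∈ S.powersetCard m, ∏ p ∈ A, x p

/-- Truncated inclusion-exclusion sums. -/
noncomputable def tsumm (m : ℕ) (S : Finset ℕ) (x : ℕ → ℝ) : ℝ :=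
  ∑ i ∈ range (m + 1), (-1) ^ i * esum i S x

lemma esum_zero (S : Finset ℕ) (x : ℕ → ℝ) : esum 0 S x = 1 := by simp [esum]

lemma esum_empty (m : ℕ) (x : ℕ → ℝ) : esum (m + 1) ∅ x = 0 := by
  rw [esum, powersetCard_eq_empty.2 (by simp)]; simp

lemma esum_insert (m : ℕ) {S : Finset ℕ} {p : ℕ} (hp : p ∉ S) (x : ℕ → ℝ) :
    esum (m + 1) (insert p S) x = esum (m + 1) S x + x p * esum m S x := by
  unfold esum
  rw [powersetCard_succ_insert hp, sum_union, sum_image, mul_sum]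
  · congr 1
    refine sum_congr rfl fun A hA => ?_
    rw [prod_insert fun h => hp ((mem_powersetCard.1 hA).1 h)]
  · intro A hA B hB h
    have hA' : p ∉ A := fun h => hp ((mem_powersetCard.1 hA).1 h)
    have hB' : p ∉ B := fun h => hp ((mem_powersetCard.1 hB).1 h)
    rw [← erase_insert hA', ← erase_insert hB', h]
  · rw [disjoint_left]
    intro A hA hB
    obtain ⟨B, _, rfl⟩ := mem_image.1 hB
    exact hp ((mem_powersetCard.1 hA).1 (mem_insert_self p B))

lemma esum_nonneg (m : ℕ) (S : Finset ℕ) (x : ℕ → ℝ) (hx : ∀ p ∈ S, 0 ≤ x p) :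
    0 ≤ esum m S x :=
  sum_nonneg fun _ hA => prod_nonneg fun p hp => hx p ((mem_powersetCard.1 hA).1 hp)

lemma tsumm_zero (S : Finset ℕ) (x : ℕ → ℝ) : tsumm 0 S x = 1 := by simp [tsumm, esum_zero]

lemma tsumm_insert (m : ℕ) {S : Finset ℕ} {p : ℕ} (hp : p ∉ S) (x : ℕ → ℝ) :
    tsumm (m + 1) (insert p S) x = tsumm (m + 1) S x - x p * tsumm m S x := by
  unfold tsumm
  rw [sum_range_succ', sum_range_succ' _ (m + 1)]
  simp only [esum_insert _ hp, esum_zero]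
  rw [mul_sum, add_sub_right_comm, ← sum_sub_distrib]
  congr 1
  refine sum_congr rfl fun i _ => ?_
  ring

lemma tsumm_empty (m : ℕ) (x : ℕ → ℝ) : tsumm m ∅ x = 1 := by
  unfold tsumm
  rw [sum_range_succ']
  simp [esum_empty, esum_zero]

lemma bonferroni (S : Finset ℕ) (x : ℕ → ℝ) (hx : ∀ p ∈ S, 0 ≤ x p ∧ x p ≤ 1) (m : ℕ) :
    0 ≤ (-1) ^ m * (tsumm m S x - ∏ p ∈ S, (1 - x p)) ∧
      (-1) ^ m * (tsumm m S x - ∏ p ∈ S, (1 - x p)) ≤ esum (m + 1) S x := by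
  induction S using Finset.induction_on generalizing m with
  | empty => simp [tsumm_empty, esum_empty]
  | insert p S hp ih =>
    have ih' := ih fun r hr => hx r (mem_insert_of_mem hr)
    obtain ⟨h0, h1⟩ := hx p (mem_insert_self p S)
    have hP0 : 0 ≤ ∏ p ∈ S, (1 - x p) :=
      prod_nonneg fun r hr => sub_nonneg.2 (hx r (mem_insert_of_mem hr)).2
    have hP1 : ∏ p ∈ S, (1 - x p) ≤ 1 :=
      prod_le_one (fun r hr => sub_nonneg.2 (hx r (mem_insert_of_mem hr)).2)
        fun r hr => sub_le_self _ (hx r (mem_insert_of_mem hr)).1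
    rw [prod_insert hp]
    cases m with
    | zero =>
      have := ih' 0
      rw [tsumm_zero] at this ⊢
      rw [esum_insert _ hp, esum_zero]
      simp only [pow_zero, one_mul] at this ⊢
      constructor <;> nlinarith
    | succ m =>
      have a1 := ih' (m + 1)
      have a2 := ih' m
      rw [tsumm_insert m hp, esum_insert _ hp]
      have e1 : (-1 : ℝ) ^ (m + 1) * (tsumm (m + 1) S x - x p * tsumm m S x
          - (1 - x p) * ∏ p ∈ S, (1 - x p))
          = (-1) ^ (m + 1) * (tsumm (m + 1) S x - ∏ p ∈ S, (1 - x p)) +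
            x p * ((-1) ^ m * (tsumm m S x - ∏ p ∈ S, (1 - x p))) := by ring
      rw [e1]
      have b1 := mul_nonneg h0 a2.1
      have b2 := mul_le_mul_of_nonneg_left a2.2 h0
      constructor <;> linarith [a1.1, a1.2]

lemma esum_le (m : ℕ) (S : Finset ℕ) (x : ℕ → ℝ) (hx : ∀ p ∈ S, 0 ≤ x p) :
    esum m S x ≤ Real.exp (-m) * Real.exp (Real.exp 1 * ∑ p ∈ S, x p) := by
  have h1 : Real.exp m * esum m S x ≤ ∏ p ∈ S, (1 + Real.exp 1 * x p) := by
    rw [prod_one_add, esum, mul_sum]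
    refine le_trans (sum_le_sum (g := fun A => ∏ p ∈ A, (Real.exp 1 * x p)) fun A hA => ?_) ?_
    · rw [prod_mul_distrib, prod_const, (mem_powersetCard.1 hA).2, ← Real.exp_nat_mul, mul_one]
    · refine sum_le_sum_of_subset_of_nonneg ?_ fun A hA _ => ?_
      · intro A hA
        exact mem_powerset.2 (mem_powersetCard.1 hA).1
      · exact prod_nonneg fun p hp => mul_nonneg (Real.exp_pos _).le (hx p (mem_powerset.1 hA hp))
  have h2 : ∏ p ∈ S, (1 + Real.exp 1 * x p) ≤ Real.exp (Real.exp 1 * ∑ p ∈ S, x p) := by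
    rw [mul_sum, Real.exp_sum]
    refine prod_le_prod (fun p hp => ?_) fun p hp => ?_
    · have := mul_nonneg (Real.exp_pos 1).le (hx p hp)
      linarith
    · rw [add_comm]; exact Real.add_one_le_exp _
  have h3 : Real.exp (-m) * Real.exp m = 1 := by rw [← Real.exp_add]; simp
  calc esum m S x = Real.exp (-m) * (Real.exp m * esum m S x) := by rw [← mul_assoc, h3, one_mul]
    _ ≤ _ := mul_le_mul_of_nonneg_left (h1.trans h2) (Real.exp_pos _).le

/-- Indicator of divisibility, as a function of the prime. -/
noncomputable def dind (n p : ℕ) : ℝ := if p ∣ n then 1 else 0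

/-- `F` averages over multiples in `I` as predicted by the density model, with error `M`. -/
def Avg (I : Finset ℕ) (H : ℝ) (G : ℕ → Prop) (F : (ℕ → ℝ) → ℝ) (M : ℝ) : Prop :=
  ∀ m : ℕ, G m → |∑ n ∈ I with m ∣ n, F (dind n) - H / m * F (fun p => 1 / (p : ℝ))| ≤ M

lemma Avg.sub {I : Finset ℕ} {H : ℝ} {G : ℕ → Prop} {F₁ F₂ : (ℕ → ℝ) → ℝ} {M₁ M₂ : ℝ}
    (h₁ : Avg I H G F₁ M₁) (h₂ : Avg I H G F₂ M₂) :
    Avg I H G (fun x => F₁ x - F₂ x) (M₁ + M₂) := by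
  intro m hm
  have a := h₁ m hm
  have b := h₂ m hm
  rw [sum_sub_distrib]
  calc _ = |(∑ n ∈ I with m ∣ n, F₁ (dind n) - H / m * F₁ (fun p => 1 / (p : ℝ))) -
        (∑ n ∈ I with m ∣ n, F₂ (dind n) - H / m * F₂ (fun p => 1 / (p : ℝ)))| := by
          congr 1; ring
    _ ≤ _ := (abs_sub _ _).trans (add_le_add a b)

lemma prod_dind {A : Finset ℕ} (hA : ∀ p ∈ A, p.Prime) (n : ℕ) :
    ∏ p ∈ A, dind n p = if (∏ p ∈ A, p) ∣ n then 1 else 0 := by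
  unfold dind
  rw [prod_ite_zero]
  congr 1
  · refine propext ⟨fun h => ?_, fun h p hp => (dvd_prod_of_mem _ hp).trans h⟩
    exact Finset.prod_primes_dvd n (fun p hp => (hA p hp).prime) h
  · simp

lemma Avg.mul_esum {I : Finset ℕ} {H : ℝ} {G G' : ℕ → Prop} {F : (ℕ → ℝ) → ℝ} {M : ℝ}
    (h : Avg I H G F M) {S : Finset ℕ} (hS : ∀ p ∈ S, p.Prime)
    (hG : ∀ m, G' m → (∀ p ∈ S, Nat.Coprime m p) ∧ ∀ A ⊆ S, G (m * ∏ p ∈ A, p)) (i : ℕ) :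
    Avg I H G' (fun x => F x * esum i S x) ((S.card : ℝ) ^ i * M) := by
  intro m hm
  obtain ⟨h1, h2⟩ := hG m hm
  have e1 : ∑ n ∈ I with m ∣ n, F (dind n) * esum i S (dind n) =
      ∑ A ∈ S.powersetCard i, ∑ n ∈ I with (m * ∏ p ∈ A, p) ∣ n, F (dind n) := by
    unfold esum
    simp_rw [mul_sum]
    rw [sum_comm]
    refine sum_congr rfl fun A hA => ?_
    have hA' := (mem_powersetCard.1 hA).1
    have hc : Nat.Coprime m (∏ p ∈ A, p) := Nat.Coprime.prod_right fun p hp => h1 p (hA' hp)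
    rw [sum_filter, sum_filter]
    refine sum_congr rfl fun n _ => ?_
    rw [prod_dind (fun p hp => hS p (hA' hp))]
    by_cases c1 : m ∣ n
    · by_cases c2 : (∏ p ∈ A, p) ∣ n
      · simp [c1, c2, hc.mul_dvd_of_dvd_of_dvd c1 c2]
      · have : ¬ (m * ∏ p ∈ A, p) ∣ n := fun h => c2 ((dvd_mul_left _ _).trans h)
        simp [c2, this]
    · have : ¬ (m * ∏ p ∈ A, p) ∣ n := fun h => c1 ((dvd_mul_right _ _).trans h)
      simp [c1, this]
  have e2 : H / m * (F (fun p => 1 / (p : ℝ)) * esum i S (fun p => 1 / (p : ℝ))) =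
      ∑ A ∈ S.powersetCard i,
        H / ((m * ∏ p ∈ A, p : ℕ) : ℝ) * F (fun p => 1 / (p : ℝ)) := by
    unfold esum
    rw [mul_sum, mul_sum]
    refine sum_congr rfl fun A _ => ?_
    push_cast
    rw [prod_div_distrib, prod_const_one]
    ring
  simp only
  rw [e1, e2, ← sum_sub_distrib]
  refine (abs_sum_le_sum_abs _ _).trans ?_
  refine (sum_le_sum fun A hA => h _ (h2 A (mem_powersetCard.1 hA).1)).trans ?_
  rw [sum_const, card_powersetCard, nsmul_eq_mul]
  have hM : 0 ≤ M := (abs_nonneg _).trans (h _ (h2 ∅ (empty_subset _)))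
  refine mul_le_mul_of_nonneg_right ?_ hM
  exact_mod_cast Nat.choose_le_pow _ _

lemma Avg.const_mul {I : Finset ℕ} {H : ℝ} {G : ℕ → Prop} {F : (ℕ → ℝ) → ℝ} {M : ℝ}
    (h : Avg I H G F M) (c : ℝ) : Avg I H G (fun x => c * F x) (|c| * M) := by
  intro m hm
  rw [← mul_sum, show H / m * (c * F (fun p => 1 / (p : ℝ))) =
    c * (H / m * F (fun p => 1 / (p : ℝ))) by ring, ← mul_sub, abs_mul]
  exact mul_le_mul_of_nonneg_left (h m hm) (abs_nonneg _)

lemma Avg.mono {I : Finset ℕ} {H : ℝ} {G : ℕ → Prop} {F : (ℕ → ℝ) → ℝ} {M M' : ℝ}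
    (h : Avg I H G F M) (hM : M ≤ M') : Avg I H G F M' := fun m hm => (h m hm).trans hM

lemma Avg.mul_tsumm {I : Finset ℕ} {H : ℝ} {G G' : ℕ → Prop} {F : (ℕ → ℝ) → ℝ} {M : ℝ}
    (hM : 0 ≤ M) (h : Avg I H G F M) {S : Finset ℕ} (hS : ∀ p ∈ S, p.Prime)
    (hG : ∀ m, G' m → (∀ p ∈ S, Nat.Coprime m p) ∧ ∀ A ⊆ S, G (m * ∏ p ∈ A, p)) (i : ℕ) :
    Avg I H G' (fun x => F x * tsumm i S x) (((S.card : ℝ) + 1) ^ i * M) := by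
  induction i with
  | zero =>
    have := h.mul_esum hS hG 0
    simpa [tsumm_zero, esum_zero] using this
  | succ i ih =>
    have e : (fun x => F x * tsumm (i + 1) S x) =
        fun x => F x * tsumm i S x - (-((-1) ^ (i + 1))) * (F x * esum (i + 1) S x) := by
      funext x
      rw [tsumm, sum_range_succ, ← tsumm]; ring
    rw [e]
    refine (ih.sub ((h.mul_esum hS hG (i + 1)).const_mul _)).mono ?_
    have h1 : |(-((-1 : ℝ) ^ (i + 1)))| = 1 := by simp
    have h2 : (S.card : ℝ) ^ i ≤ ((S.card : ℝ) + 1) ^ i := by gcongr; linarith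
    have h3 : (0 : ℝ) ≤ S.card := Nat.cast_nonneg _
    rw [h1, one_mul, ← add_mul]
    refine mul_le_mul_of_nonneg_right ?_ hM
    rw [pow_succ, pow_succ]
    nlinarith

section Levels

variable (P : ℕ → Finset ℕ) (k : ℕ → ℕ)

/-- Upper bound sieve function over the first `i` levels. -/
noncomputable def sU : ℕ → (ℕ → ℝ) → ℝ
  | 0, _ => 1
  | i + 1, x => sU i x * tsumm (2 * k i) (P i) x

/-- Lower bound sieve function over the first `i` levels. -/
noncomputable def sL : ℕ → (ℕ → ℝ) → ℝ
  | 0, _ => 1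
  | i + 1, x => sL i x * tsumm (2 * k i) (P i) x - sU P k i x * esum (2 * k i + 1) (P i) x

/-- The full sieve product over the first `i` levels. -/
noncomputable def sX (i : ℕ) (x : ℕ → ℝ) : ℝ := ∏ l ∈ range i, ∏ p ∈ P l, (1 - x p)

variable {P k}

lemma bonferroni_even {x : ℕ → ℝ} {i : ℕ} (hx : ∀ p ∈ P i, 0 ≤ x p ∧ x p ≤ 1) :
    ∏ p ∈ P i, (1 - x p) ≤ tsumm (2 * k i) (P i) x ∧
    tsumm (2 * k i) (P i) x ≤ ∏ p ∈ P i, (1 - x p) + esum (2 * k i + 1) (P i) x := by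
  have := bonferroni (P i) x hx (2 * k i)
  rw [pow_mul] at this
  simp only [even_two, Even.neg_pow, one_pow, one_mul] at this
  constructor <;> linarith [this.1, this.2]

lemma sieve_ineq (i : ℕ) {x : ℕ → ℝ} (hx : ∀ l < i, ∀ p ∈ P l, 0 ≤ x p ∧ x p ≤ 1) :
    0 ≤ sX P i x ∧ sL P k i x ≤ sX P i x ∧ sX P i x ≤ sU P k i x := by
  induction i with
  | zero => simp [sX, sL, sU]
  | succ i ih =>
    obtain ⟨h0, h1, h2⟩ := ih fun l hl => hx l (by omega)
    obtain ⟨b1, b2⟩ := bonferroni_even (k := k) (hx i (by omega))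
    have hP0 : 0 ≤ ∏ p ∈ P i, (1 - x p) :=
      prod_nonneg fun r hr => sub_nonneg.2 (hx i (by omega) r hr).2
    have he : 0 ≤ esum (2 * k i + 1) (P i) x :=
      esum_nonneg _ _ _ fun p hp => (hx i (by omega) p hp).1
    rw [sX, prod_range_succ, ← sX, sL, sU]
    refine ⟨mul_nonneg h0 hP0, ?_, ?_⟩
    · nlinarith [mul_le_mul_of_nonneg_right h1 (hP0.trans b1), mul_le_mul_of_nonneg_right h2 he,
        mul_le_mul_of_nonneg_left b2 h0]
    · exact mul_le_mul h2 b1 hP0 (h0.trans h2)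

lemma sieve_main (i : ℕ) (ε : ℕ → ℝ) (hε0 : ∀ l < i, 0 ≤ ε l)
    (hP : ∀ l < i, ∀ p ∈ P l, p.Prime)
    (hε : ∀ l < i, esum (2 * k l + 1) (P l) (fun p => 1 / (p : ℝ)) ≤
      ε l * ∏ p ∈ P l, (1 - 1 / (p : ℝ))) :
    sU P k i (fun p => 1 / (p : ℝ)) ≤ sX P i (fun p => 1 / (p : ℝ)) * ∏ l ∈ range i, (1 + ε l) ∧
    sU P k i (fun p => 1 / (p : ℝ)) - sL P k i (fun p => 1 / (p : ℝ)) ≤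
      sX P i (fun p => 1 / (p : ℝ)) * (∏ l ∈ range i, (1 + ε l)) * ∑ l ∈ range i, ε l := by
  induction i with
  | zero => simp [sX, sL, sU]
  | succ i ih =>
    obtain ⟨h1, h2⟩ := ih (fun l hl => hε0 l (by omega)) (fun l hl => hP l (by omega))
      (fun l hl => hε l (by omega))
    set x : ℕ → ℝ := fun p => 1 / (p : ℝ) with hxdef
    have hx : ∀ l < i + 1, ∀ p ∈ P l, 0 ≤ x p ∧ x p ≤ 1 := by
      intro l hl p hp
      have := one_sub_inv_pos (hP l hl p hp)
      exact ⟨by simp only [hxdef]; positivity, by simp only [hxdef]; linarith⟩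
    obtain ⟨c0, c1, c2⟩ := sieve_ineq (k := k) i fun l hl => hx l (by omega)
    obtain ⟨b1, b2⟩ := bonferroni_even (k := k) (hx i (by omega))
    have hV : 0 ≤ ∏ p ∈ P i, (1 - x p) :=
      prod_nonneg fun r hr => sub_nonneg.2 (hx i (by omega) r hr).2
    have he : 0 ≤ esum (2 * k i + 1) (P i) x :=
      esum_nonneg _ _ _ fun p hp => (hx i (by omega) p hp).1
    have hei := hε i (by omega)
    have e0 := hε0 i (by omega)
    have hpr : 0 ≤ ∏ l ∈ range i, (1 + ε l) :=
      prod_nonneg fun l hl => by have := hε0 l (by have := mem_range.1 hl; omega); linarith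
    have hsum : 0 ≤ ∑ l ∈ range i, ε l :=
      sum_nonneg fun l hl => hε0 l (by have := mem_range.1 hl; omega)
    have hT : tsumm (2 * k i) (P i) x ≤ (∏ p ∈ P i, (1 - x p)) * (1 + ε i) := by
      have : esum (2 * k i + 1) (P i) x ≤ ε i * ∏ p ∈ P i, (1 - x p) := hei
      linarith
    rw [sX, prod_range_succ, ← sX, sL, sU, prod_range_succ, sum_range_succ]
    constructor
    · calc sU P k i x * tsumm (2 * k i) (P i) x
          ≤ (sX P i x * ∏ l ∈ range i, (1 + ε l)) * ((∏ p ∈ P i, (1 - x p)) * (1 + ε i)) :=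
            mul_le_mul h1 hT (hV.trans b1) (mul_nonneg c0 hpr)
        _ = _ := by ring
    · have hXp : 0 ≤ sX P i x * ∏ l ∈ range i, (1 + ε l) := mul_nonneg c0 hpr
      calc sU P k i x * tsumm (2 * k i) (P i) x -
            (sL P k i x * tsumm (2 * k i) (P i) x - sU P k i x * esum (2 * k i + 1) (P i) x)
          = (sU P k i x - sL P k i x) * tsumm (2 * k i) (P i) x +
            sU P k i x * esum (2 * k i + 1) (P i) x := by ring
        _ ≤ (sX P i x * (∏ l ∈ range i, (1 + ε l)) * ∑ l ∈ range i, ε l) *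
            ((∏ p ∈ P i, (1 - x p)) * (1 + ε i)) +
            (sX P i x * ∏ l ∈ range i, (1 + ε l)) * (ε i * ∏ p ∈ P i, (1 - x p)) := by
              refine add_le_add (mul_le_mul h2 hT (hV.trans b1) (mul_nonneg hXp hsum))
                (mul_le_mul h1 hei he hXp)
        _ ≤ _ := by
              have : 0 ≤ (sX P i x * ∏ l ∈ range i, (1 + ε l)) *
                (ε i * ∏ p ∈ P i, (1 - x p)) * ε i := by positivity
              linarith

lemma sieve_err (q i : ℕ) {I : Finset ℕ} {H : ℝ}
    (hI : ∀ m : ℕ, Nat.Coprime m q → |((I.filter (m ∣ ·)).card : ℝ) - H / m| ≤ 2)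
    (hP : ∀ l < i, ∀ p ∈ P l, p.Prime ∧ Nat.Coprime p q)
    (hd : ∀ l < i, ∀ j < l, Disjoint (P j) (P l)) :
    Avg I H (fun m => Nat.Coprime m q ∧ ∀ l < i, ∀ p ∈ P l, Nat.Coprime m p) (sU P k i)
      (2 * ∏ l ∈ range i, (2 * ((P l).card + 1 : ℝ) ^ (2 * k l + 1))) ∧
    Avg I H (fun m => Nat.Coprime m q ∧ ∀ l < i, ∀ p ∈ P l, Nat.Coprime m p) (sL P k i)
      (2 * ∏ l ∈ range i, (2 * ((P l).card + 1 : ℝ) ^ (2 * k l + 1))) := by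
  induction i with
  | zero =>
    have : Avg I H (fun m => Nat.Coprime m q) (fun _ => 1) 2 := by
      intro m hm
      simpa using hI m hm
    constructor
    · intro m hm; simpa [sU] using this m hm.1
    · intro m hm; simpa [sL] using this m hm.1
  | succ i ih =>
    obtain ⟨h1, h2⟩ := ih (fun l hl => hP l (by omega)) (fun l hl => hd l (by omega))
    set M := 2 * ∏ l ∈ range i, (2 * ((P l).card + 1 : ℝ) ^ (2 * k l + 1)) with hMdef
    have hb : ∀ l, (0 : ℝ) ≤ (P l).card + 1 := fun l => by
      have : (0 : ℝ) ≤ (P l).card := Nat.cast_nonneg _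
      linarith
    have hM : 0 ≤ M := mul_nonneg zero_le_two
      (prod_nonneg fun l _ => mul_nonneg zero_le_two (pow_nonneg (hb l) _))
    have hS : ∀ p ∈ P i, p.Prime := fun p hp => (hP i (by omega) p hp).1
    have hG : ∀ m, (Nat.Coprime m q ∧ ∀ l < i + 1, ∀ p ∈ P l, Nat.Coprime m p) →
        (∀ p ∈ P i, Nat.Coprime m p) ∧ ∀ A ⊆ P i, (Nat.Coprime (m * ∏ p ∈ A, p) q ∧
          ∀ l < i, ∀ p ∈ P l, Nat.Coprime (m * ∏ p ∈ A, p) p) := by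
      rintro m ⟨g1, g2⟩
      refine ⟨g2 i (by omega), fun A hA => ⟨?_, ?_⟩⟩
      · exact g1.mul_left (Nat.Coprime.prod_left fun p hp => (hP i (by omega) p (hA hp)).2)
      · intro l hl p hp
        refine (g2 l (by omega) p hp).mul_left (Nat.Coprime.prod_left fun r hr => ?_)
        refine (Nat.coprime_primes (hS r (hA hr)) (hP l (by omega) p hp).1).2 ?_
        rintro rfl
        exact disjoint_left.1 (hd i (by omega) l hl) hp (hA hr)
    have t1 := h1.mul_tsumm hM hS hG (2 * k i)
    have t2 := h2.mul_tsumm hM hS hG (2 * k i)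
    have t3 := h1.mul_esum hS hG (2 * k i + 1)
    have hc : (0 : ℝ) ≤ (P i).card := Nat.cast_nonneg _
    have hpow : ((P i).card + 1 : ℝ) ^ (2 * k i) ≤ ((P i).card + 1 : ℝ) ^ (2 * k i + 1) :=
      pow_le_pow_right₀ (by linarith) (by omega)
    have hpow2 : ((P i).card : ℝ) ^ (2 * k i + 1) ≤ ((P i).card + 1 : ℝ) ^ (2 * k i + 1) := by
      gcongr; linarith
    have hpos : 0 ≤ ((P i).card + 1 : ℝ) ^ (2 * k i + 1) := pow_nonneg (hb i) _
    have e : 2 * ∏ l ∈ range (i + 1), (2 * ((P l).card + 1 : ℝ) ^ (2 * k l + 1)) =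
        (2 * ((P i).card + 1 : ℝ) ^ (2 * k i + 1)) * M := by
      rw [prod_range_succ, hMdef]; ring
    rw [e]
    constructor
    · exact t1.mono (mul_le_mul_of_nonneg_right (by linarith) hM)
    · refine (t2.sub t3).mono ?_
      rw [← add_mul]
      exact mul_le_mul_of_nonneg_right (by linarith) hM

end Levels

lemma sX_dind (P : ℕ → Finset ℕ) (i n : ℕ) :
    sX P i (dind n) = if ∀ l < i, ∀ p ∈ P l, ¬ p ∣ n then 1 else 0 := by
  have : ∀ p, 1 - dind n p = if ¬ p ∣ n then 1 else 0 := by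
    intro p; unfold dind; split_ifs <;> simp_all
  simp only [sX, this, prod_ite_zero, mem_range]
  simp

/-- Brun–Hooley sieve in abstract form. -/
theorem sieve_abstract {P : ℕ → Finset ℕ} {k : ℕ → ℕ} (q i : ℕ) {I : Finset ℕ} {H : ℝ} (hH : 0 ≤ H)
    (hI : ∀ m : ℕ, Nat.Coprime m q → |((I.filter (m ∣ ·)).card : ℝ) - H / m| ≤ 2)
    (hP : ∀ l < i, ∀ p ∈ P l, p.Prime ∧ Nat.Coprime p q)
    (hd : ∀ l < i, ∀ j < l, Disjoint (P j) (P l))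
    (ε : ℕ → ℝ) (hε0 : ∀ l < i, 0 ≤ ε l)
    (hε : ∀ l < i, esum (2 * k l + 1) (P l) (fun p => 1 / (p : ℝ)) ≤
      ε l * ∏ p ∈ P l, (1 - 1 / (p : ℝ))) :
    |((I.filter (fun n => ∀ l < i, ∀ p ∈ P l, ¬ p ∣ n)).card : ℝ) -
      H * sX P i (fun p => 1 / (p : ℝ))| ≤
      H * sX P i (fun p => 1 / (p : ℝ)) * ((∏ l ∈ range i, (1 + ε l)) * ∑ l ∈ range i, ε l) +
      2 * ∏ l ∈ range i, (2 * ((P l).card + 1 : ℝ) ^ (2 * k l + 1)) := by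
  obtain ⟨a1, a2⟩ := sieve_err (k := k) q i hI hP hd
  have g1 : Nat.Coprime 1 q ∧ ∀ l < i, ∀ p ∈ P l, Nat.Coprime 1 p := by simp
  have a1 := a1 1 g1
  have a2 := a2 1 g1
  simp only [one_dvd, filter_true, Nat.cast_one, div_one] at a1 a2
  obtain ⟨m1, m2⟩ := sieve_main (k := k) i ε hε0 (fun l hl p hp => (hP l hl p hp).1) hε
  have hx : ∀ l < i, ∀ p ∈ P l, 0 ≤ (1 / (p : ℝ)) ∧ (1 / (p : ℝ)) ≤ 1 := by
    intro l hl p hp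
    have := one_sub_inv_pos (hP l hl p hp).1
    exact ⟨by positivity, by linarith⟩
  obtain ⟨c0, c1, c2⟩ := sieve_ineq (k := k) (x := fun p => 1 / (p : ℝ)) i hx
  have hcard : ((I.filter (fun n => ∀ l < i, ∀ p ∈ P l, ¬ p ∣ n)).card : ℝ) =
      ∑ n ∈ I, sX P i (dind n) := by
    simp_rw [sX_dind]
    simp
  have hxn : ∀ n, ∀ l < i, ∀ p ∈ P l, 0 ≤ dind n p ∧ dind n p ≤ 1 := by
    intro n l _ p _
    unfold dind; split_ifs <;> norm_num
  have hle : ∑ n ∈ I, sX P i (dind n) ≤ ∑ n ∈ I, sU P k i (dind n) :=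
    sum_le_sum fun n _ => (sieve_ineq i (hxn n)).2.2
  have hge : ∑ n ∈ I, sL P k i (dind n) ≤ ∑ n ∈ I, sX P i (dind n) :=
    sum_le_sum fun n _ => (sieve_ineq i (hxn n)).2.1
  rw [hcard]
  have hm := mul_le_mul_of_nonneg_left m2 hH
  have hc1 := mul_le_mul_of_nonneg_left c1 hH
  have hc2 := mul_le_mul_of_nonneg_left c2 hH
  rw [abs_le] at a1 a2 ⊢
  constructor <;> linarith [a1.1, a1.2, a2.1, a2.2]

/-- Sieve levels: primes not dividing `q` between consecutive double powers of two. -/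
def lev (q : ℕ) : ℕ → Finset ℕ
  | 0 => (Icc 1 2).filter fun p => p.Prime ∧ Nat.Coprime p q
  | l + 1 => (Ioc (2 ^ 2 ^ l) (2 ^ 2 ^ (l + 1))).filter fun p => p.Prime ∧ Nat.Coprime p q

/-- The Mertens product over the primes up to `z` not dividing `q`. -/
noncomputable def mertq (q z : ℕ) : ℝ :=
  ∏ p ∈ z.primesLE with Nat.Coprime p q, (1 - 1 / (p : ℝ))

lemma lev_prime {q l p : ℕ} (h : p ∈ lev q l) : p.Prime ∧ Nat.Coprime p q := by
  cases l <;> exact (mem_filter.1 h).2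

lemma lev_le {q l p : ℕ} (h : p ∈ lev q l) : p ≤ 2 ^ 2 ^ l := by
  cases l with
  | zero => exact (mem_Icc.1 (mem_filter.1 h).1).2
  | succ l => exact (mem_Ioc.1 (mem_filter.1 h).1).2

lemma dpow_mono {i j : ℕ} (h : i ≤ j) : 2 ^ 2 ^ i ≤ 2 ^ 2 ^ j :=
  Nat.pow_le_pow_right two_pos (Nat.pow_le_pow_right two_pos h)

lemma lev_disjoint {q j l : ℕ} (h : j < l) : Disjoint (lev q j) (lev q l) := by
  rw [disjoint_left]
  intro p hj hl
  obtain ⟨l, rfl⟩ : ∃ l', l = l' + 1 := ⟨l - 1, by omega⟩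
  have h1 := lev_le hj
  have h2 := (mem_Ioc.1 (mem_filter.1 hl).1).1
  have h3 := dpow_mono (show j ≤ l by omega)
  omega

lemma mem_lev_iff (q J p : ℕ) :
    (∃ l < J + 1, p ∈ lev q l) ↔ p.Prime ∧ p ≤ 2 ^ 2 ^ J ∧ Nat.Coprime p q := by
  induction J with
  | zero =>
    simp only [zero_add, Nat.lt_one_iff, exists_eq_left, lev, mem_filter, mem_Icc, pow_zero, pow_one]
    exact ⟨fun h => ⟨h.2.1, h.1.2, h.2.2⟩, fun h => ⟨⟨h.1.one_lt.le, h.2.1⟩, h.1, h.2.2⟩⟩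
  | succ J ih =>
    constructor
    · rintro ⟨l, hl, h⟩
      exact ⟨(lev_prime h).1, (lev_le h).trans (dpow_mono (by omega)), (lev_prime h).2⟩
    · rintro ⟨h1, h2, h3⟩
      by_cases hle : p ≤ 2 ^ 2 ^ J
      · obtain ⟨l, hl, h⟩ := ih.2 ⟨h1, hle, h3⟩
        exact ⟨l, by omega, h⟩
      · exact ⟨J + 1, by omega, mem_filter.2 ⟨mem_Ioc.2 ⟨by omega, h2⟩, h1, h3⟩⟩

lemma lev_card (q l : ℕ) : (lev q l).card + 1 ≤ 2 ^ 2 ^ l := by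
  cases l with
  | zero =>
    have : lev q 0 ⊆ {2} := by
      intro p hp
      obtain ⟨h1, h2, _⟩ := mem_filter.1 hp
      have := h2.two_le
      rw [mem_Icc] at h1
      rw [mem_singleton]; omega
    have := card_le_card this
    simp at this ⊢
    omega
  | succ l =>
    have h1 : (lev q (l + 1)).card ≤ _ := card_filter_le _ _
    rw [Nat.card_Ioc] at h1
    have h2 : 0 < 2 ^ 2 ^ l := by positivity
    have h3 := dpow_mono (show l ≤ l + 1 by omega)
    omega

lemma lev_sum_inv (q l : ℕ) : ∑ p ∈ lev q l, (1 : ℝ) / p ≤ 11 := by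
  have h2 := Real.log_two_gt_d9
  cases l with
  | zero =>
    have : lev q 0 ⊆ Icc 1 2 := filter_subset _ _
    refine (sum_le_sum_of_subset_of_nonneg this fun _ _ _ => by positivity).trans ?_
    rw [sum_Icc_succ_top (by norm_num)]
    norm_num
  | succ l =>
    have hw : (1 : ℝ) < ((2 ^ 2 ^ l : ℕ) : ℝ) := by
      exact_mod_cast Nat.one_lt_two_pow (by positivity)
    refine (sum_prime_inv_le _ hw (2 ^ 2 ^ (l + 1)) Nat.one_le_two_pow _ ?_).trans ?_
    · intro p hp
      have := (mem_Ioc.1 (mem_filter.1 hp).1)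
      exact ⟨(lev_prime hp).1, by exact_mod_cast this.1.le, this.2⟩
    · rw [div_le_iff₀ (Real.log_pos hw)]
      push_cast
      rw [Real.log_pow, Real.log_pow]
      push_cast
      have : (1 : ℝ) ≤ 2 ^ l := one_le_pow₀ (by norm_num)
      rw [pow_succ]
      nlinarith

lemma sX_lev (q J : ℕ) : sX (lev q) (J + 1) (fun p => 1 / (p : ℝ)) = mertq q (2 ^ 2 ^ J) := by
  have h : (2 ^ 2 ^ J : ℕ).primesLE.filter (fun p => Nat.Coprime p q) =
      (range (J + 1)).biUnion (lev q) := by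
    ext p
    simp only [mem_filter, Nat.mem_primesLE, mem_biUnion, mem_range]
    rw [mem_lev_iff]
    tauto
  rw [sX, mertq, h, prod_biUnion]
  intro i _ j _ hij
  rcases lt_or_gt_of_ne hij with h | h
  · exact lev_disjoint h
  · exact (lev_disjoint h).symm

lemma sum_exp_levels (J k : ℕ) :
    ∑ l ∈ range (J + 1), Real.exp (-((2 * (k + (J - l)) + 1 : ℕ) : ℝ)) ≤ Real.exp (-2 * k) := by
  have he : Real.exp (-1) ≤ 1 / 2 := by
    have := Real.exp_neg_one_lt_d9
    linarith
  have he0 := Real.exp_pos (-1)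
  induction J generalizing k with
  | zero =>
    simp only [zero_add, range_one, sum_singleton, Nat.sub_self, add_zero]
    refine Real.exp_le_exp.2 ?_
    push_cast
    linarith
  | succ J ih =>
    rw [sum_range_succ]
    have h1 : ∑ l ∈ range (J + 1), Real.exp (-((2 * (k + (J + 1 - l)) + 1 : ℕ) : ℝ)) ≤
        Real.exp (-2 * ((k + 1 : ℕ) : ℝ)) := by
      refine le_trans (le_of_eq ?_) (ih (k + 1))
      refine sum_congr rfl fun l hl => ?_
      have : k + (J + 1 - l) = k + 1 + (J - l) := by have := mem_range.1 hl; omega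
      rw [this]
    have h2 : Real.exp (-2 * ((k + 1 : ℕ) : ℝ)) =
        Real.exp (-2 * k) * (Real.exp (-1) * Real.exp (-1)) := by
      rw [← Real.exp_add, ← Real.exp_add]; congr 1; push_cast; ring
    have h3 : Real.exp (-((2 * (k + (J + 1 - (J + 1))) + 1 : ℕ) : ℝ)) =
        Real.exp (-2 * k) * Real.exp (-1) := by
      rw [← Real.exp_add]; congr 1; push_cast; simp; ring
    rw [h2] at h1
    rw [h3]
    have h4 : Real.exp (-1) * Real.exp (-1) ≤ 1 / 4 := by nlinarith
    nlinarith [Real.exp_pos (-2 * (k : ℝ))]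

lemma sum_levels (J k : ℕ) :
    ∑ l ∈ range (J + 1), 2 ^ l * (2 * (k + (J - l)) + 2) ≤ 2 ^ J * (4 * k + 8) := by
  induction J generalizing k with
  | zero => simp; omega
  | succ J ih =>
    rw [sum_range_succ]
    have h1 : ∑ l ∈ range (J + 1), 2 ^ l * (2 * (k + (J + 1 - l)) + 2) ≤
        2 ^ J * (4 * (k + 1) + 8) := by
      refine le_trans (le_of_eq ?_) (ih (k + 1))
      refine sum_congr rfl fun l hl => ?_
      have : k + (J + 1 - l) = k + 1 + (J - l) := by have := mem_range.1 hl; omega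
      rw [this]
    rw [pow_succ]
    simp only [Nat.sub_self, add_zero]
    nlinarith

open scoped Classical in
/-- Fundamental lemma of the sieve, for sets well distributed in the class `0` modulo `m`. -/
theorem sieve_fundamental : ∃ C : ℝ, 0 < C ∧ ∀ (J k q : ℕ) (I : Finset ℕ) (H : ℝ), 0 ≤ H →
    (∀ m : ℕ, Nat.Coprime m q → |((I.filter (m ∣ ·)).card : ℝ) - H / m| ≤ 2) →
    |((I.filter (fun n => ∀ p : ℕ, p.Prime → p ≤ 2 ^ 2 ^ J → Nat.Coprime p q → ¬ p ∣ n)).card : ℝ) -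
      H * mertq q (2 ^ 2 ^ J)| ≤
      C * Real.exp (-2 * k) * (H * mertq q (2 ^ 2 ^ J)) + 2 * ((2 : ℝ) ^ 2 ^ J) ^ (4 * k + 8) := by
  set K : ℝ := Real.exp (Real.exp 1 * 11 + 22) with hK
  refine ⟨Real.exp K * K, by positivity, ?_⟩
  intro J k q I H hH hI
  set ε : ℕ → ℝ := fun l => K * Real.exp (-((2 * (k + (J - l)) + 1 : ℕ) : ℝ)) with hε
  have hK0 : 0 < K := Real.exp_pos _
  have hsum : ∑ l ∈ range (J + 1), ε l ≤ K * Real.exp (-2 * k) := by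
    rw [hε, ← mul_sum]
    exact mul_le_mul_of_nonneg_left (sum_exp_levels J k) hK0.le
  have hsum0 : 0 ≤ ∑ l ∈ range (J + 1), ε l := sum_nonneg fun l _ => by positivity
  have hprod : ∏ l ∈ range (J + 1), (1 + ε l) ≤ Real.exp K := by
    calc ∏ l ∈ range (J + 1), (1 + ε l) ≤ ∏ l ∈ range (J + 1), Real.exp (ε l) :=
          prod_le_prod (fun l _ => by positivity) fun l _ => by
            rw [add_comm]; exact Real.add_one_le_exp _
      _ = Real.exp (∑ l ∈ range (J + 1), ε l) := (Real.exp_sum _ _).symm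
      _ ≤ Real.exp K := by
        refine Real.exp_le_exp.2 (hsum.trans ?_)
        have : Real.exp (-2 * k) ≤ 1 := Real.exp_le_one_iff.2 (by
          have : (0 : ℝ) ≤ k := Nat.cast_nonneg _
          linarith)
        nlinarith
  have main := sieve_abstract (P := lev q) (k := fun l => k + (J - l)) q (J + 1) hH hI
    (fun l _ p hp => lev_prime hp) (fun l _ j hj => lev_disjoint hj) ε
    (fun l _ => by positivity) (by
      intro l _
      have h1 := esum_le (2 * (k + (J - l)) + 1) (lev q l) (fun p => 1 / (p : ℝ))
        fun p _ => by positivity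
      have h2 := prod_one_sub_ge (lev q l) fun p hp => (lev_prime hp).1
      have h3 := lev_sum_inv q l
      have h4 : Real.exp (Real.exp 1 * ∑ p ∈ lev q l, (1 : ℝ) / p) ≤
          K * ∏ p ∈ lev q l, (1 - 1 / (p : ℝ)) := by
        refine le_trans ?_ (mul_le_mul_of_nonneg_left h2 hK0.le)
        rw [hK, ← Real.exp_add]
        refine Real.exp_le_exp.2 ?_
        have := Real.exp_pos 1
        nlinarith
      calc _ ≤ _ := h1
        _ ≤ Real.exp (-((2 * (k + (J - l)) + 1 : ℕ) : ℝ)) *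
            (K * ∏ p ∈ lev q l, (1 - 1 / (p : ℝ))) :=
              mul_le_mul_of_nonneg_left h4 (Real.exp_pos _).le
        _ = _ := by simp only [hε]; ring)
  rw [sX_lev] at main
  have hset : (I.filter (fun n => ∀ l < J + 1, ∀ p ∈ lev q l, ¬ p ∣ n)) =
      (I.filter (fun n => ∀ p : ℕ, p.Prime → p ≤ 2 ^ 2 ^ J → Nat.Coprime p q → ¬ p ∣ n)) := by
    refine filter_congr fun n _ => ⟨fun h p h1 h2 h3 => ?_, fun h l hl p hp => ?_⟩
    · obtain ⟨l, hl, hp⟩ := (mem_lev_iff q J p).2 ⟨h1, h2, h3⟩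
      exact h l hl p hp
    · obtain ⟨h1, h2, h3⟩ := (mem_lev_iff q J p).1 ⟨l, hl, hp⟩
      exact h p h1 h2 h3
  rw [hset] at main
  refine main.trans (add_le_add ?_ ?_)
  · have hm : 0 ≤ H * mertq q (2 ^ 2 ^ J) := mul_nonneg hH (prod_nonneg fun p hp =>
      (one_sub_inv_pos (Nat.prime_of_mem_primesLE (mem_filter.1 hp).1)).le)
    rw [mul_comm]
    refine mul_le_mul_of_nonneg_right ?_ hm
    calc _ ≤ Real.exp K * (K * Real.exp (-2 * k)) :=
          mul_le_mul hprod hsum hsum0 (Real.exp_pos _).le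
      _ = _ := by ring
  · refine mul_le_mul_of_nonneg_left ?_ zero_le_two
    calc ∏ l ∈ range (J + 1), (2 * ((lev q l).card + 1 : ℝ) ^ (2 * (k + (J - l)) + 1))
        ≤ ∏ l ∈ range (J + 1), (2 : ℝ) ^ (2 ^ l * (2 * (k + (J - l)) + 2)) := by
          refine prod_le_prod (fun l _ => ?_) fun l _ => ?_
          · exact mul_nonneg zero_le_two (pow_nonneg (by
              have : (0 : ℝ) ≤ (lev q l).card := Nat.cast_nonneg _
              linarith) _)
          · have h1 : ((lev q l).card + 1 : ℝ) ≤ 2 ^ 2 ^ l := by exact_mod_cast lev_card q l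
            have h2 : (2 : ℝ) ≤ 2 ^ 2 ^ l := le_self_pow₀ (by norm_num) (by positivity)
            rw [pow_mul]
            calc _ ≤ (2 : ℝ) ^ 2 ^ l * ((2 : ℝ) ^ 2 ^ l) ^ (2 * (k + (J - l)) + 1) := by
                  refine mul_le_mul h2 (pow_le_pow_left₀ ?_ h1 _) (pow_nonneg ?_ _) (by positivity)
                  all_goals
                    have : (0 : ℝ) ≤ (lev q l).card := Nat.cast_nonneg _
                    linarith
              _ = _ := by ring
      _ = (2 : ℝ) ^ (∑ l ∈ range (J + 1), 2 ^ l * (2 * (k + (J - l)) + 2)) :=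
          prod_pow_eq_pow_sum _ _ _
      _ ≤ (2 : ℝ) ^ (2 ^ J * (4 * k + 8)) :=
          pow_le_pow_right₀ (by norm_num) (sum_levels J k)
      _ = _ := pow_mul _ _ _

/-- `n` has no prime factor up to `z`. -/
def Rough (z n : ℕ) : Prop := ∀ p : ℕ, p.Prime → p ≤ z → ¬ p ∣ n

open scoped Classical in
/-- Rough integers of `(Y, X]` in a residue class. -/
noncomputable def roughSet (q z : ℕ) (b : ZMod q) (Y X : ℝ) : Finset ℕ :=
  (Ioc ⌊Y⌋₊ ⌊X⌋₊).filter fun n => (n : ZMod q) = b ∧ Rough z n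

lemma abs_class_card {q : ℕ} (hq : 1 ≤ q) (b : ZMod q) {Y h : ℝ} (hY : 0 ≤ Y) (hh : 0 ≤ h)
    (m : ℕ) (hm : Nat.Coprime m q) :
    |((((Ioc ⌊Y⌋₊ ⌊Y + h⌋₊).filter (fun n : ℕ => (n : ZMod q) = b)).filter (m ∣ ·)).card : ℝ) -
      h / q / m| ≤ 2 := by
  have : NeZero q := ⟨by omega⟩
  rcases Nat.eq_zero_or_pos m with rfl | hm0
  · rw [filter_eq_empty_iff.2]
    · simp
    · intro n hn h0
      have := (mem_Ioc.1 (mem_filter.1 hn).1).1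
      rw [zero_dvd_iff] at h0
      omega
  · set v := Nat.chineseRemainder hm.symm b.val 0 with hv
    have hset : ((Ioc ⌊Y⌋₊ ⌊Y + h⌋₊).filter (fun n : ℕ => (n : ZMod q) = b)).filter (m ∣ ·) =
        (Ioc ⌊Y⌋₊ ⌊Y + h⌋₊).filter (fun n => n ≡ v [MOD (q * m)]) := by
      rw [filter_filter]
      refine filter_congr fun n _ => ?_
      rw [← Nat.modEq_and_modEq_iff_modEq_mul hm.symm, ← Nat.modEq_zero_iff_dvd]
      have h1 : (n : ZMod q) = b ↔ n ≡ b.val [MOD q] := by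
        rw [← ZMod.natCast_eq_natCast_iff, ZMod.natCast_zmod_val]
      rw [h1]
      exact and_congr ⟨fun h => h.trans v.2.1.symm, fun h => h.trans v.2.1⟩
        ⟨fun h => h.trans v.2.2.symm, fun h => h.trans v.2.2⟩
    rw [hset]
    have hr : 0 < q * m := by positivity
    have hcard := Nat.Ioc_filter_modEq_card ⌊Y⌋₊ ⌊Y + h⌋₊ hr v
    set r := q * m with hrdef
    set a := ⌊Y⌋₊
    set c := ⌊Y + h⌋₊
    have hac : a ≤ c := Nat.floor_mono (by linarith)
    have hrr : (1 : ℝ) ≤ r := by exact_mod_cast hr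
    have hrq : (0 : ℚ) < r := by exact_mod_cast hr
    have hmono : ⌊((a : ℚ) - (v : ℕ)) / r⌋ ≤ ⌊((c : ℚ) - (v : ℕ)) / r⌋ := by
      refine Int.floor_mono ?_
      have : (a : ℚ) ≤ c := by exact_mod_cast hac
      gcongr
    rw [max_eq_left (by linarith)] at hcard
    have e1 := Int.floor_le (((c : ℚ) - (v : ℕ)) / r)
    have e2 := Int.lt_floor_add_one (((c : ℚ) - (v : ℕ)) / r)
    have e3 := Int.floor_le (((a : ℚ) - (v : ℕ)) / r)
    have e4 := Int.lt_floor_add_one (((a : ℚ) - (v : ℕ)) / r)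
    set N := #{x ∈ Ioc a c | x ≡ v [MOD r]}
    have hN : (N : ℚ) = (⌊((c : ℚ) - (v : ℕ)) / r⌋ : ℚ) - ⌊((a : ℚ) - (v : ℕ)) / r⌋ := by
      exact_mod_cast hcard
    have hN2 : |(N : ℚ) - ((c : ℚ) - a) / r| ≤ 1 := by
      have : ((c : ℚ) - a) / r = ((c : ℚ) - (v : ℕ)) / r - ((a : ℚ) - (v : ℕ)) / r := by ring
      rw [this, hN, abs_le]
      constructor <;> linarith
    have hN3 : |(N : ℝ) - ((c : ℝ) - a) / r| ≤ 1 := by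
      have := (Rat.cast_le (K := ℝ)).2 hN2
      push_cast at this
      exact this
    have f1 := Nat.floor_le hY
    have f2 := Nat.lt_floor_add_one Y
    have f3 := Nat.floor_le (show 0 ≤ Y + h by linarith)
    have f4 := Nat.lt_floor_add_one (Y + h)
    have hd : |((c : ℝ) - a) / r - h / r| ≤ 1 := by
      rw [← sub_div, abs_div, abs_of_pos (show (0 : ℝ) < r by linarith), div_le_one (by linarith)]
      refine le_trans ?_ hrr
      rw [abs_le]
      constructor <;> linarith
    have e5 : h / q / m = h / r := by
      rw [hrdef]; push_cast; rw [div_div]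
    rw [e5]
    calc |(N : ℝ) - h / r| = |((N : ℝ) - ((c : ℝ) - a) / r) + (((c : ℝ) - a) / r - h / r)| := by
          congr 1; ring
      _ ≤ 2 := (abs_add_le _ _).trans (by linarith)

open scoped Classical in
theorem sieve_interval : ∃ C : ℝ, 0 < C ∧ ∀ (J k q : ℕ) (b : ZMod q) (Y h : ℝ), 1 ≤ q → IsUnit b →
    0 ≤ Y → 0 ≤ h →
    |((roughSet q (2 ^ 2 ^ J) b Y (Y + h)).card : ℝ) - h / q * mertq q (2 ^ 2 ^ J)| ≤
      C * Real.exp (-2 * k) * (h / q * mertq q (2 ^ 2 ^ J)) +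
        2 * ((2 : ℝ) ^ 2 ^ J) ^ (4 * k + 8) := by
  obtain ⟨C, hC, hmain⟩ := sieve_fundamental
  refine ⟨C, hC, ?_⟩
  intro J k q b Y h hq hb hY hh
  have := hmain J k q ((Ioc ⌊Y⌋₊ ⌊Y + h⌋₊).filter (fun n : ℕ => (n : ZMod q) = b)) (h / q)
    (by positivity) (fun m hm => abs_class_card hq b hY hh m hm)
  have hset : roughSet q (2 ^ 2 ^ J) b Y (Y + h) =
      ((Ioc ⌊Y⌋₊ ⌊Y + h⌋₊).filter (fun n : ℕ => (n : ZMod q) = b)).filter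
        (fun n => ∀ p : ℕ, p.Prime → p ≤ 2 ^ 2 ^ J → Nat.Coprime p q → ¬ p ∣ n) := by
    rw [roughSet, filter_filter]
    refine filter_congr fun n _ => and_congr_right fun hn => ?_
    refine ⟨fun h p h1 h2 _ => h p h1 h2, fun h p h1 h2 h3 => ?_⟩
    by_cases hc : Nat.Coprime p q
    · exact h p h1 h2 hc h3
    · rw [← hn, ZMod.isUnit_iff_coprime] at hb
      exact hc (Nat.Coprime.coprime_dvd_left h3 hb)
  rw [hset]
  convert this using 5

/-- Comparison of the two Mertens products. -/
lemma mertq_div_le {q : ℕ} (hq : 1 ≤ q) (z : ℕ) : mertq q z / q ≤ mert z / q.totient := by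
  have hφ : (0 : ℝ) < q.totient := by exact_mod_cast Nat.totient_pos.2 hq
  have hq0 : (0 : ℝ) < q := by exact_mod_cast hq
  have h1 : (q.totient : ℝ) = q * ∏ p ∈ q.primeFactors, (1 - 1 / (p : ℝ)) := by
    have := Nat.totient_eq_mul_prod_factors q
    have h2 : ((q.totient : ℚ) : ℝ) = ((q * ∏ p ∈ q.primeFactors, (1 - (p : ℚ)⁻¹) : ℚ) : ℝ) := by
      rw [this]
    push_cast at h2
    simpa [one_div] using h2
  have h3 : mertq q z * ∏ p ∈ q.primeFactors, (1 - 1 / (p : ℝ)) ≤ mert z := by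
    have e : mert z = mertq q z * ∏ p ∈ z.primesLE with ¬ Nat.Coprime p q, (1 - 1 / (p : ℝ)) :=
      (prod_filter_mul_prod_filter_not _ _ _).symm
    rw [e]
    refine mul_le_mul_of_nonneg_left ?_ (prod_nonneg fun p hp =>
      (one_sub_inv_pos (Nat.prime_of_mem_primesLE (mem_filter.1 hp).1)).le)
    refine prod_le_prod_of_subset_of_le_one ?_ (fun p hp =>
      (one_sub_inv_pos (Nat.prime_of_mem_primeFactors hp)).le) fun p _ _ => one_sub_inv_le_one
    intro p hp
    obtain ⟨h4, h5⟩ := mem_filter.1 hp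
    have h6 := Nat.prime_of_mem_primesLE h4
    rw [h6.coprime_iff_not_dvd, not_not] at h5
    exact Nat.mem_primeFactors.2 ⟨h6, h5, by omega⟩
  rw [div_le_div_iff₀ hq0 hφ, h1]
  calc mertq q z * (q * ∏ p ∈ q.primeFactors, (1 - 1 / (p : ℝ)))
      = (mertq q z * ∏ p ∈ q.primeFactors, (1 - 1 / (p : ℝ))) * q := by ring
    _ ≤ _ := mul_le_mul_of_nonneg_right h3 hq0.le

lemma mertq_div_eq {q : ℕ} (hq : 1 ≤ q) {z : ℕ} (hz : q ≤ z) :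
    mertq q z / q = mert z / q.totient := by
  have hφ : (0 : ℝ) < q.totient := by exact_mod_cast Nat.totient_pos.2 hq
  have hq0 : (0 : ℝ) < q := by exact_mod_cast hq
  have h1 : (q.totient : ℝ) = q * ∏ p ∈ q.primeFactors, (1 - 1 / (p : ℝ)) := by
    have := Nat.totient_eq_mul_prod_factors q
    have h2 : ((q.totient : ℚ) : ℝ) = ((q * ∏ p ∈ q.primeFactors, (1 - (p : ℚ)⁻¹) : ℚ) : ℝ) := by
      rw [this]
    push_cast at h2
    simpa [one_div] using h2
  have e : mert z = mertq q z * ∏ p ∈ z.primesLE with ¬ Nat.Coprime p q, (1 - 1 / (p : ℝ)) :=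
    (prod_filter_mul_prod_filter_not _ _ _).symm
  have hset : z.primesLE.filter (fun p => ¬ Nat.Coprime p q) = q.primeFactors := by
    ext p
    simp only [mem_filter, Nat.mem_primesLE, Nat.mem_primeFactors]
    constructor
    · rintro ⟨⟨_, h2⟩, h3⟩
      exact ⟨h2, by rwa [h2.coprime_iff_not_dvd, not_not] at h3, by omega⟩
    · rintro ⟨h1, h2, h3⟩
      exact ⟨⟨(Nat.le_of_dvd (by omega) h2).trans hz, h1⟩, by rwa [h1.coprime_iff_not_dvd, not_not]⟩
  rw [hset] at e
  rw [div_eq_div_iff hq0.ne' hφ.ne', e]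
  nth_rewrite 1 [h1]
  ring

lemma Rough.mono {w z n : ℕ} (h : w ≤ z) (hn : Rough z n) : Rough w n :=
  fun p hp hpw => hn p hp (hpw.trans h)

lemma roughSet_subset (q : ℕ) {w z : ℕ} (h : w ≤ z) (b : ZMod q) (Y X : ℝ) :
    roughSet q z b Y X ⊆ roughSet q w b Y X := by
  intro n hn
  classical
  rw [roughSet, mem_filter] at hn ⊢
  exact ⟨hn.1, hn.2.1, hn.2.2.mono h⟩

lemma mem_roughSet {q z : ℕ} {b : ZMod q} {Y X : ℝ} {n : ℕ} :
    n ∈ roughSet q z b Y X ↔ n ∈ Ioc ⌊Y⌋₊ ⌊X⌋₊ ∧ (n : ZMod q) = b ∧ Rough z n := by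
  classical
  rw [roughSet, mem_filter]

lemma totient_pos_real {q : ℕ} (hq : 1 ≤ q) : (0 : ℝ) < q.totient := by
  exact_mod_cast Nat.totient_pos.2 hq

lemma totient_le_real (q : ℕ) : (q.totient : ℝ) ≤ q := by exact_mod_cast Nat.totient_le q

/-- Admissible sieve levels: the numbers `2 ^ 2 ^ J`. -/
def Dpow (w : ℕ) : Prop := ∃ J : ℕ, w = 2 ^ 2 ^ J

lemma Dpow.two_le {w : ℕ} (h : Dpow w) : 2 ≤ w := by
  obtain ⟨J, rfl⟩ := h
  exact Nat.le_self_pow (by positivity) 2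

lemma Dpow.pow {w : ℕ} (h : Dpow w) : Dpow (w ^ 64) := by
  obtain ⟨J, rfl⟩ := h
  exact ⟨J + 6, by rw [← pow_mul, pow_add]; norm_num⟩

lemma sieve_interval_dpow : ∃ C : ℝ, 0 < C ∧ ∀ (z k q : ℕ) (b : ZMod q) (Y h : ℝ), Dpow z →
    1 ≤ q → IsUnit b → 0 ≤ Y → 0 ≤ h →
    |((roughSet q z b Y (Y + h)).card : ℝ) - h / q * mertq q z| ≤
      C * Real.exp (-2 * k) * (h / q * mertq q z) + 2 * (z : ℝ) ^ (4 * k + 8) := by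
  obtain ⟨C, hC, H⟩ := sieve_interval
  refine ⟨C, hC, fun z k q b Y h ⟨J, hJ⟩ hq hb hY hh => ?_⟩
  have := H J k q b Y h hq hb hY hh
  have hc : ((2 ^ 2 ^ J : ℕ) : ℝ) = (2 : ℝ) ^ 2 ^ J := by push_cast; rfl
  rw [← hc, ← hJ] at this
  exact this

/-- Brun–Titchmarsh: an upper bound for rough integers in an interval and a residue class. -/
theorem brun_titchmarsh : ∃ C : ℝ, 0 < C ∧ ∀ (wn q : ℕ) (b : ZMod q) (Y h : ℝ), Dpow wn → 1 ≤ q → IsUnit b →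
    0 ≤ Y → 0 < h → (wn : ℝ) ^ 10 ≤ h / q →
    ((roughSet q wn b Y (Y + h)).card : ℝ) ≤
      C * (h / (q.totient * Real.log wn)) := by
  obtain ⟨C, hC, H⟩ := sieve_interval_dpow
  refine ⟨2 + C, by linarith, ?_⟩
  intro wn q b Y h hwd hq hb hY hh hw
  have hφ := totient_pos_real hq
  have hφq := totient_le_real q
  have hq0 : (0 : ℝ) < q := by exact_mod_cast hq
  have key := H wn 0 q b Y h hwd hq hb hY hh.le
  have hw2 : (2 : ℝ) ≤ wn := by exact_mod_cast hwd.two_le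
  generalize hwn : (wn : ℝ) = w at *
  have hlw : 0 < Real.log w := Real.log_pos (by linarith)
  have hlw1 : Real.log w ≤ w := (Real.log_le_sub_one_of_pos (by linarith)).trans (by linarith)
  have hm : h / q * mertq q wn ≤ h / (q.totient * Real.log w) := by
    have h1 := mertq_div_le hq wn
    have h2 := mert_le wn hwd.two_le
    rw [hwn] at h2
    calc h / q * mertq q wn = h * (mertq q wn / q) := by ring
      _ ≤ h * (1 / Real.log w / q.totient) := by
        refine mul_le_mul_of_nonneg_left (h1.trans ?_) hh.le
        gcongr
      _ = _ := by field_simp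
  have hp : 2 * w ^ (4 * 0 + 8) ≤ h / (q.totient * Real.log w) := by
    have h1 : 2 * w ^ 8 * Real.log w ≤ w ^ 10 := by
      have : 0 < w ^ 8 := by positivity
      calc 2 * w ^ 8 * Real.log w ≤ w * w ^ 8 * w := by gcongr
        _ = w ^ 10 := by ring
    rw [le_div_iff₀ (by positivity)]
    have h2 : w ^ 10 * q ≤ h := (le_div_iff₀ hq0).1 hw
    calc 2 * w ^ (4 * 0 + 8) * (q.totient * Real.log w)
        = (2 * w ^ 8 * Real.log w) * q.totient := by ring
      _ ≤ w ^ 10 * q := by gcongr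
      _ ≤ h := h2
  simp only [Nat.cast_zero, mul_zero, Real.exp_zero, mul_one] at key
  have := (abs_le.1 key).2
  simp only [mul_zero] at hp
  have hCm := mul_le_mul_of_nonneg_left hm hC.le
  linarith

/-- Counting rough integers in an interval and a residue class with a power-saving error in terms
of `log h / log z`. -/
theorem rough_count : ∃ C : ℝ, 0 < C ∧ ∀ (wn zn q : ℕ) (b : ZMod q) (Y h : ℝ),
    Dpow wn → zn = wn ^ 64 → 1 ≤ q → IsUnit b →
    0 ≤ Y → 0 < h → (wn : ℝ) ^ 10 ≤ h / q → (q : ℝ) ≤ (wn : ℝ) ^ 4 →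
    |((roughSet q zn b Y (Y + h)).card : ℝ) -
        h * mert zn / q.totient| ≤
      C * (h / (q.totient * Real.log zn)) *
        Real.exp (-(Real.log h / (4 * Real.log zn))) := by
  obtain ⟨C₁, hC₁, H₁⟩ := brun_titchmarsh
  obtain ⟨C₂, hC₂, H₂⟩ := sieve_interval_dpow
  refine ⟨(64 * C₁ + 1) * Real.exp 15 + C₂ * Real.exp 2 + 1, by positivity, ?_⟩
  intro wn zn q b Y h hwd hzw' hq hb hY hh hw hqw
  have hφ := totient_pos_real hq
  have hφq := totient_le_real q
  have hq0 : (0 : ℝ) < q := by exact_mod_cast hq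
  have key1 := H₁ wn q b Y h hwd hq hb hY hh hw
  have hzd : Dpow zn := hzw' ▸ hwd.pow
  have hwz : wn ≤ zn := hzw' ▸ Nat.le_self_pow (by norm_num) wn
  have hzn2 := hzd.two_le
  have hw2 : (2 : ℝ) ≤ wn := by exact_mod_cast hwd.two_le
  have hzw : (zn : ℝ) = (wn : ℝ) ^ 64 := by exact_mod_cast hzw'
  clear hzw'
  generalize hwn : (wn : ℝ) = w at *
  generalize hzn : (zn : ℝ) = z at *
  have hlw : 0 < Real.log w := Real.log_pos (by linarith)
  have hlz : Real.log z = 64 * Real.log w := by rw [hzw, Real.log_pow]; norm_num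
  have hlw0 : 0.69 ≤ Real.log w := by
    have := Real.log_two_gt_d9
    have := Real.log_le_log (by norm_num) hw2
    linarith
  have hl44 : 44 ≤ Real.log z := by rw [hlz]; linarith
  have hl0 : 0 < Real.log z := by linarith
  have hmz : mert zn ≤ 1 / Real.log z := by
    have := mert_le zn hzn2
    rwa [hzn] at this
  have hmain : h * mert zn / q.totient ≤ h / (q.totient * Real.log z) := by
    calc _ ≤ h * (1 / Real.log z) / q.totient := by gcongr
      _ = _ := by field_simp
  have hmain0 : 0 ≤ h * mert zn / q.totient := by
    have := mert_pos zn
    positivity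
  set B := h / (q.totient * Real.log z) with hB
  have hB0 : 0 < B := by positivity
  set E := Real.exp (-(Real.log h / (4 * Real.log z))) with hE
  have hE0 : 0 < E := Real.exp_pos _
  rcases le_or_gt (Real.log h) (60 * Real.log z) with hsmall | hlarge
  · have hc : ((roughSet q zn b Y (Y + h)).card : ℝ) ≤ 64 * C₁ * B := by
      have h1 : ((roughSet q zn b Y (Y + h)).card : ℝ) ≤
          (roughSet q wn b Y (Y + h)).card := by
        exact_mod_cast card_le_card (roughSet_subset q hwz b Y _)
      refine h1.trans (key1.trans (le_of_eq ?_))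
      rw [hB, hlz]
      field_simp
    have hE15 : 1 ≤ Real.exp 15 * E := by
      rw [hE, ← Real.exp_add]
      refine Real.one_le_exp ?_
      have : Real.log h / (4 * Real.log z) ≤ 15 := by
        rw [div_le_iff₀ (by positivity)]; linarith
      linarith
    have hBE : B ≤ B * (Real.exp 15 * E) := le_mul_of_one_le_right hB0.le hE15
    have : |((roughSet q zn b Y (Y + h)).card : ℝ) -
        h * mert zn / q.totient| ≤ (64 * C₁ + 1) * B := by
      have hcard0 : (0 : ℝ) ≤ (roughSet q zn b Y (Y + h)).card := Nat.cast_nonneg _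
      have : 0 ≤ C₁ * B := by positivity
      rw [abs_le]
      constructor <;> linarith
    calc _ ≤ (64 * C₁ + 1) * B := this
      _ ≤ (64 * C₁ + 1) * (B * (Real.exp 15 * E)) := by gcongr
      _ ≤ _ := by
        have : 0 ≤ (C₂ * Real.exp 2 + 1) * B * E := by positivity
        linarith
  · set k := ⌊Real.log h / (8 * Real.log z)⌋₊ with hk
    have key2 := H₂ zn k q b Y h hzd hq hb hY hh.le
    rw [hzn] at key2
    have hlogh : 0 < Real.log h := by linarith
    have hk1 : (k : ℝ) ≤ Real.log h / (8 * Real.log z) := Nat.floor_le (by positivity)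
    have hk2 : Real.log h / (8 * Real.log z) < k + 1 := Nat.lt_floor_add_one _
    have hqz : q ≤ zn := by
      have : (q : ℝ) ≤ z := by
        rw [hzw]; exact hqw.trans (pow_le_pow_right₀ (by linarith) (by norm_num))
      rw [← hzn] at this
      exact_mod_cast this
    have hmq : h / q * mertq q zn = h * mert zn / q.totient := by
      have := mertq_div_eq hq hqz
      calc _ = h * (mertq q zn / q) := by ring
        _ = _ := by rw [this]; ring
    rw [hmq] at key2
    have hek : Real.exp (-2 * k) ≤ Real.exp 2 * E := by
      rw [hE, ← Real.exp_add]
      refine Real.exp_le_exp.2 ?_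
      have : Real.log h / (4 * Real.log z) = 2 * (Real.log h / (8 * Real.log z)) := by
        field_simp; norm_num
      linarith
    have herr : 2 * z ^ (4 * k + 8) ≤ B * E := by
      have hz2 : 2 ≤ z := by rw [← hzn]; exact_mod_cast hzn2
      have hz0 : 0 < z := by linarith
      have h1 : 2 * z ^ (4 * k + 8) ≤ z ^ (4 * k + 9) := by
        rw [pow_succ z (4 * k + 8), mul_comm]
        gcongr
      have h2 : z ^ (4 * k + 9) ≤ Real.exp (Real.log h / 2 + 9 * Real.log z) := by
        have : z ^ (4 * k + 9) = Real.exp (((4 * k + 9 : ℕ) : ℝ) * Real.log z) := by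
          rw [Real.exp_nat_mul, Real.exp_log hz0]
        rw [this]
        refine Real.exp_le_exp.2 ?_
        push_cast
        have : (k : ℝ) * (8 * Real.log z) ≤ Real.log h := (le_div_iff₀ (by positivity)).1 hk1
        nlinarith
      have h3 : (q.totient : ℝ) * Real.log z ≤ z := by
        have h4 : Real.log w ≤ w := (Real.log_le_sub_one_of_pos (by linarith)).trans (by linarith)
        have h5 : (64 : ℝ) ≤ w ^ 6 := by
          calc (64 : ℝ) = 2 ^ 6 := by norm_num
            _ ≤ w ^ 6 := by gcongr
        calc (q.totient : ℝ) * Real.log z ≤ w ^ 4 * (64 * Real.log w) := by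
              rw [hlz]; gcongr; linarith
          _ ≤ w ^ 4 * (w ^ 6 * w) := by gcongr
          _ = w ^ 11 := by ring
          _ ≤ w ^ 64 := pow_le_pow_right₀ (by linarith) (by norm_num)
          _ = z := hzw.symm
      have h4 : Real.exp (Real.log h - Real.log z) ≤ B := by
        rw [Real.exp_sub, Real.exp_log hh, Real.exp_log hz0, hB]
        gcongr
      refine h1.trans (h2.trans ?_)
      calc _ ≤ Real.exp (Real.log h - Real.log z) * E := by
            rw [hE, ← Real.exp_add]
            refine Real.exp_le_exp.2 ?_
            have : Real.log h / (4 * Real.log z) ≤ Real.log h / 176 := by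
              gcongr; linarith
            linarith
        _ ≤ _ := by gcongr
    calc _ ≤ _ := key2
      _ ≤ C₂ * (Real.exp 2 * E) * B + B * E := by gcongr
      _ ≤ _ := by
        have : 0 ≤ (64 * C₁ + 1) * Real.exp 15 * B * E := by positivity
        linarith

/-- Sums of `log^k` over rough integers in a residue class. -/
noncomputable def logSum (k q z : ℕ) (b : ZMod q) (Y X : ℝ) : ℝ :=
  ∑ n ∈ roughSet q z b Y X, Real.log n ^ k

lemma Rough.eq_one {z n : ℕ} (h : Rough z n) (hn : n ≤ z) : n = 1 ∨ n = 0 := by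
  by_contra hc
  push Not at hc
  have h1 := Nat.minFac_prime hc.1
  exact h _ h1 ((Nat.minFac_le (by omega)).trans hn) (Nat.minFac_dvd n)

lemma pow_sub_pow_le_two {v l η : ℝ} (hv : 0 ≤ v) (hη : 0 ≤ η) (hη1 : η ≤ 1) (h1 : v ≤ l)
    (h2 : l ≤ v + η) {k : ℕ} (hk : k ≤ 2) : |l ^ k - v ^ k| ≤ 2 * η * (v + 1) := by
  have h3 : 0 ≤ η * v := by positivity
  interval_cases k
  · simp; nlinarith
  · rw [pow_one, pow_one, abs_of_nonneg (by linarith)]; nlinarith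
  · rw [abs_of_nonneg (by nlinarith)]; nlinarith

lemma pow_mul_exp_le {v ℓ : ℝ} (hv : 0 ≤ v) (hℓ : 0 < ℓ) {k : ℕ} (hk : k ≤ 2) :
    v ^ k * Real.exp (-(v / (4 * ℓ))) ≤ 128 * ℓ ^ k * Real.exp (-(v / (8 * ℓ))) := by
  have h1 : Real.exp (-(v / (4 * ℓ))) = Real.exp (-(v / (8 * ℓ))) * Real.exp (-(v / (8 * ℓ))) := by
    rw [← Real.exp_add]; congr 1; field_simp; ring
  have h2 : (v / (8 * ℓ)) ^ k * Real.exp (-(v / (8 * ℓ))) ≤ 2 := by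
    have hx : 0 ≤ v / (8 * ℓ) := by positivity
    generalize v / (8 * ℓ) = x at hx
    have h3 : x ^ k ≤ 2 * Real.exp x := by
      have h4 := Real.quadratic_le_exp_of_nonneg hx
      interval_cases k <;> nlinarith
    calc x ^ k * Real.exp (-x) ≤ 2 * Real.exp x * Real.exp (-x) := by gcongr
      _ = 2 := by rw [mul_assoc, ← Real.exp_add]; simp
  have h5 : v ^ k = (8 * ℓ) ^ k * (v / (8 * ℓ)) ^ k := by
    rw [← mul_pow]; congr 1; field_simp
  rw [h1, h5]
  have h6 : (8 : ℝ) ^ k ≤ 64 := by interval_cases k <;> norm_num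
  have hE := Real.exp_pos (-(v / (8 * ℓ)))
  calc (8 * ℓ) ^ k * (v / (8 * ℓ)) ^ k * (Real.exp (-(v / (8 * ℓ))) * Real.exp (-(v / (8 * ℓ))))
      = 8 ^ k * ℓ ^ k * ((v / (8 * ℓ)) ^ k * Real.exp (-(v / (8 * ℓ)))) *
        Real.exp (-(v / (8 * ℓ))) := by rw [mul_pow]; ring
    _ ≤ 64 * ℓ ^ k * 2 * Real.exp (-(v / (8 * ℓ))) := by gcongr
    _ = _ := by ring

/-- Short-interval asymptotics for `log^k`-weighted rough integers in residue classes. -/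
theorem logSum_bound : ∃ C : ℝ, 0 < C ∧ ∀ (wn zn q : ℕ) (b : ZMod q) (η y : ℝ) (k : ℕ),
    Dpow wn → zn = wn ^ 64 → 1 ≤ q →
    IsUnit b → 0 < η → η ≤ 1 → 1 ≤ y → k ≤ 2 → (q : ℝ) ≤ η * (wn : ℝ) ^ 4 →
    |logSum k q zn b y (y * (1 + η)) -
        Real.log y ^ k * (η * y * mert zn / q.totient)| ≤
      C * (η * y / (q.totient * Real.log zn)) *
        (Real.log zn ^ k *
          Real.exp (-(Real.log y / (8 * Real.log zn))) +
          η * (Real.log y + 1)) := by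
  obtain ⟨C₁, hC₁, H₁⟩ := rough_count
  refine ⟨128 * (C₁ * Real.exp 1 + Real.exp 15) + 2 * (C₁ + 1), by positivity, ?_⟩
  intro wn zn q b η y k hwd hzw' hq hb hη hη1 hy hk hqw
  have hφ := totient_pos_real hq
  have hφq := totient_le_real q
  have hq0 : (0 : ℝ) < q := by exact_mod_cast hq
  have key := H₁ wn zn q b y (η * y) hwd hzw' hq hb (by linarith) (by positivity)
  rw [show y + η * y = y * (1 + η) by ring] at key
  have hzd : Dpow zn := hzw' ▸ hwd.pow
  have hwz : wn ≤ zn := hzw' ▸ Nat.le_self_pow (by norm_num) wn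
  have hzn2 := hzd.two_le
  have hw2 : (2 : ℝ) ≤ wn := by exact_mod_cast hwd.two_le
  have hzw : (zn : ℝ) = (wn : ℝ) ^ 64 := by exact_mod_cast hzw'
  clear hzw'
  generalize hwn : (wn : ℝ) = w at *
  generalize hzn : (zn : ℝ) = z at *
  have hlw : 0 < Real.log w := Real.log_pos (by linarith)
  have hlz : Real.log z = 64 * Real.log w := by rw [hzw, Real.log_pow]; norm_num
  have hl0 : 0 < Real.log z := by linarith
  have hz0 : 0 < z := by rw [hzw]; positivity
  have hmz : mert zn ≤ 1 / Real.log z := by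
    have := mert_le zn hzn2
    rwa [hzn] at this
  have hmain : η * y * mert zn / q.totient ≤ η * y / (q.totient * Real.log z) := by
    calc _ ≤ η * y * (1 / Real.log z) / q.totient := by gcongr
      _ = _ := by field_simp
  have hmain0 : 0 ≤ η * y * mert zn / q.totient := by
    have := mert_pos zn
    positivity
  set B := η * y / (q.totient * Real.log z) with hB
  have hB0 : 0 < B := by positivity
  set v := Real.log y with hv
  have hv0 : 0 ≤ v := Real.log_nonneg hy
  set R := roughSet q zn b y (y * (1 + η)) with hR
  -- the counting bound
  have hcount : |(R.card : ℝ) - η * y * mert zn / q.totient| ≤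
      (C₁ * Real.exp 1 + Real.exp 15) * B * Real.exp (-(v / (4 * Real.log z))) ∧
      (R.card : ℝ) ≤ (C₁ + 1) * B := by
    rcases lt_or_ge (2 * y) z with hsmall | hlarge
    · have hRe : R = ∅ := by
        rw [hR, eq_empty_iff_forall_notMem]
        intro n hn
        obtain ⟨hn, _, hr⟩ := mem_roughSet.1 hn
        rw [mem_Ioc] at hn
        have h1 : y < n := (Nat.floor_lt (by linarith)).1 hn.1
        have h2 : (n : ℝ) ≤ y * (1 + η) := (Nat.le_floor_iff (by positivity)).1 hn.2
        have h3 : (n : ℝ) ≤ (zn : ℝ) := by rw [hzn]; nlinarith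
        have h4 : n ≤ zn := by exact_mod_cast h3
        have h5 : 1 < n := by exact_mod_cast hy.trans_lt h1
        rcases hr.eq_one h4 with h | h <;> omega
      rw [hRe, card_empty, Nat.cast_zero, zero_sub, abs_neg, abs_of_nonneg hmain0]
      refine ⟨?_, by positivity⟩
      have hE15 : 1 ≤ Real.exp 15 * Real.exp (-(v / (4 * Real.log z))) := by
        rw [← Real.exp_add]
        refine Real.one_le_exp ?_
        have : v / (4 * Real.log z) ≤ 15 := by
          rw [div_le_iff₀ (by positivity)]
          have : v ≤ Real.log z := Real.log_le_log (by linarith) (by linarith)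
          linarith
        linarith
      calc _ ≤ B := hmain
        _ ≤ B * (Real.exp 15 * Real.exp (-(v / (4 * Real.log z)))) :=
          le_mul_of_one_le_right hB0.le hE15
        _ ≤ _ := by
          have : 0 ≤ C₁ * Real.exp 1 * B * Real.exp (-(v / (4 * Real.log z))) := by positivity
          linarith
    · have hcond : w ^ 10 ≤ η * y / q := by
        rw [le_div_iff₀ hq0]
        have h1 : w ^ 10 * (η * w ^ 4) ≤ η * y := by
          have h2 : w ^ 14 ≤ y := by
            have : w ^ 14 * 2 ≤ w ^ 64 := by
              calc w ^ 14 * 2 ≤ w ^ 14 * w := by gcongr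
                _ = w ^ 15 := by ring
                _ ≤ w ^ 64 := pow_le_pow_right₀ (by linarith) (by norm_num)
            rw [hzw] at hlarge
            linarith
          calc w ^ 10 * (η * w ^ 4) = η * w ^ 14 := by ring
            _ ≤ _ := by gcongr
        exact le_trans (by gcongr) h1
      have hqw4 : (q : ℝ) ≤ w ^ 4 := hqw.trans (mul_le_of_le_one_left (by positivity) hη1)
      have key := key hcond hqw4
      have hlog : Real.log (η * y) ≥ v - 4 * Real.log w := by
        rw [Real.log_mul hη.ne' (by linarith), ← hv]
        have : 1 ≤ η * w ^ 4 := le_trans (by exact_mod_cast hq) hqw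
        have := Real.log_nonneg this
        rw [Real.log_mul hη.ne' (by positivity), Real.log_pow] at this
        push_cast at this
        linarith
      have hexp : Real.exp (-(Real.log (η * y) / (4 * Real.log z))) ≤
          Real.exp 1 * Real.exp (-(v / (4 * Real.log z))) := by
        rw [← Real.exp_add]
        refine Real.exp_le_exp.2 ?_
        have h5 : (v - 4 * Real.log w) / (4 * Real.log z) ≤ Real.log (η * y) / (4 * Real.log z) := by
          gcongr
        have h6 : (v - 4 * Real.log w) / (4 * Real.log z) = v / (4 * Real.log z) - 1 / 64 := by
          rw [hlz]; field_simp
        linarith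
      have hexp1 : Real.exp (-(Real.log (η * y) / (4 * Real.log z))) ≤ 1 := by
        refine Real.exp_le_one_iff.2 ?_
        have h7 : 0 ≤ Real.log (η * y) := by
          refine Real.log_nonneg ?_
          have h8 : (1 : ℝ) ≤ w ^ 10 := one_le_pow₀ (by linarith)
          have h9 := h8.trans hcond
          rw [le_div_iff₀ hq0] at h9
          have : (1 : ℝ) ≤ q := by exact_mod_cast hq
          linarith
        have : 0 ≤ Real.log (η * y) / (4 * Real.log z) := by positivity
        linarith
      constructor
      · calc _ ≤ _ := key
          _ ≤ C₁ * B * (Real.exp 1 * Real.exp (-(v / (4 * Real.log z)))) := by gcongr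
          _ ≤ _ := by
            have : 0 ≤ Real.exp 15 * B * Real.exp (-(v / (4 * Real.log z))) := by positivity
            linarith
      · have h1 : C₁ * B * Real.exp (-(Real.log (η * y) / (4 * Real.log z))) ≤ C₁ * B :=
          mul_le_of_le_one_right (by positivity) hexp1
        have := (abs_le.1 key).2
        linarith
  obtain ⟨hc1, hc2⟩ := hcount
  have hsplit : logSum k q zn b y (y * (1 + η)) -
      v ^ k * (η * y * mert zn / q.totient) =
      ∑ n ∈ R, (Real.log n ^ k - v ^ k) +
        v ^ k * ((R.card : ℝ) - η * y * mert zn / q.totient) := by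
    rw [logSum, sum_sub_distrib, sum_const, nsmul_eq_mul]; ring
  rw [hsplit]
  have hs1 : |∑ n ∈ R, (Real.log n ^ k - v ^ k)| ≤ R.card * (2 * η * (v + 1)) := by
    refine (abs_sum_le_sum_abs _ _).trans ?_
    rw [← nsmul_eq_mul, ← sum_const]
    refine sum_le_sum fun n hn => ?_
    rw [hR, mem_roughSet, mem_Ioc] at hn
    have h1 : y < n := (Nat.floor_lt (by linarith)).1 hn.1.1
    have h2 : (n : ℝ) ≤ y * (1 + η) := (Nat.le_floor_iff (by positivity)).1 hn.1.2
    refine pow_sub_pow_le_two hv0 hη.le hη1 (Real.log_le_log (by linarith) h1.le) ?_ hk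
    calc Real.log n ≤ Real.log (y * (1 + η)) := Real.log_le_log (by linarith) h2
      _ = v + Real.log (1 + η) := Real.log_mul (by linarith) (by linarith)
      _ ≤ v + η := by
        have := Real.log_le_sub_one_of_pos (show 0 < 1 + η by linarith)
        linarith
  have hs2 : |v ^ k * ((R.card : ℝ) - η * y * mert zn / q.totient)| ≤
      128 * (C₁ * Real.exp 1 + Real.exp 15) * B *
        (Real.log z ^ k * Real.exp (-(v / (8 * Real.log z)))) := by
    rw [abs_mul, abs_of_nonneg (pow_nonneg hv0 k)]
    calc _ ≤ v ^ k * ((C₁ * Real.exp 1 + Real.exp 15) * B * Real.exp (-(v / (4 * Real.log z)))) := by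
          gcongr
      _ = (C₁ * Real.exp 1 + Real.exp 15) * B * (v ^ k * Real.exp (-(v / (4 * Real.log z)))) := by
          ring
      _ ≤ (C₁ * Real.exp 1 + Real.exp 15) * B *
          (128 * Real.log z ^ k * Real.exp (-(v / (8 * Real.log z)))) := by
          have := pow_mul_exp_le hv0 hl0 hk
          gcongr
      _ = _ := by ring
  have hs3 : (R.card : ℝ) * (2 * η * (v + 1)) ≤ (C₁ + 1) * B * (2 * η * (v + 1)) := by gcongr
  refine (abs_add_le _ _).trans ((add_le_add (hs1.trans hs3) hs2).trans ?_)
  have p1 : 0 ≤ 2 * (C₁ + 1) * B * (Real.log z ^ k * Real.exp (-(v / (8 * Real.log z)))) := by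
    positivity
  have p2 : 0 ≤ 128 * (C₁ * Real.exp 1 + Real.exp 15) * B * (η * (v + 1)) := by positivity
  linarith

end ExcChar

namespace ExcChar

open Finset Real MeasureTheory

/-- The Fourier integral with the normalisation `e^{-itv}`. -/
noncomputable def ft (g : ℝ → ℂ) (t : ℝ) : ℂ := ∫ v, g v * Complex.exp (-(t * v : ℝ) * Complex.I)

lemma norm_exp_real_I (a : ℝ) : ‖Complex.exp (-(a : ℝ) * Complex.I)‖ = 1 := by
  rw [show (-(a : ℂ)) = ((-a : ℝ) : ℂ) by push_cast; ring]
  exact Complex.norm_exp_ofReal_mul_I _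

lemma norm_ft_le (g : ℝ → ℂ) (t : ℝ) : ‖ft g t‖ ≤ ∫ v, ‖g v‖ := by
  refine (norm_integral_le_integral_norm _).trans (le_of_eq ?_)
  congr 1
  ext v
  rw [norm_mul, norm_exp_real_I, mul_one]

lemma ft_continuous {g : ℝ → ℂ} (hg : Integrable g) : Continuous (ft g) := by
  refine continuous_of_dominated (bound := fun v => ‖g v‖) ?_ ?_ hg.norm ?_
  · intro t
    exact hg.aestronglyMeasurable.mul (by fun_prop)
  · intro t
    refine Filter.Eventually.of_forall fun v => ?_
    rw [norm_mul, norm_exp_real_I, mul_one]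
  · refine Filter.Eventually.of_forall fun v => ?_
    fun_prop

lemma integral_mul_ft {f g : ℝ → ℂ} (hf : Integrable f) (hg : Integrable g) :
    ∫ t, f t * ft g t = ∫ v, g v * ft f v := by
  have h1 : ∀ t, f t * ft g t = ∫ v, f t * g v * Complex.exp (-(t * v : ℝ) * Complex.I) := by
    intro t
    rw [ft, ← integral_const_mul]
    congr 1; ext v; ring
  have h2 : ∀ v, g v * ft f v = ∫ t, f t * g v * Complex.exp (-(t * v : ℝ) * Complex.I) := by
    intro v
    rw [ft, ← integral_const_mul]
    congr 1; ext t
    rw [mul_comm v t]; ring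
  simp_rw [h1, h2]
  refine integral_integral_swap ?_
  have := hf.mul_prod hg
  have h3 : Integrable (fun p : ℝ × ℝ => Complex.exp (-(p.1 * p.2 : ℝ) * Complex.I) *
      (f p.1 * g p.2)) (volume.prod volume) := by
    refine this.bdd_mul (c := 1) (Continuous.aestronglyMeasurable (by fun_prop)) ?_
    refine Filter.Eventually.of_forall fun p => ?_
    rw [norm_exp_real_I]
  refine h3.congr (Filter.Eventually.of_forall fun p => ?_)
  simp only [Function.uncurry]
  ring

lemma conj_ft (g : ℝ → ℂ) (t : ℝ) :
    (starRingEnd ℂ) (ft g t) = ft (fun v => (starRingEnd ℂ) (g v)) (-t) := by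
  rw [ft, ft, ← integral_conj]
  congr 1; ext v
  rw [map_mul, ← Complex.exp_conj]
  congr 2
  simp

lemma ft_mul_exp (g : ℝ → ℂ) (t a : ℝ) :
    ft (fun v => g v * Complex.exp (-(a * v : ℝ) * Complex.I)) t = ft g (t + a) := by
  rw [ft, ft]
  congr 1; ext v
  rw [mul_assoc, ← Complex.exp_add]
  congr 2
  push_cast; ring

lemma ft_gauss {T : ℝ} (hT : 0 < T) (u : ℝ) :
    ft (fun t => ((Real.exp (-(t / T) ^ 2) : ℝ) : ℂ)) u =
      ((√π * T * Real.exp (-(T * u / 2) ^ 2) : ℝ) : ℂ) := by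
  have hb : 0 < ((1 / T ^ 2 : ℝ) : ℂ).re := by rw [Complex.ofReal_re]; positivity
  have h := fourierIntegral_gaussian hb (-u : ℂ)
  rw [ft]
  have h1 : ∀ v : ℝ, ((Real.exp (-(v / T) ^ 2) : ℝ) : ℂ) * Complex.exp (-(u * v : ℝ) * Complex.I) =
      Complex.exp (Complex.I * (-u : ℂ) * v) * Complex.exp (-((1 / T ^ 2 : ℝ) : ℂ) * v ^ 2) := by
    intro v
    rw [Complex.ofReal_exp, mul_comm]
    congr 2
    · push_cast; ring
    · push_cast; field_simp
  simp_rw [h1]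
  rw [h, Complex.ofReal_mul, Complex.ofReal_exp]
  congr 1
  · rw [show ((π : ℂ) / ((1 / T ^ 2 : ℝ) : ℂ)) = ((π * T ^ 2 : ℝ) : ℂ) by push_cast; field_simp,
      show (1 / 2 : ℂ) = ((1 / 2 : ℝ) : ℂ) by push_cast; rfl,
      ← Complex.ofReal_cpow (by positivity), ← Real.sqrt_eq_rpow, Real.sqrt_mul (by positivity),
      Real.sqrt_sq hT.le]
  · congr 1
    push_cast
    field_simp
    ring

lemma integrable_gauss {T : ℝ} (hT : 0 < T) : Integrable fun t : ℝ => Real.exp (-(t / T) ^ 2) := by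
  have := integrable_exp_neg_mul_sq (b := 1 / T ^ 2) (by positivity)
  refine this.congr (Filter.Eventually.of_forall fun t => ?_)
  simp only
  congr 1
  field_simp

lemma integral_gauss {T : ℝ} (hT : 0 < T) : ∫ t : ℝ, Real.exp (-(t / T) ^ 2) = √π * T := by
  have h := integral_gaussian (1 / T ^ 2)
  rw [div_div_eq_mul_div, div_one, Real.sqrt_mul (by positivity), Real.sqrt_sq hT.le] at h
  rw [← h]
  congr 1; ext t; congr 1; field_simp

/-- The Gaussian-weighted mean square of a Fourier integral as a double integral. -/
lemma integral_gauss_ft_sq {g : ℝ → ℂ} (hg : Integrable g) {T : ℝ} (hT : 0 < T) :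
    ((∫ t, Real.exp (-(t / T) ^ 2) * ‖ft g t‖ ^ 2 : ℝ) : ℂ) =
      ∫ v, g v * ∫ v', (starRingEnd ℂ) (g v') *
        ((√π * T * Real.exp (-(T * (v - v') / 2) ^ 2) : ℝ) : ℂ) := by
  set G : ℝ → ℂ := fun t => ((Real.exp (-(t / T) ^ 2) : ℝ) : ℂ) with hG
  have hGi : Integrable G := (integrable_gauss hT).ofReal
  set gc : ℝ → ℂ := fun v => (starRingEnd ℂ) (g v) with hgc
  have hgci : Integrable gc := hg.norm.mono' (Complex.continuous_conj.comp_aestronglyMeasurable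
    hg.aestronglyMeasurable) (Filter.Eventually.of_forall fun v => by simp [hgc])
  set f : ℝ → ℂ := fun t => G t * (starRingEnd ℂ) (ft g t) with hf
  have hfi : Integrable f := by
    have : Integrable (fun t => (starRingEnd ℂ) (ft g t) * G t) := by
      refine hGi.bdd_mul (c := ∫ v, ‖g v‖) ?_ ?_
      · exact (Complex.continuous_conj.comp (ft_continuous hg)).aestronglyMeasurable
      · refine Filter.Eventually.of_forall fun t => ?_
        rw [RCLike.norm_conj]
        exact norm_ft_le g t
    refine this.congr (Filter.Eventually.of_forall fun t => ?_)
    simp only [hf]; ring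
  have h1 : ((∫ t, Real.exp (-(t / T) ^ 2) * ‖ft g t‖ ^ 2 : ℝ) : ℂ) = ∫ t, f t * ft g t := by
    rw [← integral_complex_ofReal]
    congr 1; ext t
    simp only [hf, hG]
    rw [mul_assoc, ← Complex.normSq_eq_conj_mul_self, Complex.normSq_eq_norm_sq]
    push_cast; ring
  rw [h1, integral_mul_ft hfi hg]
  congr 1; ext v
  congr 1
  have h2 : ft f v = ∫ t, (fun s => G s * Complex.exp (-(-v * s : ℝ) * Complex.I)) t * ft gc t := by
    rw [ft, ← integral_neg_eq_self]
    congr 1; ext t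
    simp only [hf]
    rw [conj_ft, neg_neg]
    have : G (-t) = G t := by simp [hG, neg_div]
    rw [this]
    rw [show v * -t = -v * t by ring]
    ring
  have hi2 : Integrable fun s => G s * Complex.exp (-(-v * s : ℝ) * Complex.I) := by
    have : Integrable (fun s => Complex.exp (-(-v * s : ℝ) * Complex.I) * G s) := by
      refine hGi.bdd_mul (c := 1) (Continuous.aestronglyMeasurable (by fun_prop)) ?_
      exact Filter.Eventually.of_forall fun t => by rw [norm_exp_real_I]
    refine this.congr (Filter.Eventually.of_forall fun t => ?_)
    ring
  rw [h2, integral_mul_ft hi2 hgci]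
  congr 1; ext v'
  congr 1
  rw [ft_mul_exp, hG, ft_gauss hT, show (T * (v' + -v) / 2) ^ 2 = (T * (v - v') / 2) ^ 2 by ring]

/-- A Plancherel-type inequality on a bounded interval. -/
theorem setIntegral_ft_sq_le {g : ℝ → ℂ} (hg : Integrable g)
    (hg2 : Integrable fun v => ‖g v‖ ^ 2) {T : ℝ} (hT : 0 < T) :
    ∫ t in Set.Icc (-T) T, ‖ft g t‖ ^ 2 ≤ 20 * ∫ v, ‖g v‖ ^ 2 := by
  have hGi := integrable_gauss hT
  have hint : Integrable fun t => Real.exp (-(t / T) ^ 2) * ‖ft g t‖ ^ 2 := by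
    have : Integrable (fun t => ‖ft g t‖ ^ 2 * Real.exp (-(t / T) ^ 2)) := by
      refine hGi.bdd_mul (c := (∫ v, ‖g v‖) ^ 2) ?_ ?_
      · exact ((ft_continuous hg).norm.pow 2).aestronglyMeasurable
      · refine Filter.Eventually.of_forall fun t => ?_
        rw [norm_pow, norm_norm]
        gcongr
        exact norm_ft_le g t
    refine this.congr (Filter.Eventually.of_forall fun t => ?_)
    ring
  have h1 : ∫ t in Set.Icc (-T) T, ‖ft g t‖ ^ 2 ≤
      Real.exp 1 * ∫ t, Real.exp (-(t / T) ^ 2) * ‖ft g t‖ ^ 2 := by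
    rw [← integral_const_mul]
    calc ∫ t in Set.Icc (-T) T, ‖ft g t‖ ^ 2
        ≤ ∫ t in Set.Icc (-T) T, Real.exp 1 * (Real.exp (-(t / T) ^ 2) * ‖ft g t‖ ^ 2) := by
          refine setIntegral_mono_on ?_ (hint.const_mul _).integrableOn measurableSet_Icc ?_
          · exact (((ft_continuous hg).norm.pow 2).continuousOn).integrableOn_compact isCompact_Icc
          · intro t ht
            rw [← mul_assoc, ← Real.exp_add]
            refine le_mul_of_one_le_left (by positivity) (Real.one_le_exp ?_)
            have : (t / T) ^ 2 ≤ 1 := by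
              rw [sq_le_one_iff_abs_le_one, abs_div, abs_of_pos hT, div_le_one hT]
              exact abs_le.2 ht
            linarith
      _ ≤ _ := setIntegral_le_integral (hint.const_mul _)
          (Filter.Eventually.of_forall fun t => by positivity)
  set k : ℝ → ℝ := fun u => √π * T * Real.exp (-(T * u / 2) ^ 2) with hk
  have hk0 : ∀ u, 0 ≤ k u := fun u => by positivity
  have hki : Integrable k := by
    have := (integrable_gauss (T := 2 / T) (by positivity)).const_mul (√π * T)
    refine this.congr (Filter.Eventually.of_forall fun t => ?_)
    simp only [hk]
    congr 4
    field_simp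
  have hkI : ∫ u, k u = 2 * π := by
    have := integral_gauss (T := 2 / T) (by positivity)
    rw [hk, integral_const_mul]
    have h : (fun u : ℝ => Real.exp (-(T * u / 2) ^ 2)) = fun u => Real.exp (-(u / (2 / T)) ^ 2) := by
      ext u; congr 3; field_simp
    rw [h, this]
    have := Real.mul_self_sqrt pi_pos.le
    field_simp
    nlinarith
  have hkconv : ∀ v, ∫ v', k (v - v') = 2 * π := fun v => by
    rw [integral_sub_left_eq_self k volume v, hkI]
  have hksymm : ∀ u, k (-u) = k u := fun u => by
    simp only [hk]; congr 3; ring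
  have hprod : Integrable (fun p : ℝ × ℝ => ‖g p.1‖ ^ 2 * k (p.1 - p.2)) (volume.prod volume) := by
    have h := hg2.mul_prod hki (μ := volume) (ν := volume)
    have hmp := measurePreserving_prod_neg_add (G := ℝ) volume volume
    refine (hmp.integrable_comp_of_integrable h).congr (Filter.Eventually.of_forall fun p => ?_)
    simp only [Function.comp]
    rw [← hksymm (p.1 - p.2)]
    congr 2; ring
  have hprod' : Integrable (fun p : ℝ × ℝ => ‖g p.2‖ ^ 2 * k (p.1 - p.2)) (volume.prod volume) := by
    refine hprod.swap.congr (Filter.Eventually.of_forall fun p => ?_)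
    simp only [Function.comp, Prod.fst_swap, Prod.snd_swap]
    rw [← hksymm (p.1 - p.2)]
    congr 2; ring
  set M : ℝ × ℝ → ℝ := fun p => (‖g p.1‖ ^ 2 * k (p.1 - p.2) + ‖g p.2‖ ^ 2 * k (p.1 - p.2)) / 2
    with hM
  have hMi : Integrable M (volume.prod volume) := (hprod.add hprod').div_const 2
  have hMI : ∫ v, ∫ v', M (v, v') = 2 * π * ∫ v, ‖g v‖ ^ 2 := by
    rw [← integral_prod M hMi, hM, integral_div, integral_add hprod hprod', integral_prod _ hprod,
      integral_prod_symm _ hprod']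
    have e1 : ∀ v, ∫ v', ‖g v‖ ^ 2 * k (v - v') = 2 * π * ‖g v‖ ^ 2 := fun v => by
      rw [integral_const_mul, hkconv]; ring
    have e2 : ∀ v', ∫ v, ‖g v'‖ ^ 2 * k (v - v') = 2 * π * ‖g v'‖ ^ 2 := fun v' => by
      rw [integral_const_mul, integral_sub_right_eq_self k v', hkI]; ring
    simp only [e1, e2]
    rw [integral_const_mul]
    ring
  have key : ∫ t, Real.exp (-(t / T) ^ 2) * ‖ft g t‖ ^ 2 ≤ 2 * π * ∫ v, ‖g v‖ ^ 2 := by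
    have h0 : 0 ≤ ∫ t, Real.exp (-(t / T) ^ 2) * ‖ft g t‖ ^ 2 :=
      integral_nonneg fun t => by positivity
    calc _ = ‖((∫ t, Real.exp (-(t / T) ^ 2) * ‖ft g t‖ ^ 2 : ℝ) : ℂ)‖ := by
          rw [Complex.norm_real, Real.norm_of_nonneg h0]
      _ ≤ ∫ v, ∫ v', M (v, v') := by
          rw [integral_gauss_ft_sq hg hT]
          refine norm_integral_le_of_norm_le hMi.integral_prod_left ?_
          filter_upwards [hMi.prod_right_ae] with v hv
          rw [← integral_const_mul]
          refine norm_integral_le_of_norm_le hv (Filter.Eventually.of_forall fun v' => ?_)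
          rw [norm_mul, norm_mul, RCLike.norm_conj, Complex.norm_real,
            Real.norm_of_nonneg (hk0 (v - v'))]
          have : ‖g v‖ * ‖g v'‖ ≤ (‖g v‖ ^ 2 + ‖g v'‖ ^ 2) / 2 := by
            nlinarith [sq_nonneg (‖g v‖ - ‖g v'‖)]
          calc _ = ‖g v‖ * ‖g v'‖ * k (v - v') := by ring
            _ ≤ (‖g v‖ ^ 2 + ‖g v'‖ ^ 2) / 2 * k (v - v') := by
              have := hk0 (v - v'); gcongr
            _ = M (v, v') := by simp only [hM]; ring
      _ = _ := hMI
  refine h1.trans ?_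
  have hI0 : 0 ≤ ∫ v, ‖g v‖ ^ 2 := integral_nonneg fun v => by positivity
  calc _ ≤ Real.exp 1 * (2 * π * ∫ v, ‖g v‖ ^ 2) := by gcongr
    _ = (Real.exp 1 * (2 * π)) * ∫ v, ‖g v‖ ^ 2 := by ring
    _ ≤ 20 * ∫ v, ‖g v‖ ^ 2 := by
      gcongr
      have := Real.exp_one_lt_d9
      have := Real.pi_lt_d2
      have := Real.pi_pos
      nlinarith

/-- The Mellin transform of the indicator of a short multiplicative interval. -/
noncomputable def cfac (η : ℝ) (s : ℂ) : ℂ := (Complex.exp (s * Real.log (1 + η)) - 1) / s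

lemma half_le_norm_cfac {η : ℝ} {s : ℂ} (hη : 0 < η) (hη1 : η ≤ 1 / 3) (hs : s ≠ 0)
    (h : ‖s‖ * η ≤ 1 / 4) : η / 2 ≤ ‖cfac η s‖ := by
  set l := Real.log (1 + η) with hl
  have hl1 : l ≤ η := by
    have := Real.log_le_sub_one_of_pos (show 0 < 1 + η by linarith); linarith
  have hl2 : 3 / 4 * η ≤ l := by
    have h1 := Real.one_sub_inv_le_log_of_pos (show 0 < 1 + η by linarith)
    have h2 : 1 - (1 + η)⁻¹ = η / (1 + η) := by field_simp; ring
    have h3 : 3 / 4 * η ≤ η / (1 + η) := by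
      rw [le_div_iff₀ (by linarith)]; nlinarith
    linarith
  have hl0 : 0 < l := by linarith
  have hsn : 0 < ‖s‖ := norm_pos_iff.2 hs
  have hw : ‖s * l‖ = ‖s‖ * l := by rw [norm_mul, Complex.norm_real, Real.norm_of_nonneg hl0.le]
  have hw1 : ‖s‖ * l ≤ 1 / 4 := le_trans (by gcongr) h
  have h1 := Complex.norm_exp_sub_one_sub_id_le (x := s * l) (by rw [hw]; linarith)
  rw [hw] at h1
  have h2 : ‖s * l‖ - ‖Complex.exp (s * l) - 1 - s * l‖ ≤ ‖Complex.exp (s * l) - 1‖ := by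
    have := norm_sub_norm_le (s * l) (-(Complex.exp (s * l) - 1 - s * l))
    rw [norm_neg] at this
    refine this.trans (le_of_eq ?_)
    congr 1; ring
  rw [cfac, norm_div, le_div_iff₀ hsn]
  rw [hw] at h2
  rw [← hl]
  have h3 : (‖s‖ * l) ^ 2 ≤ 1 / 4 * (‖s‖ * l) := by
    have : 0 ≤ ‖s‖ * l := by positivity
    nlinarith
  have h4 : ‖s‖ * (3 / 4 * η) ≤ ‖s‖ * l := by gcongr
  have h5 : 0 ≤ ‖s‖ * η := by positivity
  nlinarith

lemma integral_exp_neg_Ioc {s : ℂ} (hs : s ≠ 0) (a b : ℝ) :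
    ∫ v in a..b, Complex.exp (-s * v) = (Complex.exp (-s * a) - Complex.exp (-s * b)) / s := by
  rw [integral_exp_mul_complex (neg_ne_zero.2 hs), div_neg, ← neg_div, neg_sub]

/-- Short-interval sums of `f` determine the L-series of `f`. -/
theorem cfac_mul_LSeries {f : ℕ → ℂ} (hf : ∀ n < 2, f n = 0) {s : ℂ} (hs : 0 < s.re)
    (hsum : LSeriesSummable f s) {η : ℝ} (hη : 0 < η) (hη1 : η ≤ 1) :
    cfac η s * LSeries f s =
      ∫ v in Set.Ioi (0 : ℝ), (∑ n ∈ Ioc ⌊Real.exp v⌋₊ ⌊Real.exp v * (1 + η)⌋₊, f n) *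
        Complex.exp (-s * v) := by
  have hs0 : s ≠ 0 := by rintro rfl; simp at hs
  set l := Real.log (1 + η) with hl
  have hl0 : 0 < l := Real.log_pos (by linarith)
  have hl2 : l ≤ Real.log 2 := Real.log_le_log (by linarith) (by linarith)
  set I : ℕ → Set ℝ := fun n => Set.Ico (Real.log n - l) (Real.log n) with hI
  set F : ℕ → ℝ → ℂ := fun n => (I n).indicator fun v => f n * Complex.exp (-s * v) with hF
  have hIint : ∀ n, IntegrableOn (fun v : ℝ => f n * Complex.exp (-s * v)) (I n) := fun n =>
    ((by fun_prop : Continuous fun v : ℝ => f n * Complex.exp (-s * v)).integrableOn_Icc).mono_set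
      Set.Ico_subset_Icc_self
  have hFi : ∀ n, Integrable (F n) (volume.restrict (Set.Ioi 0)) := fun n =>
    ((integrable_indicator_iff measurableSet_Ico).2 (hIint n)).integrableOn
  have hsub : ∀ n, 2 ≤ n → Set.Ioc (Real.log n - l) (Real.log n) ⊆ Set.Ioi 0 := by
    intro n hn v hv
    have : Real.log 2 ≤ Real.log n := Real.log_le_log (by norm_num) (by exact_mod_cast hn)
    exact lt_of_le_of_lt (by linarith) hv.1
  have hval : ∀ n, ∫ v in Set.Ioi (0 : ℝ), F n v = cfac η s * LSeries.term f s n := by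
    intro n
    rcases lt_or_ge n 2 with hn | hn
    · have h1 : F n = 0 := by
        ext v; simp [hF, hf n hn]
      have h2 : LSeries.term f s n = 0 := by
        rw [LSeries.term_def, hf n hn]; simp
      rw [h1, h2]; simp
    · have hn0 : n ≠ 0 := by omega
      have hnr : (0 : ℝ) < n := by positivity
      have e1 : ∫ v in Set.Ioi (0 : ℝ), F n v = ∫ v in I n, f n * Complex.exp (-s * v) := by
        have hsub' : I n ⊆ Set.Ici 0 := by
          intro v hv
          have : Real.log 2 ≤ Real.log n := Real.log_le_log (by norm_num) (by exact_mod_cast hn)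
          exact le_trans (by linarith) hv.1
        rw [← integral_Ici_eq_integral_Ioi, hF, setIntegral_indicator measurableSet_Ico,
          Set.inter_eq_self_of_subset_right hsub']
      rw [e1, hI, integral_Ico_eq_integral_Ioc, ← intervalIntegral.integral_of_le (by linarith),
        intervalIntegral.integral_const_mul, integral_exp_neg_Ioc hs0, LSeries.term_def, if_neg hn0,
        cfac]
      have e2 : ((n : ℂ)) ^ s = Complex.exp (s * Real.log n) := by
        rw [Complex.cpow_def_of_ne_zero (by exact_mod_cast hn0), ← Complex.ofReal_natCast,
          Complex.ofReal_log hnr.le, mul_comm]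
      rw [e2, div_eq_mul_inv (f n), ← Complex.exp_neg]
      have e3 : Complex.exp (-s * ((Real.log n - l : ℝ) : ℂ)) =
          Complex.exp (s * l) * Complex.exp (-(s * Real.log n)) := by
        rw [← Complex.exp_add]; congr 1; push_cast; ring
      rw [e3, neg_mul]
      ring
  have hnorm : ∀ n, ∫ v in Set.Ioi (0 : ℝ), ‖F n v‖ ≤ l * Real.exp (s.re * l) *
      ‖LSeries.term f s n‖ := by
    intro n
    rcases lt_or_ge n 2 with hn | hn
    · have h1 : F n = 0 := by
        ext v; simp [hF, hf n hn]
      rw [h1]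
      simp only [Pi.zero_apply, norm_zero, integral_zero]
      positivity
    · have hn0 : n ≠ 0 := by omega
      have hnr : (0 : ℝ) < n := by positivity
      have e1 : ∫ v in Set.Ioi (0 : ℝ), ‖F n v‖ ≤ ∫ v, ‖F n v‖ :=
        setIntegral_le_integral ((integrable_indicator_iff measurableSet_Ico).2 (hIint n)).norm
          (Filter.Eventually.of_forall fun v => norm_nonneg _)
      refine e1.trans ?_
      have e2 : (fun v => ‖F n v‖) = (I n).indicator fun v => ‖f n * Complex.exp (-s * v)‖ := by
        ext v; rw [hF]; exact norm_indicator_eq_indicator_norm _ _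
      rw [e2, integral_indicator measurableSet_Ico]
      have e3 : ∀ v ∈ I n, ‖‖f n * Complex.exp (-s * v)‖‖ ≤
          Real.exp (s.re * l) * ‖LSeries.term f s n‖ := by
        intro v hv
        rw [norm_norm, norm_mul, Complex.norm_exp, LSeries.norm_term_eq, if_neg hn0]
        have : (-s * (v : ℂ)).re = - (s.re * v) := by simp
        rw [this, Real.rpow_def_of_pos hnr, div_eq_mul_inv, ← Real.exp_neg,
          mul_comm (Real.exp _), mul_assoc, ← Real.exp_add]
        refine mul_le_mul_of_nonneg_left (Real.exp_le_exp.2 ?_) (norm_nonneg _)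
        have := hv.1
        nlinarith
      have e4 := norm_setIntegral_le_of_norm_le_const (μ := volume) (s := I n)
        (by rw [hI]; simp) e3
      have e5 : volume.real (I n) = l := by
        rw [hI, Real.volume_real_Ico_of_le (by linarith)]; ring
      rw [e5] at e4
      refine (Real.le_norm_self _).trans (e4.trans (le_of_eq ?_))
      ring
  have hsn : Summable fun n => ∫ v in Set.Ioi (0 : ℝ), ‖F n v‖ :=
    Summable.of_nonneg_of_le (fun n => integral_nonneg fun v => norm_nonneg _) hnorm
      (hsum.norm.mul_left _)
  have := hasSum_integral_of_summable_integral_norm hFi hsn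
  rw [LSeries, ← tsum_mul_left]
  rw [tsum_congr fun n => (hval n).symm, this.tsum_eq]
  refine setIntegral_congr_fun measurableSet_Ioi fun v hv => ?_
  rw [tsum_eq_sum (s := Ioc ⌊Real.exp v⌋₊ ⌊Real.exp v * (1 + η)⌋₊), sum_mul]
  · refine sum_congr rfl fun n hn => ?_
    rw [mem_Ioc] at hn
    have h1 : Real.exp v < n := (Nat.floor_lt (by positivity)).1 hn.1
    have h2 : (n : ℝ) ≤ Real.exp v * (1 + η) := (Nat.le_floor_iff (by positivity)).1 hn.2
    have hnr : (0 : ℝ) < n := (Real.exp_pos v).trans h1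
    rw [hF]
    refine Set.indicator_of_mem ?_ _
    refine ⟨?_, (Real.lt_log_iff_exp_lt hnr).2 h1⟩
    have := Real.log_le_log hnr h2
    rw [Real.log_mul (by positivity) (by linarith), Real.log_exp] at this
    linarith
  · intro n hn
    rcases Nat.eq_zero_or_pos n with rfl | hn0
    · simp [hF, hf 0 (by norm_num)]
    have hnr : (0 : ℝ) < n := by exact_mod_cast hn0
    rw [hF]
    refine Set.indicator_of_notMem ?_ _
    intro hmem
    apply hn
    rw [mem_Ioc]
    refine ⟨(Nat.floor_lt (by positivity)).2 ((Real.lt_log_iff_exp_lt hnr).1 hmem.2),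
      (Nat.le_floor_iff (by positivity)).2 ?_⟩
    have h3 : Real.log n ≤ v + l := by have := hmem.1; linarith
    have := Real.exp_le_exp.2 h3
    rwa [Real.exp_log hnr, Real.exp_add, hl, Real.exp_log (by linarith)] at this

/-- Sums over short multiplicative intervals. -/
noncomputable def shortSum (η : ℝ) (f : ℕ → ℂ) (v : ℝ) : ℂ :=
  ∑ n ∈ Ioc ⌊Real.exp v⌋₊ ⌊Real.exp v * (1 + η)⌋₊, f n

lemma measurable_shortSum {η : ℝ} (hη : 0 ≤ η) (f : ℕ → ℂ) : Measurable (shortSum η f) := by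
  have h : shortSum η f = fun v => (∑ n ∈ Finset.range (⌊Real.exp v * (1 + η)⌋₊ + 1), f n) -
      ∑ n ∈ Finset.range (⌊Real.exp v⌋₊ + 1), f n := by
    ext v
    have hle : ⌊Real.exp v⌋₊ + 1 ≤ ⌊Real.exp v * (1 + η)⌋₊ + 1 := by
      refine Nat.succ_le_succ (Nat.floor_le_floor ?_)
      nlinarith [Real.exp_pos v]
    rw [← Finset.sum_Ico_eq_sub _ hle, shortSum]
    congr 1
    ext n; simp only [mem_Ioc, mem_Ico]; omega
  rw [h]
  have h1 : Measurable fun m : ℕ => ∑ n ∈ Finset.range (m + 1), f n := measurable_from_top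
  exact (h1.comp (Nat.measurable_floor.comp (by fun_prop))).sub
    (h1.comp (Nat.measurable_floor.comp (by fun_prop)))

/-- The majorant for normalized short-interval errors. -/
noncomputable def majo (k : ℕ) (ℓ η Q v : ℝ) : ℝ :=
  ℓ ^ k * Real.exp (-(1 / (8 * ℓ)) * v) + 3 * Q * η * Real.exp (-(1 / (2 * Q)) * v)

lemma majo_nonneg {k : ℕ} {ℓ η Q v : ℝ} (hℓ : 0 < ℓ) (hQ : 0 < Q) (hη : 0 < η) :
    0 ≤ majo k ℓ η Q v := by
  unfold majo; positivity

lemma integrableOn_majo (k : ℕ) {ℓ η Q : ℝ} (hℓ : 0 < ℓ) (hQ : 0 < Q) :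
    IntegrableOn (majo k ℓ η Q) (Set.Ioi 0) :=
  ((exp_neg_integrableOn_Ioi 0 (by positivity)).const_mul _).add
    ((exp_neg_integrableOn_Ioi 0 (by positivity)).const_mul _)

lemma integral_exp_neg_mul_Ioi {a : ℝ} (ha : 0 < a) :
    ∫ v in Set.Ioi (0 : ℝ), Real.exp (-a * v) = 1 / a := by
  rw [integral_exp_mul_Ioi (by linarith)]
  simp

lemma integral_majo_le {k : ℕ} {ℓ η Q : ℝ} (hℓ : 1 ≤ ℓ) (hQ : 1 ≤ Q) (hη : 0 < η)
    (h : η * Q ^ 3 ≤ 1 / 18) : ∫ v in Set.Ioi (0 : ℝ), majo k ℓ η Q v ≤ 9 * ℓ ^ (k + 1) := by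
  have i1 := (exp_neg_integrableOn_Ioi 0 (show 0 < 1 / (8 * ℓ) by positivity)).const_mul (ℓ ^ k)
  have i2 := (exp_neg_integrableOn_Ioi 0 (show 0 < 1 / (2 * Q) by positivity)).const_mul
    (3 * Q * η)
  unfold majo
  rw [integral_add i1 i2, integral_const_mul, integral_const_mul,
    integral_exp_neg_mul_Ioi (by positivity), integral_exp_neg_mul_Ioi (by positivity)]
  have h1 : 1 ≤ ℓ ^ (k + 1) := one_le_pow₀ hℓ
  have h2 : Q ^ 2 ≤ Q ^ 3 := pow_le_pow_right₀ hQ (by norm_num)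
  have h3 : η * Q ^ 2 ≤ η * Q ^ 3 := by gcongr
  have e1 : ℓ ^ k * (1 / (1 / (8 * ℓ))) = 8 * ℓ ^ (k + 1) := by
    rw [one_div_one_div]; ring
  have e2 : 3 * Q * η * (1 / (1 / (2 * Q))) = 6 * (η * Q ^ 2) := by
    rw [one_div_one_div]; ring
  rw [e1, e2]; linarith

lemma majo_sq_le {k : ℕ} {ℓ η Q v : ℝ} : majo k ℓ η Q v ^ 2 ≤
    2 * ℓ ^ (2 * k) * Real.exp (-(1 / (4 * ℓ)) * v) +
      18 * Q ^ 2 * η ^ 2 * Real.exp (-(1 / Q) * v) := by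
  unfold majo
  have e1 : Real.exp (-(1 / (4 * ℓ)) * v) = Real.exp (-(1 / (8 * ℓ)) * v) ^ 2 := by
    rw [← Real.exp_nat_mul]; congr 1; push_cast; ring
  have e2 : Real.exp (-(1 / Q) * v) = Real.exp (-(1 / (2 * Q)) * v) ^ 2 := by
    rw [← Real.exp_nat_mul]; congr 1; push_cast; ring
  rw [e1, e2]
  refine add_pow_two_le_aux.trans (le_of_eq ?_)
  ring
where
  add_pow_two_le_aux {a b : ℝ} : (a + b) ^ 2 ≤ 2 * a ^ 2 + 2 * b ^ 2 := by
    nlinarith [sq_nonneg (a - b)]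

lemma integrableOn_majo_sq (k : ℕ) {ℓ η Q : ℝ} (hℓ : 0 < ℓ) (hQ : 0 < Q) :
    IntegrableOn (fun v => majo k ℓ η Q v ^ 2) (Set.Ioi 0) := by
  refine Integrable.mono' (((exp_neg_integrableOn_Ioi 0 (show 0 < 1 / (4 * ℓ) by positivity)).const_mul
    (2 * ℓ ^ (2 * k))).add ((exp_neg_integrableOn_Ioi 0 (show 0 < 1 / Q by positivity)).const_mul
    (18 * Q ^ 2 * η ^ 2))) ?_ (Filter.Eventually.of_forall fun v => ?_)
  · unfold majo
    exact (by fun_prop : Continuous _).aestronglyMeasurable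
  · rw [Real.norm_of_nonneg (sq_nonneg _)]
    exact majo_sq_le

lemma integral_majo_sq_le {k : ℕ} {ℓ η Q : ℝ} (hℓ : 1 ≤ ℓ) (hQ : 1 ≤ Q) (hη : 0 < η)
    (h : η * Q ^ 3 ≤ 1 / 18) :
    ∫ v in Set.Ioi (0 : ℝ), majo k ℓ η Q v ^ 2 ≤ 9 * ℓ ^ (2 * k + 1) := by
  have i1 := (exp_neg_integrableOn_Ioi 0 (show 0 < 1 / (4 * ℓ) by positivity)).const_mul
    (2 * ℓ ^ (2 * k))
  have i2 := (exp_neg_integrableOn_Ioi 0 (show 0 < 1 / Q by positivity)).const_mul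
    (18 * Q ^ 2 * η ^ 2)
  have h0 := setIntegral_mono (integrableOn_majo_sq k (η := η) (show 0 < ℓ by linarith)
    (show 0 < Q by linarith)) (i1.add i2) (fun v => majo_sq_le)
  refine h0.trans ?_
  simp only [Pi.add_apply]
  rw [integral_add i1 i2, integral_const_mul, integral_const_mul,
    integral_exp_neg_mul_Ioi (by positivity), integral_exp_neg_mul_Ioi (by positivity)]
  have h1 : 1 ≤ ℓ ^ (2 * k + 1) := one_le_pow₀ hℓ
  have e1 : 2 * ℓ ^ (2 * k) * (1 / (1 / (4 * ℓ))) = 8 * ℓ ^ (2 * k + 1) := by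
    rw [one_div_one_div]; ring
  have e2 : 18 * Q ^ 2 * η ^ 2 * (1 / (1 / Q)) = 18 * (η * Q ^ 3) * η := by
    rw [one_div_one_div]; ring
  have h4 : η ≤ 1 / 18 := by
    have : 1 ≤ Q ^ 3 := one_le_pow₀ hQ
    nlinarith
  rw [e1, e2]; nlinarith

lemma exp_mul_le_majo {k : ℕ} {ℓ η Q σ v : ℝ} (hℓ : 0 < ℓ) (hQ : 1 ≤ Q) (hη : 0 < η)
    (hσ : 1 + 1 / Q ≤ σ) (hv : 0 ≤ v) :
    Real.exp v * (ℓ ^ k * Real.exp (-(v / (8 * ℓ))) + η * (v + 1)) * Real.exp (-σ * v) ≤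
      majo k ℓ η Q v := by
  have h1 : Real.exp v * Real.exp (-σ * v) ≤ Real.exp (-(1 / Q) * v) := by
    rw [← Real.exp_add]
    refine Real.exp_le_exp.2 ?_
    nlinarith
  have h2 : Real.exp (-(1 / Q) * v) = Real.exp (-(1 / (2 * Q)) * v) *
      Real.exp (-(1 / (2 * Q)) * v) := by
    rw [← Real.exp_add]; congr 1; field_simp; ring
  have h3 : (v + 1) * Real.exp (-(1 / (2 * Q)) * v) ≤ 3 * Q := by
    have h4 : 1 / (2 * Q) * v + 1 ≤ Real.exp (1 / (2 * Q) * v) := Real.add_one_le_exp _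
    have h5 : v = 2 * Q * (1 / (2 * Q) * v) := by field_simp
    have h6 : v + 1 ≤ 3 * Q * Real.exp (1 / (2 * Q) * v) := by
      have : 0 ≤ 1 / (2 * Q) * v := by positivity
      nlinarith
    calc (v + 1) * Real.exp (-(1 / (2 * Q)) * v) ≤
        3 * Q * Real.exp (1 / (2 * Q) * v) * Real.exp (-(1 / (2 * Q)) * v) := by gcongr
      _ = 3 * Q := by rw [mul_assoc, ← Real.exp_add]; simp
  have h7 : Real.exp (-(1 / Q) * v) ≤ 1 := Real.exp_le_one_iff.2 (by
    have : 0 ≤ 1 / Q * v := by positivity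
    linarith)
  have e1 : -(v / (8 * ℓ)) = -(1 / (8 * ℓ)) * v := by ring
  have hpos : 0 ≤ ℓ ^ k * Real.exp (-(v / (8 * ℓ))) + η * (v + 1) := by positivity
  calc _ = (Real.exp v * Real.exp (-σ * v)) *
        (ℓ ^ k * Real.exp (-(v / (8 * ℓ))) + η * (v + 1)) := by ring
    _ ≤ Real.exp (-(1 / Q) * v) * (ℓ ^ k * Real.exp (-(v / (8 * ℓ))) + η * (v + 1)) := by gcongr
    _ = Real.exp (-(1 / Q) * v) * (ℓ ^ k * Real.exp (-(v / (8 * ℓ)))) +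
        η * (((v + 1) * Real.exp (-(1 / (2 * Q)) * v)) * Real.exp (-(1 / (2 * Q)) * v)) := by
        rw [h2]; ring
    _ ≤ 1 * (ℓ ^ k * Real.exp (-(v / (8 * ℓ)))) +
        η * ((3 * Q) * Real.exp (-(1 / (2 * Q)) * v)) := by gcongr
    _ = majo k ℓ η Q v := by rw [majo, e1]; ring

lemma norm_exp_neg_mul (s : ℂ) (v : ℝ) : ‖Complex.exp (-s * v)‖ = Real.exp (-s.re * v) := by
  rw [Complex.norm_exp]; simp

lemma integrableOn_pow_mul_exp_neg (k : ℕ) {a : ℂ} (ha : 0 < a.re) :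
    IntegrableOn (fun v : ℝ => ((v ^ k : ℝ) : ℂ) * Complex.exp (-a * v)) (Set.Ioi 0) := by
  have h3 := Real.GammaIntegral_convergent (s := k + 1) (by positivity)
  have h4 := integrableOn_Ioi_comp_mul_left_iff (fun x : ℝ => Real.exp (-x) * x ^ ((k + 1 : ℝ) - 1))
    0 ha
  rw [mul_zero] at h4
  have h5 := (h4.2 h3).const_mul ((a.re ^ k)⁻¹)
  refine Integrable.mono' h5 (Measurable.aestronglyMeasurable (by fun_prop))
    ((ae_restrict_iff' measurableSet_Ioi).2 (Filter.Eventually.of_forall fun v hv => ?_))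
  have hv0 : (0 : ℝ) < v := hv
  rw [norm_mul, norm_exp_neg_mul, Complex.norm_real, Real.norm_of_nonneg (by positivity)]
  have : (a.re * v) ^ ((k + 1 : ℝ) - 1) = a.re ^ k * v ^ k := by
    rw [add_sub_cancel_right, Real.rpow_natCast, mul_pow]
  rw [this, neg_mul]
  refine le_of_eq ?_
  field_simp

lemma integral_pow_mul_exp_neg (k : ℕ) {a : ℂ} (ha : 0 < a.re) :
    ∫ v in Set.Ioi (0 : ℝ), ((v ^ k : ℝ) : ℂ) * Complex.exp (-a * v) =
      k.factorial / a ^ (k + 1) := by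
  have ha0 : a ≠ 0 := by rintro rfl; simp at ha
  induction k with
  | zero =>
    simp only [pow_zero, Complex.ofReal_one, one_mul, Nat.factorial_zero, Nat.cast_one, zero_add,
      pow_one]
    rw [integral_exp_mul_complex_Ioi (by simpa using ha)]
    simp
  | succ k ih =>
    have hd : ∀ v ∈ Set.Ici (0 : ℝ), HasDerivAt
        (fun v : ℝ => ((v ^ (k + 1) : ℝ) : ℂ) * Complex.exp (-a * v))
        ((k + 1) * (((v ^ k : ℝ) : ℂ) * Complex.exp (-a * v)) -
          a * (((v ^ (k + 1) : ℝ) : ℂ) * Complex.exp (-a * v))) v := by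
      intro v _
      have d1 : HasDerivAt (fun v : ℝ => ((v ^ (k + 1) : ℝ) : ℂ)) (((k + 1 : ℕ) * v ^ k : ℝ) : ℂ) v := by
        have := (hasDerivAt_pow (k + 1) v).ofReal_comp
        simpa using this
      have d2 : HasDerivAt (fun v : ℝ => Complex.exp (-a * v)) (Complex.exp (-a * v) * (-a * 1)) v :=
        ((Complex.ofRealCLM.hasDerivAt (x := v)).const_mul (-a)).cexp
      convert! d1.mul d2 using 1
      push_cast; ring
    have ht : Filter.Tendsto (fun v : ℝ => ((v ^ (k + 1) : ℝ) : ℂ) * Complex.exp (-a * v))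
        Filter.atTop (nhds 0) := by
      rw [tendsto_zero_iff_norm_tendsto_zero]
      have h1 := (Real.tendsto_pow_mul_exp_neg_atTop_nhds_zero (k + 1)).comp
        (Filter.tendsto_id.const_mul_atTop ha)
      have h2 := h1.const_mul ((a.re ^ (k + 1))⁻¹)
      rw [mul_zero] at h2
      refine h2.congr' ?_
      filter_upwards [Filter.eventually_ge_atTop 0] with v hv
      rw [norm_mul, norm_exp_neg_mul, Complex.norm_real, Real.norm_of_nonneg (by positivity)]
      simp only [Function.comp, id, mul_pow]
      rw [neg_mul]
      field_simp
    have h := integral_Ioi_of_hasDerivAt_of_tendsto' hd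
      (((integrableOn_pow_mul_exp_neg k ha).const_mul _).sub
        ((integrableOn_pow_mul_exp_neg (k + 1) ha).const_mul _)) ht
    rw [integral_sub ((integrableOn_pow_mul_exp_neg k ha).const_mul _)
        ((integrableOn_pow_mul_exp_neg (k + 1) ha).const_mul _),
        integral_const_mul, integral_const_mul, ih] at h
    simp only [ne_eq, Nat.add_eq_zero_iff, one_ne_zero, and_false, not_false_eq_true, zero_pow,
      Complex.ofReal_zero, zero_mul, sub_zero] at h
    have h5 : a * (∫ v in Set.Ioi (0 : ℝ), ((v ^ (k + 1) : ℝ) : ℂ) * Complex.exp (-a * v)) =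
      (k + 1) * (k.factorial / a ^ (k + 1)) := (sub_eq_zero.1 h).symm
    rw [← mul_right_inj' ha0, h5, Nat.factorial_succ, pow_succ a (k + 1)]
    push_cast
    field_simp

/-- A bound for an L-series with approximately known short-interval sums. -/
theorem norm_LSeries_le_of_shortSum {f : ℕ → ℂ} (hf : ∀ n < 2, f n = 0) {s : ℂ}
    (hsum : LSeriesSummable f s) {k : ℕ} {ℓ η Q A : ℝ} {c : ℂ} (hℓ : 1 ≤ ℓ) (hQ : 1 ≤ Q)
    (hη : 0 < η) (h : η * Q ^ 3 ≤ 1 / 18) (hs : 1 + 1 / Q ≤ s.re) (hsη : ‖s‖ * η ≤ 1 / 4)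
    (hA : 0 ≤ A)
    (hb : ∀ v : ℝ, 0 ≤ v → ‖shortSum η f v - c * (v ^ k * Real.exp v : ℝ)‖ ≤
      A * (Real.exp v * (ℓ ^ k * Real.exp (-(v / (8 * ℓ))) + η * (v + 1)))) :
    ‖LSeries f s‖ ≤ 2 / η * (A * (9 * ℓ ^ (k + 1)) + ‖c‖ * (k.factorial / ‖s - 1‖ ^ (k + 1))) := by
  have hQ0 : 0 < 1 / Q := by positivity
  have hs0 : 0 < s.re := by linarith
  have hη1 : η ≤ 1 / 3 := by
    have : 1 ≤ Q ^ 3 := one_le_pow₀ hQ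
    nlinarith
  have hsne : s ≠ 0 := by rintro rfl; simp at hs0
  have h1 := cfac_mul_LSeries hf hs0 hsum hη (by linarith)
  have h2 := half_le_norm_cfac hη hη1 hsne hsη
  have hs1 : 0 < (s - 1).re := by simp; linarith
  have e0 : ∀ v : ℝ, c * (v ^ k * Real.exp v : ℝ) * Complex.exp (-s * v) =
      c * (((v ^ k : ℝ) : ℂ) * Complex.exp (-(s - 1) * v)) := by
    intro v
    push_cast
    rw [mul_assoc, mul_assoc, ← Complex.exp_add]
    congr 3; ring
  have hmain : ∫ v in Set.Ioi (0 : ℝ), c * (v ^ k * Real.exp v : ℝ) * Complex.exp (-s * v) =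
      c * (k.factorial / (s - 1) ^ (k + 1)) := by
    simp_rw [e0]
    rw [integral_const_mul, integral_pow_mul_exp_neg k hs1]
  have hb' : ∀ v ∈ Set.Ioi (0 : ℝ),
      ‖(shortSum η f v - c * (v ^ k * Real.exp v : ℝ)) * Complex.exp (-s * v)‖ ≤
      A * majo k ℓ η Q v := by
    intro v hv
    rw [norm_mul, norm_exp_neg_mul]
    calc _ ≤ A * (Real.exp v * (ℓ ^ k * Real.exp (-(v / (8 * ℓ))) + η * (v + 1))) *
          Real.exp (-s.re * v) := by gcongr; exact hb v (le_of_lt hv)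
      _ = A * (Real.exp v * (ℓ ^ k * Real.exp (-(v / (8 * ℓ))) + η * (v + 1)) *
          Real.exp (-s.re * v)) := by ring
      _ ≤ _ := by gcongr; exact exp_mul_le_majo (by linarith) hQ hη hs (le_of_lt hv)
  have hi1 : IntegrableOn (fun v : ℝ => (shortSum η f v - c * (v ^ k * Real.exp v : ℝ)) *
      Complex.exp (-s * v)) (Set.Ioi 0) := by
    refine Integrable.mono' ((integrableOn_majo k (by linarith) (by linarith)).const_mul A) ?_
      ((ae_restrict_iff' measurableSet_Ioi).2 (Filter.Eventually.of_forall hb'))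
    refine (Measurable.aestronglyMeasurable ?_)
    exact ((measurable_shortSum hη.le f).sub (by fun_prop)).mul (by fun_prop)
  have hi2 : IntegrableOn (fun v : ℝ => c * (v ^ k * Real.exp v : ℝ) *
      Complex.exp (-s * v)) (Set.Ioi 0) := by
    simp_rw [e0]
    exact (integrableOn_pow_mul_exp_neg k hs1).const_mul c
  have h3 : cfac η s * LSeries f s =
      (∫ v in Set.Ioi (0 : ℝ), (shortSum η f v - c * (v ^ k * Real.exp v : ℝ)) *
      Complex.exp (-s * v)) + c * (k.factorial / (s - 1) ^ (k + 1)) := by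
    rw [h1, ← hmain, ← integral_add hi1 hi2]
    refine setIntegral_congr_fun measurableSet_Ioi fun v _ => ?_
    simp only [shortSum]; ring
  have h4 : ‖∫ v in Set.Ioi (0 : ℝ), (shortSum η f v - c * (v ^ k * Real.exp v : ℝ)) *
      Complex.exp (-s * v)‖ ≤ A * (9 * ℓ ^ (k + 1)) := by
    refine (norm_integral_le_of_norm_le
      ((integrableOn_majo k (by linarith) (by linarith)).const_mul A)
      ((ae_restrict_iff' measurableSet_Ioi).2 (Filter.Eventually.of_forall hb'))).trans ?_
    rw [integral_const_mul]
    gcongr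
    exact integral_majo_le hℓ hQ hη h
  have h5 : η / 2 * ‖LSeries f s‖ ≤ A * (9 * ℓ ^ (k + 1)) +
      ‖c‖ * (k.factorial / ‖s - 1‖ ^ (k + 1)) := by
    calc _ ≤ ‖cfac η s‖ * ‖LSeries f s‖ := by gcongr
      _ = ‖cfac η s * LSeries f s‖ := (norm_mul _ _).symm
      _ ≤ _ := by
        rw [h3]
        refine (norm_add_le _ _).trans (add_le_add h4 (le_of_eq ?_))
        simp
  rw [div_mul_eq_mul_div, le_div_iff₀ hη]
  linarith

/-- A character restricted to integers free of prime factors `≤ z`. -/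
noncomputable def liftChar (z : ℕ) {q : ℕ} (χ : DirichletCharacter ℂ q) :
    DirichletCharacter ℂ (q * primorial z) :=
  DirichletCharacter.changeLevel (dvd_mul_right _ _) χ

lemma rough_iff_coprime {z n : ℕ} : Rough z n ↔ Nat.Coprime n (primorial z) := by
  constructor
  · intro h
    rw [Nat.coprime_comm]
    refine Nat.Coprime.prod_left fun p hp => ?_
    rw [mem_filter, mem_range] at hp
    exact (Nat.Prime.coprime_iff_not_dvd hp.2).2 (h p hp.2 (by omega))
  · intro h p hp hpz hdvd
    have h1 : p ∣ primorial z := Finset.dvd_prod_of_mem _ (by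
      rw [mem_filter, mem_range]; exact ⟨by omega, hp⟩)
    have := Nat.dvd_gcd hdvd h1
    rw [Nat.Coprime] at h
    rw [h] at this
    exact hp.one_lt.ne' (Nat.dvd_one.1 this)

open scoped Classical in
lemma liftChar_apply (z : ℕ) {q : ℕ} (χ : DirichletCharacter ℂ q) (n : ℕ) :
    liftChar z χ n = if Rough z n then χ n else 0 := by
  split_ifs with h
  · by_cases hq : Nat.Coprime n q
    · have hu : IsUnit (n : ZMod (q * primorial z)) := by
        rw [ZMod.isUnit_iff_coprime]
        exact Nat.Coprime.mul_right hq (rough_iff_coprime.1 h)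
      have h1 := DirichletCharacter.changeLevel_eq_cast_of_dvd χ (dvd_mul_right q (primorial z))
        hu.unit
      rw [IsUnit.unit_spec, ZMod.cast_natCast (dvd_mul_right _ _)] at h1
      exact h1
    · rw [MulChar.map_nonunit, MulChar.map_nonunit]
      · rwa [ZMod.isUnit_iff_coprime]
      · rw [ZMod.isUnit_iff_coprime]
        exact fun h' => hq (Nat.Coprime.coprime_mul_right_right h')
  · refine MulChar.map_nonunit _ ?_
    rw [ZMod.isUnit_iff_coprime]
    exact fun h' => h (rough_iff_coprime.2 (Nat.Coprime.coprime_mul_left_right h'))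

/-- The coefficients `χ(n) (log n) ^ k` over rough `n`. -/
noncomputable def dco (z k : ℕ) {q : ℕ} (χ : DirichletCharacter ℂ q) (n : ℕ) : ℂ :=
  liftChar z χ n * ((Real.log n ^ k : ℝ) : ℂ)

/-- The (signed) derivatives of the sifted Dirichlet series. -/
noncomputable def dser (z k : ℕ) {q : ℕ} (χ : DirichletCharacter ℂ q) (s : ℂ) : ℂ :=
  LSeries (dco z k χ) s

/-- The coefficients `dco` without the term `n = 1`. -/
noncomputable def dtail (z k : ℕ) {q : ℕ} (χ : DirichletCharacter ℂ q) (n : ℕ) : ℂ :=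
  if n < 2 then 0 else dco z k χ n

lemma log_pow_le_rpow (k : ℕ) {ε x : ℝ} (hε : 0 < ε) (hx : 1 ≤ x) :
    Real.log x ^ k ≤ (k.factorial / ε ^ k) * x ^ ε := by
  have hl := Real.log_nonneg hx
  have h1 := Real.pow_div_factorial_le_exp (ε * Real.log x) (by positivity) k
  rw [div_le_iff₀ (by positivity), mul_pow] at h1
  rw [div_mul_eq_mul_div, le_div_iff₀ (by positivity), Real.rpow_def_of_pos (by linarith),
    mul_comm (Real.log x) ε]
  linarith

/-- Crude convergence statement for series with logarithmic coefficients. -/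
lemma LSeriesSummable_of_le_log {f : ℕ → ℂ} {k : ℕ} (hf : ∀ n, ‖f n‖ ≤ Real.log n ^ k) {s : ℂ}
    (hs : 1 < s.re) : LSeriesSummable f s := by
  set ε := (s.re - 1) / 2 with hε
  have hε0 : 0 < ε := by rw [hε]; linarith
  refine LSeriesSummable_of_le_const_mul_rpow (x := 1 + ε) (by linarith)
    ⟨k.factorial / ε ^ k, fun n hn => (hf n).trans ?_⟩
  rw [add_sub_cancel_left]
  exact log_pow_le_rpow k hε0 (by exact_mod_cast Nat.one_le_iff_ne_zero.2 hn)

lemma norm_dco_le (z k : ℕ) {q : ℕ} (χ : DirichletCharacter ℂ q) (n : ℕ) :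
    ‖dco z k χ n‖ ≤ Real.log n ^ k := by
  rw [dco, norm_mul, Complex.norm_real, Real.norm_of_nonneg
    (pow_nonneg (Real.log_natCast_nonneg _) _)]
  exact mul_le_of_le_one_left (pow_nonneg (Real.log_natCast_nonneg _) _)
    (DirichletCharacter.norm_le_one _ _)

lemma norm_dtail_le (z k : ℕ) {q : ℕ} (χ : DirichletCharacter ℂ q) (n : ℕ) :
    ‖dtail z k χ n‖ ≤ Real.log n ^ k := by
  rw [dtail]; split_ifs
  · rw [norm_zero]; exact pow_nonneg (Real.log_natCast_nonneg _) _
  · exact norm_dco_le z k χ n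

lemma LSeries_dtail (z k : ℕ) {q : ℕ} (χ : DirichletCharacter ℂ q) {s : ℂ} (hs : 1 < s.re) :
    LSeries (dtail z k χ) s = dser z k χ s - if k = 0 then 1 else 0 := by
  rw [eq_sub_iff_add_eq, dser]
  have h1 : LSeries (fun n => if n = 1 then (if k = 0 then (1 : ℂ) else 0) else 0) s =
      if k = 0 then 1 else 0 := by
    rw [LSeries, tsum_eq_single 1]
    · simp
    · intro n hn; rw [LSeries.term_def]; simp [hn]
  rw [← h1, ← LSeries_add (LSeriesSummable_of_le_log (norm_dtail_le z k χ) hs)]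
  · refine LSeries_congr (fun {n} hn => ?_) s
    rw [Pi.add_apply, dtail]
    by_cases h : n = 1
    · subst h
      by_cases hk : k = 0 <;> simp [dco, hk]
    · rw [if_neg (by omega), if_neg h, add_zero]
  · refine LSeriesSummable_of_le_const_mul_rpow (x := 1) hs ⟨1, fun n _ => ?_⟩
    split_ifs <;> simp

open scoped Classical in
lemma shortSum_dtail {q : ℕ} [NeZero q] (z k : ℕ) (χ : DirichletCharacter ℂ q) {η v : ℝ}
    (hv : 0 ≤ v) :
    shortSum η (dtail z k χ) v =
      ∑ b : ZMod q, χ b * (logSum k q z b (Real.exp v) (Real.exp v * (1 + η)) : ℂ) := by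
  have h1 : 1 ≤ ⌊Real.exp v⌋₊ := Nat.le_floor (by simpa using Real.one_le_exp hv)
  rw [shortSum, ← Finset.sum_fiberwise_of_maps_to (g := fun n : ℕ => (n : ZMod q))
    (t := Finset.univ) (fun _ _ => mem_univ _)]
  refine sum_congr rfl fun b _ => ?_
  rw [logSum, Complex.ofReal_sum, mul_sum]
  have h2 : roughSet q z b (Real.exp v) (Real.exp v * (1 + η)) =
      ((Ioc ⌊Real.exp v⌋₊ ⌊Real.exp v * (1 + η)⌋₊).filter (fun n : ℕ => (n : ZMod q) = b)).filter
        (fun n => Rough z n) := by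
    ext n; rw [mem_roughSet]; simp only [mem_filter, and_assoc]
  rw [h2, sum_filter (p := fun n => Rough z n)]
  refine sum_congr rfl fun n hn => ?_
  rw [mem_filter, mem_Ioc] at hn
  rw [dtail, if_neg (by omega), dco, liftChar_apply]
  split_ifs
  · rw [hn.2]
  · simp

/-- Admissible parameters. -/
structure Lvl (q w z : ℕ) (Q : ℝ) : Prop where
  hq : 1 ≤ q
  hw : Dpow w
  hz : z = w ^ 64
  hqQ : (q : ℝ) ≤ Q
  hQ : 16 ≤ Q
  hw1 : Q ^ 2 ≤ w
  hw2 : (w : ℝ) ≤ Q ^ 4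

namespace Lvl

variable {q w z : ℕ} {Q : ℝ}

lemma log_z (h : Lvl q w z Q) : Real.log z = 64 * Real.log w := by
  rw [h.hz]; push_cast; rw [Real.log_pow]; norm_num

lemma one_le_logQ (h : Lvl q w z Q) : 1 ≤ Real.log Q := by
  rw [Real.le_log_iff_exp_le (by linarith [h.hQ])]
  linarith [h.hQ, Real.exp_one_lt_d9]

lemma log_ge (h : Lvl q w z Q) : 128 * Real.log Q ≤ Real.log z := by
  have h1 := Real.log_le_log (by have := h.hQ; positivity) h.hw1
  rw [Real.log_pow] at h1
  rw [h.log_z]; push_cast at h1; linarith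

lemma log_le (h : Lvl q w z Q) : Real.log z ≤ 256 * Real.log Q := by
  have h1 := Real.log_le_log (by exact_mod_cast (by have := h.hw.two_le; omega : 0 < w)) h.hw2
  rw [Real.log_pow] at h1
  rw [h.log_z]; push_cast at h1; linarith

lemma one_le_log (h : Lvl q w z Q) : 1 ≤ Real.log z := by
  linarith [h.log_ge, h.one_le_logQ]

lemma Q_pos (h : Lvl q w z Q) : 0 < Q := by linarith [h.hQ]

lemma eta_pos (h : Lvl q w z Q) : 0 < (Q ^ 7)⁻¹ := inv_pos.2 (pow_pos h.Q_pos 7)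

lemma eta_small (h : Lvl q w z Q) : (Q ^ 7)⁻¹ * Q ^ 3 ≤ 1 / 18 := by
  have h0 := h.Q_pos
  have : (Q ^ 7)⁻¹ * Q ^ 3 = (Q ^ 4)⁻¹ := by field_simp
  rw [this, one_div]
  refine inv_anti₀ (by norm_num) ?_
  have : (16 : ℝ) ^ 4 ≤ Q ^ 4 := pow_le_pow_left₀ (by norm_num) h.hQ 4
  linarith

lemma eta_le_one (h : Lvl q w z Q) : (Q ^ 7)⁻¹ ≤ 1 :=
  inv_le_one_of_one_le₀ (one_le_pow₀ (by linarith [h.hQ]))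

lemma q_le (h : Lvl q w z Q) : (q : ℝ) ≤ (Q ^ 7)⁻¹ * (w : ℝ) ^ 4 := by
  have h0 := h.Q_pos
  have h1 : (Q ^ 2) ^ 4 ≤ (w : ℝ) ^ 4 := pow_le_pow_left₀ (by positivity) h.hw1 4
  calc (q : ℝ) ≤ Q := h.hqQ
    _ = (Q ^ 7)⁻¹ * (Q ^ 2) ^ 4 := by field_simp
    _ ≤ _ := by gcongr

lemma norm_mul_eta (h : Lvl q w z Q) {s : ℂ} (h1 : |s.re| ≤ 2) (h2 : |s.im| ≤ 2 * Q ^ 6) :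
    ‖s‖ * (Q ^ 7)⁻¹ ≤ 1 / 4 := by
  have h0 := h.Q_pos
  have h3 : 1 ≤ Q ^ 6 := one_le_pow₀ (by linarith [h.hQ])
  have h4 : ‖s‖ ≤ 4 * Q ^ 6 := by
    have := Complex.norm_le_abs_re_add_abs_im s
    linarith
  calc ‖s‖ * (Q ^ 7)⁻¹ ≤ 4 * Q ^ 6 * (Q ^ 7)⁻¹ := by gcongr
    _ = 4 / Q := by field_simp
    _ ≤ 1 / 4 := by rw [div_le_iff₀ h0]; linarith [h.hQ]

end Lvl

/-- The error term for short sums of `log ^ k` over rough integers in a residue class. -/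
noncomputable def logErr (k q z : ℕ) (η : ℝ) (b : ZMod q) (v : ℝ) : ℝ :=
  logSum k q z b (Real.exp v) (Real.exp v * (1 + η)) -
    v ^ k * (η * Real.exp v * mert z / q.totient)

lemma logErr_bound : ∃ C : ℝ, 0 < C ∧ ∀ (w z q : ℕ) (Q : ℝ) (b : ZMod q) (v : ℝ) (k : ℕ),
    Lvl q w z Q → IsUnit b → 0 ≤ v → k ≤ 2 →
    |logErr k q z (Q ^ 7)⁻¹ b v| ≤ C * (Q ^ 7)⁻¹ / (q.totient * Real.log z) *
      (Real.exp v * (Real.log z ^ k * Real.exp (-(v / (8 * Real.log z))) + (Q ^ 7)⁻¹ * (v + 1))) := by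
  obtain ⟨C, hC, H⟩ := logSum_bound
  refine ⟨C, hC, fun w z q Q b v k h hb hv hk => ?_⟩
  have := H w z q b (Q ^ 7)⁻¹ (Real.exp v) k h.hw h.hz h.hq hb h.eta_pos h.eta_le_one
    (Real.one_le_exp hv) hk h.q_le
  rw [Real.log_exp] at this
  refine this.trans (le_of_eq ?_)
  ring

lemma sum_dirichletCharacter {q : ℕ} [NeZero q] (χ : DirichletCharacter ℂ q) :
    ∑ b : ZMod q, χ b = if χ = 1 then (q.totient : ℂ) else 0 := by
  split_ifs with h
  · subst h
    rw [MulChar.sum_one_eq_card_units, ZMod.card_units_eq_totient]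
  · exact MulChar.sum_eq_zero_of_ne_one h

lemma shortSum_dtail_eq {q : ℕ} [NeZero q] (z k : ℕ) (χ : DirichletCharacter ℂ q) {η v : ℝ}
    (hv : 0 ≤ v) :
    shortSum η (dtail z k χ) v =
      ∑ b : ZMod q, χ b * (logErr k q z η b v : ℂ) +
        (if χ = 1 then (η * mert z : ℝ) else 0 : ℂ) * (v ^ k * Real.exp v : ℝ) := by
  rw [shortSum_dtail z k χ hv]
  have hφ : (q.totient : ℂ) ≠ 0 := by
    exact_mod_cast (Nat.totient_pos.2 (Nat.pos_of_ne_zero (NeZero.ne q))).ne'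
  have h1 : ∀ b : ZMod q, χ b * (logSum k q z b (Real.exp v) (Real.exp v * (1 + η)) : ℂ) =
      χ b * (logErr k q z η b v : ℂ) +
        χ b * ((v ^ k * (η * Real.exp v * mert z / q.totient) : ℝ) : ℂ) := by
    intro b
    rw [← mul_add, ← Complex.ofReal_add, logErr, sub_add_cancel]
  rw [sum_congr rfl fun b _ => h1 b, sum_add_distrib, ← sum_mul, sum_dirichletCharacter]
  congr 1
  split_ifs
  · push_cast; field_simp
  · simp

lemma card_units_filter {q : ℕ} [NeZero q] (F : ZMod q → ℝ) {A : ℝ} (χ : DirichletCharacter ℂ q)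
    (hF : ∀ b, IsUnit b → |F b| ≤ A) : ‖∑ b : ZMod q, χ b * (F b : ℂ)‖ ≤ q.totient * A := by
  have h1 : ∀ b : ZMod q, ‖χ b * (F b : ℂ)‖ ≤ ((1 : DirichletCharacter ℂ q) b).re * A := by
    intro b
    by_cases hb : IsUnit b
    · rw [MulChar.one_apply hb, norm_mul, Complex.norm_real, Complex.one_re, one_mul]
      exact (mul_le_of_le_one_left (norm_nonneg _) (DirichletCharacter.norm_le_one _ _)).trans
        (hF b hb)
    · rw [MulChar.map_nonunit _ hb, MulChar.map_nonunit _ hb]; simp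
  refine (norm_sum_le _ _).trans ((sum_le_sum fun b _ => h1 b).trans (le_of_eq ?_))
  rw [← sum_mul, ← Complex.re_sum, sum_dirichletCharacter, if_pos rfl, Complex.natCast_re]

/-- Pointwise bounds for the sifted Dirichlet series near the line `Re s = 1`. -/
theorem norm_dser_le : ∃ C : ℝ, 0 < C ∧ ∀ (w z q : ℕ) (Q : ℝ) [NeZero q]
    (χ : DirichletCharacter ℂ q) (k : ℕ) (s : ℂ),
    Lvl q w z Q → k ≤ 2 → 1 + 1 / Q ≤ s.re → s.re ≤ 2 → |s.im| ≤ 2 * Q ^ 6 →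
    ‖dser z k χ s - if k = 0 then 1 else 0‖ ≤
      C * (Real.log z ^ k + if χ = 1 then 1 / (Real.log z * ‖s - 1‖ ^ (k + 1)) else 0) := by
  obtain ⟨C, hC, H⟩ := logErr_bound
  refine ⟨18 * C + 4, by positivity, fun w z q Q _ χ k s h hk hs1 hs2 ht => ?_⟩
  have hQ0 : 0 < 1 / Q := one_div_pos.2 h.Q_pos
  have hs : 1 < s.re := by linarith
  have hφ := totient_pos_real h.hq
  have hL := h.one_le_log
  have hη := h.eta_pos
  have hz2 : 2 ≤ z := by
    rw [h.hz]
    calc 2 ≤ w := h.hw.two_le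
      _ = w ^ 1 := (pow_one w).symm
      _ ≤ w ^ 64 := Nat.pow_le_pow_right (by have := h.hw.two_le; omega) (by norm_num)
  rw [← LSeries_dtail z k χ hs]
  have key := norm_LSeries_le_of_shortSum (f := dtail z k χ) (fun n hn => by simp [dtail, hn])
    (LSeriesSummable_of_le_log (norm_dtail_le z k χ) hs) (k := k) (ℓ := Real.log z)
    (η := (Q ^ 7)⁻¹) (Q := Q) (A := C * (Q ^ 7)⁻¹ / Real.log z)
    (c := if χ = 1 then ((Q ^ 7)⁻¹ * mert z : ℝ) else 0) hL (by linarith [h.hQ]) hη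
    h.eta_small hs1 (h.norm_mul_eta (by rw [abs_of_pos] <;> linarith) ht) (by positivity) ?_
  · refine key.trans ?_
    have hm := mert_le z hz2
    have hQp := h.Q_pos
    have hm0 := mert_pos z
    have e1 : 2 / (Q ^ 7)⁻¹ * (C * (Q ^ 7)⁻¹ / Real.log z * (9 * Real.log z ^ (k + 1))) =
        18 * C * Real.log z ^ k := by
      rw [pow_succ]; field_simp; ring
    have hk2 : (k.factorial : ℝ) ≤ 2 := by
      exact_mod_cast (Nat.factorial_le hk)
    rw [mul_add, e1]
    have hLk : 0 < Real.log z ^ k := by positivity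
    split_ifs with h1
    · have hs0 : 0 < ‖s - 1‖ := norm_pos_iff.2 (by
        intro h0; rw [sub_eq_zero] at h0; rw [h0] at hs; simp at hs)
      rw [Complex.norm_real, Real.norm_of_nonneg (by positivity)]
      have e2 : 2 / (Q ^ 7)⁻¹ * ((Q ^ 7)⁻¹ * mert z * (k.factorial / ‖s - 1‖ ^ (k + 1))) =
          2 * mert z * k.factorial / ‖s - 1‖ ^ (k + 1) := by
        field_simp
      rw [e2]
      have e3 : 2 * mert z * k.factorial / ‖s - 1‖ ^ (k + 1) ≤
          4 * (1 / (Real.log z * ‖s - 1‖ ^ (k + 1))) := by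
        calc _ ≤ 2 * (1 / Real.log z) * 2 / ‖s - 1‖ ^ (k + 1) := by gcongr
          _ = _ := by field_simp; ring
      have e4 : 0 ≤ 18 * C * (1 / (Real.log z * ‖s - 1‖ ^ (k + 1))) := by positivity
      linarith
    · rw [norm_zero, zero_mul, mul_zero, add_zero, add_zero]
      nlinarith
  · intro v hv
    rw [shortSum_dtail_eq z k χ hv]
    have e0 : (if χ = 1 then (((Q ^ 7)⁻¹ * mert z : ℝ) : ℂ) else 0) =
      (if χ = 1 then (((Q ^ 7)⁻¹ * mert z : ℝ) : ℂ) else 0 : ℂ) := rfl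
    rw [add_sub_cancel_right]
    refine (card_units_filter _ χ fun b hb => H w z q Q b v k h hb hv hk).trans (le_of_eq ?_)
    field_simp

lemma sum_norm_sq_charSum_le {q : ℕ} [NeZero q] (F : ZMod q → ℝ) {A : ℝ}
    (hF : ∀ b, IsUnit b → |F b| ≤ A) :
    ∑ χ : DirichletCharacter ℂ q, ‖∑ b : ZMod q, χ b * (F b : ℂ)‖ ^ 2 ≤ (q.totient * A) ^ 2 := by
  classical
  have h1 : ∀ χ : DirichletCharacter ℂ q, ((‖∑ b : ZMod q, χ b * (F b : ℂ)‖ ^ 2 : ℝ) : ℂ) =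
      ∑ b : ZMod q, ∑ b' : ZMod q, (F b : ℂ) * F b' * (star (χ b') * χ b) := by
    intro χ
    push_cast
    rw [← Complex.mul_conj', map_sum, sum_mul_sum]
    refine sum_congr rfl fun b _ => sum_congr rfl fun b' _ => ?_
    simp only [map_mul, Complex.conj_ofReal, Complex.star_def]
    ring
  have h2 : ∀ b b' : ZMod q, ∑ χ : DirichletCharacter ℂ q, star (χ b') * χ b =
      if b' = b ∧ IsUnit b' then (q.totient : ℂ) else 0 := by
    intro b b'
    by_cases hb : IsUnit b'
    · simp only [hb, and_true]
      rw [← DirichletCharacter.sum_char_inv_mul_char_eq ℂ hb b]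
      refine sum_congr rfl fun χ _ => ?_
      rw [MulChar.star_apply', MulChar.inv_apply_eq_inv']
      congr 1
      refine inv_eq_of_mul_eq_one_right ?_
      rw [← map_mul, ZMod.mul_inv_of_unit _ hb, map_one]
    · simp only [hb, and_false, if_false]
      refine sum_eq_zero fun χ _ => ?_
      rw [MulChar.map_nonunit _ hb]; simp
  have h3 : ((∑ χ : DirichletCharacter ℂ q, ‖∑ b : ZMod q, χ b * (F b : ℂ)‖ ^ 2 : ℝ) : ℂ) =
      ((q.totient * ∑ b : ZMod q, if IsUnit b then F b ^ 2 else 0 : ℝ) : ℂ) := by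
    rw [Complex.ofReal_sum, sum_congr rfl fun χ _ => h1 χ, sum_comm]
    push_cast
    rw [mul_sum]
    refine sum_congr rfl fun b _ => ?_
    rw [sum_comm]
    simp_rw [← mul_sum, h2]
    rw [Finset.sum_eq_single b]
    · by_cases hb : IsUnit b
      · simp [hb]; ring
      · simp [hb]
    · intro b' _ hb'; simp [hb']
    · simp
  rw [Complex.ofReal_inj.1 h3]
  have h4 : ∑ b : ZMod q, (if IsUnit b then F b ^ 2 else 0) ≤ q.totient * A ^ 2 := by
    have h5 : ∀ b : ZMod q, (if IsUnit b then F b ^ 2 else 0) ≤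
        ((1 : DirichletCharacter ℂ q) b).re * A ^ 2 := by
      intro b
      split_ifs with hb
      · rw [MulChar.one_apply hb, Complex.one_re, one_mul, ← sq_abs]
        have := hF b hb
        gcongr
      · rw [MulChar.map_nonunit _ hb]; simp
    refine (sum_le_sum fun b _ => h5 b).trans (le_of_eq ?_)
    rw [← sum_mul, ← Complex.re_sum, sum_dirichletCharacter, if_pos rfl, Complex.natCast_re]
  calc _ ≤ (q.totient : ℝ) * (q.totient * A ^ 2) := by gcongr
    _ = _ := by ring

lemma continuous_LSeries_vertical {f : ℕ → ℂ} {k : ℕ} (hf : ∀ n, ‖f n‖ ≤ Real.log n ^ k) {σ : ℝ}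
    (hσ : 1 < σ) : Continuous fun t : ℝ => LSeries f (σ + t * Complex.I) := by
  have h1 : LSeries.abscissaOfAbsConv f ≤ 1 :=
    LSeries.abscissaOfAbsConv_le_of_forall_lt_LSeriesSummable fun y hy =>
      LSeriesSummable_of_le_log hf (by simpa using hy)
  have h2 := (LSeries_differentiableOn f).continuousOn
  rw [← continuousOn_univ]
  refine h2.comp (by fun_prop) fun t _ => ?_
  simp only [Set.mem_ofPred_eq]
  refine lt_of_le_of_lt h1 ?_
  simp
  exact_mod_cast hσ

set_option maxHeartbeats 1000000 in
/-- Mean square bound over all nonprincipal characters. -/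
theorem sum_integral_dser_sq_le : ∃ C : ℝ, 0 < C ∧ ∀ (w z q : ℕ) (Q σ : ℝ) [NeZero q] (k : ℕ),
    Lvl q w z Q → k ≤ 2 → 1 + 1 / Q ≤ σ → σ ≤ 2 →
    ∑ χ ∈ univ.erase (1 : DirichletCharacter ℂ q), ∫ t in Set.Icc (-Q ^ 6) (Q ^ 6),
      ‖dser z k χ (σ + t * Complex.I) - if k = 0 then 1 else 0‖ ^ 2 ≤
      C * (Real.log z ^ (2 * k) / Real.log z) := by
  obtain ⟨C, hC, H⟩ := logErr_bound
  refine ⟨720 * C ^ 2, by positivity, fun w z q Q σ _ k h hk hs1 hs2 => ?_⟩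
  have hQ0 : 0 < 1 / Q := one_div_pos.2 h.Q_pos
  have hQp := h.Q_pos
  have hQ16 := h.hQ
  have hs : 1 < σ := by linarith
  have hφ := totient_pos_real h.hq
  have hL := h.one_le_log
  have hη := h.eta_pos
  have hηs := h.eta_small
  obtain ⟨η, hηd⟩ : ∃ η, η = (Q ^ 7)⁻¹ := ⟨_, rfl⟩
  have hnm : ∀ t ∈ Set.Icc (-Q ^ 6) (Q ^ 6), ‖(σ + t * Complex.I : ℂ)‖ * η ≤ 1 / 4 := by
    intro t ht
    rw [hηd]
    refine h.norm_mul_eta ?_ ?_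
    · simp; rw [abs_of_pos] <;> linarith
    · simp
      have := abs_le.2 ht
      have : 0 < Q ^ 6 := by positivity
      linarith
  have hη1 : η ≤ 1 / 3 := by
    have : 1 ≤ Q ^ 3 := one_le_pow₀ (by linarith)
    rw [← hηd] at hηs hη
    nlinarith
  have H' := fun b v => H w z q Q b v k h
  rw [← hηd] at hη hηs
  simp_rw [← hηd] at H'
  obtain ⟨ℓ, hℓ⟩ : ∃ ℓ, ℓ = Real.log z := ⟨_, rfl⟩
  rw [← hℓ] at hL ⊢
  simp_rw [← hℓ] at H'
  set g : DirichletCharacter ℂ q → ℝ → ℂ := fun χ =>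
    (Set.Ioi (0 : ℝ)).indicator fun v => shortSum η (dtail z k χ) v * Complex.exp (-(σ : ℂ) * v)
    with hg
  set A := C * η / ℓ with hA
  have hA0 : 0 ≤ A := by positivity
  have hgm : ∀ χ, AEStronglyMeasurable (g χ) := fun χ =>
    (((measurable_shortSum hη.le _).mul (by fun_prop)).indicator measurableSet_Ioi).aestronglyMeasurable
  have hgsum : ∀ v, ∑ χ ∈ univ.erase (1 : DirichletCharacter ℂ q), ‖g χ v‖ ^ 2 ≤
      (Set.Ioi (0 : ℝ)).indicator (fun v => A ^ 2 * majo k ℓ η Q v ^ 2) v := by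
    intro v
    by_cases hv : v ∈ Set.Ioi (0 : ℝ)
    · have hv0 : (0 : ℝ) ≤ v := le_of_lt hv
      simp only [hg, Set.indicator_of_mem hv]
      have e1 : ∀ χ ∈ univ.erase (1 : DirichletCharacter ℂ q),
          ‖shortSum η (dtail z k χ) v * Complex.exp (-(σ : ℂ) * v)‖ ^ 2 =
          ‖∑ b : ZMod q, χ b * (logErr k q z η b v : ℂ)‖ ^ 2 * Real.exp (-σ * v) ^ 2 := by
        intro χ hχ
        rw [shortSum_dtail_eq z k χ hv0, if_neg (ne_of_mem_erase hχ), zero_mul, add_zero, norm_mul,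
          norm_exp_neg_mul, mul_pow, Complex.ofReal_re]
      rw [sum_congr rfl e1, ← sum_mul]
      obtain ⟨X, hX⟩ : ∃ X, X = Real.exp v * (ℓ ^ k * Real.exp (-(v / (8 * ℓ))) + η * (v + 1)) :=
        ⟨_, rfl⟩
      have e2 : ∑ χ : DirichletCharacter ℂ q, ‖∑ b : ZMod q, χ b * (logErr k q z η b v : ℂ)‖ ^ 2 ≤
          (q.totient * (C * η / (q.totient * ℓ) * X)) ^ 2 :=
        sum_norm_sq_charSum_le (logErr k q z η · v) fun b hb => by
          rw [hX]; exact H' b v hb hv0 hk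
      have e3 := sum_le_sum_of_subset_of_nonneg (erase_subset (1 : DirichletCharacter ℂ q) univ)
        (f := fun χ => ‖∑ b : ZMod q, χ b * (logErr k q z η b v : ℂ)‖ ^ 2)
        (fun χ _ _ => sq_nonneg _)
      have e4 := exp_mul_le_majo (k := k) (ℓ := ℓ) (by linarith) (by linarith : 1 ≤ Q) hη hs1 hv0
      rw [← hX] at e4
      have hX0 : 0 ≤ X := by rw [hX]; positivity
      calc _ ≤ (q.totient * (C * η / (q.totient * ℓ) * X)) ^ 2 * Real.exp (-σ * v) ^ 2 :=
            mul_le_mul_of_nonneg_right (e3.trans e2) (sq_nonneg _)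
        _ = A ^ 2 * (X * Real.exp (-σ * v)) ^ 2 := by
          rw [hA]; field_simp
        _ ≤ _ := by
          gcongr
    · simp only [hg, Set.indicator_of_notMem hv]; simp
  have hsqi : Integrable ((Set.Ioi (0 : ℝ)).indicator (fun v => A ^ 2 * majo k ℓ η Q v ^ 2)) :=
    (integrable_indicator_iff measurableSet_Ioi).2
      ((integrableOn_majo_sq k (by linarith) hQp).const_mul _)
  have hgle : ∀ χ ∈ univ.erase (1 : DirichletCharacter ℂ q), ∀ v, ‖g χ v‖ ^ 2 ≤
      (Set.Ioi (0 : ℝ)).indicator (fun v => A ^ 2 * majo k ℓ η Q v ^ 2) v := fun χ hχ v =>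
    (single_le_sum (f := fun χ => ‖g χ v‖ ^ 2) (fun _ _ => sq_nonneg _) hχ).trans (hgsum v)
  have hg2 : ∀ χ ∈ univ.erase (1 : DirichletCharacter ℂ q), Integrable fun v => ‖g χ v‖ ^ 2 := by
    intro χ hχ
    refine hsqi.mono' ((hgm χ).norm.pow 2) (Filter.Eventually.of_forall fun v => ?_)
    rw [Real.norm_of_nonneg (sq_nonneg _)]
    exact hgle χ hχ v
  have hg1 : ∀ χ ∈ univ.erase (1 : DirichletCharacter ℂ q), Integrable (g χ) := by
    intro χ hχ
    refine Integrable.mono' ((integrable_indicator_iff measurableSet_Ioi).2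
      ((integrableOn_majo k (ℓ := ℓ) (η := η) (Q := Q) (by linarith) hQp).const_mul A)) (hgm χ)
      (Filter.Eventually.of_forall fun v => ?_)
    refine le_of_sq_le_sq ?_ (Set.indicator_nonneg (fun v _ => mul_nonneg hA0
      (majo_nonneg (by linarith) hQp hη)) v)
    refine (hgle χ hχ v).trans (le_of_eq ?_)
    by_cases hv : v ∈ Set.Ioi (0 : ℝ)
    · simp only [Set.indicator_of_mem hv]; ring
    · simp only [Set.indicator_of_notMem hv]; simp
  have hft : ∀ χ, ∀ t : ℝ, ft (g χ) t = cfac η (σ + t * Complex.I) *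
      (dser z k χ (σ + t * Complex.I) - if k = 0 then 1 else 0) := by
    intro χ t
    have hre : (σ + t * Complex.I : ℂ).re = σ := by simp
    rw [← LSeries_dtail z k χ (by rw [hre]; exact hs),
      cfac_mul_LSeries (fun n hn => by simp [dtail, hn]) (by rw [hre]; linarith)
      (LSeriesSummable_of_le_log (norm_dtail_le z k χ) (by rw [hre]; exact hs)) hη (by linarith), ft,
      ← integral_indicator measurableSet_Ioi]
    congr 1
    ext v
    by_cases hv : v ∈ Set.Ioi (0 : ℝ)
    · simp only [hg, Set.indicator_of_mem hv]
      rw [mul_assoc, ← Complex.exp_add, shortSum]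
      congr 2; push_cast; ring
    · simp only [hg, Set.indicator_of_notMem hv]; simp
  have hmain : ∀ χ ∈ univ.erase (1 : DirichletCharacter ℂ q),
      ∫ t in Set.Icc (-Q ^ 6) (Q ^ 6),
        ‖dser z k χ (σ + t * Complex.I) - if k = 0 then 1 else 0‖ ^ 2 ≤
      4 / η ^ 2 * (20 * ∫ v, ‖g χ v‖ ^ 2) := by
    intro χ hχ
    refine le_trans ?_ (mul_le_mul_of_nonneg_left (setIntegral_ft_sq_le (hg1 χ hχ) (hg2 χ hχ)
      (show 0 < Q ^ 6 by positivity)) (by positivity))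
    rw [← integral_const_mul]
    refine integral_mono_of_nonneg (Filter.Eventually.of_forall fun t => sq_nonneg _)
      ((((ft_continuous (hg1 χ hχ)).norm.pow 2).const_mul _).integrableOn_Icc) ?_
    refine (ae_restrict_iff' measurableSet_Icc).2 (Filter.Eventually.of_forall fun t ht => ?_)
    simp only
    rw [hft, norm_mul, mul_pow]
    have hc := half_le_norm_cfac hη hη1 (s := σ + t * Complex.I)
      (by intro h0; have := congrArg Complex.re h0; simp at this; linarith) (hnm t ht)
    have hc2 : η ^ 2 / 4 ≤ ‖cfac η (σ + t * Complex.I)‖ ^ 2 := by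
      calc η ^ 2 / 4 = (η / 2) ^ 2 := by ring
        _ ≤ _ := by gcongr
    have : 1 ≤ 4 / η ^ 2 * ‖cfac η (σ + t * Complex.I)‖ ^ 2 := by
      calc (1 : ℝ) = 4 / η ^ 2 * (η ^ 2 / 4) := by field_simp
        _ ≤ _ := by gcongr
    rw [← mul_assoc]
    exact le_mul_of_one_le_left (sq_nonneg _) this
  refine (sum_le_sum hmain).trans ?_
  rw [← mul_sum, ← mul_sum, ← integral_finsetSum _ hg2]
  have hI : ∫ v, ∑ χ ∈ univ.erase (1 : DirichletCharacter ℂ q), ‖g χ v‖ ^ 2 ≤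
      A ^ 2 * (9 * ℓ ^ (2 * k + 1)) := by
    refine (integral_mono (integrable_finsetSum _ hg2) hsqi hgsum).trans ?_
    rw [integral_indicator measurableSet_Ioi, integral_const_mul]
    gcongr
    exact integral_majo_sq_le hL (by linarith) hη hηs
  calc _ ≤ 4 / η ^ 2 * (20 * (A ^ 2 * (9 * ℓ ^ (2 * k + 1)))) := by gcongr
    _ = _ := by rw [hA, pow_succ]; field_simp; ring

lemma abscissa_lt_of_le_log {f : ℕ → ℂ} {k : ℕ} (hf : ∀ n, ‖f n‖ ≤ Real.log n ^ k) {s : ℂ}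
    (hs : 1 < s.re) : LSeries.abscissaOfAbsConv f < s.re := by
  have h : LSeries.abscissaOfAbsConv f ≤ ((1 : ℝ) : EReal) :=
    LSeries.abscissaOfAbsConv_le_of_forall_lt_LSeriesSummable fun y hy =>
      LSeriesSummable_of_le_log hf (by simpa using hy)
  exact h.trans_lt (by exact_mod_cast hs)

lemma dser_zero_eq (z : ℕ) {q : ℕ} (χ : DirichletCharacter ℂ q) (s : ℂ) :
    dser z 0 χ s = LSeries (fun n => liftChar z χ n) s := by
  rw [dser]; congr 1; ext n; simp [dco]

lemma hasDerivAt_dser (z k : ℕ) {q : ℕ} (χ : DirichletCharacter ℂ q) {s : ℂ} (hs : 1 < s.re) :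
    HasDerivAt (dser z k χ) (-dser z (k + 1) χ s) s := by
  have := LSeries_hasDerivAt (abscissa_lt_of_le_log (norm_dco_le z k χ) hs)
  convert! this using 2
  rw [dser]; congr 1; ext n
  simp only [dco, LSeries.logMul, ← Complex.natCast_log, pow_succ]
  push_cast; ring

lemma convex_reProdIm {S T : Set ℝ} (hS : Convex ℝ S) (hT : Convex ℝ T) :
    Convex ℝ (S ×ℂ T) :=
  (hS.linear_preimage Complex.reLm).inter (hT.linear_preimage Complex.imLm)

lemma norm_dser_sub_le (z k : ℕ) {q : ℕ} (χ : DirichletCharacter ℂ q) {S : Set ℂ} {B : ℝ}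
    (hS : Convex ℝ S) (h1 : ∀ s ∈ S, 1 < s.re) (hB : ∀ s ∈ S, ‖dser z (k + 1) χ s‖ ≤ B)
    {a b : ℂ} (ha : a ∈ S) (hb : b ∈ S) : ‖dser z k χ b - dser z k χ a‖ ≤ B * ‖b - a‖ :=
  hS.norm_image_sub_le_of_norm_hasDerivWithin_le
    (fun s hs => (hasDerivAt_dser z k χ (h1 s hs)).hasDerivWithinAt)
    (fun s hs => by rw [norm_neg]; exact hB s hs) ha hb

lemma liftChar_one (z q : ℕ) : liftChar z (1 : DirichletCharacter ℂ q) = 1 := map_one _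

lemma liftChar_mul (z : ℕ) {q : ℕ} (χ ψ : DirichletCharacter ℂ q) :
    liftChar z (χ * ψ) = liftChar z χ * liftChar z ψ := map_mul _ _ _

lemma dser_341 (z : ℕ) {q : ℕ} (χ : DirichletCharacter ℂ q) {σ : ℝ} (hσ : 1 < σ) (t : ℝ) :
    1 ≤ ‖dser z 0 (1 : DirichletCharacter ℂ q) σ‖ ^ 3 * ‖dser z 0 χ (σ + t * Complex.I)‖ ^ 4 *
      ‖dser z 0 (χ ^ 2) (σ + (2 * t : ℝ) * Complex.I)‖ := by
  have := DirichletCharacter.norm_LSeries_product_ge_one (liftChar z χ)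
    (x := σ - 1) (by linarith) t
  rw [← liftChar_one z, pow_two (liftChar z χ), ← liftChar_mul, ← pow_two, norm_mul, norm_mul,
    norm_pow, norm_pow] at this
  rw [dser_zero_eq, dser_zero_eq, dser_zero_eq]
  convert! this.le using 5 <;> (push_cast; ring_nf)

/-- Coefficients of `log L`. -/
noncomputable def logco (z : ℕ) {q : ℕ} (χ : DirichletCharacter ℂ q) (n : ℕ) : ℂ :=
  liftChar z χ n * (ArithmeticFunction.vonMangoldt n : ℂ) / (Real.log n : ℂ)

lemma norm_logco_le (z : ℕ) {q : ℕ} (χ : DirichletCharacter ℂ q) (n : ℕ) :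
    ‖logco z χ n‖ ≤ Real.log n ^ 0 := by
  rw [logco, norm_div, norm_mul, Complex.norm_real, Complex.norm_real, pow_zero,
    Real.norm_of_nonneg (Real.log_natCast_nonneg _),
    Real.norm_of_nonneg ArithmeticFunction.vonMangoldt_nonneg]
  refine div_le_one_of_le₀ ?_ (Real.log_natCast_nonneg _)
  calc _ ≤ 1 * ArithmeticFunction.vonMangoldt n := by
        exact mul_le_mul_of_nonneg_right (DirichletCharacter.norm_le_one _ _)
          ArithmeticFunction.vonMangoldt_nonneg
    _ ≤ _ := by rw [one_mul]; exact ArithmeticFunction.vonMangoldt_le_log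

lemma norm_dser_zero (z : ℕ) {q : ℕ} (χ : DirichletCharacter ℂ q) {s : ℂ} (hs : 1 < s.re) :
    ‖dser z 0 χ s‖ = Real.exp (LSeries (logco z χ) s).re := by
  rw [dser_zero_eq, ← DirichletCharacter.LSeries_eq_exp_LSeries _ hs, Complex.norm_exp]
  rfl

lemma dser_zero_ne_zero (z : ℕ) {q : ℕ} (χ : DirichletCharacter ℂ q) {s : ℂ} (hs : 1 < s.re) :
    dser z 0 χ s ≠ 0 := by
  rw [← norm_pos_iff, norm_dser_zero z χ hs]; exact Real.exp_pos _

lemma re_term_ofReal (f : ℕ → ℂ) (σ : ℝ) {n : ℕ} (hn : n ≠ 0) :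
    (LSeries.term f σ n).re = (f n).re * (n : ℝ) ^ (-σ) := by
  rw [LSeries.term_of_ne_zero hn, ← Complex.ofReal_natCast, ← Complex.ofReal_cpow (by positivity),
    Complex.div_ofReal_re, Real.rpow_neg (by positivity)]
  rfl

lemma real_char_values {q : ℕ} {χ : DirichletCharacter ℂ q} (hχ : χ ^ 2 = 1) (a : ZMod q) :
    χ a = 0 ∨ χ a = 1 ∨ χ a = -1 := by
  by_cases ha : IsUnit a
  · right
    have : χ a ^ 2 = 1 := by
      rw [← MulChar.pow_apply' χ two_ne_zero, hχ, MulChar.one_apply ha]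
    exact mul_self_eq_one_iff.1 (by rw [← pow_two]; exact this)
  · left; exact MulChar.map_nonunit _ ha

lemma one_le_dser_mul {q : ℕ} (z : ℕ) {χ ψ : DirichletCharacter ℂ q} (hχ : χ ^ 2 = 1)
    (hψ : ψ ^ 2 = 1) {σ : ℝ} (hσ : 1 < σ) :
    1 ≤ ‖dser z 0 (1 : DirichletCharacter ℂ q) σ‖ * ‖dser z 0 χ σ‖ * ‖dser z 0 ψ σ‖ *
      ‖dser z 0 (χ * ψ) σ‖ := by
  have hs : 1 < (σ : ℂ).re := by simpa using hσ
  have S (θ : DirichletCharacter ℂ q) := LSeriesSummable_of_le_log (norm_logco_le z θ) hs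
  rw [norm_dser_zero z _ hs, norm_dser_zero z _ hs, norm_dser_zero z _ hs, norm_dser_zero z _ hs,
    ← Real.exp_add, ← Real.exp_add, ← Real.exp_add, ← Complex.add_re, ← Complex.add_re,
    ← Complex.add_re, ← LSeries_add (S _) (S _), ← LSeries_add ((S _).add (S _)) (S _),
    ← LSeries_add (((S _).add (S _)).add (S _)) (S _), Real.one_le_exp_iff, LSeries,
    Complex.re_tsum ((((S _).add (S _)).add (S _)).add (S _))]
  refine tsum_nonneg fun n => ?_
  rcases eq_or_ne n 0 with rfl | hn
  · simp
  rw [re_term_ofReal _ _ hn]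
  refine mul_nonneg ?_ (by positivity)
  have e : (logco z (1 : DirichletCharacter ℂ q) + logco z χ + logco z ψ + logco z (χ * ψ)) n =
      (1 + liftChar z χ n) * (1 + liftChar z ψ n) * logco z (1 : DirichletCharacter ℂ q) n := by
    simp only [Pi.add_apply, logco, liftChar_mul, MulChar.mul_apply, liftChar_one]
    by_cases hu : IsUnit (n : ZMod (q * primorial z))
    · rw [MulChar.one_apply hu]; ring
    · simp [MulChar.map_nonunit _ hu]
  have hl : 0 ≤ (logco z (1 : DirichletCharacter ℂ q) n).re ∧
      (logco z (1 : DirichletCharacter ℂ q) n).im = 0 := by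
    have e2 : logco z (1 : DirichletCharacter ℂ q) n = 0 ∨
      logco z (1 : DirichletCharacter ℂ q) n =
        ((ArithmeticFunction.vonMangoldt n / Real.log n : ℝ) : ℂ) := by
      rw [logco, liftChar_one]
      by_cases hu : IsUnit (n : ZMod (q * primorial z))
      · right; rw [MulChar.one_apply hu]; push_cast; ring
      · left; simp [MulChar.map_nonunit _ hu]
    rcases e2 with h | h <;> rw [h]
    · simp
    · rw [Complex.ofReal_re]
      exact ⟨div_nonneg ArithmeticFunction.vonMangoldt_nonneg (Real.log_natCast_nonneg _),
        Complex.ofReal_im _⟩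
  have V (θ : DirichletCharacter ℂ q) (hθ : θ ^ 2 = 1) :
      0 ≤ (1 + liftChar z θ n).re ∧ (1 + liftChar z θ n).im = 0 := by
    have : (liftChar z θ) ^ 2 = 1 := by rw [pow_two, ← liftChar_mul, ← pow_two, hθ, liftChar_one]
    rcases real_char_values this n with h | h | h <;> rw [h] <;> norm_num
  obtain ⟨h1, h2⟩ := V χ hχ
  obtain ⟨h3, h4⟩ := V ψ hψ
  rw [e, Complex.mul_re, Complex.mul_re, Complex.mul_im, h2, h4, hl.2]
  have := hl.1
  simp only [mul_zero, sub_zero]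
  positivity

/-- Upper bounds for the sifted series in the form used for lower bounds. -/
lemma norm_dser_bounds : ∃ A : ℝ, 1 ≤ A ∧ ∀ (w z q : ℕ) (Q : ℝ) [NeZero q]
    (χ : DirichletCharacter ℂ q) (k : ℕ) (s : ℂ), Lvl q w z Q → k ≤ 2 →
    1 + 1 / Q ≤ s.re → s.re ≤ 2 → |s.im| ≤ 2 * Q ^ 6 →
    (χ ≠ 1 → ‖dser z k χ s‖ ≤ A * Real.log z ^ k) ∧
    ‖dser z k χ s‖ ≤ A * Real.log z ^ k * (1 + 1 / (Real.log z * ‖s - 1‖) ^ (k + 1)) := by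
  obtain ⟨C, hC, H⟩ := norm_dser_le
  refine ⟨C + 1, by linarith, fun w z q Q _ χ k s h hk h1 h2 h3 => ?_⟩
  have hl := h.one_le_log
  have hl0 : 0 < Real.log z := by linarith
  have hlk : 1 ≤ Real.log z ^ k := one_le_pow₀ hl
  have := H w z q Q χ k s h hk h1 h2 h3
  have hn : ‖(if k = 0 then (1 : ℂ) else 0)‖ ≤ 1 := by split_ifs <;> simp
  have h4 : ‖dser z k χ s‖ ≤ ‖dser z k χ s - if k = 0 then 1 else 0‖ + 1 := by
    have := norm_sub_norm_le (dser z k χ s) (if k = 0 then (1 : ℂ) else 0)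
    linarith
  constructor
  · intro hχ
    rw [if_neg hχ, add_zero] at this
    nlinarith
  · have hs : 0 < ‖s - 1‖ := by
      rw [norm_pos_iff, sub_ne_zero]
      rintro rfl
      have := h.Q_pos
      have : 0 < 1 / Q := by positivity
      simp at h1; linarith
    have e : (if χ = 1 then 1 / (Real.log z * ‖s - 1‖ ^ (k + 1)) else 0) ≤
        Real.log z ^ k * (1 / (Real.log z * ‖s - 1‖) ^ (k + 1)) := by
      split_ifs
      · apply le_of_eq; rw [mul_pow, pow_succ (Real.log z)]; field_simp
      · positivity
    have e2 : 0 ≤ Real.log z ^ k * (1 / (Real.log z * ‖s - 1‖) ^ (k + 1)) := by positivity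
    nlinarith [mul_le_mul_of_nonneg_left e hC.le]

/-- The abstract `3-4-1` argument combined with the mean value theorem. -/
lemma dser_lower_of_bounds {q : ℕ} (z : ℕ) (χ : DirichletCharacter ℂ q) {A τ L σ t : ℝ}
    (hA : 1 ≤ A) (hτ : 0 < τ) (hτ1 : τ ≤ 1) (hL : 2 ≤ L) (hσ : 1 < σ) (hσ2 : σ ≤ 3 / 2)
    (h0 : ∀ x : ℝ, σ < x → x ≤ σ + 1 / L →
      ‖dser z 0 (1 : DirichletCharacter ℂ q) x‖ ≤ A / (L * (x - σ)))
    (h1 : ∀ x : ℝ, σ ≤ x → x ≤ 2 → ‖dser z 1 χ (x + t * Complex.I)‖ ≤ A * L)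
    (h2 : ∀ x : ℝ, σ ≤ x → x ≤ 2 → ‖dser z 0 (χ ^ 2) (x + (2 * t : ℝ) * Complex.I)‖ ≤ A / τ) :
    τ / (16 * A ^ 7) ≤ ‖dser z 0 χ (σ + t * Complex.I)‖ := by
  obtain ⟨μ, hμ⟩ : ∃ μ : ℝ, μ = 1 / (2 * A ^ 2) := ⟨_, rfl⟩
  have hA0 : 0 < A := by linarith
  have hμ0 : 0 < μ := by rw [hμ]; positivity
  have hμ1 : μ ≤ 1 := by
    rw [hμ, div_le_one (by positivity)]; nlinarith
  have hκ0 : 0 < μ ^ 4 * τ := by positivity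
  have hκ1 : μ ^ 4 * τ ≤ 1 := mul_le_one₀ (pow_le_one₀ hμ0.le hμ1) hτ.le hτ1
  obtain ⟨x, hx⟩ : ∃ x : ℝ, x = σ + μ ^ 4 * τ / L := ⟨_, rfl⟩
  have hL0 : 0 < L := by linarith
  have hxσ : σ < x := by rw [hx]; have : 0 < μ ^ 4 * τ / L := by positivity
                         linarith
  have hxL : x ≤ σ + 1 / L := by rw [hx]; gcongr
  have hL2 : 1 / L ≤ 1 / 2 := one_div_le_one_div_of_le (by norm_num) hL
  have hx2 : x ≤ 2 := by linarith
  have key := dser_341 z χ (hσ.trans hxσ) t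
  have b0 := h0 x hxσ hxL
  have b2 := h2 x hxσ.le hx2
  have e0 : L * (x - σ) = μ ^ 4 * τ := by rw [hx]; field_simp; ring
  rw [e0] at b0
  obtain ⟨X, hX⟩ : ∃ X : ℝ, X = ‖dser z 0 χ (x + t * Complex.I)‖ := ⟨_, rfl⟩
  rw [← hX] at key
  have hX0 : 0 ≤ X := by rw [hX]; exact norm_nonneg _
  have k1 : 1 ≤ (A / (μ ^ 4 * τ)) ^ 3 * X ^ 4 * (A / τ) := key.trans (by gcongr)
  have k2 : (μ ^ 3 * τ / A) ^ 4 ≤ X ^ 4 := by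
    have : (A / (μ ^ 4 * τ)) ^ 3 * X ^ 4 * (A / τ) = X ^ 4 / (μ ^ 3 * τ / A) ^ 4 := by
      field_simp
    rw [this, one_le_div (by positivity)] at k1
    exact k1
  have k3 : μ ^ 3 * τ / A ≤ X := le_of_pow_le_pow_left₀ (by norm_num) hX0 k2
  have k4 : ‖dser z 0 χ (x + t * Complex.I) - dser z 0 χ (σ + t * Complex.I)‖ ≤
      A * L * ‖((x : ℂ) + t * Complex.I) - (σ + t * Complex.I)‖ := by
    refine norm_dser_sub_le z 0 χ (convex_reProdIm (convex_Icc σ 2) (convex_singleton t)) ?_ ?_ ?_ ?_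
    · rintro s ⟨hs, -⟩
      exact lt_of_lt_of_le hσ hs.1
    · rintro s ⟨hs, hs'⟩
      have := h1 s.re hs.1 hs.2
      rwa [← show s.im = t from hs', Complex.re_add_im] at this
    · rw [Complex.mem_reProdIm]; simp; linarith
    · rw [Complex.mem_reProdIm]; simp; exact ⟨hxσ.le, hx2⟩
  have k5 : ‖((x : ℂ) + t * Complex.I) - (σ + t * Complex.I)‖ = μ ^ 4 * τ / L := by
    rw [add_sub_add_right_eq_sub, ← Complex.ofReal_sub, Complex.norm_real,
      Real.norm_of_nonneg (by linarith), hx]; ring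
  rw [k5, show A * L * (μ ^ 4 * τ / L) = A * μ ^ 4 * τ by field_simp] at k4
  have k6 := norm_sub_norm_le (dser z 0 χ (x + t * Complex.I)) (dser z 0 χ (σ + t * Complex.I))
  rw [← hX] at k6
  have k7 : μ ^ 3 * τ / A - A * μ ^ 4 * τ = τ / (16 * A ^ 7) := by
    rw [hμ]; field_simp; norm_num
  linarith

set_option maxHeartbeats 1000000 in
/-- Lower bounds for sifted series on vertical lines: away from the possible exceptional
character they are bounded below. -/
theorem dser_lower : ∃ c : ℝ, 0 < c ∧ ∀ (w z q : ℕ) (Q σ : ℝ) [NeZero q],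
    Lvl q w z Q → 1 + 1 / Q ≤ σ → σ ≤ 3 / 2 →
    (∀ t : ℝ, 1 ≤ |t| → |t| ≤ Q ^ 6 →
      c ≤ ‖dser z 0 (1 : DirichletCharacter ℂ q) (σ + t * Complex.I)‖) ∧
    ∃ ψ : DirichletCharacter ℂ q, ψ ^ 2 = 1 ∧
      (∀ χ : DirichletCharacter ℂ q, χ ≠ 1 → χ ≠ ψ → ∀ t : ℝ, |t| ≤ Q ^ 6 →
        c ≤ ‖dser z 0 χ (σ + t * Complex.I)‖) ∧
      (ψ ≠ 1 → ∀ t : ℝ, |t| ≤ Q ^ 6 →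
        c * ‖dser z 0 ψ σ‖ ≤ ‖dser z 0 ψ (σ + t * Complex.I)‖ ∧
        c * min 1 (|t| * Real.log z) ≤ ‖dser z 0 ψ (σ + t * Complex.I)‖) := by
  obtain ⟨A, hA, H⟩ := norm_dser_bounds
  have hA0 : 0 < A := by linarith
  obtain ⟨c0, hc0⟩ : ∃ c0 : ℝ, c0 = 1 / (16 * (2 * A) ^ 7) := ⟨_, rfl⟩
  have hc00 : 0 < c0 := by rw [hc0]; positivity
  have hc01 : c0 ≤ 1 := by
    rw [hc0, div_le_one (by positivity)]
    have : 1 ≤ (2 * A) ^ 7 := one_le_pow₀ (by linarith)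
    linarith
  obtain ⟨ν, hν⟩ : ∃ ν : ℝ, ν = 1 / (8 * A ^ 2) := ⟨_, rfl⟩
  have hν0 : 0 < ν := by rw [hν]; positivity
  have hν1 : ν ≤ 1 := by
    rw [hν, div_le_one (by positivity)]; nlinarith
  have hνA : 8 * A ^ 2 * ν = 1 := by rw [hν]; field_simp
  refine ⟨c0 * ν ^ 2, by positivity, fun w z q Q σ _ h hσ1 hσ2 => ?_⟩
  have hQ := h.Q_pos
  have hQ16 := h.hQ
  have hσ : 1 < σ := by have : 0 < 1 / Q := by positivity
                        linarith
  have hQ6 : (1 : ℝ) ≤ Q ^ 6 := one_le_pow₀ (by linarith)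
  obtain ⟨L, hL⟩ : ∃ L : ℝ, L = Real.log z := ⟨_, rfl⟩
  have hL2 : 2 ≤ L := by rw [hL]; linarith [h.log_ge, h.one_le_logQ]
  have hL0 : 0 < L := by linarith
  -- common upper bounds
  have B0 : ∀ x : ℝ, σ < x → x ≤ σ + 1 / L →
      ‖dser z 0 (1 : DirichletCharacter ℂ q) x‖ ≤ 2 * A / (L * (x - σ)) := by
    intro x hx1 hx2
    have hL2' : 1 / L ≤ 1 / 2 := one_div_le_one_div_of_le (by norm_num) hL2
    have := (H w z q Q 1 0 x h (by norm_num) (by simp; rw [← one_div]; linarith)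
      (by simp; linarith) (by simp; positivity)).2
    rw [← hL, pow_zero, mul_one, zero_add, pow_one, ← Complex.ofReal_one, ← Complex.ofReal_sub,
      Complex.norm_real, Real.norm_of_nonneg (by linarith)] at this
    refine this.trans ?_
    have h1 : 0 < L * (x - σ) := mul_pos hL0 (by linarith)
    have h2 : L * (x - σ) ≤ 1 := by
      calc L * (x - σ) ≤ L * (1 / L) := by gcongr; linarith
        _ = 1 := by field_simp
    have h3 : 1 / (L * (x - 1)) ≤ 1 / (L * (x - σ)) := by
      apply one_div_le_one_div_of_le h1; gcongr
    have h4 : 1 ≤ 1 / (L * (x - σ)) := (one_le_div h1).2 h2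
    calc A * (1 + 1 / (L * (x - 1))) ≤ A * (1 / (L * (x - σ)) + 1 / (L * (x - σ))) := by gcongr
      _ = _ := by ring
  have Bne : ∀ (χ : DirichletCharacter ℂ q) (k : ℕ) (x t : ℝ), χ ≠ 1 → k ≤ 2 → σ ≤ x → x ≤ 2 →
      |t| ≤ 2 * Q ^ 6 → ‖dser z k χ (x + t * Complex.I)‖ ≤ A * L ^ k := by
    intro χ k x t hχ hk hx1 hx2 ht
    rw [hL]
    exact (H w z q Q χ k (x + t * Complex.I) h hk (by simp; rw [← one_div]; linarith)
      (by simpa using hx2) (by simpa using ht)).1 hχ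
  have Ball : ∀ (χ : DirichletCharacter ℂ q) (k : ℕ) (x t : ℝ), k ≤ 2 → σ ≤ x → x ≤ 2 →
      t ≠ 0 → |t| ≤ 2 * Q ^ 6 → ‖dser z k χ (x + t * Complex.I)‖ ≤
        A * L ^ k * (1 + 1 / (L * |t|) ^ (k + 1)) := by
    intro χ k x t hk hx1 hx2 ht0 ht
    rw [hL] at *
    refine (H w z q Q χ k (x + t * Complex.I) h hk (by simp; rw [← one_div]; linarith)
      (by simpa using hx2) (by simpa using ht)).2.trans ?_
    have h1 : |t| ≤ ‖(x : ℂ) + t * Complex.I - 1‖ := by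
      have := Complex.abs_im_le_norm ((x : ℂ) + t * Complex.I - 1)
      simpa using this
    have : 0 < |t| := abs_pos.2 ht0
    gcongr
  have abs2 : ∀ t : ℝ, |t| ≤ Q ^ 6 → |2 * t| ≤ 2 * Q ^ 6 := by
    intro t ht; rw [abs_mul, abs_two]; linarith
  have low : ∀ (χ : DirichletCharacter ℂ q) (τ t : ℝ), 0 < τ → τ ≤ 1 →
      (∀ x : ℝ, σ ≤ x → x ≤ 2 → ‖dser z 1 χ (x + t * Complex.I)‖ ≤ 2 * A * L) →
      (∀ x : ℝ, σ ≤ x → x ≤ 2 →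
        ‖dser z 0 (χ ^ 2) (x + (2 * t : ℝ) * Complex.I)‖ ≤ 2 * A / τ) →
      c0 * τ ≤ ‖dser z 0 χ (σ + t * Complex.I)‖ := by
    intro χ τ t h1 h2 h3 h4
    have := dser_lower_of_bounds z χ (by linarith : 1 ≤ 2 * A) h1 h2 hL2 hσ hσ2 B0 h3 h4
    refine le_trans (le_of_eq ?_) this
    rw [hc0]; ring
  have Bne1 : ∀ (χ : DirichletCharacter ℂ q) (t : ℝ), χ ≠ 1 → |t| ≤ Q ^ 6 → 
      ∀ x : ℝ, σ ≤ x → x ≤ 2 → ‖dser z 1 χ (x + t * Complex.I)‖ ≤ 2 * A * L := by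
    intro χ t hχ ht x hx1 hx2
    have := Bne χ 1 x t hχ (by norm_num) hx1 hx2 (by linarith)
    rw [pow_one] at this; nlinarith
  have hc : c0 * ν ^ 2 ≤ c0 := mul_le_of_le_one_right hc00.le (pow_le_one₀ hν0.le hν1)
  have hcν : c0 * ν ^ 2 ≤ c0 * ν := by gcongr; nlinarith
  have real_low : ∀ (χ : DirichletCharacter ℂ q) (t : ℝ), χ ≠ 1 → χ ^ 2 = 1 → |t| ≤ Q ^ 6 →
      c0 * min 1 (|t| * L) ≤ ‖dser z 0 χ (σ + t * Complex.I)‖ := by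
    intro χ t hχ hχ2 ht
    rcases eq_or_ne t 0 with rfl | ht0
    · simp
    have htp : 0 < |t| * L := mul_pos (abs_pos.2 ht0) hL0
    refine low χ _ t (lt_min one_pos htp) (min_le_left _ _) (Bne1 χ t hχ ht) ?_
    intro x hx1 hx2
    have := Ball (χ ^ 2) 0 x (2 * t) (by norm_num) hx1 hx2 (by simpa using ht0) (abs2 t ht)
    refine this.trans ?_
    have hm : 0 < min 1 (|t| * L) := lt_min one_pos htp
    have h1 : 1 / (L * |2 * t|) ≤ 1 / min 1 (|t| * L) := by
      apply one_div_le_one_div_of_le hm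
      refine (min_le_right _ _).trans ?_
      rw [abs_mul, abs_two]; nlinarith
    have h2 : 1 ≤ 1 / min 1 (|t| * L) := (one_le_div hm).2 (min_le_left _ _)
    calc A * L ^ 0 * (1 + 1 / (L * |2 * t|) ^ (0 + 1)) = A * (1 + 1 / (L * |2 * t|)) := by ring
      _ ≤ A * (1 / min 1 (|t| * L) + 1 / min 1 (|t| * L)) := by gcongr
      _ = _ := by ring
  have complex_low : ∀ (χ : DirichletCharacter ℂ q) (t : ℝ), χ ^ 2 ≠ 1 → |t| ≤ Q ^ 6 →
      c0 ≤ ‖dser z 0 χ (σ + t * Complex.I)‖ := by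
    intro χ t hχ2 ht
    have hχ : χ ≠ 1 := by rintro rfl; simp at hχ2
    have := low χ 1 t one_pos le_rfl (Bne1 χ t hχ ht) ?_
    · simpa using this
    intro x hx1 hx2
    have := Bne (χ ^ 2) 0 x (2 * t) hχ2 (by norm_num) hx1 hx2 (abs2 t ht)
    simp only [pow_zero, mul_one] at this
    simp only [div_one]
    linarith
  -- distance estimate
  have dist : ∀ (χ : DirichletCharacter ℂ q) (x x' t t' : ℝ), χ ≠ 1 → σ ≤ x → x ≤ 2 →
      σ ≤ x' → x' ≤ 2 → |t| ≤ Q ^ 6 → |t'| ≤ Q ^ 6 →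
      ‖dser z 0 χ (x' + t' * Complex.I) - dser z 0 χ (x + t * Complex.I)‖ ≤
        A * L * (|x' - x| + |t' - t|) := by
    intro χ x x' t t' hχ h1 h2 h3 h4 h5 h6
    have := norm_dser_sub_le z 0 χ (B := A * L)
      (convex_reProdIm (convex_Icc σ 2) (convex_Icc (-Q ^ 6) (Q ^ 6))) ?_ ?_
      (a := x + t * Complex.I) (b := x' + t' * Complex.I) ?_ ?_
    · refine this.trans ?_
      gcongr
      refine (Complex.norm_le_abs_re_add_abs_im _).trans (le_of_eq ?_)
      simp
    · rintro s ⟨hs, -⟩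
      exact lt_of_lt_of_le hσ hs.1
    · rintro s ⟨hs, hs'⟩
      have := Bne χ 1 s.re s.im hχ (by norm_num) hs.1 hs.2 ((abs_le.2 hs').trans (by linarith))
      rwa [Complex.re_add_im, pow_one] at this
    · rw [Complex.mem_reProdIm]; simp; exact ⟨⟨h1, h2⟩, abs_le.1 h5⟩
    · rw [Complex.mem_reProdIm]; simp; exact ⟨⟨h3, h4⟩, abs_le.1 h6⟩
  constructor
  · intro t ht1 ht2
    have ht0 : t ≠ 0 := by rintro rfl; simp at ht1; linarith
    have hLt : 1 ≤ L * |t| := by nlinarith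
    have := low 1 1 t one_pos le_rfl ?_ ?_
    · linarith
    · intro x hx1 hx2
      refine (Ball 1 1 x t (by norm_num) hx1 hx2 ht0 (by linarith)).trans ?_
      have : 1 / (L * |t|) ^ (1 + 1) ≤ 1 := by
        rw [div_le_one (by positivity)]; exact one_le_pow₀ hLt
      calc _ ≤ A * L ^ 1 * (1 + 1) := by gcongr
        _ = _ := by ring
    · intro x hx1 hx2
      refine (Ball (1 ^ 2) 0 x (2 * t) (by norm_num) hx1 hx2 (by simpa using ht0)
        (abs2 t ht2)).trans ?_
      have : 1 / (L * |2 * t|) ^ (0 + 1) ≤ 1 := by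
        rw [div_le_one (by positivity)]
        apply one_le_pow₀; rw [abs_mul, abs_two]; nlinarith
      calc _ ≤ A * L ^ 0 * (1 + 1) := by gcongr
        _ = _ := by ring
  obtain ⟨x1, hx1⟩ : ∃ x1 : ℝ, x1 = σ + ν ^ 2 / L := ⟨_, rfl⟩
  have hν2 : ν ^ 2 ≤ 1 := pow_le_one₀ hν0.le hν1
  have hσx : σ < x1 := by rw [hx1]; have : 0 < ν ^ 2 / L := by positivity
                          linarith
  have hx1L : x1 ≤ σ + 1 / L := by rw [hx1]; gcongr
  have hL2' : 1 / L ≤ 1 / 2 := one_div_le_one_div_of_le (by norm_num) hL2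
  have hx12 : x1 ≤ 2 := by linarith
  have B01 := B0 x1 hσx hx1L
  rw [show L * (x1 - σ) = ν ^ 2 by rw [hx1]; field_simp; ring] at B01
  -- a real character which is not small near the real axis is bounded below
  have nonexc : ∀ (χ : DirichletCharacter ℂ q) (t : ℝ), χ ≠ 1 → χ ^ 2 = 1 →
      ν / (2 * A) ≤ ‖dser z 0 χ x1‖ → |t| ≤ Q ^ 6 →
      c0 * ν ^ 2 ≤ ‖dser z 0 χ (σ + t * Complex.I)‖ := by
    intro χ t hχ hχ2 hbig ht
    by_cases hτ : |t| * L ≤ ν ^ 2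
    · have := dist χ σ x1 t 0 hχ le_rfl (by linarith) hσx.le hx12 ht (by simp; positivity)
      rw [Complex.ofReal_zero, zero_mul, add_zero, zero_sub, abs_neg, abs_of_pos (by linarith)]
        at this
      have e1 : A * L * (x1 - σ + |t|) ≤ ν / (4 * A) := by
        have : A * L * (x1 - σ + |t|) = A * (ν ^ 2 + |t| * L) := by
          rw [hx1]; field_simp; ring
        rw [this, le_div_iff₀ (by positivity)]
        calc A * (ν ^ 2 + |t| * L) * (4 * A) ≤ A * (ν ^ 2 + ν ^ 2) * (4 * A) := by gcongr
          _ = ν * (8 * A ^ 2 * ν) := by ring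
          _ = ν := by rw [hνA, mul_one]
      have e2 := norm_sub_norm_le (dser z 0 χ x1) (dser z 0 χ (σ + t * Complex.I))
      have e3 : ν / (2 * A) - ν / (4 * A) = ν / (4 * A) := by field_simp; norm_num
      have e4 : c0 * ν ^ 2 ≤ ν / (4 * A) := by
        rw [le_div_iff₀ (by positivity)]
        have : ν * (4 * A) ≤ 1 := by nlinarith
        nlinarith
      linarith
    · push Not at hτ
      refine le_trans ?_ (real_low χ t hχ hχ2 ht)
      gcongr
      exact le_min hν2 hτ.le
  -- at most one real character is small
  have uniq : ∀ χ ψ : DirichletCharacter ℂ q, χ ≠ 1 → ψ ≠ 1 → χ ^ 2 = 1 → ψ ^ 2 = 1 →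
      ‖dser z 0 χ x1‖ < ν / (2 * A) → ‖dser z 0 ψ x1‖ < ν / (2 * A) → χ = ψ := by
    intro χ ψ hχ hψ hχ2 hψ2 h1 h2
    by_contra hne
    have h3 : χ * ψ ≠ 1 := by
      intro h4
      apply hne
      calc χ = χ * ψ ^ 2 := by rw [hψ2, mul_one]
        _ = χ * ψ * ψ := by rw [pow_two, mul_assoc]
        _ = ψ := by rw [h4, one_mul]
    have h4 := one_le_dser_mul z hχ2 hψ2 (hσ.trans hσx)
    have h5 := Bne (χ * ψ) 0 x1 0 h3 (by norm_num) hσx.le hx12 (by simp; positivity)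
    simp only [Complex.ofReal_zero, zero_mul, add_zero, pow_zero, mul_one] at h5
    have h6 : ‖dser z 0 (1 : DirichletCharacter ℂ q) x1‖ * ‖dser z 0 χ x1‖ * ‖dser z 0 ψ x1‖ *
      ‖dser z 0 (χ * ψ) x1‖ ≤ 2 * A / ν ^ 2 * (ν / (2 * A)) * (ν / (2 * A)) * A := by gcongr
    have h7 : 2 * A / ν ^ 2 * (ν / (2 * A)) * (ν / (2 * A)) * A = 1 / 2 := by
      field_simp
    linarith
  by_cases hex : ∃ ψ : DirichletCharacter ℂ q, ψ ≠ 1 ∧ ψ ^ 2 = 1 ∧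
      ‖dser z 0 ψ x1‖ < ν / (2 * A)
  · obtain ⟨ψ, hψ, hψ2, hsm⟩ := hex
    refine ⟨ψ, hψ2, fun χ hχ hχψ t ht => ?_, fun _ t ht => ⟨?_, ?_⟩⟩
    · by_cases hχ2 : χ ^ 2 = 1
      · refine nonexc χ t hχ hχ2 ?_ ht
        by_contra hlt
        exact hχψ (uniq χ ψ hχ hψ hχ2 hψ2 (not_le.1 hlt) hsm)
      · exact hc.trans (complex_low χ t hχ2 ht)
    · have hl := Bne ψ 0 σ 0 hψ (by norm_num) le_rfl (by linarith) (by simp; positivity)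
      simp only [Complex.ofReal_zero, zero_mul, add_zero, pow_zero, mul_one] at hl
      have d := dist ψ σ σ t 0 hψ le_rfl (by linarith) le_rfl (by linarith) ht
        (by simp; positivity)
      simp only [Complex.ofReal_zero, zero_mul, add_zero, sub_self, abs_zero, zero_add, zero_sub,
        abs_neg] at d
      have d2 := norm_sub_norm_le (dser z 0 ψ σ) (dser z 0 ψ (σ + t * Complex.I))
      have r := real_low ψ t hψ hψ2 ht
      obtain ⟨l, hl'⟩ : ∃ l : ℝ, l = ‖dser z 0 ψ σ‖ := ⟨_, rfl⟩
      rw [← hl'] at hl d2 ⊢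
      have hl0 : 0 ≤ l := by rw [hl']; exact norm_nonneg _
      have hν4 : ν ≤ 1 / 2 := by
        nlinarith
      by_cases hcase : A * L * |t| ≤ l / 2
      · have : c0 * ν ^ 2 ≤ 1 / 2 := by nlinarith
        nlinarith
      · push Not at hcase
        refine le_trans ?_ r
        have : ν ^ 2 * l ≤ min 1 (|t| * L) := by
          refine le_min ?_ ?_
          · have : ν ^ 2 * l ≤ ν * A := by
              calc ν ^ 2 * l ≤ (ν * 1) * A := by rw [pow_two]; gcongr
                _ = _ := by ring
            nlinarith
          · have e : l ≤ 2 * A * (|t| * L) := by nlinarith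
            have : ν ^ 2 * l ≤ ν * (2 * A * (|t| * L)) := by
              calc ν ^ 2 * l ≤ (ν * 1) * (2 * A * (|t| * L)) := by rw [pow_two]; gcongr
                _ = _ := by ring
            have e2 : ν * (2 * A) ≤ 1 := by nlinarith
            have e3 : 0 ≤ |t| * L := by positivity
            nlinarith
        calc c0 * ν ^ 2 * l = c0 * (ν ^ 2 * l) := by ring
          _ ≤ _ := by gcongr
    · rw [← hL]
      refine le_trans ?_ (real_low ψ t hψ hψ2 ht)
      have : 0 ≤ min 1 (|t| * L) := le_min zero_le_one (by positivity)
      gcongr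
  · push Not at hex
    refine ⟨1, one_pow _, fun χ hχ _ t ht => ?_, fun h => absurd rfl h⟩
    by_cases hχ2 : χ ^ 2 = 1
    · exact nonexc χ t hχ hχ2 (hex χ hχ hχ2) ht
    · exact hc.trans (complex_low χ t hχ2 ht)

/-- Coefficients `χ(n) Λ(n) (log n) ^ k` over rough `n`. -/
noncomputable def vco (z k : ℕ) {q : ℕ} (χ : DirichletCharacter ℂ q) (n : ℕ) : ℂ :=
  liftChar z χ n * ((ArithmeticFunction.vonMangoldt n * Real.log n ^ k : ℝ) : ℂ)

/-- Coefficients `χ(n) (Λ(n) log n - (log n) ^ 2)` over rough `n`. -/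
noncomputable def hco (z : ℕ) {q : ℕ} (χ : DirichletCharacter ℂ q) (n : ℕ) : ℂ :=
  liftChar z χ n *
    ((ArithmeticFunction.vonMangoldt n * Real.log n - Real.log n ^ 2 : ℝ) : ℂ)

lemma norm_vco_le (z k : ℕ) {q : ℕ} (χ : DirichletCharacter ℂ q) (n : ℕ) :
    ‖vco z k χ n‖ ≤ Real.log n ^ (k + 1) := by
  have h0 := Real.log_natCast_nonneg n
  have h1 : ArithmeticFunction.vonMangoldt n ≤ Real.log n := ArithmeticFunction.vonMangoldt_le_log
  have h2 : 0 ≤ ArithmeticFunction.vonMangoldt n := ArithmeticFunction.vonMangoldt_nonneg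
  rw [vco, norm_mul, Complex.norm_real, Real.norm_of_nonneg (by positivity), pow_succ']
  calc _ ≤ 1 * (Real.log n * Real.log n ^ k) := by
        gcongr; exact DirichletCharacter.norm_le_one _ _
    _ = _ := one_mul _

lemma norm_hco_le (z : ℕ) {q : ℕ} (χ : DirichletCharacter ℂ q) (n : ℕ) :
    ‖hco z χ n‖ ≤ Real.log n ^ 2 := by
  have h0 := Real.log_natCast_nonneg n
  have h1 : ArithmeticFunction.vonMangoldt n ≤ Real.log n := ArithmeticFunction.vonMangoldt_le_log
  have h2 : 0 ≤ ArithmeticFunction.vonMangoldt n := ArithmeticFunction.vonMangoldt_nonneg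
  rw [hco, norm_mul, Complex.norm_real, Real.norm_eq_abs]
  calc _ ≤ 1 * Real.log n ^ 2 := by
        gcongr
        · exact DirichletCharacter.norm_le_one _ _
        · rw [abs_le]; constructor <;> nlinarith
    _ = _ := one_mul _

lemma LSeries_vco_zero (z : ℕ) {q : ℕ} (χ : DirichletCharacter ℂ q) {s : ℂ} (hs : 1 < s.re) :
    LSeries (vco z 0 χ) s = dser z 1 χ s / dser z 0 χ s := by
  have h := DirichletCharacter.LSeries_twist_vonMangoldt_eq (liftChar z χ) hs
  have h2 : deriv (LSeries fun n => liftChar z χ n) s = -dser z 1 χ s := by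
    have := (hasDerivAt_dser z 0 χ hs).deriv
    rw [zero_add] at this
    rw [← this]; congr 1; ext s; rw [dser_zero_eq]
  rw [h2, neg_neg, ← dser_zero_eq] at h
  rw [← h]
  congr 1; ext n; simp [vco]

lemma LSeries_vco_one (z : ℕ) {q : ℕ} (χ : DirichletCharacter ℂ q) {s : ℂ} (hs : 1 < s.re) :
    LSeries (vco z 1 χ) s =
      dser z 2 χ s / dser z 0 χ s - (dser z 1 χ s / dser z 0 χ s) ^ 2 := by
  have h := LSeries_hasDerivAt (abscissa_lt_of_le_log (norm_vco_le z 0 χ) hs)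
  have e : LSeries.logMul (vco z 0 χ) = vco z 1 χ := by
    ext n
    simp only [vco, LSeries.logMul, ← Complex.natCast_log]
    push_cast; ring
  rw [e] at h
  have h0 := dser_zero_ne_zero z χ hs
  have h1 : HasDerivAt (fun s => dser z 1 χ s / dser z 0 χ s) _ s :=
    (hasDerivAt_dser z 1 χ hs).div (hasDerivAt_dser z 0 χ hs) h0
  have h2 : LSeries (vco z 0 χ) =ᶠ[nhds s] fun s => dser z 1 χ s / dser z 0 χ s := by
    filter_upwards [(isOpen_lt continuous_const Complex.continuous_re).mem_nhds hs] with y hy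
    exact LSeries_vco_zero z χ hy
  have h3 := h.unique (h1.congr_of_eventuallyEq h2)
  rw [← neg_inj, h3]
  simp only [zero_add, Nat.reduceAdd]
  field_simp
  ring

lemma LSeries_hco (z : ℕ) {q : ℕ} (χ : DirichletCharacter ℂ q) {s : ℂ} (hs : 1 < s.re) :
    LSeries (hco z χ) s = LSeries (vco z 1 χ) s - dser z 2 χ s := by
  rw [dser, ← LSeries_sub (LSeriesSummable_of_le_log (norm_vco_le z 1 χ) hs)
    (LSeriesSummable_of_le_log (norm_dco_le z 2 χ) hs)]
  congr 1; ext n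
  simp only [hco, vco, dco, Pi.sub_apply]
  push_cast; ring

lemma norm_LSeries_hco_le (z : ℕ) {q : ℕ} (χ : DirichletCharacter ℂ q) {s : ℂ} (hs : 1 < s.re) :
    ‖LSeries (hco z χ) s‖ ≤ ‖dser z 2 χ s‖ * ‖dser z 0 χ s - 1‖ / ‖dser z 0 χ s‖ +
      ‖dser z 1 χ s‖ ^ 2 / ‖dser z 0 χ s‖ ^ 2 := by
  have h0 := dser_zero_ne_zero z χ hs
  have e : LSeries (hco z χ) s = -(dser z 2 χ s * (dser z 0 χ s - 1) / dser z 0 χ s) -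
      dser z 1 χ s ^ 2 / dser z 0 χ s ^ 2 := by
    rw [LSeries_hco z χ hs, LSeries_vco_one z χ hs]
    field_simp; ring
  rw [e]
  refine (norm_sub_le _ _).trans (le_of_eq ?_)
  rw [norm_neg]; simp only [norm_mul, norm_div, norm_pow]

/-- When the sifted series is bounded below, `hco` is controlled by mean squares. -/
lemma norm_LSeries_hco_le_of_lower (z : ℕ) {q : ℕ} (χ : DirichletCharacter ℂ q) {s : ℂ}
    {c L : ℝ} (hs : 1 < s.re) (hL : 0 < L) (hc : 0 < c) (h : c ≤ ‖dser z 0 χ s‖) :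
    ‖LSeries (hco z χ) s‖ ≤ (‖dser z 2 χ s‖ ^ 2 / L ^ 2 + ‖dser z 0 χ s - 1‖ ^ 2 * L ^ 2) / c +
      ‖dser z 1 χ s‖ ^ 2 / c ^ 2 := by
  refine (norm_LSeries_hco_le z χ hs).trans ?_
  have : ‖dser z 2 χ s‖ * ‖dser z 0 χ s - 1‖ ≤
      ‖dser z 2 χ s‖ ^ 2 / L ^ 2 + ‖dser z 0 χ s - 1‖ ^ 2 * L ^ 2 := by
    have e : ‖dser z 2 χ s‖ * ‖dser z 0 χ s - 1‖ =
      (‖dser z 2 χ s‖ / L) * (‖dser z 0 χ s - 1‖ * L) := by field_simp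
    rw [e, ← div_pow, ← mul_pow]
    nlinarith [sq_nonneg (‖dser z 2 χ s‖ / L - ‖dser z 0 χ s - 1‖ * L),
      sq_nonneg (‖dser z 2 χ s‖ / L), sq_nonneg (‖dser z 0 χ s - 1‖ * L)]
  gcongr

lemma continuous_dser_vertical (z k : ℕ) {q : ℕ} (χ : DirichletCharacter ℂ q) {σ : ℝ}
    (hσ : 1 < σ) : Continuous fun t : ℝ => dser z k χ (σ + t * Complex.I) :=
  continuous_LSeries_vertical (norm_dco_le z k χ) hσ

lemma integral_cauchy_kernel {a L : ℝ} (ha : 0 < a) (hL : 0 < L) :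
    Integrable (fun t : ℝ => L ^ 2 / (a ^ 2 + (t * L) ^ 2)) ∧
      ∫ t : ℝ, L ^ 2 / (a ^ 2 + (t * L) ^ 2) = π * L / a := by
  have e : (fun t : ℝ => L ^ 2 / (a ^ 2 + (t * L) ^ 2)) =
      fun t => (L / a) ^ 2 * (1 + (L / a * t) ^ 2)⁻¹ := by
    ext t
    have : a ^ 2 + (t * L) ^ 2 ≠ 0 := by positivity
    have : 1 + (L / a * t) ^ 2 ≠ 0 := by positivity
    have : a ^ 2 + L ^ 2 * t ^ 2 ≠ 0 := by positivity
    field_simp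
  have hne : L / a ≠ 0 := by positivity
  rw [e]
  constructor
  · exact ((integrable_comp_mul_left_iff (fun x : ℝ => (1 + x ^ 2)⁻¹) hne).2
      integrable_inv_one_add_sq).const_mul _
  · rw [integral_const_mul, Measure.integral_comp_mul_left (fun x : ℝ => (1 + x ^ 2)⁻¹),
      integral_univ_inv_one_add_sq, abs_of_pos (by positivity), smul_eq_mul]
    field_simp

set_option maxHeartbeats 1000000 in
/-- Integral bounds for `hco` over vertical segments. -/
theorem integral_hco_le : ∃ C : ℝ, 0 < C ∧ ∀ (w z q : ℕ) (Q σ : ℝ) [NeZero q],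
    Lvl q w z Q → 1 + 1 / Q ≤ σ → σ ≤ 3 / 2 →
    ∃ ψ : DirichletCharacter ℂ q, ψ ^ 2 = 1 ∧
      (∑ χ ∈ (univ.erase (1 : DirichletCharacter ℂ q)).erase ψ,
        ∫ t in Set.Icc (-Q ^ 6) (Q ^ 6), ‖LSeries (hco z χ) (σ + t * Complex.I)‖ ≤
          C * Real.log z) ∧
      (ψ ≠ 1 → ∫ t in Set.Icc (-Q ^ 6) (Q ^ 6), ‖LSeries (hco z ψ) (σ + t * Complex.I)‖ ≤
          C * Real.log z / ‖dser z 0 ψ σ‖) := by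
  obtain ⟨c, hc, Hlow⟩ := dser_lower
  obtain ⟨A, hA, Hup⟩ := norm_dser_bounds
  obtain ⟨B, hB, Hsq⟩ := sum_integral_dser_sq_le
  have hA0 : 0 < A := by linarith
  obtain ⟨D, hD⟩ : ∃ D : ℝ, D = 2 * B / c + B / c ^ 2 := ⟨_, rfl⟩
  have hD0 : 0 < D := by rw [hD]; positivity
  obtain ⟨K, hK⟩ : ∃ K : ℝ, K = 2 * (A ^ 2 * (A + 1) + A ^ 2) / c ^ 2 := ⟨_, rfl⟩
  have hK0 : 0 < K := by rw [hK]; positivity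
  refine ⟨D + (D * A + K * π), by positivity, fun w z q Q σ _ h hσ1 hσ2 => ?_⟩
  obtain ⟨-, ψ, hψ2, hne, hex⟩ := Hlow w z q Q σ h hσ1 hσ2
  refine ⟨ψ, hψ2, ?_, ?_⟩
  all_goals
    have hQ := h.Q_pos
    have hσ : 1 < σ := by have : 0 < 1 / Q := by positivity
                          linarith
    have hQ6 : (0 : ℝ) ≤ Q ^ 6 := by positivity
    have hL1 := h.one_le_log
    obtain ⟨L, hL⟩ : ∃ L : ℝ, L = Real.log z := ⟨_, rfl⟩
    have S0 := Hsq w z q Q σ 0 h (by norm_num) hσ1 (by linarith)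
    have S1 := Hsq w z q Q σ 1 h (by norm_num) hσ1 (by linarith)
    have S2 := Hsq w z q Q σ 2 h (by norm_num) hσ1 (by linarith)
    simp only [OfNat.ofNat_ne_zero, one_ne_zero, if_false, if_true, sub_zero, mul_zero, pow_zero,
      mul_one] at S0 S1 S2
    rw [← hL] at hL1 S0 S1 S2 ⊢
    have hL0 : 0 < L := by linarith
    obtain ⟨I0, hI0⟩ : ∃ I0 : DirichletCharacter ℂ q → ℝ, I0 = fun χ =>
      ∫ t in Set.Icc (-Q ^ 6) (Q ^ 6), ‖dser z 0 χ (σ + t * Complex.I) - 1‖ ^ 2 := ⟨_, rfl⟩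
    obtain ⟨I1, hI1⟩ : ∃ I1 : DirichletCharacter ℂ q → ℝ, I1 = fun χ =>
      ∫ t in Set.Icc (-Q ^ 6) (Q ^ 6), ‖dser z 1 χ (σ + t * Complex.I)‖ ^ 2 := ⟨_, rfl⟩
    obtain ⟨I2, hI2⟩ : ∃ I2 : DirichletCharacter ℂ q → ℝ, I2 = fun χ =>
      ∫ t in Set.Icc (-Q ^ 6) (Q ^ 6), ‖dser z 2 χ (σ + t * Complex.I)‖ ^ 2 := ⟨_, rfl⟩
    obtain ⟨R, hR⟩ : ∃ R : DirichletCharacter ℂ q → ℝ → ℝ, R = fun (χ : DirichletCharacter ℂ q) (t : ℝ) =>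
      (‖dser z 2 χ (σ + t * Complex.I)‖ ^ 2 / L ^ 2 +
        ‖dser z 0 χ (σ + t * Complex.I) - 1‖ ^ 2 * L ^ 2) / c +
      ‖dser z 1 χ (σ + t * Complex.I)‖ ^ 2 / c ^ 2 := ⟨_, rfl⟩
    have cd (k : ℕ) (χ : DirichletCharacter ℂ q) := continuous_dser_vertical z k χ hσ
    have i0 (χ : DirichletCharacter ℂ q) : IntegrableOn
        (fun t : ℝ => ‖dser z 0 χ (σ + t * Complex.I) - 1‖ ^ 2) (Set.Icc (-Q ^ 6) (Q ^ 6)) :=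
      ((((cd 0 χ).sub continuous_const).norm).pow 2).continuousOn.integrableOn_compact
        isCompact_Icc
    have i1 (χ : DirichletCharacter ℂ q) : IntegrableOn
        (fun t : ℝ => ‖dser z 1 χ (σ + t * Complex.I)‖ ^ 2) (Set.Icc (-Q ^ 6) (Q ^ 6)) :=
      (((cd 1 χ).norm).pow 2).continuousOn.integrableOn_compact isCompact_Icc
    have i2 (χ : DirichletCharacter ℂ q) : IntegrableOn
        (fun t : ℝ => ‖dser z 2 χ (σ + t * Complex.I)‖ ^ 2) (Set.Icc (-Q ^ 6) (Q ^ 6)) :=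
      (((cd 2 χ).norm).pow 2).continuousOn.integrableOn_compact isCompact_Icc
    have iR (χ : DirichletCharacter ℂ q) : IntegrableOn (R χ) (Set.Icc (-Q ^ 6) (Q ^ 6)) := by
      rw [hR]
      exact ((((i2 χ).div_const _).add ((i0 χ).mul_const _)).div_const _).add
        ((i1 χ).div_const _)
    have eR (χ : DirichletCharacter ℂ q) : ∫ t in Set.Icc (-Q ^ 6) (Q ^ 6), R χ t =
        (I2 χ / L ^ 2 + I0 χ * L ^ 2) / c + I1 χ / c ^ 2 := by
      rw [hR, hI0, hI1, hI2]
      simp only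
      have iA : IntegrableOn (fun t : ℝ => (‖dser z 2 χ (σ + t * Complex.I)‖ ^ 2 / L ^ 2 +
          ‖dser z 0 χ (σ + t * Complex.I) - 1‖ ^ 2 * L ^ 2) / c) (Set.Icc (-Q ^ 6) (Q ^ 6)) :=
        (((i2 χ).div_const _).add ((i0 χ).mul_const _)).div_const _
      rw [integral_add iA ((i1 χ).div_const _), integral_div, integral_div,
        integral_add ((i2 χ).div_const _) ((i0 χ).mul_const _), integral_div, integral_mul_const]
    have iH (χ : DirichletCharacter ℂ q) : IntegrableOn
        (fun t : ℝ => ‖LSeries (hco z χ) (σ + t * Complex.I)‖) (Set.Icc (-Q ^ 6) (Q ^ 6)) :=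
      ((continuous_LSeries_vertical (norm_hco_le z χ) hσ).norm).continuousOn.integrableOn_compact
        isCompact_Icc
    have R0 (χ : DirichletCharacter ℂ q) (t : ℝ) : 0 ≤ R χ t := by rw [hR]; positivity
    have hreσ (t : ℝ) : 1 < ((σ : ℂ) + t * Complex.I).re := by simpa using hσ
    have sumR : ∑ χ ∈ univ.erase (1 : DirichletCharacter ℂ q),
        ∫ t in Set.Icc (-Q ^ 6) (Q ^ 6), R χ t ≤ D * L := by
      simp only [eR]
      rw [sum_add_distrib, ← sum_div, ← sum_div, sum_add_distrib, ← sum_div, ← sum_mul]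
      have S0' : ∑ χ ∈ univ.erase (1 : DirichletCharacter ℂ q), I0 χ ≤ B * (1 / L) := by
        rw [hI0]; exact S0
      have S1' : ∑ χ ∈ univ.erase (1 : DirichletCharacter ℂ q), I1 χ ≤ B * (L ^ 2 / L) := by
        rw [hI1]; exact S1
      have S2' : ∑ χ ∈ univ.erase (1 : DirichletCharacter ℂ q), I2 χ ≤ B * (L ^ 4 / L) := by
        rw [hI2]; exact S2
      calc _ ≤ (B * (L ^ 4 / L) / L ^ 2 + B * (1 / L) * L ^ 2) / c + B * (L ^ 2 / L) / c ^ 2 := by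
            gcongr
        _ = D * L := by rw [hD]; field_simp; ring
  · calc _ ≤ ∑ χ ∈ (univ.erase (1 : DirichletCharacter ℂ q)).erase ψ,
          ∫ t in Set.Icc (-Q ^ 6) (Q ^ 6), R χ t := by
          refine sum_le_sum fun χ hχ => ?_
          rw [mem_erase, mem_erase] at hχ
          refine setIntegral_mono_on (iH χ) (iR χ) measurableSet_Icc fun t ht => ?_
          rw [hR]
          exact norm_LSeries_hco_le_of_lower z χ (hreσ t) hL0 hc
            (hne χ hχ.2.1 hχ.1 t (abs_le.2 ht))
      _ ≤ ∑ χ ∈ univ.erase (1 : DirichletCharacter ℂ q),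
          ∫ t in Set.Icc (-Q ^ 6) (Q ^ 6), R χ t :=
          sum_le_sum_of_subset_of_nonneg (erase_subset _ _)
            fun χ _ _ => integral_nonneg (R0 χ)
      _ ≤ D * L := sumR
      _ ≤ _ := by gcongr; have : 0 ≤ D * A + K * π := by positivity
                  linarith
  · intro hψ
    obtain ⟨l, hl⟩ : ∃ l : ℝ, l = ‖dser z 0 ψ σ‖ := ⟨_, rfl⟩
    have hl0 : 0 < l := by
      rw [hl, norm_pos_iff]; exact dser_zero_ne_zero z ψ (by simpa using hσ)
    have up (k : ℕ) (hk : k ≤ 2) (t : ℝ) (ht : |t| ≤ Q ^ 6) :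
        ‖dser z k ψ (σ + t * Complex.I)‖ ≤ A * L ^ k := by
      rw [hL]
      exact (Hup w z q Q ψ k (σ + t * Complex.I) h hk (by simp; rw [← one_div]; linarith)
        (by simp; linarith) (by simp; linarith)).1 hψ
    have hlA : l ≤ A := by
      have := up 0 (by norm_num) 0 (by simp; positivity)
      simpa [hl] using this
    rw [← hl]
    obtain ⟨ik, ek⟩ := integral_cauchy_kernel hl0 hL0
    have point : ∀ t ∈ Set.Icc (-Q ^ 6) (Q ^ 6), ‖LSeries (hco z ψ) (σ + t * Complex.I)‖ ≤
        R ψ t + K * (L ^ 2 / (l ^ 2 + (t * L) ^ 2)) := by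
      intro t ht
      have hten := abs_le.2 ht
      obtain ⟨e1, e2⟩ := hex hψ t hten
      rw [← hL] at e2
      rw [← hl] at e1
      by_cases hτ : 1 ≤ |t| * L
      · rw [min_eq_left hτ, mul_one] at e2
        have h1 : 0 ≤ K * (L ^ 2 / (l ^ 2 + (t * L) ^ 2)) := by positivity
        have h2 := norm_LSeries_hco_le_of_lower z ψ (hreσ t) hL0 hc e2
        have h3 : ‖LSeries (hco z ψ) (σ + t * Complex.I)‖ ≤ R ψ t := by rw [hR]; exact h2
        linarith
      · rw [min_eq_right (not_le.1 hτ).le] at e2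
        have h0 : 0 < ‖dser z 0 ψ (σ + t * Complex.I)‖ :=
          norm_pos_iff.2 (dser_zero_ne_zero z ψ (hreσ t))
        have u0 := up 0 (by norm_num) t hten
        have u1 := up 1 (by norm_num) t hten
        have u2 := up 2 (by norm_num) t hten
        rw [pow_zero, mul_one] at u0
        rw [pow_one] at u1
        have u0' : ‖dser z 0 ψ (σ + t * Complex.I) - 1‖ ≤ A + 1 := by
          refine (norm_sub_le _ _).trans ?_
          rw [norm_one]; linarith
        have hh := norm_LSeries_hco_le z ψ (hreσ t)
        obtain ⟨m, hm⟩ : ∃ m : ℝ, m = ‖dser z 0 ψ (σ + t * Complex.I)‖ := ⟨_, rfl⟩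
        rw [← hm] at h0 u0 e1 e2 hh
        have e3 : c ^ 2 * (l ^ 2 + (t * L) ^ 2) / 2 ≤ m ^ 2 := by
          have a1 := pow_le_pow_left₀ (by positivity) e1 2
          have a2 := pow_le_pow_left₀ (by positivity) e2 2
          rw [mul_pow, mul_pow, sq_abs] at a2
          nlinarith
        have hpos : 0 < l ^ 2 + (t * L) ^ 2 := by positivity
        calc _ ≤ _ := hh
          _ ≤ A * L ^ 2 * (A + 1) / m + (A * L) ^ 2 / m ^ 2 := by gcongr
          _ ≤ A * L ^ 2 * (A + 1) * A / m ^ 2 + (A * L) ^ 2 / m ^ 2 := by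
              have : A * L ^ 2 * (A + 1) / m ≤ A * L ^ 2 * (A + 1) * A / m ^ 2 := by
                rw [div_le_div_iff₀ h0 (by positivity), pow_two m]
                have : 0 ≤ A * L ^ 2 * (A + 1) * m := by positivity
                nlinarith
              linarith
          _ = (A ^ 2 * (A + 1) + A ^ 2) * L ^ 2 / m ^ 2 := by ring
          _ ≤ (A ^ 2 * (A + 1) + A ^ 2) * L ^ 2 / (c ^ 2 * (l ^ 2 + (t * L) ^ 2) / 2) := by
              gcongr
          _ = K * (L ^ 2 / (l ^ 2 + (t * L) ^ 2)) := by rw [hK]; field_simp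
          _ ≤ _ := by linarith [R0 ψ t]
    have hsing : ∫ t in Set.Icc (-Q ^ 6) (Q ^ 6), R ψ t ≤ D * L :=
      (single_le_sum (f := fun χ => ∫ t in Set.Icc (-Q ^ 6) (Q ^ 6), R χ t)
        (fun χ _ => integral_nonneg (R0 χ)) (mem_erase.2 ⟨hψ, mem_univ _⟩)).trans sumR
    calc _ ≤ ∫ t in Set.Icc (-Q ^ 6) (Q ^ 6), (R ψ t + K * (L ^ 2 / (l ^ 2 + (t * L) ^ 2))) :=
          setIntegral_mono_on (iH ψ) ((iR ψ).add (ik.integrableOn.const_mul K))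
            measurableSet_Icc point
      _ = (∫ t in Set.Icc (-Q ^ 6) (Q ^ 6), R ψ t) +
          K * ∫ t in Set.Icc (-Q ^ 6) (Q ^ 6), (L ^ 2 / (l ^ 2 + (t * L) ^ 2)) := by
          rw [integral_add (iR ψ) (ik.integrableOn.const_mul K), integral_const_mul]
      _ ≤ D * L + K * (π * L / l) := by
          gcongr
          rw [← ek]
          exact setIntegral_le_integral ik (Filter.Eventually.of_forall fun t => by positivity)
      _ ≤ D * A * L / l + K * (π * L / l) := by
          have : D * L ≤ D * A * L / l := by
            rw [le_div_iff₀ hl0]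
            have : 0 ≤ D * L := by positivity
            nlinarith
          linarith
      _ = (D * A + K * π) * L / l := by ring
      _ ≤ (D + (D * A + K * π)) * L / l := by
          have : D * A + K * π ≤ D + (D * A + K * π) := by linarith
          exact div_le_div_of_nonneg_right (mul_le_mul_of_nonneg_right this hL0.le) hl0.le

lemma one_add_sq_le_norm {σ : ℝ} (hσ : 1 ≤ σ) (t : ℝ) :
    1 + t ^ 2 ≤ ‖((σ : ℂ) + t * Complex.I) * ((σ : ℂ) + t * Complex.I + 1)‖ := by
  have h1 : ‖((σ : ℂ) + t * Complex.I)‖ ^ 2 = σ ^ 2 + t ^ 2 := by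
    rw [Complex.sq_norm, Complex.normSq_apply]; simp; ring
  have h2 : ‖((σ : ℂ) + t * Complex.I)‖ ≤ ‖((σ : ℂ) + t * Complex.I + 1)‖ := by
    refine (sq_le_sq₀ (norm_nonneg _) (norm_nonneg _)).1 ?_
    rw [h1, Complex.sq_norm, Complex.normSq_apply]
    simp
    nlinarith
  rw [norm_mul]
  have h0 := norm_nonneg ((σ : ℂ) + t * Complex.I)
  nlinarith

lemma ne_zero_vertical {σ : ℝ} (hσ : 1 ≤ σ) (t : ℝ) : ((σ : ℂ) + t * Complex.I) ≠ 0 ∧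
    ((σ : ℂ) + t * Complex.I + 1) ≠ 0 := by
  have h := one_add_sq_le_norm hσ t
  have h2 : ((σ : ℂ) + t * Complex.I) * ((σ : ℂ) + t * Complex.I + 1) ≠ 0 := by
    rw [← norm_pos_iff]; nlinarith
  exact ⟨left_ne_zero_of_mul h2, right_ne_zero_of_mul h2⟩

lemma continuous_inv_vertical {σ : ℝ} (hσ : 1 ≤ σ) :
    Continuous fun t : ℝ => 1 / (((σ : ℂ) + t * Complex.I) * ((σ : ℂ) + t * Complex.I + 1)) := by
  refine Continuous.div continuous_const (by fun_prop) fun t => ?_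
  exact mul_ne_zero (ne_zero_vertical hσ t).1 (ne_zero_vertical hσ t).2

lemma norm_inv_vertical_le {σ : ℝ} (hσ : 1 ≤ σ) (t : ℝ) :
    ‖1 / (((σ : ℂ) + t * Complex.I) * ((σ : ℂ) + t * Complex.I + 1))‖ ≤ (1 + t ^ 2)⁻¹ := by
  rw [norm_div, norm_one, one_div]
  exact inv_anti₀ (by positivity) (one_add_sq_le_norm hσ t)

/-- Perron formula for a hinge function. -/
lemma integral_hinge {σ : ℝ} (hσ : 1 ≤ σ) (u : ℝ) :
    ∫ t : ℝ, Complex.exp (((σ : ℂ) + t * Complex.I) * u) *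
      (1 / (((σ : ℂ) + t * Complex.I) * ((σ : ℂ) + t * Complex.I + 1))) =
      ((2 * π * max 0 (1 - Real.exp (-u)) : ℝ) : ℂ) := by
  obtain ⟨f, hf⟩ : ∃ f : ℝ → ℂ, f = fun t : ℝ =>
    (Set.Ioc (0 : ℝ) 1).indicator (fun _ : ℝ => (1 : ℂ)) t -
      (Set.Ioc (0 : ℝ) 1).indicator (fun t : ℝ => (t : ℂ) ^ (1 : ℂ)) t := ⟨_, rfl⟩
  have hm (s : ℂ) (hs : 0 < s.re) : HasMellin f s (1 / (s * (s + 1))) := by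
    have h1 := hasMellin_one_Ioc hs
    have h2 := hasMellin_cpow_Ioc 1 (s := s) (by simp; linarith)
    have h3 := hasMellin_sub h1.1 h2.1
    rw [h1.2, h2.2] at h3
    have e : (1 : ℂ) / s - 1 / (s + 1) = 1 / (s * (s + 1)) := by
      have a1 : s ≠ 0 := by rintro rfl; simp at hs
      have a2 : s + 1 ≠ 0 := by
        intro h
        have := congrArg Complex.re h
        simp at this; linarith
      field_simp; ring
    rw [e] at h3
    rw [hf]; exact h3
  have hre (t : ℝ) : 0 < ((σ : ℂ) + t * Complex.I).re := by simp; linarith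
  have hff : ∀ t : ℝ, 0 < t → f t = ((max 0 (1 - t) : ℝ) : ℂ) := by
    intro t ht
    rw [hf]
    by_cases h1 : t ≤ 1
    · have : t ∈ Set.Ioc (0 : ℝ) 1 := ⟨ht, h1⟩
      simp only [Set.indicator_of_mem this]
      rw [max_eq_right (by linarith)]; simp
    · have : t ∉ Set.Ioc (0 : ℝ) 1 := fun h => h1 h.2
      simp only [Set.indicator_of_notMem this]
      rw [max_eq_left (by linarith)]; simp
  have key := mellinInv_mellin_eq σ f (Real.exp_pos (-u)) (hm σ (by simpa using hre 0)).1 ?_ ?_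
  · rw [hff _ (Real.exp_pos _), mellinInv] at key
    have e2 : (∫ t : ℝ, Complex.exp (((σ : ℂ) + t * Complex.I) * u) *
      (1 / (((σ : ℂ) + t * Complex.I) * ((σ : ℂ) + t * Complex.I + 1)))) =
      ∫ y : ℝ, ((Real.exp (-u) : ℝ) : ℂ) ^ (-((σ : ℂ) + y * Complex.I)) •
        mellin f ((σ : ℂ) + y * Complex.I) := by
      refine integral_congr_ae (Filter.Eventually.of_forall fun t => ?_)
      simp only
      rw [(hm _ (hre t)).2, smul_eq_mul,
        Complex.cpow_def_of_ne_zero (by exact_mod_cast (Real.exp_pos _).ne'),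
        ← Complex.ofReal_log (Real.exp_pos _).le, Real.log_exp]
      congr 2
      push_cast; ring
    rw [e2]
    rw [Complex.real_smul] at key
    generalize (∫ y : ℝ, ((Real.exp (-u) : ℝ) : ℂ) ^ (-((σ : ℂ) + y * Complex.I)) •
        mellin f ((σ : ℂ) + y * Complex.I)) = J at key ⊢
    have hpi : (π : ℂ) ≠ 0 := by exact_mod_cast Real.pi_ne_zero
    push_cast at key ⊢
    rw [← key]
    field_simp
  · have : (fun t : ℝ => mellin f (σ + t * Complex.I)) = fun t : ℝ =>
        1 / (((σ : ℂ) + t * Complex.I) * ((σ : ℂ) + t * Complex.I + 1)) := by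
      ext t; exact (hm _ (hre t)).2
    unfold Complex.VerticalIntegrable
    rw [this]
    exact integrable_inv_one_add_sq.mono' (continuous_inv_vertical hσ).aestronglyMeasurable
      (Filter.Eventually.of_forall fun t => norm_inv_vertical_le hσ t)
  · have hc : ContinuousAt (fun t : ℝ => ((max 0 (1 - t) : ℝ) : ℂ)) (Real.exp (-u)) := by
      fun_prop
    refine hc.congr ?_
    filter_upwards [lt_mem_nhds (Real.exp_pos (-u))] with t ht
    exact (hff t ht).symm

/-- Perron formula with hinge weight for transforms of a general measure. -/
lemma perron_hinge {α : Type*} [MeasurableSpace α] (μ : Measure α) [SFinite μ] (a : α → ℂ)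
    (v : α → ℝ) (hv : Measurable v) {σ : ℝ} (hσ : 1 ≤ σ)
    (ha : AEStronglyMeasurable a μ)
    (hi : Integrable (fun n => a n * (Real.exp (-σ * v n) : ℝ)) μ) (u : ℝ) :
    ∫ t : ℝ, (∫ n, a n * Complex.exp (-((σ : ℂ) + t * Complex.I) * v n) ∂μ) *
      (Complex.exp (((σ : ℂ) + t * Complex.I) * u) /
        (((σ : ℂ) + t * Complex.I) * ((σ : ℂ) + t * Complex.I + 1))) =
      2 * π * ∫ n, a n * ((max 0 (1 - Real.exp (v n - u)) : ℝ) : ℂ) ∂μ := by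
  have e1 : ∀ t : ℝ, (∫ n, a n * Complex.exp (-((σ : ℂ) + t * Complex.I) * v n) ∂μ) *
      (Complex.exp (((σ : ℂ) + t * Complex.I) * u) /
        (((σ : ℂ) + t * Complex.I) * ((σ : ℂ) + t * Complex.I + 1))) =
      ∫ n, a n * (Complex.exp (((σ : ℂ) + t * Complex.I) * ((u - v n : ℝ) : ℂ)) *
        (1 / (((σ : ℂ) + t * Complex.I) * ((σ : ℂ) + t * Complex.I + 1)))) ∂μ := by
    intro t
    rw [← integral_mul_const]
    refine integral_congr_ae (Filter.Eventually.of_forall fun n => ?_)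
    simp only
    have : Complex.exp (((σ : ℂ) + t * Complex.I) * ((u - v n : ℝ) : ℂ)) =
        Complex.exp (-((σ : ℂ) + t * Complex.I) * v n) *
          Complex.exp (((σ : ℂ) + t * Complex.I) * u) := by
      rw [← Complex.exp_add]; congr 1; push_cast; ring
    rw [this]; ring
  simp only [e1]
  rw [integral_integral_swap]
  · rw [← integral_const_mul]
    refine integral_congr_ae (Filter.Eventually.of_forall fun n => ?_)
    simp only
    rw [integral_const_mul, integral_hinge hσ]
    push_cast
    rw [neg_sub]
    ring
  · have hb : Integrable (fun p : ℝ × α => ((1 + p.1 ^ 2)⁻¹ : ℝ) *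
        (‖a p.2 * (Real.exp (-σ * v p.2) : ℝ)‖ * Real.exp (σ * u))) (volume.prod μ) :=
      integrable_inv_one_add_sq.mul_prod (hi.norm.mul_const _)
    refine hb.mono' ?_ (Filter.Eventually.of_forall fun p => ?_)
    · refine (ha.comp_snd).mul (Measurable.aestronglyMeasurable ?_)
      have hv2 : Measurable fun p : ℝ × α => v p.2 := hv.comp measurable_snd
      have h1 : Measurable fun p : ℝ × α => p.1 := measurable_fst
      have := ((continuous_inv_vertical hσ).measurable).comp h1
      refine Measurable.mul ?_ this
      fun_prop
    · simp only [Function.uncurry]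
      rw [norm_mul, norm_mul, Complex.norm_exp, norm_mul, Complex.norm_real, norm_of_nonneg
        (Real.exp_pos _).le]
      have e3 : (((σ : ℂ) + p.1 * Complex.I) * ((u - v p.2 : ℝ) : ℂ)).re =
          -σ * v p.2 + σ * u := by simp; ring
      rw [e3, Real.exp_add]
      have := norm_inv_vertical_le hσ p.1
      calc _ = ‖1 / (((σ : ℂ) + p.1 * Complex.I) * ((σ : ℂ) + p.1 * Complex.I + 1))‖ *
            (‖a p.2‖ * Real.exp (-σ * v p.2) * Real.exp (σ * u)) := by ring
        _ ≤ _ := by gcongr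

/-- The trapezoidal weight equal to `1` up to `x` and vanishing beyond `x * (1 + δ)`. -/
noncomputable def trap (x δ y : ℝ) : ℝ :=
  (max 0 (x * (1 + δ) - y) - max 0 (x - y)) / (δ * x)

/-- The Mellin-type kernel of `trap`. -/
noncomputable def trapKer (x δ : ℝ) (s : ℂ) : ℂ :=
  (Complex.exp ((s + 1) * Real.log (x * (1 + δ))) - Complex.exp ((s + 1) * Real.log x)) /
    (δ * x * (s * (s + 1)))

lemma perron_hinge' {α : Type*} [MeasurableSpace α] (μ : Measure α) [SFinite μ] (a : α → ℂ)
    (v : α → ℝ) (hv : Measurable v) {σ : ℝ} (hσ : 1 ≤ σ)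
    (ha : AEStronglyMeasurable a μ)
    (hi : Integrable (fun n => a n * (Real.exp (-σ * v n) : ℝ)) μ) {y : ℝ} (hy : 0 < y) :
    ∫ t : ℝ, (∫ n, a n * Complex.exp (-((σ : ℂ) + t * Complex.I) * v n) ∂μ) *
      (Complex.exp (((σ : ℂ) + t * Complex.I + 1) * Real.log y) /
        (((σ : ℂ) + t * Complex.I) * ((σ : ℂ) + t * Complex.I + 1))) =
      2 * π * ∫ n, a n * ((max 0 (y - Real.exp (v n)) : ℝ) : ℂ) ∂μ := by
  have h := perron_hinge μ a v hv hσ ha hi (Real.log y)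
  have e (n : α) : a n * ((max 0 (y - Real.exp (v n)) : ℝ) : ℂ) =
      y * (a n * ((max 0 (1 - Real.exp (v n - Real.log y)) : ℝ) : ℂ)) := by
    have : max 0 (y - Real.exp (v n)) = y * max 0 (1 - Real.exp (v n - Real.log y)) := by
      rw [mul_max_of_nonneg _ _ hy.le, Real.exp_sub, Real.exp_log hy, mul_zero]
      congr 1; field_simp
    rw [this]; push_cast; ring
  simp only [e]
  rw [integral_const_mul, mul_left_comm, ← h, ← integral_const_mul]
  refine integral_congr_ae (Filter.Eventually.of_forall fun t => ?_)
  simp only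
  rw [add_mul _ (1 : ℂ), Complex.exp_add, one_mul, ← Complex.ofReal_exp (Real.log y),
    Real.exp_log hy]
  ring

lemma integrable_perron {A : ℝ → ℂ} (hA : Continuous A) {B : ℝ} (hB : ∀ t, ‖A t‖ ≤ B)
    {σ : ℝ} (hσ : 1 ≤ σ) (u : ℝ) :
    Integrable fun t : ℝ => A t *
      (Complex.exp (((σ : ℂ) + t * Complex.I + 1) * u) /
        (((σ : ℂ) + t * Complex.I) * ((σ : ℂ) + t * Complex.I + 1))) := by
  have hc : Continuous fun t : ℝ => A t *
      (Complex.exp (((σ : ℂ) + t * Complex.I + 1) * u) /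
        (((σ : ℂ) + t * Complex.I) * ((σ : ℂ) + t * Complex.I + 1))) := by
    refine hA.mul (Continuous.div (by fun_prop) (by fun_prop) fun t => ?_)
    exact mul_ne_zero (ne_zero_vertical hσ t).1 (ne_zero_vertical hσ t).2
  refine (integrable_inv_one_add_sq.const_mul (B * Real.exp ((σ + 1) * u))).mono'
    hc.aestronglyMeasurable (Filter.Eventually.of_forall fun t => ?_)
  have h1 := norm_inv_vertical_le hσ t
  have hB0 : 0 ≤ B := (norm_nonneg _).trans (hB t)
  rw [norm_mul, div_eq_mul_one_div, norm_mul, Complex.norm_exp]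
  have e : (((σ : ℂ) + t * Complex.I + 1) * u).re = (σ + 1) * u := by simp
  rw [e, ← mul_assoc]
  gcongr
  exact hB t

/-- Perron formula with trapezoidal weight for transforms of a general measure. -/
lemma perron_trap {α : Type*} [MeasurableSpace α] (μ : Measure α) [SFinite μ] (a : α → ℂ)
    (v : α → ℝ) (hv : Measurable v) {σ : ℝ} (hσ : 1 ≤ σ)
    (ha : AEStronglyMeasurable a μ)
    (hi : Integrable (fun n => a n * (Real.exp (-σ * v n) : ℝ)) μ)
    (hc : Continuous fun t : ℝ => ∫ n, a n * Complex.exp (-((σ : ℂ) + t * Complex.I) * v n) ∂μ)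
    {x δ : ℝ} (hx : 0 < x) (hδ : 0 < δ) :
    Integrable (fun t : ℝ => (∫ n, a n * Complex.exp (-((σ : ℂ) + t * Complex.I) * v n) ∂μ) *
      trapKer x δ (σ + t * Complex.I)) ∧
    ∫ t : ℝ, (∫ n, a n * Complex.exp (-((σ : ℂ) + t * Complex.I) * v n) ∂μ) *
      trapKer x δ (σ + t * Complex.I) =
      2 * π * ∫ n, a n * (trap x δ (Real.exp (v n)) : ℝ) ∂μ := by
  obtain ⟨A, hA⟩ : ∃ A : ℝ → ℂ, A = fun t : ℝ =>
    ∫ n, a n * Complex.exp (-((σ : ℂ) + t * Complex.I) * v n) ∂μ := ⟨_, rfl⟩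
  have hx' : 0 < x * (1 + δ) := by positivity
  have h1 := perron_hinge' μ a v hv hσ ha hi hx
  have h2 := perron_hinge' μ a v hv hσ ha hi hx'
  have hAt (t : ℝ) : ∫ n, a n * Complex.exp (-((σ : ℂ) + t * Complex.I) * v n) ∂μ = A t := by
    rw [hA]
  simp only [hAt] at hc h1 h2 ⊢
  have hB : ∀ t, ‖A t‖ ≤ ∫ n, ‖a n * (Real.exp (-σ * v n) : ℝ)‖ ∂μ := by
    intro t
    rw [← hAt]
    refine (norm_integral_le_integral_norm _).trans (le_of_eq ?_)
    refine integral_congr_ae (Filter.Eventually.of_forall fun n => ?_)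
    simp only [norm_mul, Complex.norm_exp, Complex.norm_real]
    rw [norm_of_nonneg (Real.exp_pos _).le]
    congr 2; simp
  have i1 := integrable_perron hc hB hσ (Real.log x)
  have i2 := integrable_perron hc hB hσ (Real.log (x * (1 + δ)))
  have ek (t : ℝ) : A t * trapKer x δ (σ + t * Complex.I) =
      (A t * (Complex.exp (((σ : ℂ) + t * Complex.I + 1) * Real.log (x * (1 + δ))) /
        (((σ : ℂ) + t * Complex.I) * ((σ : ℂ) + t * Complex.I + 1))) -
      A t * (Complex.exp (((σ : ℂ) + t * Complex.I + 1) * Real.log x) /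
        (((σ : ℂ) + t * Complex.I) * ((σ : ℂ) + t * Complex.I + 1)))) * (1 / (δ * x) : ℝ) := by
    rw [trapKer, ← mul_sub, ← sub_div]
    push_cast
    have a1 := ne_zero_vertical hσ t
    have a2 : (δ : ℂ) ≠ 0 := by exact_mod_cast hδ.ne'
    have a3 : (x : ℂ) ≠ 0 := by exact_mod_cast hx.ne'
    field_simp
  simp only [ek]
  refine ⟨(i2.sub i1).mul_const _, ?_⟩
  have j (y : ℝ) (hy : 0 < y) : Integrable (fun n => a n * ((max 0 (y - Real.exp (v n)) : ℝ) : ℂ)) μ := by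
    refine (hi.norm.mul_const (y ^ σ * y)).mono' (ha.mul ?_)
      (Filter.Eventually.of_forall fun n => ?_)
    · exact (by fun_prop : Measurable fun n => ((max 0 (y - Real.exp (v n)) : ℝ) : ℂ)).aestronglyMeasurable
    · rw [norm_mul, norm_mul, Complex.norm_real, Complex.norm_real, norm_of_nonneg (by positivity),
        norm_of_nonneg (by positivity), mul_assoc]
      gcongr
      by_cases h : y ≤ Real.exp (v n)
      · rw [max_eq_left (by linarith)]; positivity
      · push Not at h
        rw [max_eq_right (by linarith)]
        have hv1 : v n < Real.log y := (Real.lt_log_iff_exp_lt hy).2 h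
        have : 1 ≤ Real.exp (-σ * v n) * y ^ σ := by
          rw [Real.rpow_def_of_pos hy, ← Real.exp_add, Real.one_le_exp_iff]
          nlinarith
        have h0 := Real.exp_pos (v n)
        rw [← mul_assoc]
        nlinarith
  rw [integral_mul_const, integral_sub i2 i1, h1, h2, ← mul_sub, ← integral_sub (j _ hx') (j _ hx),
    mul_assoc, ← integral_mul_const]
  congr 1
  refine integral_congr_ae (Filter.Eventually.of_forall fun n => ?_)
  simp only [trap]
  push_cast
  ring

lemma trap_nonneg {x δ : ℝ} (hx : 0 < x) (hδ : 0 < δ) (y : ℝ) : 0 ≤ trap x δ y := by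
  refine div_nonneg (sub_nonneg.2 ?_) (by positivity)
  have : 0 < δ * x := by positivity
  exact max_le_max le_rfl (by nlinarith)

lemma trap_le_one {x δ : ℝ} (hx : 0 < x) (hδ : 0 < δ) (y : ℝ) : trap x δ y ≤ 1 := by
  have h : 0 < δ * x := by positivity
  rw [trap, div_le_one h]
  rcases le_total (x - y) 0 with h1 | h1
  · rw [max_eq_left h1]
    rcases le_total (x * (1 + δ) - y) 0 with h2 | h2
    · rw [max_eq_left h2]; linarith
    · rw [max_eq_right h2]; nlinarith
  · rw [max_eq_right h1, max_eq_right (by nlinarith)]; nlinarith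

lemma trap_eq_one {x δ y : ℝ} (hx : 0 < x) (hδ : 0 < δ) (hy : y ≤ x) : trap x δ y = 1 := by
  have h : 0 < δ * x := by positivity
  rw [trap, max_eq_right (by linarith), max_eq_right (by nlinarith), div_eq_one_iff_eq h.ne']
  ring

lemma trap_eq_zero {x δ y : ℝ} (hx : 0 < x) (hδ : 0 < δ) (hy : x * (1 + δ) ≤ y) :
    trap x δ y = 0 := by
  have h : 0 < δ * x := by positivity
  rw [trap, max_eq_left (by linarith), max_eq_left (by nlinarith)]
  simp

/-- Sums weighted by `trap`. -/
noncomputable def trapSum (f : ℕ → ℂ) (x δ : ℝ) : ℂ :=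
  ∑ n ∈ Icc 1 ⌊x * (1 + δ)⌋₊, f n * (trap x δ n : ℝ)

lemma perron_LSeries {f : ℕ → ℂ} {k : ℕ} (hk : k ≠ 0) (hf : ∀ n, ‖f n‖ ≤ Real.log n ^ k) {σ : ℝ}
    (hσ : 1 < σ) {x δ : ℝ} (hx : 0 < x) (hδ : 0 < δ) :
    Integrable (fun t : ℝ => LSeries f (σ + t * Complex.I) * trapKer x δ (σ + t * Complex.I)) ∧
    ∫ t : ℝ, LSeries f (σ + t * Complex.I) * trapKer x δ (σ + t * Complex.I) =
      2 * π * trapSum f x δ := by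
  have f0 : f 0 = 0 := by
    have := hf 0
    simpa [zero_pow hk] using this
  have term (s : ℂ) (n : ℕ) : f n * Complex.exp (-s * (Real.log n : ℝ)) = LSeries.term f s n := by
    rcases eq_or_ne n 0 with rfl | hn
    · simp [f0]
    · rw [LSeries.term_of_ne_zero hn, div_eq_mul_inv, ← Complex.cpow_neg,
        Complex.cpow_def_of_ne_zero (by exact_mod_cast hn), Complex.natCast_log]
      congr 2; ring
  have hsum (t : ℝ) : LSeriesSummable f (σ + t * Complex.I) :=
    LSeriesSummable_of_le_log hf (by simpa using hσ)
  have hint (s : ℂ) (hs : 1 < s.re) : Integrable (fun n : ℕ => f n * Complex.exp (-s * (Real.log n : ℝ)))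
      Measure.count := by
    rw [integrable_count_iff]
    simp only [term]
    exact (LSeriesSummable_of_le_log hf hs).norm
  have hL (t : ℝ) : ∫ n : ℕ, f n * Complex.exp (-((σ : ℂ) + t * Complex.I) * (Real.log n : ℝ))
      ∂Measure.count = LSeries f (σ + t * Complex.I) := by
    rw [integral_countable (hint _ (by simpa using hσ)), LSeries]
    refine tsum_congr fun n => ?_
    rw [term, Measure.real, Measure.count_singleton]
    simp
  have hc : Continuous fun t : ℝ => ∫ n : ℕ, f n *
      Complex.exp (-((σ : ℂ) + t * Complex.I) * (Real.log n : ℝ)) ∂Measure.count := by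
    simp only [hL]
    exact continuous_LSeries_vertical hf hσ
  have key := perron_trap (Measure.count : Measure ℕ) f (fun n => Real.log n) (by fun_prop) hσ.le
    (measurable_of_countable f).aestronglyMeasurable (by
      have := hint σ (by simpa using hσ)
      refine this.congr (Filter.Eventually.of_forall fun n => ?_)
      simp only; push_cast; rfl) hc hx hδ
  simp only [hL] at key
  refine ⟨key.1, key.2.trans ?_⟩
  congr 1
  have hz : ∀ n ∉ Icc 1 ⌊x * (1 + δ)⌋₊, f n * ((trap x δ (Real.exp (Real.log n)) : ℝ) : ℂ) = 0 := by
    intro n hn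
    rcases eq_or_ne n 0 with rfl | hn0
    · simp [f0]
    · rw [mem_Icc, not_and] at hn
      have := hn (by omega)
      rw [not_le, Nat.floor_lt (by positivity)] at this
      rw [Real.exp_log (by positivity), trap_eq_zero hx hδ this.le]; simp
  rw [integral_countable]
  · simp only [Measure.real, Measure.count_singleton, ENNReal.toReal_one, one_smul]
    rw [tsum_eq_sum hz, trapSum]
    refine sum_congr rfl fun n hn => ?_
    rw [mem_Icc] at hn
    rw [Real.exp_log (by have : 0 < n := by omega
                         positivity)]
  · rw [integrable_count_iff]
    exact summable_of_ne_finset_zero (s := Icc 1 ⌊x * (1 + δ)⌋₊) fun n hn => by rw [hz n hn, norm_zero]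

lemma exp_mul_log_le {x : ℝ} (hx : 3 ≤ x) {δ : ℝ} (hδ : 0 < δ) (hδ1 : δ ≤ 1) :
    Real.exp ((1 + 1 / Real.log x) * Real.log (x * (1 + δ))) ≤ 12 * x := by
  have hl : 1 ≤ Real.log x := by
    rw [Real.le_log_iff_exp_le (by linarith)]; linarith [Real.exp_one_lt_d9]
  have h1 : Real.log (x * (1 + δ)) ≤ Real.log x + Real.log 2 := by
    rw [← Real.log_mul (by positivity) (by norm_num)]
    exact Real.log_le_log (by positivity) (by nlinarith)
  have h2 : (1 + 1 / Real.log x) * Real.log (x * (1 + δ)) ≤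
      Real.log x + 1 + Real.log 2 + Real.log 2 := by
    have h2' : 0 ≤ Real.log 2 := Real.log_nonneg (by norm_num)
    calc _ ≤ (1 + 1 / Real.log x) * (Real.log x + Real.log 2) := by gcongr
      _ = Real.log x + 1 + Real.log 2 + Real.log 2 * (1 / Real.log x) := by field_simp; ring
      _ ≤ _ := by
        have : 1 / Real.log x ≤ 1 := by rw [div_le_one (by linarith)]; exact hl
        nlinarith
  calc _ ≤ _ := Real.exp_le_exp.2 h2
    _ = x * Real.exp 1 * 2 * 2 := by
      rw [Real.exp_add, Real.exp_add, Real.exp_add, Real.exp_log (by linarith),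
        Real.exp_log (by norm_num)]
    _ ≤ _ := by nlinarith [Real.exp_one_lt_d9]

lemma norm_trapKer_le {x δ σ : ℝ} (hx : 3 ≤ x) (hδ : 0 < δ) (hδ1 : δ ≤ 1)
    (hσ : σ = 1 + 1 / Real.log x) (t : ℝ) :
    ‖trapKer x δ (σ + t * Complex.I)‖ ≤ 12 * x / ‖(σ : ℂ) + t * Complex.I‖ := by
  have hl : 0 < Real.log x := Real.log_pos (by linarith)
  have hσ1 : 1 ≤ σ := by rw [hσ]; have : 0 < 1 / Real.log x := by positivity
                         linarith
  obtain ⟨s, hs⟩ : ∃ s : ℂ, s = σ + t * Complex.I := ⟨_, rfl⟩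
  have hsre : s.re = σ := by rw [hs]; simp
  have hx0 : 0 < x := by linarith
  obtain ⟨hs0, hs1⟩ := ne_zero_vertical hσ1 t
  rw [← hs] at hs0 hs1 ⊢
  have hD (y : ℝ) (hy : y ∈ Set.Icc x (x * (1 + δ))) : HasDerivWithinAt
      (fun y : ℝ => Complex.exp ((s + 1) * Real.log y))
      (Complex.exp ((s + 1) * Real.log y) * ((s + 1) * ((y⁻¹ : ℝ) : ℂ))) (Set.Icc x (x * (1 + δ))) y := by
    have hy0 : y ≠ 0 := by have := hy.1; linarith
    exact ((((Real.hasDerivAt_log hy0).ofReal_comp).const_mul (s + 1)).cexp).hasDerivWithinAt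
  have hbd (y : ℝ) (hy : y ∈ Set.Icc x (x * (1 + δ))) :
      ‖Complex.exp ((s + 1) * Real.log y) * ((s + 1) * ((y⁻¹ : ℝ) : ℂ))‖ ≤ 12 * x * ‖s + 1‖ := by
    have hy0 : 0 < y := by have := hy.1; linarith
    rw [norm_mul, norm_mul, Complex.norm_exp, Complex.norm_real, norm_of_nonneg (by positivity)]
    have e : ((s + 1) * Real.log y).re = σ * Real.log y + Real.log y := by
      rw [Complex.re_mul_ofReal]; simp [hsre]; ring
    rw [e, Real.exp_add, Real.exp_log hy0]
    have h1 : Real.exp (σ * Real.log y) ≤ 12 * x := by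
      refine le_trans (Real.exp_le_exp.2 ?_) (hσ ▸ exp_mul_log_le hx hδ hδ1)
      exact mul_le_mul_of_nonneg_left (Real.log_le_log hy0 hy.2) (by linarith)
    calc _ = Real.exp (σ * Real.log y) * ‖s + 1‖ := by field_simp
      _ ≤ _ := by gcongr
  have hle : x ≤ x * (1 + δ) := by nlinarith
  have key := (convex_Icc x (x * (1 + δ))).norm_image_sub_le_of_norm_hasDerivWithin_le hD hbd
    (Set.left_mem_Icc.2 hle) (Set.right_mem_Icc.2 hle)
  rw [trapKer, norm_div]
  have e3 : ‖(δ : ℂ) * x * (s * (s + 1))‖ = δ * x * ‖s‖ * ‖s + 1‖ := by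
    rw [norm_mul, norm_mul, norm_mul, Complex.norm_real, Complex.norm_real,
      norm_of_nonneg hδ.le, norm_of_nonneg hx0.le]; ring
  have e4 : ‖x * (1 + δ) - x‖ = δ * x := by
    rw [show x * (1 + δ) - x = δ * x by ring]; exact norm_of_nonneg (by positivity)
  rw [e4] at key
  have n0 := norm_pos_iff.2 hs0
  have n1 := norm_pos_iff.2 hs1
  rw [e3, div_le_div_iff₀ (by positivity) n0]
  calc _ ≤ 12 * x * ‖s + 1‖ * (δ * x) * ‖s‖ := by gcongr
    _ = _ := by ring

lemma norm_trapKer_le' {x δ σ : ℝ} (hx : 3 ≤ x) (hδ : 0 < δ) (hδ1 : δ ≤ 1)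
    (hσ : σ = 1 + 1 / Real.log x) (t : ℝ) :
    ‖trapKer x δ (σ + t * Complex.I)‖ ≤ 48 * x / δ * (1 + t ^ 2)⁻¹ := by
  have hl : 0 < Real.log x := Real.log_pos (by linarith)
  have hσ1 : 1 ≤ σ := by rw [hσ]; have : 0 < 1 / Real.log x := by positivity
                         linarith
  have hx0 : 0 < x := by linarith
  have hnum (y : ℝ) (hy : y ≤ x * (1 + δ)) (hy0 : 0 < y) :
      ‖Complex.exp (((σ : ℂ) + t * Complex.I + 1) * Real.log y)‖ ≤ 24 * x ^ 2 := by
    rw [Complex.norm_exp]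
    have e : (((σ : ℂ) + t * Complex.I + 1) * Real.log y).re = σ * Real.log y + Real.log y := by
      rw [Complex.re_mul_ofReal]; simp; ring
    rw [e, Real.exp_add, Real.exp_log hy0]
    have h1 : Real.exp (σ * Real.log y) ≤ 12 * x := by
      refine le_trans (Real.exp_le_exp.2 ?_) (hσ ▸ exp_mul_log_le hx hδ hδ1)
      exact mul_le_mul_of_nonneg_left (Real.log_le_log hy0 hy) (by linarith)
    calc _ ≤ 12 * x * (x * (1 + δ)) := by gcongr
      _ ≤ 12 * x * (x * 2) := by gcongr; linarith
      _ = _ := by ring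
  rw [trapKer, norm_div, norm_mul, norm_mul, Complex.norm_real, Complex.norm_real,
      norm_of_nonneg hδ.le, norm_of_nonneg hx0.le]
  have h1 := hnum (x * (1 + δ)) le_rfl (by positivity)
  have h2 := hnum x (by nlinarith) hx0
  calc _ ≤ (24 * x ^ 2 + 24 * x ^ 2) / (δ * x * (1 + t ^ 2)) := by
        gcongr
        · exact (norm_sub_le _ _).trans (add_le_add h1 h2)
        · exact one_add_sq_le_norm hσ1 t
    _ = _ := by field_simp; ring

lemma norm_liftChar_le_one (z : ℕ) {q : ℕ} (χ : DirichletCharacter ℂ q) (n : ℕ) :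
    ‖liftChar z χ n‖ ≤ ‖liftChar z (1 : DirichletCharacter ℂ q) n‖ := by
  rw [liftChar_apply, liftChar_apply]
  split_ifs with h
  · by_cases hu : IsUnit (n : ZMod q)
    · rw [MulChar.one_apply hu, norm_one]; exact DirichletCharacter.norm_le_one _ _
    · rw [MulChar.map_nonunit _ hu, MulChar.map_nonunit _ hu]
  · simp

lemma norm_LSeries_le_dser {z q k : ℕ} {f : ℕ → ℂ}
    (hf : ∀ n, ‖f n‖ ≤ ‖dco z k (1 : DirichletCharacter ℂ q) n‖) {s : ℂ} (hs : 1 < s.re) :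
    ‖LSeries f s‖ ≤ ‖dser z k (1 : DirichletCharacter ℂ q) s.re‖ := by
  have hs' : 1 < ((s.re : ℂ)).re := by simpa using hs
  have hd := LSeriesSummable_of_le_log (norm_dco_le z k (1 : DirichletCharacter ℂ q)) hs'
  have hfS := LSeriesSummable_of_le_log (fun n => (hf n).trans (norm_dco_le z k _ n)) hs
  have h1 : ∀ n, ‖LSeries.term f s n‖ ≤
      (LSeries.term (dco z k (1 : DirichletCharacter ℂ q)) s.re n).re := by
    intro n
    rcases eq_or_ne n 0 with rfl | hn
    · simp
    · rw [re_term_ofReal _ _ hn, LSeries.norm_term_eq, if_neg hn, Real.rpow_neg (by positivity),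
        ← div_eq_mul_inv]
      have e : ‖dco z k (1 : DirichletCharacter ℂ q) n‖ =
          (dco z k (1 : DirichletCharacter ℂ q) n).re := by
        have hl : 0 ≤ Real.log n ^ k := by have := Real.log_natCast_nonneg n; positivity
        rw [dco, liftChar_apply]
        split_ifs
        · by_cases hu : IsUnit (n : ZMod q)
          · rw [MulChar.one_apply hu, one_mul, Complex.norm_real, Complex.ofReal_re,
              norm_of_nonneg hl]
          · rw [MulChar.map_nonunit _ hu]; simp
        · simp
      rw [← e]
      exact div_le_div_of_nonneg_right (hf n) (by positivity)
  have hre : Summable fun n => (LSeries.term (dco z k (1 : DirichletCharacter ℂ q)) s.re n).re :=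
    Complex.reCLM.summable hd
  calc ‖LSeries f s‖ ≤ ∑' n, ‖LSeries.term f s n‖ := norm_tsum_le_tsum_norm hfS.norm
    _ ≤ ∑' n, (LSeries.term (dco z k (1 : DirichletCharacter ℂ q)) s.re n).re :=
        hfS.norm.tsum_le_tsum h1 hre
    _ = (dser z k (1 : DirichletCharacter ℂ q) s.re).re := by
        rw [dser, LSeries, Complex.re_tsum hd]
    _ ≤ _ := Complex.re_le_norm _

/-- Crude bound for Dirichlet series dominated by `(log n) ^ 2` on rough numbers. -/
lemma norm_LSeries_crude : ∃ C : ℝ, 0 < C ∧ ∀ (w z q : ℕ) (Q x : ℝ) [NeZero q] (f : ℕ → ℂ) (t : ℝ),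
    Lvl q w z Q → 2 ≤ Real.log x → Real.log x ≤ Q →
    (∀ n, ‖f n‖ ≤ ‖dco z 2 (1 : DirichletCharacter ℂ q) n‖) →
    ‖LSeries f (((1 + 1 / Real.log x : ℝ) : ℂ) + t * Complex.I)‖ ≤ C * Q ^ 4 * Real.log z := by
  obtain ⟨A, hA, H⟩ := norm_dser_bounds
  refine ⟨A * 512, by linarith, fun w z q Q x _ f t h hx1 hx2 hf => ?_⟩
  have hQ := h.hQ
  have hx0 : 0 < Real.log x := by linarith
  have h1 : 1 / Q ≤ 1 / Real.log x := one_div_le_one_div_of_le hx0 hx2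
  have h2 : 1 / Real.log x ≤ 1 := by rw [div_le_one hx0]; linarith
  have h0 : 0 < 1 / Real.log x := by positivity
  refine (norm_LSeries_le_dser hf (by simpa using hx0)).trans ?_
  have e : (((1 + 1 / Real.log x : ℝ) : ℂ) + t * Complex.I).re = 1 + 1 / Real.log x := by simp
  rw [e]
  have := (H w z q Q 1 2 ((1 + 1 / Real.log x : ℝ) : ℂ) h le_rfl (by rw [Complex.ofReal_re]; linarith)
    (by rw [Complex.ofReal_re]; linarith) (by rw [Complex.ofReal_im, abs_zero]; positivity)).2
  refine this.trans ?_
  have e2 : ‖((1 + 1 / Real.log x : ℝ) : ℂ) - 1‖ = 1 / Real.log x := by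
    push_cast
    rw [add_sub_cancel_left, ← Complex.ofReal_one, ← Complex.ofReal_div, Complex.norm_real,
      norm_of_nonneg h0.le]
  rw [e2]
  have hz := h.one_le_log
  have hz2 : Real.log z ≤ 256 * Q := h.log_le.trans (by
    have := Real.log_le_self (show 0 ≤ Q by linarith); linarith)
  have h3 : 1 / (Real.log z * (1 / Real.log x)) ^ (2 + 1) ≤ Q ^ 3 := by
    have : 1 / (Real.log z * (1 / Real.log x)) ≤ Q := by
      rw [mul_one_div, one_div_div, div_le_iff₀ (by linarith)]; nlinarith
    calc _ = (1 / (Real.log z * (1 / Real.log x))) ^ 3 := by rw [one_div_pow]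
      _ ≤ Q ^ 3 := pow_le_pow_left₀ (by positivity) this 3
  have h4 : (1 : ℝ) ≤ Q ^ 3 := one_le_pow₀ (by linarith)
  calc _ ≤ A * Real.log z ^ 2 * (Q ^ 3 + Q ^ 3) := by gcongr
    _ = A * (2 * Q ^ 3) * Real.log z * Real.log z := by ring
    _ ≤ A * (2 * Q ^ 3) * Real.log z * (256 * Q) := by gcongr
    _ = _ := by ring

lemma norm_hco_le_dco (z : ℕ) {q : ℕ} (χ : DirichletCharacter ℂ q) (n : ℕ) :
    ‖hco z χ n‖ ≤ ‖dco z 2 (1 : DirichletCharacter ℂ q) n‖ := by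
  have h0 := Real.log_natCast_nonneg n
  have h1 : ArithmeticFunction.vonMangoldt n ≤ Real.log n := ArithmeticFunction.vonMangoldt_le_log
  have h2 : 0 ≤ ArithmeticFunction.vonMangoldt n := ArithmeticFunction.vonMangoldt_nonneg
  rw [hco, dco, norm_mul, norm_mul, Complex.norm_real, Complex.norm_real]
  refine mul_le_mul (norm_liftChar_le_one z χ n) ?_ (norm_nonneg _) (norm_nonneg _)
  rw [Real.norm_eq_abs, Real.norm_eq_abs, abs_of_nonneg (by positivity : 0 ≤ Real.log n ^ 2),
    abs_le]
  constructor <;> nlinarith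

lemma norm_vco_le_dco (z : ℕ) {q : ℕ} (χ : DirichletCharacter ℂ q) (n : ℕ) :
    ‖vco z 1 χ n‖ ≤ ‖dco z 2 (1 : DirichletCharacter ℂ q) n‖ := by
  have h0 := Real.log_natCast_nonneg n
  have h1 : ArithmeticFunction.vonMangoldt n ≤ Real.log n := ArithmeticFunction.vonMangoldt_le_log
  have h2 : 0 ≤ ArithmeticFunction.vonMangoldt n := ArithmeticFunction.vonMangoldt_nonneg
  rw [vco, dco, norm_mul, norm_mul, Complex.norm_real, Complex.norm_real]
  refine mul_le_mul (norm_liftChar_le_one z χ n) ?_ (norm_nonneg _) (norm_nonneg _)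
  rw [Real.norm_of_nonneg (by positivity), Real.norm_of_nonneg (by positivity)]
  nlinarith

/-- Splitting of a Perron integral at height `T`. -/
lemma norm_integral_trapKer_le {F : ℝ → ℂ} {x δ σ T B : ℝ} (hx : 3 ≤ x)
    (hδ : 0 < δ) (hδ1 : δ ≤ 1) (hσ : σ = 1 + 1 / Real.log x) (hT : 1 ≤ T)
    (hi : Integrable fun t : ℝ => F t * trapKer x δ (σ + t * Complex.I))
    (hB : ∀ t, ‖F t‖ ≤ B) :
    ‖∫ t : ℝ, F t * trapKer x δ (σ + t * Complex.I)‖ ≤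
      (∫ t in Set.Icc (-T) T, ‖F t * trapKer x δ (σ + t * Complex.I)‖) +
        96 * π * B * x / (δ * T) := by
  have hB0 : 0 ≤ B := (norm_nonneg _).trans (hB 0)
  obtain ⟨ik, ek⟩ := integral_cauchy_kernel (show 0 < T by linarith) one_pos
  refine (norm_integral_le_integral_norm _).trans ?_
  rw [← integral_add_compl (measurableSet_Icc (a := -T) (b := T)) hi.norm]
  gcongr
  have hm : Integrable fun t : ℝ => 96 * B * x / δ * ((1 : ℝ) ^ 2 / (T ^ 2 + (t * 1) ^ 2)) :=
    ik.const_mul _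
  calc ∫ t in (Set.Icc (-T) T)ᶜ, ‖F t * trapKer x δ (σ + t * Complex.I)‖
      ≤ ∫ t in (Set.Icc (-T) T)ᶜ, 96 * B * x / δ * ((1 : ℝ) ^ 2 / (T ^ 2 + (t * 1) ^ 2)) := by
        refine setIntegral_mono_on hi.norm.integrableOn hm.integrableOn
          measurableSet_Icc.compl fun t ht => ?_
        have ht' : T < |t| := by
          by_contra h
          exact ht (abs_le.1 (not_lt.1 h))
        have ht2 : T ^ 2 ≤ t ^ 2 := by
          rw [← sq_abs t]; exact pow_le_pow_left₀ (by linarith) ht'.le 2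
        rw [norm_mul]
        have hk := norm_trapKer_le' hx hδ hδ1 hσ t
        have : (1 + t ^ 2)⁻¹ ≤ 2 * ((1 : ℝ) ^ 2 / (T ^ 2 + (t * 1) ^ 2)) := by
          rw [mul_one, one_pow, mul_one_div, inv_eq_one_div,
            div_le_div_iff₀ (by positivity) (by positivity)]
          linarith
        calc _ ≤ B * (48 * x / δ * (2 * ((1 : ℝ) ^ 2 / (T ^ 2 + (t * 1) ^ 2)))) := by
              have h48 : 0 ≤ 48 * x / δ := div_nonneg (by linarith) hδ.le
              exact mul_le_mul (hB t) (hk.trans (mul_le_mul_of_nonneg_left this h48))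
                (norm_nonneg _) hB0
          _ = _ := by ring
    _ ≤ ∫ t : ℝ, 96 * B * x / δ * ((1 : ℝ) ^ 2 / (T ^ 2 + (t * 1) ^ 2)) :=
        setIntegral_le_integral hm (Filter.Eventually.of_forall fun t => by
          have : 0 ≤ 96 * B * x / δ := div_nonneg (mul_nonneg (by linarith) (by linarith)) hδ.le
          simp only [Pi.zero_apply]
          positivity)
    _ = _ := by rw [integral_const_mul, ek]; field_simp

lemma norm_trapSum_hco_le : ∃ C : ℝ, 0 < C ∧ ∀ (w z q : ℕ) (Q x : ℝ) [NeZero q]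
    (χ : DirichletCharacter ℂ q), Lvl q w z Q → 2 ≤ Real.log x → Real.log x ≤ Q → 3 ≤ x →
    ‖trapSum (hco z χ) x (1 / Real.log x)‖ ≤
      12 * x * (∫ t in Set.Icc (-Q ^ 6) (Q ^ 6),
        ‖LSeries (hco z χ) (((1 + 1 / Real.log x : ℝ) : ℂ) + t * Complex.I)‖) +
        C * x * Real.log z / Q := by
  obtain ⟨A, hA, H⟩ := norm_LSeries_crude
  refine ⟨96 * π * A, by positivity, fun w z q Q x _ χ h hx1 hx2 hx3 => ?_⟩
  obtain ⟨σ, hσ⟩ : ∃ σ : ℝ, σ = 1 + 1 / Real.log x := ⟨_, rfl⟩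
  obtain ⟨δ, hδ⟩ : ∃ δ : ℝ, δ = 1 / Real.log x := ⟨_, rfl⟩
  have hδ0 : 0 < δ := by rw [hδ]; positivity
  have hδ1 : δ ≤ 1 := by rw [hδ, div_le_one (by linarith)]; linarith
  have hσ1 : 1 < σ := by rw [hσ, ← hδ]; linarith
  have hx0 : 0 < x := by linarith
  have hQ := h.hQ
  have hT : 1 ≤ Q ^ 6 := one_le_pow₀ (by linarith)
  rw [← hσ, ← hδ]
  have hcr : ∀ t : ℝ, ‖LSeries (hco z χ) (σ + t * Complex.I)‖ ≤ A * Q ^ 4 * Real.log z := fun t => by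
    rw [hσ]; exact H w z q Q x _ t h hx1 hx2 (norm_hco_le_dco z χ)
  have hcont := continuous_LSeries_vertical (norm_hco_le z χ) hσ1
  obtain ⟨i1, e1⟩ := perron_LSeries two_ne_zero (norm_hco_le z χ) hσ1 hx0 hδ0
  have key := norm_integral_trapKer_le hx3 hδ0 hδ1 hσ hT i1 hcr
  rw [e1, norm_mul] at key
  have e2 : ‖(2 * π : ℂ)‖ = 2 * π := by
    rw [norm_mul, Complex.norm_real, norm_of_nonneg Real.pi_pos.le]; simp
  rw [e2] at key
  have hz0 : 0 ≤ Real.log z := by linarith [h.one_le_log]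
  have h3 : 96 * π * (A * Q ^ 4 * Real.log z) * x / (δ * Q ^ 6) ≤ 96 * π * A * x * Real.log z / Q := by
    have e3 : 96 * π * (A * Q ^ 4 * Real.log z) * x / (δ * Q ^ 6) =
        96 * π * A * x * Real.log z / Q * (Real.log x / Q) := by
      rw [hδ]; field_simp
    rw [e3]
    refine mul_le_of_le_one_right (by positivity) ?_
    rw [div_le_one (by linarith)]; exact hx2
  have h4 : ∫ t in Set.Icc (-Q ^ 6) (Q ^ 6),
      ‖LSeries (hco z χ) (σ + t * Complex.I) * trapKer x δ (σ + t * Complex.I)‖ ≤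
      12 * x * ∫ t in Set.Icc (-Q ^ 6) (Q ^ 6), ‖LSeries (hco z χ) (σ + t * Complex.I)‖ := by
    rw [← integral_const_mul]
    refine setIntegral_mono_on i1.norm.integrableOn
      ((continuous_const.mul hcont.norm).continuousOn.integrableOn_compact isCompact_Icc)
      measurableSet_Icc fun t _ => ?_
    rw [norm_mul, mul_comm]
    gcongr
    refine (norm_trapKer_le hx3 hδ0 hδ1 hσ t).trans (div_le_self (by linarith) ?_)
    have : |((σ : ℂ) + t * Complex.I).re| ≤ _ := Complex.abs_re_le_norm _
    have e : ((σ : ℂ) + t * Complex.I).re = σ := by simp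
    rw [e, abs_of_pos (by linarith)] at this
    linarith
  have h5 : ‖trapSum (hco z χ) x δ‖ ≤ 2 * π * ‖trapSum (hco z χ) x δ‖ :=
    le_mul_of_one_le_left (norm_nonneg _) (by linarith [Real.pi_gt_three])
  linarith

/-- Character sums of `hco` with trapezoidal weight. -/
theorem sum_norm_trapSum_hco_le : ∃ C : ℝ, 0 < C ∧ ∀ (w z q : ℕ) (Q x : ℝ) [NeZero q],
    Lvl q w z Q → 2 ≤ Real.log x → Real.log x ≤ Q → 3 ≤ x →
    ∃ ψ : DirichletCharacter ℂ q, ψ ^ 2 = 1 ∧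
      (∑ χ ∈ (univ.erase (1 : DirichletCharacter ℂ q)).erase ψ,
        ‖trapSum (hco z χ) x (1 / Real.log x)‖ ≤ C * x * Real.log z) ∧
      (ψ ≠ 1 → ‖trapSum (hco z ψ) x (1 / Real.log x)‖ ≤
        C * x * Real.log z * (1 + 1 / ‖dser z 0 ψ (1 + 1 / Real.log x : ℝ)‖)) := by
  obtain ⟨A, hA, H⟩ := norm_trapSum_hco_le
  obtain ⟨B, hB, HB⟩ := integral_hco_le
  refine ⟨12 * B + A, by positivity, fun w z q Q x _ h hx1 hx2 hx3 => ?_⟩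
  have hQ := h.hQ
  have hL := h.one_le_log
  have hx0 : 0 < Real.log x := by linarith
  have hxp : 0 < x := by linarith
  have h1 : 1 / Q ≤ 1 / Real.log x := one_div_le_one_div_of_le hx0 hx2
  have h2 : 1 / Real.log x ≤ 1 / 2 := one_div_le_one_div_of_le (by norm_num) hx1
  obtain ⟨ψ, hψ2, a1, a2⟩ := HB w z q Q (1 + 1 / Real.log x) h (by linarith) (by linarith)
  refine ⟨ψ, hψ2, ?_, fun hψ => ?_⟩
  · refine (sum_le_sum fun χ _ => H w z q Q x χ h hx1 hx2 hx3).trans ?_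
    rw [sum_add_distrib, ← mul_sum, sum_const, nsmul_eq_mul]
    have hc : ((((univ.erase (1 : DirichletCharacter ℂ q)).erase ψ).card : ℕ) : ℝ) ≤ Q := by
      refine le_trans ?_ h.hqQ
      have c1 : ((univ.erase (1 : DirichletCharacter ℂ q)).erase ψ).card ≤
          (univ : Finset (DirichletCharacter ℂ q)).card :=
        card_le_card ((erase_subset _ _).trans (erase_subset _ _))
      have c2 : (univ : Finset (DirichletCharacter ℂ q)).card = q.totient := by
        rw [card_univ, ← Nat.card_eq_fintype_card, DirichletCharacter.card_eq_totient_of_hasEnoughRootsOfUnity]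
      have := Nat.totient_le q
      exact_mod_cast (by omega : ((univ.erase (1 : DirichletCharacter ℂ q)).erase ψ).card ≤ q)
    calc _ ≤ 12 * x * (B * Real.log z) + Q * (A * x * Real.log z / Q) := by gcongr
      _ = _ := by field_simp
  · have a3 := a2 hψ
    obtain ⟨l, hl⟩ : ∃ l : ℝ, l = ‖dser z 0 ψ (1 + 1 / Real.log x : ℝ)‖ := ⟨_, rfl⟩
    rw [← hl] at a3 ⊢
    have hl0 : 0 ≤ l := by rw [hl]; positivity
    have : 0 ≤ 1 / l := by positivity
    calc _ ≤ _ := H w z q Q x ψ h hx1 hx2 hx3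
      _ ≤ 12 * x * (B * Real.log z / l) + A * x * Real.log z / 1 := by gcongr; linarith
      _ = 12 * B * x * Real.log z * (1 / l) + A * x * Real.log z := by ring
      _ ≤ _ := by
        have e1 : 0 ≤ 12 * B * x * Real.log z := by positivity
        have e2 : 0 ≤ A * x * Real.log z * (1 / l) := by positivity
        nlinarith

lemma trap_eq_integral {x δ : ℝ} (hx : 0 < x) (hδ : 0 < δ) (y : ℝ) :
    ∫ t in Set.Icc x (x * (1 + δ)), (Set.Ici y).indicator (fun _ => (1 : ℝ)) t =
      δ * x * trap x δ y := by
  have h0 : 0 < δ * x := by positivity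
  rw [setIntegral_indicator measurableSet_Ici]
  have e : Set.Icc x (x * (1 + δ)) ∩ Set.Ici y = Set.Icc (max x y) (x * (1 + δ)) := by
    ext t; simp only [Set.mem_inter_iff, Set.mem_Icc, Set.mem_Ici, max_le_iff]; tauto
  rw [e, setIntegral_const, Measure.real, Real.volume_Icc, smul_eq_mul, mul_one,
    ENNReal.toReal_ofReal', trap, mul_div_cancel₀ _ h0.ne']
  rcases le_total x y with h | h
  · rw [max_eq_right h, max_eq_left (sub_nonpos.2 h), sub_zero, max_comm]
  · have h1 : 0 ≤ x * (1 + δ) - x := by linarith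
    have h2 : 0 ≤ x * (1 + δ) - y := by linarith
    rw [max_eq_left h, max_eq_right (sub_nonneg.2 h), max_eq_right h2, max_eq_left h1]
    ring

/-- A `trap`-weighted sum is an average of sums with sharp cutoffs. -/
lemma norm_trapSum_le {f : ℕ → ℂ} {x δ B : ℝ} (hx : 0 < x) (hδ : 0 < δ)
    (hB : ∀ y, x ≤ y → y ≤ x * (1 + δ) → ‖∑ n ∈ Icc 1 ⌊y⌋₊, f n‖ ≤ B) :
    ‖trapSum f x δ‖ ≤ B := by
  have h0 : 0 < δ * x := by positivity
  have hfin : volume (Set.Icc x (x * (1 + δ))) < ⊤ := by rw [Real.volume_Icc]; exact ENNReal.ofReal_lt_top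
  have hint (n : ℕ) : IntegrableOn
      (fun t => f n * (((Set.Ici (n : ℝ)).indicator (fun _ => (1 : ℝ)) t : ℝ) : ℂ))
      (Set.Icc x (x * (1 + δ))) := by
    refine Integrable.const_mul ?_ _
    refine Integrable.ofReal ?_
    exact (integrableOn_const hfin.ne).indicator measurableSet_Ici
  have key : ((δ * x : ℝ) : ℂ) * trapSum f x δ =
      ∫ t in Set.Icc x (x * (1 + δ)), ∑ n ∈ Icc 1 ⌊x * (1 + δ)⌋₊,
        f n * (((Set.Ici (n : ℝ)).indicator (fun _ => (1 : ℝ)) t : ℝ) : ℂ) := by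
    rw [integral_finsetSum _ fun n _ => hint n, trapSum, mul_sum]
    refine sum_congr rfl fun n _ => ?_
    rw [integral_const_mul, integral_complex_ofReal, trap_eq_integral hx hδ]
    push_cast; ring
  have bd := norm_setIntegral_le_of_norm_le_const (C := B) (f := fun t : ℝ =>
    ∑ n ∈ Icc 1 ⌊x * (1 + δ)⌋₊,
        f n * (((Set.Ici (n : ℝ)).indicator (fun _ => (1 : ℝ)) t : ℝ) : ℂ)) hfin (by
    rintro t ⟨ht1, ht2⟩
    refine le_trans (le_of_eq (congrArg _ ?_)) (hB t ht1 ht2)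
    have hs : Icc 1 ⌊t⌋₊ ⊆ Icc 1 ⌊x * (1 + δ)⌋₊ := Icc_subset_Icc_right (Nat.floor_mono ht2)
    rw [← sum_subset hs]
    · refine sum_congr rfl fun n hn => ?_
      have : (n : ℝ) ≤ t := (Nat.le_floor_iff (by linarith)).1 (mem_Icc.1 hn).2
      rw [Set.indicator_of_mem (by simpa using this)]; simp
    · intro n hn hn'
      have : ¬ (n : ℝ) ≤ t := fun hc =>
        hn' (mem_Icc.2 ⟨(mem_Icc.1 hn).1, Nat.le_floor hc⟩)
      rw [Set.indicator_of_notMem (by simpa using this)]; simp)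
  rw [← key, norm_mul, Complex.norm_real, norm_of_nonneg h0.le, Measure.real, Real.volume_Icc,
    ENNReal.toReal_ofReal (by nlinarith)] at bd
  have e : x * (1 + δ) - x = δ * x := by ring
  rw [e, mul_comm B] at bd
  exact le_of_mul_le_mul_left bd h0

lemma logSum_split {k q z : ℕ} {b : ZMod q} {Y X W : ℝ} (h1 : Y ≤ X) (h2 : X ≤ W) :
    logSum k q z b Y W = logSum k q z b Y X + logSum k q z b X W := by
  classical
  have e : roughSet q z b Y W = roughSet q z b Y X ∪ roughSet q z b X W := by
    ext n
    have i1 := Nat.floor_mono h1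
    have i2 := Nat.floor_mono h2
    simp only [mem_union, mem_roughSet, mem_Ioc]
    constructor
    · rintro ⟨⟨a1, a2⟩, a3⟩
      rcases le_or_gt n ⌊X⌋₊ with h | h
      · exact Or.inl ⟨⟨a1, h⟩, a3⟩
      · exact Or.inr ⟨⟨h, a2⟩, a3⟩
    · rintro (⟨⟨a1, a2⟩, a3⟩ | ⟨⟨a1, a2⟩, a3⟩)
      · exact ⟨⟨a1, by omega⟩, a3⟩
      · exact ⟨⟨by omega, a2⟩, a3⟩
  rw [logSum, e, sum_union]
  · rfl
  · rw [disjoint_left]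
    intro n hn hn'
    have a1 := (mem_Ioc.1 (mem_roughSet.1 hn).1).2
    have a2 := (mem_Ioc.1 (mem_roughSet.1 hn').1).1
    omega

/-- Sums of `(log n) ^ 2` over rough integers hardly depend on the residue class. -/
lemma abs_logSum_two_sub_le : ∃ C : ℝ, 0 < C ∧ ∀ (w z q : ℕ) (Q : ℝ) (b b' : ZMod q) (y : ℝ),
    Lvl q w z Q → IsUnit b → IsUnit b' → 1 ≤ y → Real.log y ≤ 2 * Q →
    |logSum 2 q z b 1 y - logSum 2 q z b' 1 y| ≤ C * (y * Real.log z / q.totient) := by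
  obtain ⟨C, hC, H⟩ := logSum_bound
  refine ⟨4 * C, by positivity, fun w z q Q b b' y h hb hb' => ?_⟩
  obtain ⟨η, hηd⟩ : ∃ η, η = (Q ^ 7)⁻¹ := ⟨_, rfl⟩
  have hη0 : 0 < η := hηd ▸ h.eta_pos
  have hη1 : η ≤ 1 := hηd ▸ h.eta_le_one
  have hηQ : η * Q ≤ 1 / 4 := by
    have hQ := h.hQ
    have : η * Q = (Q ^ 6)⁻¹ := by rw [hηd]; field_simp
    rw [this, one_div]
    apply inv_anti₀ (by norm_num)
    calc (4 : ℝ) ≤ Q := by linarith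
      _ ≤ Q ^ 6 := le_self_pow₀ (by linarith) (by norm_num)
  have hφ := totient_pos_real h.hq
  have hL := h.one_le_log
  have empty (c : ZMod q) (y : ℝ) (hy : y < 2) : logSum 2 q z c 1 y = 0 := by
    rw [logSum]
    refine sum_eq_zero fun n hn => ?_
    have h1 := mem_Ioc.1 (mem_roughSet.1 hn).1
    have h2 : ⌊y⌋₊ < 2 := by
      rcases le_or_gt 0 y with h0 | h0
      · exact (Nat.floor_lt h0).2 (by exact_mod_cast hy)
      · rw [Nat.floor_of_nonpos h0.le]; norm_num
    rw [Nat.floor_one] at h1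
    omega
  have main : ∀ m : ℕ, ∀ y : ℝ, 1 ≤ y → Real.log y ≤ 2 * Q → y < (1 + η) ^ m →
      |logSum 2 q z b 1 y - logSum 2 q z b' 1 y| ≤ 4 * C * (y * Real.log z / q.totient) := by
    intro m
    induction m with
    | zero => intro y hy1 _ hy; simp at hy; linarith
    | succ m ih =>
      intro y hy1 hyQ hy
      have hbase : 0 ≤ 4 * C * (y * Real.log z / q.totient) := by positivity
      rcases lt_or_ge y (1 + η) with hlt | hge
      · rw [empty b y (by linarith), empty b' y (by linarith)]; simpa using hbase
      obtain ⟨v, hv⟩ : ∃ v, v = y / (1 + η) := ⟨_, rfl⟩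
      have hyv : y = v * (1 + η) := by rw [hv]; field_simp
      have hv1 : 1 ≤ v := by rw [hv, le_div_iff₀ (by linarith)]; linarith
      have hvy : v ≤ y := by rw [hyv]; nlinarith
      have hvQ : Real.log v ≤ 2 * Q := (Real.log_le_log (by linarith) hvy).trans hyQ
      have hvm : v < (1 + η) ^ m := by
        rw [hv, div_lt_iff₀ (by linarith), ← pow_succ]; exact hy
      have i1 := ih v hv1 hvQ hvm
      have hstep (c : ZMod q) (hc : IsUnit c) := H w z q c η v 2 h.hw h.hz h.hq hc hη0 hη1 hv1 le_rfl
        (hηd ▸ h.q_le)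
      have s1 := hstep b hb
      have s2 := hstep b' hb'
      have herr : C * (η * v / (q.totient * Real.log z)) * (Real.log z ^ 2 *
          Real.exp (-(Real.log v / (8 * Real.log z))) + η * (Real.log v + 1)) ≤
          2 * C * (η * v * Real.log z / q.totient) := by
        have hlv := Real.log_nonneg hv1
        have e1 : Real.exp (-(Real.log v / (8 * Real.log z))) ≤ 1 :=
          Real.exp_le_one_iff.2 (neg_nonpos.2 (by positivity))
        have e2 : η * (Real.log v + 1) ≤ 1 := by
          have := h.hQ
          nlinarith
        have e3 : Real.log z ^ 2 * Real.exp (-(Real.log v / (8 * Real.log z))) +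
            η * (Real.log v + 1) ≤ 2 * Real.log z ^ 2 := by nlinarith [sq_nonneg (Real.log z)]
        calc _ ≤ C * (η * v / (q.totient * Real.log z)) * (2 * Real.log z ^ 2) := by gcongr
          _ = _ := by field_simp
      rw [← hyv] at s1 s2
      rw [logSum_split hv1 hvy, logSum_split hv1 hvy]
      rw [abs_le] at *
      have : 4 * C * (y * Real.log z / q.totient) = 4 * C * (v * Real.log z / q.totient) +
          2 * (2 * C * (η * v * Real.log z / q.totient)) := by rw [hyv]; ring
      constructor <;> linarith [s1.1, s1.2, s2.1, s2.2, i1.1, i1.2]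
  intro hy1 hyQ
  obtain ⟨m, hm⟩ := pow_unbounded_of_one_lt y (show 1 < 1 + η by linarith)
  exact main m y hy1 hyQ hm

/-- Coefficients `g` restricted to rough integers in a residue class. -/
noncomputable def cco (z : ℕ) {q : ℕ} (b : ZMod q) (g : ℕ → ℝ) (n : ℕ) : ℂ :=
  open Classical in if (n : ZMod q) = b ∧ Rough z n then (g n : ℂ) else 0

lemma trapSum_add (f g : ℕ → ℂ) (x δ : ℝ) :
    trapSum (fun n => f n + g n) x δ = trapSum f x δ + trapSum g x δ := by
  simp only [trapSum, add_mul, sum_add_distrib]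

lemma trapSum_const_mul (c : ℂ) (f : ℕ → ℂ) (x δ : ℝ) :
    trapSum (fun n => c * f n) x δ = c * trapSum f x δ := by
  simp only [trapSum, mul_sum, mul_assoc]

lemma trapSum_sum {ι : Type*} (s : Finset ι) (f : ι → ℕ → ℂ) (x δ : ℝ) :
    trapSum (fun n => ∑ i ∈ s, f i n) x δ = ∑ i ∈ s, trapSum (f i) x δ := by
  simp only [trapSum, sum_mul]
  rw [sum_comm]

lemma sum_char_mul_liftChar {q : ℕ} [NeZero q] (z : ℕ) {a : ZMod q} (ha : IsUnit a) (g : ℕ → ℝ)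
    (n : ℕ) : ∑ χ : DirichletCharacter ℂ q, χ a⁻¹ * (liftChar z χ n * (g n : ℂ)) =
      (q.totient : ℂ) * cco z a g n := by
  classical
  simp only [← mul_assoc, ← sum_mul]
  rw [cco]
  by_cases hr : Rough z n
  · simp only [liftChar_apply, hr, if_true, and_true]
    rw [DirichletCharacter.sum_char_inv_mul_char_eq ℂ ha]
    simp only [@eq_comm _ a]
    split_ifs <;> simp
  · simp [liftChar_apply, hr]

lemma liftChar_mul_eq_sum {q : ℕ} [NeZero q] (z : ℕ) (χ : DirichletCharacter ℂ q) (g : ℕ → ℝ)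
    (n : ℕ) : liftChar z χ n * (g n : ℂ) = ∑ b : ZMod q, χ b * cco z b g n := by
  classical
  rw [sum_eq_single (n : ZMod q)]
  · rw [liftChar_apply, cco]
    by_cases hr : Rough z n <;> simp [hr]
  · intro b _ hb
    rw [cco, if_neg (fun h => hb h.1.symm), mul_zero]
  · simp

lemma sum_cco {q : ℕ} (z : ℕ) (b : ZMod q) {y : ℝ} :
    ∑ n ∈ Icc 1 ⌊y⌋₊, cco z b (fun n => Real.log n ^ 2) n = (logSum 2 q z b 1 y : ℂ) := by
  classical
  rw [logSum, Complex.ofReal_sum]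
  have hs : roughSet q z b 1 y ⊆ Icc 1 ⌊y⌋₊ := by
    intro n hn
    have := mem_Ioc.1 (mem_roughSet.1 hn).1
    rw [Nat.floor_one] at this
    exact mem_Icc.2 ⟨by omega, this.2⟩
  rw [← sum_subset hs]
  · refine sum_congr rfl fun n hn => ?_
    rw [cco, if_pos (mem_roughSet.1 hn).2]
  · intro n hn hn'
    rw [cco]
    split_ifs with h
    · have hn1 : n = 1 := by
        by_contra hc
        refine hn' (mem_roughSet.2 ⟨mem_Ioc.2 ?_, h⟩)
        have := mem_Icc.1 hn
        rw [Nat.floor_one]; omega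
      simp [hn1]
    · rfl

lemma norm_trapSum_cco_sub_le : ∃ C : ℝ, 0 < C ∧ ∀ (w z q : ℕ) (Q x : ℝ) (b b' : ZMod q),
    Lvl q w z Q → 2 ≤ Real.log x → Real.log x ≤ Q → 3 ≤ x → IsUnit b → IsUnit b' →
    ‖trapSum (cco z b fun n => Real.log n ^ 2) x (1 / Real.log x) -
      trapSum (cco z b' fun n => Real.log n ^ 2) x (1 / Real.log x)‖ ≤
      C * (x * Real.log z / q.totient) := by
  obtain ⟨C, hC, H⟩ := abs_logSum_two_sub_le
  refine ⟨2 * C, by positivity, fun w z q Q x b b' h hx1 hx2 hx3 hb hb' => ?_⟩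
  have hφ := totient_pos_real h.hq
  have hL := h.one_le_log
  have hδ0 : 0 < 1 / Real.log x := by positivity
  have hδ1 : 1 / Real.log x ≤ 1 := by rw [div_le_one (by linarith)]; linarith
  have e : trapSum (cco z b fun n => Real.log n ^ 2) x (1 / Real.log x) -
      trapSum (cco z b' fun n => Real.log n ^ 2) x (1 / Real.log x) =
      trapSum (fun n => cco z b (fun n => Real.log n ^ 2) n -
        cco z b' (fun n => Real.log n ^ 2) n) x (1 / Real.log x) := by
    simp only [trapSum, sub_mul, sum_sub_distrib]
  rw [e]
  refine norm_trapSum_le (by linarith) hδ0 fun y hy1 hy2 => ?_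
  rw [sum_sub_distrib, sum_cco, sum_cco, ← Complex.ofReal_sub, Complex.norm_real, norm_eq_abs]
  have hy3 : y ≤ 2 * x := by nlinarith
  have hy4 : Real.log y ≤ 2 * Q := by
    calc Real.log y ≤ Real.log (2 * x) := Real.log_le_log (by linarith) hy3
      _ = Real.log 2 + Real.log x := Real.log_mul (by norm_num) (by linarith)
      _ ≤ 2 * Q := by linarith [Real.log_two_lt_d9]
  refine (H w z q Q b b' y h hb hb' (by linarith) hy4).trans ?_
  calc C * (y * Real.log z / q.totient) ≤ C * ((2 * x) * Real.log z / q.totient) := by gcongr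
    _ = _ := by ring

lemma vco_one_eq (z : ℕ) {q : ℕ} (χ : DirichletCharacter ℂ q) (n : ℕ) :
    vco z 1 χ n = hco z χ n + dco z 2 χ n := by
  rw [vco, hco, dco, ← mul_add]; push_cast; ring

lemma sum_erase_erase {α : Type*} [Fintype α] [DecidableEq α] (f : α → ℂ) (a b : α) :
    ∑ i ∈ (univ.erase a).erase b, f i = ∑ i, f i - f a - if b = a then 0 else f b := by
  rw [← add_sum_erase univ f (mem_univ a)]
  split_ifs with h
  · rw [h, erase_eq_of_notMem (notMem_erase a univ)]; ring
  · rw [← add_sum_erase (univ.erase a) f (mem_erase.2 ⟨h, mem_univ b⟩)]; ring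

lemma char_inv_eq_self {q : ℕ} {ψ : DirichletCharacter ℂ q} (h : ψ ^ 2 = 1) {a : ZMod q}
    (ha : IsUnit a) : ψ a⁻¹ = ψ a := by
  have h1 : ψ a⁻¹ * ψ a = 1 := by
    rw [← map_mul, ZMod.inv_mul_of_unit a ha, map_one]
  have h2 : ψ a * ψ a = 1 := by
    rw [← MulChar.mul_apply, ← pow_two, h, MulChar.one_apply ha]
  have h3 : ψ a ≠ 0 := fun hc => by rw [hc, mul_zero] at h2; exact zero_ne_one h2
  exact mul_right_cancel₀ h3 (h1.trans h2.symm)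

lemma trapSum_congr {f g : ℕ → ℂ} (h : ∀ n, f n = g n) (x δ : ℝ) :
    trapSum f x δ = trapSum g x δ := by rw [funext h]

/-- Dichotomy for `Λ(n) log n` with trapezoidal weight. -/
theorem norm_trapSum_class_sub_le : ∃ C : ℝ, 0 < C ∧ ∀ (w z q : ℕ) (Q x : ℝ) [NeZero q],
    Lvl q w z Q → 2 ≤ Real.log x → Real.log x ≤ Q → 3 ≤ x →
    ∃ ψ : DirichletCharacter ℂ q, ψ ^ 2 = 1 ∧
      (∀ a : ZMod q, IsUnit a →
        ‖(q.totient : ℂ) * trapSum (cco z a fun n => ArithmeticFunction.vonMangoldt n * Real.log n)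
            x (1 / Real.log x) - trapSum (vco z 1 (1 : DirichletCharacter ℂ q)) x (1 / Real.log x) -
          (open Classical in if ψ = 1 then 0 else
            ψ a * trapSum (vco z 1 ψ) x (1 / Real.log x))‖ ≤ C * (x * Real.log z)) ∧
      (ψ ≠ 1 → ‖trapSum (vco z 1 ψ) x (1 / Real.log x)‖ ≤
        C * (x * Real.log z) * (1 + 1 / ‖dser z 0 ψ (1 + 1 / Real.log x : ℝ)‖)) := by
  classical
  obtain ⟨A, hA, H⟩ := sum_norm_trapSum_hco_le
  obtain ⟨B, hB, HB⟩ := norm_trapSum_cco_sub_le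
  refine ⟨A + 4 * B, by positivity, fun w z q Q x _ h hx1 hx2 hx3 => ?_⟩
  obtain ⟨ψ, hψ, H1, H2⟩ := H w z q Q x h hx1 hx2 hx3
  have hB' (b b' : ZMod q) (hb : IsUnit b) (hb' : IsUnit b') := HB w z q Q x b b' h hx1 hx2 hx3 hb hb'
  generalize 1 / Real.log x = δ at *
  have hφ := totient_pos_real h.hq
  have hL := h.one_le_log
  have hX : 0 ≤ x * Real.log z := by positivity
  obtain ⟨D, hD⟩ : ∃ D : ZMod q → ℂ, D = fun b => trapSum (cco z b fun n => Real.log n ^ 2) x δ :=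
    ⟨_, rfl⟩
  have hcl (b b' : ZMod q) (hb : IsUnit b) (hb' : IsUnit b') :
      ‖D b - D b'‖ ≤ B * (x * Real.log z / q.totient) := by rw [hD]; exact hB' b b' hb hb'
  have hdco (χ : DirichletCharacter ℂ q) : trapSum (dco z 2 χ) x δ = ∑ b, χ b * D b := by
    rw [hD]
    simp only [← trapSum_const_mul]
    rw [← trapSum_sum]
    exact trapSum_congr (fun n => by rw [dco, liftChar_mul_eq_sum z χ fun n => Real.log n ^ 2]) x δ
  have hsum1 (b' : ZMod q) (hb' : IsUnit b') (χ : DirichletCharacter ℂ q) :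
      ‖∑ b, χ b * (D b - D b')‖ ≤ B * (x * Real.log z) := by
    have : ∀ b : ZMod q, ‖χ b * (D b - D b')‖ ≤
        (if IsUnit b then 1 else 0 : ℝ) * (B * (x * Real.log z / q.totient)) := by
      intro b
      split_ifs with hb
      · rw [norm_mul]
        exact mul_le_mul (DirichletCharacter.norm_le_one _ _) (hcl b b' hb hb') (norm_nonneg _)
          zero_le_one
      · rw [MulChar.map_nonunit _ hb]; simp
    refine (norm_sum_le _ _).trans ((sum_le_sum fun b _ => this b).trans (le_of_eq ?_))
    have hc : ∑ b : ZMod q, (if IsUnit b then 1 else 0 : ℝ) = q.totient := by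
      have := sum_dirichletCharacter (1 : DirichletCharacter ℂ q)
      rw [if_pos rfl] at this
      have e : ((∑ b : ZMod q, (if IsUnit b then 1 else 0 : ℝ) : ℝ) : ℂ) = q.totient := by
        rw [← this, Complex.ofReal_sum]
        refine sum_congr rfl fun b _ => ?_
        split_ifs with hb
        · rw [MulChar.one_apply hb]; simp
        · rw [MulChar.map_nonunit _ hb]; simp
      exact_mod_cast e
    rw [← sum_mul, hc]
    field_simp
  have hdne (χ : DirichletCharacter ℂ q) (hχ : χ ≠ 1) :
      ‖trapSum (dco z 2 χ) x δ‖ ≤ B * (x * Real.log z) := by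
    have := hsum1 1 isUnit_one χ
    simp only [mul_sub, sum_sub_distrib, ← sum_mul] at this
    rwa [sum_dirichletCharacter, if_neg hχ, zero_mul, sub_zero, ← hdco] at this
  have hd1 (a : ZMod q) (ha : IsUnit a) :
      ‖(q.totient : ℂ) * D a - trapSum (dco z 2 (1 : DirichletCharacter ℂ q)) x δ‖ ≤
        B * (x * Real.log z) := by
    have := hsum1 a ha 1
    simp only [mul_sub, sum_sub_distrib, ← sum_mul] at this
    rw [sum_dirichletCharacter, if_pos rfl, ← hdco, norm_sub_rev] at this
    exact this
  have hvco (χ : DirichletCharacter ℂ q) :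
      trapSum (vco z 1 χ) x δ = trapSum (hco z χ) x δ + trapSum (dco z 2 χ) x δ := by
    rw [trapSum_congr (vco_one_eq z χ), trapSum_add]
  refine ⟨ψ, hψ, fun a ha => ?_, fun hne => ?_⟩
  · have orth (g : ℕ → ℝ) (f : DirichletCharacter ℂ q → ℕ → ℂ)
        (hf : ∀ χ n, f χ n = liftChar z χ n * (g n : ℂ)) :
        ∑ χ : DirichletCharacter ℂ q, χ a⁻¹ * trapSum (f χ) x δ =
          q.totient * trapSum (cco z a g) x δ := by
      simp only [← trapSum_const_mul]
      rw [← trapSum_sum]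
      exact trapSum_congr (fun n => by simp only [hf]; exact sum_char_mul_liftChar z ha g n) x δ
    have o1 := orth (fun n => ArithmeticFunction.vonMangoldt n * Real.log n) (fun χ => vco z 1 χ)
      (fun χ n => by rw [vco, pow_one])
    have o2 := orth (fun n => Real.log n ^ 2) (fun χ => dco z 2 χ) (fun χ n => rfl)
    have ea1 : (1 : DirichletCharacter ℂ q) a⁻¹ = 1 := by
      rw [char_inv_eq_self (by simp) ha, MulChar.one_apply ha]
    have key : (q.totient : ℂ) * trapSum (cco z a fun n => ArithmeticFunction.vonMangoldt n * Real.log n)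
            x δ - trapSum (vco z 1 (1 : DirichletCharacter ℂ q)) x δ -
          (if ψ = 1 then 0 else ψ a * trapSum (vco z 1 ψ) x δ) =
        ∑ χ ∈ (univ.erase (1 : DirichletCharacter ℂ q)).erase ψ, χ a⁻¹ * trapSum (hco z χ) x δ +
        ((q.totient : ℂ) * D a - trapSum (dco z 2 (1 : DirichletCharacter ℂ q)) x δ -
          (if ψ = 1 then 0 else ψ a * trapSum (dco z 2 ψ) x δ)) := by
      have s1 := sum_erase_erase (fun χ : DirichletCharacter ℂ q => χ a⁻¹ * trapSum (vco z 1 χ) x δ) 1 ψ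
      have s2 := sum_erase_erase (fun χ : DirichletCharacter ℂ q => χ a⁻¹ * trapSum (dco z 2 χ) x δ) 1 ψ
      have e1 : D a = trapSum (cco z a fun n => Real.log n ^ 2) x δ := by rw [hD]
      simp only [o1, o2, ea1, one_mul, char_inv_eq_self hψ ha] at s1 s2
      rw [← s1, e1, ← s2, ← sum_add_distrib]
      exact sum_congr rfl fun χ _ => by rw [hvco]; ring
    rw [key]
    have n1 : ‖∑ χ ∈ (univ.erase (1 : DirichletCharacter ℂ q)).erase ψ,
        χ a⁻¹ * trapSum (hco z χ) x δ‖ ≤ A * x * Real.log z := by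
      refine (norm_sum_le _ _).trans ((sum_le_sum fun χ _ => ?_).trans H1)
      rw [norm_mul]
      exact mul_le_of_le_one_left (norm_nonneg _) (DirichletCharacter.norm_le_one _ _)
    have n2 : ‖(if ψ = 1 then 0 else ψ a * trapSum (dco z 2 ψ) x δ)‖ ≤ B * (x * Real.log z) := by
      split_ifs with hc
      · rw [norm_zero]; positivity
      · rw [norm_mul]
        exact (mul_le_of_le_one_left (norm_nonneg _) (DirichletCharacter.norm_le_one _ _)).trans
          (hdne ψ hc)
    have n3 := hd1 a ha
    have t1 := norm_add_le (∑ χ ∈ (univ.erase (1 : DirichletCharacter ℂ q)).erase ψ,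
        χ a⁻¹ * trapSum (hco z χ) x δ)
      ((q.totient : ℂ) * D a - trapSum (dco z 2 (1 : DirichletCharacter ℂ q)) x δ -
          (if ψ = 1 then 0 else ψ a * trapSum (dco z 2 ψ) x δ))
    have t2 := norm_sub_le ((q.totient : ℂ) * D a -
      trapSum (dco z 2 (1 : DirichletCharacter ℂ q)) x δ)
      (if ψ = 1 then 0 else ψ a * trapSum (dco z 2 ψ) x δ)
    have : 0 ≤ B * (x * Real.log z) := by positivity
    linarith
  · rw [hvco]
    have h1 := H2 hne
    have h2 := hdne ψ hne
    have h3 : 0 ≤ 1 / ‖dser z 0 ψ ((1 + δ : ℝ) : ℂ)‖ := by positivity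
    refine (norm_add_le _ _).trans ((add_le_add h1 h2).trans ?_)
    have h4 : 0 ≤ B * (x * Real.log z) := by positivity
    have h5 := mul_nonneg h4 h3
    linarith

end ExcChar

namespace ExcChar

open Finset Real MeasureTheory
open ArithmeticFunction (vonMangoldt vonMangoldt_nonneg vonMangoldt_le_log)

/-- Prime powers of small primes contribute little to Chebyshev sums. -/
lemma sum_vonMangoldt_not_rough_le (w N : ℕ) :
    ∑ n ∈ Icc 1 N, (open Classical in if Rough w n then 0 else vonMangoldt n) ≤ w * Real.log N := by
  classical
  rcases Nat.eq_zero_or_pos N with rfl | hN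
  · simp
  have hlN := Real.log_natCast_nonneg N
  have h1 : ∀ n ∈ Icc 1 N, (if Rough w n then 0 else vonMangoldt n) ≤
      ∑ p ∈ (Icc 1 w).filter Nat.Prime, ∑ k ∈ Icc 1 (Nat.log p N),
        if n = p ^ k then Real.log p else 0 := by
    intro n hn
    have hnn : ∀ p ∈ (Icc 1 w).filter Nat.Prime, 0 ≤ ∑ k ∈ Icc 1 (Nat.log p N),
        if n = p ^ k then Real.log p else 0 := fun p _ => sum_nonneg fun k _ => by
      split_ifs
      · exact Real.log_natCast_nonneg p
      · exact le_rfl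
    split_ifs with hr
    · exact sum_nonneg hnn
    by_cases hpp : IsPrimePow n
    · obtain ⟨p, k, hp, hk, rfl⟩ := (isPrimePow_nat_iff n).1 hpp
      have hpw : p ≤ w := by
        by_contra hc
        refine hr fun l hl hlw hd => ?_
        have := (Nat.prime_dvd_prime_iff_eq hl hp).1 (hl.dvd_of_dvd_pow hd)
        omega
      have hm : p ∈ (Icc 1 w).filter Nat.Prime := mem_filter.2 ⟨mem_Icc.2 ⟨hp.one_le, hpw⟩, hp⟩
      refine le_trans ?_ (single_le_sum hnn hm)
      have hkl : k ∈ Icc 1 (Nat.log p N) := by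
        have : k ≤ Nat.log p N := Nat.le_log_of_pow_le hp.one_lt (mem_Icc.1 hn).2
        exact mem_Icc.2 ⟨hk, this⟩
      refine le_trans ?_ (single_le_sum (fun j _ => ?_) hkl)
      · rw [if_pos rfl, ArithmeticFunction.vonMangoldt_apply_pow hk.ne',
          ArithmeticFunction.vonMangoldt_apply_prime hp]
      · split_ifs
        · exact Real.log_natCast_nonneg p
        · exact le_rfl
    · rw [ArithmeticFunction.vonMangoldt_eq_zero_iff.2 hpp]
      exact sum_nonneg hnn
  refine (sum_le_sum h1).trans ?_
  rw [sum_comm]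
  have h2 : ∀ p ∈ (Icc 1 w).filter Nat.Prime, ∑ n ∈ Icc 1 N, ∑ k ∈ Icc 1 (Nat.log p N),
      (if n = p ^ k then Real.log p else 0) ≤ Real.log N := by
    intro p hp
    have hp' := (mem_filter.1 hp).2
    rw [sum_comm]
    calc _ ≤ ∑ k ∈ Icc 1 (Nat.log p N), Real.log p := by
          refine sum_le_sum fun k _ => ?_
          rw [sum_ite_eq']
          split_ifs
          · exact le_rfl
          · exact Real.log_natCast_nonneg p
      _ = Real.log ((p ^ Nat.log p N : ℕ) : ℝ) := by
          rw [sum_const, nsmul_eq_mul, Nat.card_Icc, Nat.cast_pow, Real.log_pow]; simp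
      _ ≤ Real.log N := by
          refine Real.log_le_log (by exact_mod_cast pow_pos hp'.pos _) ?_
          exact_mod_cast Nat.pow_log_le_self p hN.ne'
  refine (sum_le_sum h2).trans ?_
  rw [sum_const, nsmul_eq_mul]
  gcongr
  exact (card_filter_le _ _).trans (by simp)

/-- Chebyshev sums over a residue class. -/
noncomputable def psiCls {q : ℕ} (a : ZMod q) (Y X : ℝ) : ℝ :=
  ∑ n ∈ Ioc ⌊Y⌋₊ ⌊X⌋₊, if (n : ZMod q) = a then vonMangoldt n else 0

lemma psiCls_mono {q : ℕ} (a : ZMod q) (Y : ℝ) {X X' : ℝ} (h : X ≤ X') :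
    psiCls a Y X ≤ psiCls a Y X' := by
  refine sum_le_sum_of_subset_of_nonneg (Ioc_subset_Ioc_right (Nat.floor_mono h)) fun n _ _ => ?_
  split_ifs
  · exact vonMangoldt_nonneg
  · exact le_rfl

lemma exists_dpow_le {r : ℝ} (hr : 2 ≤ r) : ∃ w : ℕ, Dpow w ∧ (w : ℝ) ≤ r ∧ r < (w : ℝ) ^ 2 := by
  have h : ∃ J : ℕ, r < ((2 ^ 2 ^ J : ℕ) : ℝ) := by
    obtain ⟨n, hn⟩ := exists_nat_gt r
    refine ⟨n, hn.trans ?_⟩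
    exact_mod_cast (Nat.lt_two_pow_self (n := n)).trans (Nat.lt_two_pow_self (n := 2 ^ n))
  classical
  obtain ⟨m, hm⟩ : ∃ m, m = Nat.find h := ⟨_, rfl⟩
  have h1 := Nat.find_spec h
  rw [← hm] at h1
  cases m with
  | zero => norm_num at h1; linarith
  | succ m =>
    refine ⟨2 ^ 2 ^ m, ⟨m, rfl⟩, ?_, ?_⟩
    · exact not_lt.1 (Nat.find_min h (by omega : m < Nat.find h))
    · rw [pow_succ 2 m, pow_mul] at h1
      exact_mod_cast h1

/-- The Brun-Titchmarsh inequality for the von Mangoldt function. -/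
theorem psiCls_le : ∃ C : ℝ, 0 < C ∧ ∀ (q : ℕ) (a : ZMod q) (r Y h : ℝ), 1 ≤ q → IsUnit a →
    2 ≤ r → (q : ℝ) ≤ r ^ 2 → r ^ 15 ≤ h → 0 ≤ Y → Y + h ≤ 2 * r ^ 20 →
    psiCls a Y (Y + h) ≤ C * (h / q.totient) := by
  classical
  obtain ⟨C, hC, H⟩ := brun_titchmarsh
  refine ⟨42 * C + 21, by positivity, fun q a r Y h hq ha hr hqr hh hY hYh => ?_⟩
  have hφ := totient_pos_real hq
  have hq0 : (0 : ℝ) < q := by exact_mod_cast hq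
  have hφq := totient_le_real q
  have hr0 : 0 < r := by linarith
  have hh0 : 0 < h := lt_of_lt_of_le (by positivity) hh
  obtain ⟨w, hw, hwr, hrw⟩ := exists_dpow_le hr
  have hw2 : (2 : ℝ) ≤ w := by exact_mod_cast hw.two_le
  have hlw : Real.log r ≤ 2 * Real.log w := by
    calc Real.log r ≤ Real.log ((w : ℝ) ^ 2) := Real.log_le_log hr0 hrw.le
      _ = _ := by rw [Real.log_pow]; norm_num
  have hlr : 0 < Real.log r := Real.log_pos (by linarith)
  have hlw0 : 0 < Real.log w := Real.log_pos (by linarith)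
  have hl2 : Real.log 2 ≤ Real.log r := Real.log_le_log (by norm_num) hr
  have hlN : Real.log (2 * r ^ 20) ≤ 21 * Real.log r := by
    rw [Real.log_mul (by norm_num) (by positivity), Real.log_pow]; push_cast; linarith
  have hhq : r ^ 10 ≤ h / q := by
    rw [le_div_iff₀ hq0]
    calc r ^ 10 * q ≤ r ^ 10 * r ^ 2 := by gcongr
      _ ≤ r ^ 10 * r ^ 5 := by gcongr <;> linarith
      _ = r ^ 15 := by ring
      _ ≤ h := hh
  have bt := H w q a Y h hw hq ha hY hh0 ((pow_le_pow_left₀ (by linarith) hwr 10).trans hhq)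
  have hN : ⌊Y + h⌋₊ ≤ 2 * r ^ 20 := (Nat.floor_le (by linarith)).trans hYh
  have hNl : Real.log (⌊Y + h⌋₊ : ℝ) ≤ 21 * Real.log r := by
    rcases Nat.eq_zero_or_pos ⌊Y + h⌋₊ with h0 | h0
    · rw [h0]; simp; linarith
    · exact (Real.log_le_log (by exact_mod_cast h0) hN).trans hlN
  have hsplit : psiCls a Y (Y + h) ≤ ∑ n ∈ roughSet q w a Y (Y + h), vonMangoldt n +
      ∑ n ∈ Icc 1 ⌊Y + h⌋₊, (if Rough w n then 0 else vonMangoldt n) := by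
    have e1 : ∑ n ∈ roughSet q w a Y (Y + h), vonMangoldt n =
        ∑ n ∈ Ioc ⌊Y⌋₊ ⌊Y + h⌋₊, if (n : ZMod q) = a ∧ Rough w n then vonMangoldt n else 0 := by
      rw [← sum_filter]
      refine sum_congr ?_ fun _ _ => rfl
      ext n; rw [mem_roughSet, mem_filter]
    have e2 : ∑ n ∈ Ioc ⌊Y⌋₊ ⌊Y + h⌋₊, (if Rough w n then 0 else vonMangoldt n) ≤
        ∑ n ∈ Icc 1 ⌊Y + h⌋₊, (if Rough w n then 0 else vonMangoldt n) := by
      refine sum_le_sum_of_subset_of_nonneg (fun n hn => ?_) fun n _ _ => ?_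
      · rw [mem_Ioc] at hn; exact mem_Icc.2 ⟨by omega, hn.2⟩
      · split_ifs
        · exact le_rfl
        · exact vonMangoldt_nonneg
    rw [e1]
    refine le_trans ?_ (add_le_add_right e2 _)
    rw [psiCls, ← sum_add_distrib]
    refine sum_le_sum fun n _ => ?_
    have := vonMangoldt_nonneg (n := n)
    by_cases c1 : (n : ZMod q) = a <;> by_cases c2 : Rough w n <;> simp [c1, c2, this]
  have t1 : ∑ n ∈ roughSet q w a Y (Y + h), vonMangoldt n ≤ 42 * C * (h / q.totient) := by
    calc _ ≤ ∑ n ∈ roughSet q w a Y (Y + h), 21 * Real.log r := by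
          refine sum_le_sum fun n hn => vonMangoldt_le_log.trans (le_trans ?_ hNl)
          have := mem_Ioc.1 (mem_roughSet.1 hn).1
          exact Real.log_le_log (by exact_mod_cast (by omega : 0 < n)) (by exact_mod_cast this.2)
      _ = (roughSet q w a Y (Y + h)).card * (21 * Real.log r) := by rw [sum_const, nsmul_eq_mul]
      _ ≤ (C * (h / (q.totient * Real.log w))) * (21 * (2 * Real.log w)) := by gcongr
      _ = _ := by field_simp; ring
  have t2 : ∑ n ∈ Icc 1 ⌊Y + h⌋₊, (if Rough w n then 0 else vonMangoldt n) ≤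
      21 * (h / q.totient) := by
    calc _ ≤ w * Real.log (⌊Y + h⌋₊ : ℝ) := sum_vonMangoldt_not_rough_le w _
      _ ≤ r * (21 * r) := by
          refine mul_le_mul hwr (hNl.trans ?_) (Real.log_natCast_nonneg _) hr0.le
          gcongr
          linarith [Real.log_le_sub_one_of_pos hr0]
      _ = 21 * r ^ 2 := by ring
      _ ≤ 21 * r ^ 10 := by gcongr <;> linarith
      _ ≤ 21 * (h / q) := by gcongr
      _ ≤ 21 * (h / q.totient) := by gcongr
  linarith

lemma sum_exp_neg_le (J : ℕ) : ∑ j ∈ range J, Real.exp (-(j : ℝ)) ≤ 2 := by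
  have h1 : ∀ j ∈ range J, Real.exp (-(j : ℝ)) ≤ (1 / 2 : ℝ) ^ j := by
    intro j _
    have : -(j : ℝ) = j * (-1) := by ring
    rw [this, Real.exp_nat_mul]
    refine pow_le_pow_left₀ (Real.exp_pos _).le ?_ j
    rw [Real.exp_neg, one_div]
    exact inv_anti₀ (by norm_num) (by linarith [Real.exp_one_gt_d9])
  exact (sum_le_sum h1).trans (sum_geometric_two_le J)

lemma le_card_filter_le {t : ℝ} (J : ℕ) (ht0 : 0 ≤ t) (htJ : t < J) :
    t ≤ ∑ j ∈ range J, if (j : ℝ) ≤ t then (1 : ℝ) else 0 := by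
  classical
  rw [sum_boole]
  have : range (⌊t⌋₊ + 1) ⊆ (range J).filter fun j : ℕ => (j : ℝ) ≤ t := by
    intro j hj
    rw [mem_range] at hj
    have h1 : (j : ℝ) ≤ t := (Nat.le_floor_iff ht0).1 (by omega)
    refine mem_filter.2 ⟨mem_range.2 ?_, h1⟩
    exact_mod_cast h1.trans_lt htJ
  have h2 := card_le_card this
  rw [card_range] at h2
  have h3 : ((⌊t⌋₊ + 1 : ℕ) : ℝ) ≤ _ := Nat.cast_le.2 h2
  push_cast at h3
  linarith [Nat.lt_floor_add_one t]

/-- Logarithmically weighted Chebyshev sums over a residue class. -/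
lemma sum_vonMangoldt_mul_log_le : ∃ C : ℝ, 0 < C ∧ ∀ (q : ℕ) (a : ZMod q) (r : ℝ), 1 ≤ q →
    IsUnit a → 2 ≤ r → (q : ℝ) ≤ r ^ 2 →
    ∑ n ∈ Ioc 0 ⌊r ^ 20⌋₊, (if (n : ZMod q) = a then
      vonMangoldt n * (Real.log (r ^ 20) - Real.log n) else 0) ≤ C * (r ^ 20 / q.totient) := by
  classical
  obtain ⟨C, hC, H⟩ := psiCls_le
  refine ⟨24 * C, by positivity, fun q a r hq ha hr hqr => ?_⟩
  have hφ := totient_pos_real hq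
  have hr0 : 0 < r := by linarith
  have hlr : 0 < Real.log r := Real.log_pos (by linarith)
  obtain ⟨x, hx⟩ : ∃ x, x = r ^ 20 := ⟨_, rfl⟩
  have hx1 : 1 < x := by rw [hx]; exact one_lt_pow₀ (by linarith) (by norm_num)
  have hlx : Real.log x = 20 * Real.log r := by rw [hx, Real.log_pow]; norm_num
  rw [← hx]
  obtain ⟨J, hJ⟩ : ∃ J, J = ⌊Real.log x⌋₊ + 1 := ⟨_, rfl⟩
  have hJ1 : Real.log x < J := by rw [hJ]; push_cast; exact Nat.lt_floor_add_one _
  have hJ2 : (J : ℝ) ≤ 20 * r := by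
    rw [hJ]; push_cast
    have := Nat.floor_le (show 0 ≤ Real.log x by linarith)
    linarith [Real.log_le_sub_one_of_pos hr0]
  have h15 : r ^ 15 ≤ x := by rw [hx]; exact pow_le_pow_right₀ (by linarith) (by norm_num)
  have hj (j : ℕ) : psiCls a 0 (x * Real.exp (-j)) ≤ C * ((x * Real.exp (-j) + r ^ 15) / q.totient) := by
    have hp := Real.exp_pos (-(j : ℝ))
    have he : Real.exp (-(j : ℝ)) ≤ 1 := Real.exp_le_one_iff.2 (by simp)
    have h1 := H q a r 0 (max (x * Real.exp (-j)) (r ^ 15)) hq ha hr hqr (le_max_right _ _) le_rfl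
      (by rw [zero_add, ← hx]; exact max_le (by nlinarith) (by linarith))
    rw [zero_add] at h1
    refine (psiCls_mono a 0 (le_max_left _ _)).trans (h1.trans ?_)
    gcongr
    refine max_le ?_ ?_
    · have : 0 ≤ r ^ 15 := by positivity
      linarith
    · have : 0 ≤ x * Real.exp (-j) := by positivity
      linarith
  have step : ∑ n ∈ Ioc 0 ⌊x⌋₊, (if (n : ZMod q) = a then
      vonMangoldt n * (Real.log x - Real.log n) else 0) ≤
      ∑ j ∈ range J, psiCls a 0 (x * Real.exp (-j)) := by
    have e : ∀ j ∈ range J, psiCls a 0 (x * Real.exp (-j)) = ∑ n ∈ Ioc 0 ⌊x⌋₊,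
        (if (n : ZMod q) = a then vonMangoldt n else 0) *
          (if (j : ℝ) ≤ Real.log x - Real.log n then 1 else 0) := by
      intro j _
      have hle : x * Real.exp (-(j : ℝ)) ≤ x := mul_le_of_le_one_right (by linarith)
        (Real.exp_le_one_iff.2 (by simp))
      rw [psiCls, Nat.floor_zero]
      rw [← sum_subset (Ioc_subset_Ioc_right (Nat.floor_mono hle))]
      · refine sum_congr rfl fun n hn => ?_
        have hn1 : (0 : ℝ) < n := by exact_mod_cast (mem_Ioc.1 hn).1
        have hn2 : (n : ℝ) ≤ x * Real.exp (-j) := (Nat.le_floor_iff (by positivity)).1 (mem_Ioc.1 hn).2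
        have hn3 := Real.log_le_log hn1 hn2
        rw [Real.log_mul (by linarith) (Real.exp_pos _).ne', Real.log_exp] at hn3
        rw [if_pos (show (j : ℝ) ≤ Real.log x - Real.log n by linarith), mul_one]
      · intro n hn hn'
        have hn1 : (0 : ℝ) < n := by exact_mod_cast (mem_Ioc.1 hn).1
        rw [if_neg (c := (j : ℝ) ≤ Real.log x - Real.log n), mul_zero]
        intro hc
        refine hn' (mem_Ioc.2 ⟨(mem_Ioc.1 hn).1, Nat.le_floor ?_⟩)
        rw [← Real.log_le_log_iff hn1 (by positivity), Real.log_mul (by linarith)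
          (Real.exp_pos _).ne', Real.log_exp]
        linarith
    rw [sum_congr rfl e, sum_comm]
    refine sum_le_sum fun n hn => ?_
    have hn1 : (1 : ℝ) ≤ n := by exact_mod_cast (mem_Ioc.1 hn).1
    have hn2 : (n : ℝ) ≤ x := (Nat.le_floor_iff (by linarith)).1 (mem_Ioc.1 hn).2
    rw [← mul_sum]
    split_ifs with hc
    · refine mul_le_mul_of_nonneg_left (le_card_filter_le J ?_ ?_) vonMangoldt_nonneg
      · linarith [Real.log_le_log (by linarith) hn2]
      · linarith [Real.log_nonneg hn1]
    · rw [zero_mul]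
  refine step.trans ((sum_le_sum fun j _ => hj j).trans ?_)
  rw [← mul_sum, ← sum_div, sum_add_distrib, ← mul_sum, sum_const, card_range, nsmul_eq_mul]
  have s1 := sum_exp_neg_le J
  have s2 : (J : ℝ) * r ^ 15 ≤ 20 * x := by
    calc (J : ℝ) * r ^ 15 ≤ 20 * r * r ^ 15 := by gcongr
      _ = 20 * r ^ 16 := by ring
      _ ≤ 20 * r ^ 20 := by gcongr <;> linarith
      _ = 20 * x := by rw [hx]
  calc C * ((x * ∑ j ∈ range J, Real.exp (-(j : ℝ)) + J * r ^ 15) / q.totient) ≤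
      C * ((x * 2 + 20 * x) / q.totient) := by gcongr
    _ ≤ C * (24 * x / q.totient) := by gcongr; linarith
    _ = _ := by ring

/-- Removal of the weights `log n` and `trap` in a residue class. -/
lemma norm_trapSum_cco_sub_psiCls_le : ∃ C : ℝ, 0 < C ∧ ∀ (q z : ℕ) (a : ZMod q) (r x : ℝ), 1 ≤ q →
    IsUnit a → 3 ≤ r → (q : ℝ) ≤ r ^ 2 → x = r ^ 20 → (z : ℝ) ≤ r ^ 15 →
    ‖trapSum (cco z a fun n => vonMangoldt n * Real.log n) x (1 / Real.log x) -
      ((Real.log x * psiCls a 0 x : ℝ) : ℂ)‖ ≤ C * (x / q.totient) := by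
  classical
  obtain ⟨C₁, hC₁, H₁⟩ := psiCls_le
  obtain ⟨C₂, hC₂, H₂⟩ := sum_vonMangoldt_mul_log_le
  refine ⟨C₂ + 800 + 2 * C₁, by positivity, fun q z a r x hq ha hr hqr hx hz => ?_⟩
  have hφ := totient_pos_real hq
  have hφq := totient_le_real q
  have hr0 : 0 < r := by linarith
  have hlr : 1 < Real.log r := by
    rw [Real.lt_log_iff_exp_lt hr0]; linarith [Real.exp_one_lt_d9]
  have hlrr : Real.log r ≤ r := by linarith [Real.log_le_sub_one_of_pos hr0]
  have hlx : Real.log x = 20 * Real.log r := by rw [hx, Real.log_pow]; norm_num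
  have hx0 : 0 < x := by rw [hx]; positivity
  obtain ⟨δ, hδ⟩ : ∃ δ, δ = 1 / Real.log x := ⟨_, rfl⟩
  have hδ0 : 0 < δ := by rw [hδ]; apply one_div_pos.2; linarith
  have hδ1 : δ ≤ 1 := by rw [hδ, div_le_one (by linarith)]; linarith
  have hδx : δ * Real.log x = 1 := by rw [hδ]; exact one_div_mul_cancel (by linarith)
  rw [← hδ]
  have hX2 : x * (1 + δ) ≤ 2 * x := by nlinarith
  have hxX : x ≤ x * (1 + δ) := by nlinarith
  have hl2 : Real.log (2 * x) ≤ 2 * Real.log x := by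
    rw [Real.log_mul (by norm_num) hx0.ne']
    linarith [Real.log_two_lt_d9]
  obtain ⟨N, hN⟩ : ∃ N, N = ⌊x * (1 + δ)⌋₊ := ⟨_, rfl⟩
  have hNle : (N : ℝ) ≤ 2 * x := by
    rw [hN]; exact (Nat.floor_le (by positivity)).trans hX2
  have hfl : ⌊x⌋₊ ≤ N := by rw [hN]; exact Nat.floor_mono hxX
  have hN1 : 1 ≤ N := by
    refine le_trans (Nat.le_floor ?_) hfl
    rw [hx]; push_cast; exact one_le_pow₀ (by linarith)
  have hlN : Real.log N ≤ 2 * Real.log x :=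
    (Real.log_le_log (by exact_mod_cast hN1) hNle).trans hl2
  have eI : Icc 1 N = Ioc 0 N := by ext n; simp [Nat.succ_le_iff]
  -- the three error sums
  obtain ⟨E₁, hE₁⟩ : ∃ E₁ : ℕ → ℝ, E₁ = fun n : ℕ => if n ≤ ⌊x⌋₊ then (if (n : ZMod q) = a then
      vonMangoldt n * (Real.log x - Real.log n) else 0) else 0 := ⟨_, rfl⟩
  obtain ⟨E₂, hE₂⟩ : ∃ E₂ : ℕ → ℝ, E₂ = fun n : ℕ => Real.log x * (if Rough z n then 0 else vonMangoldt n) :=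
    ⟨_, rfl⟩
  obtain ⟨E₃, hE₃⟩ : ∃ E₃ : ℕ → ℝ, E₃ = fun n : ℕ => if n ≤ ⌊x⌋₊ then 0 else
      (2 * Real.log x) * (if (n : ZMod q) = a then vonMangoldt n else 0) := ⟨_, rfl⟩
  have hsub : Ioc 0 ⌊x⌋₊ ⊆ Ioc 0 N := Ioc_subset_Ioc_right hfl
  have s1 : ∑ n ∈ Ioc 0 N, E₁ n ≤ C₂ * (x / q.totient) := by
    have := H₂ q a r hq ha (by linarith) hqr
    rw [← hx] at this
    refine le_trans (le_of_eq ?_) this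
    rw [← sum_subset hsub]
    · refine sum_congr rfl fun n hn => ?_
      rw [hE₁]; exact if_pos (mem_Ioc.1 hn).2
    · intro n hn hn'
      rw [hE₁]
      refine if_neg fun hc => hn' (mem_Ioc.2 ⟨(mem_Ioc.1 hn).1, hc⟩)
  have s2 : ∑ n ∈ Ioc 0 N, E₂ n ≤ 800 * (x / q.totient) := by
    have h1 := sum_vonMangoldt_not_rough_le z N
    rw [eI] at h1
    have h2 : Real.log x * (z * Real.log N) ≤ 800 * r ^ 17 := by
      calc Real.log x * (z * Real.log N) ≤ (20 * r) * (r ^ 15 * (2 * (20 * r))) := by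
            gcongr
            · linarith
            · linarith
        _ = _ := by ring
    have h3 : r ^ 17 ≤ x / q.totient := by
      rw [le_div_iff₀ hφ]
      calc r ^ 17 * q.totient ≤ r ^ 17 * r ^ 3 := by
            gcongr
            refine (hφq.trans hqr).trans (pow_le_pow_right₀ (by linarith) (by norm_num))
        _ = x := by rw [hx]; ring
    rw [hE₂, ← mul_sum]
    refine le_trans (mul_le_mul_of_nonneg_left h1 (by linarith)) ?_
    linarith
  have s3 : ∑ n ∈ Ioc 0 N, E₃ n ≤ 2 * C₁ * (x / q.totient) := by
    have hh : r ^ 15 ≤ δ * x := by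
      rw [hδ, hlx, one_div_mul_eq_div, le_div_iff₀ (by linarith), hx]
      have h4 : 20 ≤ r ^ 4 := by
        calc (20 : ℝ) ≤ 3 ^ 4 := by norm_num
          _ ≤ r ^ 4 := by gcongr
      calc r ^ 15 * (20 * Real.log r) ≤ r ^ 15 * (r ^ 4 * r) := by gcongr
        _ = r ^ 20 := by ring
    have e : x + δ * x = x * (1 + δ) := by ring
    have := H₁ q a r x (δ * x) hq ha (by linarith) hqr hh hx0.le (by rw [e, ← hx]; exact hX2)
    rw [e] at this
    have e2 : ∑ n ∈ Ioc 0 N, E₃ n = (2 * Real.log x) * psiCls a x (x * (1 + δ)) := by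
      rw [psiCls, mul_sum, ← hN]
      have hsub' : Ioc ⌊x⌋₊ N ⊆ Ioc 0 N := Ioc_subset_Ioc_left (Nat.zero_le _)
      rw [← sum_subset hsub']
      · refine sum_congr rfl fun n hn => ?_
        rw [hE₃]; exact if_neg (by have := (mem_Ioc.1 hn).1; omega)
      · intro n hn hn'
        rw [hE₃]
        refine if_pos ?_
        by_contra hc
        exact hn' (mem_Ioc.2 ⟨by omega, (mem_Ioc.1 hn).2⟩)
    rw [e2]
    have h5 : 0 ≤ 2 * Real.log x := by linarith
    calc 2 * Real.log x * psiCls a x (x * (1 + δ)) ≤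
        2 * Real.log x * (C₁ * (δ * x / q.totient)) := mul_le_mul_of_nonneg_left this h5
      _ = 2 * C₁ * ((δ * Real.log x) * x / q.totient) := by ring
      _ = _ := by rw [hδx, one_mul]
  have ep : psiCls a 0 x = ∑ n ∈ Ioc 0 N, if n ≤ ⌊x⌋₊ then
      (if (n : ZMod q) = a then vonMangoldt n else 0) else 0 := by
    rw [psiCls, Nat.floor_zero, ← sum_subset hsub]
    · exact sum_congr rfl fun n hn => (if_pos (mem_Ioc.1 hn).2).symm
    · intro n hn hn'
      exact if_neg fun hc => hn' (mem_Ioc.2 ⟨(mem_Ioc.1 hn).1, hc⟩)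
  rw [trapSum, ← hN, eI, ep, mul_sum, Complex.ofReal_sum, ← sum_sub_distrib]
  refine (norm_sum_le _ _).trans ?_
  have hterm : ∀ n ∈ Ioc 0 N, ‖cco z a (fun n => vonMangoldt n * Real.log n) n * (trap x δ n : ℝ) -
      ((Real.log x * (if n ≤ ⌊x⌋₊ then
      (if (n : ZMod q) = a then vonMangoldt n else 0) else 0) : ℝ) : ℂ)‖ ≤ E₁ n + E₂ n + E₃ n := by
    intro n hn
    have hn0 := (mem_Ioc.1 hn).1
    have hnN := (mem_Ioc.1 hn).2
    have hn0' : (0 : ℝ) < n := by exact_mod_cast hn0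
    have hL := vonMangoldt_nonneg (n := n)
    have hln := Real.log_natCast_nonneg n
    have hlnN : Real.log n ≤ 2 * Real.log x :=
      (Real.log_le_log hn0' (by exact_mod_cast hnN)).trans hlN
    have hlx0 : 0 ≤ Real.log x := by linarith
    have ht0 := trap_nonneg hx0 hδ0 (n : ℝ)
    have ht1 := trap_le_one hx0 hδ0 (n : ℝ)
    rw [hE₁, hE₂, hE₃]
    rw [cco]
    by_cases hnx : n ≤ ⌊x⌋₊
    · have hnx' : (n : ℝ) ≤ x := (Nat.le_floor_iff hx0.le).1 hnx
      have hlnx := Real.log_le_log hn0' hnx'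
      rw [trap_eq_one hx0 hδ0 hnx']
      simp only [hnx, if_true, Complex.ofReal_one, mul_one, add_zero]
      by_cases hc : (n : ZMod q) = a
      · by_cases hR : Rough z n
        · simp only [hc, hR, and_self, if_true]
          rw [← Complex.ofReal_sub, Complex.norm_real, norm_eq_abs, abs_le]
          constructor <;> nlinarith
        · simp only [hc, hR, and_false, if_true, if_false]
          rw [zero_sub, norm_neg, Complex.norm_real, norm_eq_abs, abs_of_nonneg (by positivity)]
          have : 0 ≤ vonMangoldt n * (Real.log x - Real.log n) := mul_nonneg hL (by linarith)
          linarith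
      · simp only [hc, false_and, if_false, mul_zero, Complex.ofReal_zero, sub_zero, norm_zero,
          zero_add]
        split_ifs <;> positivity
    · simp only [hnx, if_false, mul_zero, Complex.ofReal_zero, sub_zero, zero_add]
      by_cases hc : (n : ZMod q) = a
      · by_cases hR : Rough z n
        · simp only [hc, hR, and_self, if_true]
          rw [← Complex.ofReal_mul, Complex.norm_real, norm_eq_abs, abs_of_nonneg (by positivity)]
          calc vonMangoldt n * Real.log n * trap x δ n ≤ vonMangoldt n * Real.log n * 1 := by gcongr
            _ ≤ vonMangoldt n * (2 * Real.log x) * 1 := by gcongr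
            _ = _ := by ring
        · simp only [hc, hR, and_false, if_true, if_false]
          rw [zero_mul, norm_zero]; positivity
      · simp only [hc, false_and, if_false, zero_mul, norm_zero, mul_zero, add_zero]
        split_ifs <;> positivity
  refine (sum_le_sum hterm).trans ?_
  rw [sum_add_distrib, sum_add_distrib]
  linarith

/-- Character-twisted Chebyshev sums. -/
noncomputable def psiChar {q : ℕ} (χ : DirichletCharacter ℂ q) (x : ℝ) : ℂ :=
  ∑ n ∈ Icc 1 ⌊x⌋₊, (vonMangoldt n : ℂ) * χ n

lemma psiChar_eq_sum {q : ℕ} [NeZero q] (χ : DirichletCharacter ℂ q) (x : ℝ) :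
    psiChar χ x = ∑ b : ZMod q, χ b * (psiCls b 0 x : ℂ) := by
  have eI : Icc 1 ⌊x⌋₊ = Ioc 0 ⌊x⌋₊ := by ext n; simp [Nat.succ_le_iff]
  simp only [psiChar, psiCls, Nat.floor_zero, eI, Complex.ofReal_sum, mul_sum]
  rw [sum_comm]
  refine sum_congr rfl fun n _ => ?_
  rw [sum_eq_single (n : ZMod q)]
  · rw [if_pos rfl, mul_comm]
  · intro b _ hb
    rw [if_neg fun h => hb h.symm]; simp
  · simp

lemma norm_trapSum_vco_sub_psiChar_le : ∃ C : ℝ, 0 < C ∧ ∀ (q z : ℕ) [NeZero q]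
    (χ : DirichletCharacter ℂ q) (r x : ℝ), 3 ≤ r → (q : ℝ) ≤ r ^ 2 → x = r ^ 20 →
    (z : ℝ) ≤ r ^ 15 →
    ‖trapSum (vco z 1 χ) x (1 / Real.log x) - (Real.log x : ℂ) * psiChar χ x‖ ≤ C * x := by
  obtain ⟨C, hC, H⟩ := norm_trapSum_cco_sub_psiCls_le
  refine ⟨C, hC, fun q z _ χ r x hr hqr hx hz => ?_⟩
  have hq : 1 ≤ q := NeZero.one_le
  have hφ := totient_pos_real hq
  have hx0 : 0 < x := by rw [hx]; positivity
  have e1 : trapSum (vco z 1 χ) x (1 / Real.log x) = ∑ b : ZMod q, χ b *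
      trapSum (cco z b fun n => vonMangoldt n * Real.log n) x (1 / Real.log x) := by
    simp only [← trapSum_const_mul]
    rw [← trapSum_sum]
    exact trapSum_congr (fun n => by
      rw [vco, pow_one, liftChar_mul_eq_sum z χ fun n => vonMangoldt n * Real.log n]) x _
  rw [e1, psiChar_eq_sum, mul_sum, ← sum_sub_distrib]
  refine (norm_sum_le _ _).trans ?_
  have hb : ∀ b : ZMod q, ‖χ b * trapSum (cco z b fun n => vonMangoldt n * Real.log n) x
      (1 / Real.log x) - (Real.log x : ℂ) * (χ b * (psiCls b 0 x : ℂ))‖ ≤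
      ((1 : DirichletCharacter ℂ q) b).re * (C * (x / q.totient)) := by
    intro b
    by_cases hu : IsUnit b
    · have := H q z b r x hq hu hr hqr hx hz
      rw [MulChar.one_apply hu, Complex.one_re, one_mul]
      have e : χ b * trapSum (cco z b fun n => vonMangoldt n * Real.log n) x
          (1 / Real.log x) - (Real.log x : ℂ) * (χ b * (psiCls b 0 x : ℂ)) =
          χ b * (trapSum (cco z b fun n => vonMangoldt n * Real.log n) x (1 / Real.log x) -
            ((Real.log x * psiCls b 0 x : ℝ) : ℂ)) := by push_cast; ring
      rw [e, norm_mul]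
      exact (mul_le_of_le_one_left (norm_nonneg _) (DirichletCharacter.norm_le_one _ _)).trans this
    · rw [MulChar.map_nonunit _ hu, MulChar.map_nonunit _ hu]; simp
  refine (sum_le_sum fun b _ => hb b).trans (le_of_eq ?_)
  rw [← sum_mul, ← Complex.re_sum, sum_dirichletCharacter, if_pos rfl, Complex.natCast_re]
  field_simp

/-- Dichotomy for Chebyshev sums in residue classes. -/
theorem norm_psiCls_sub_le : ∃ C : ℝ, 0 < C ∧ ∀ (w z q : ℕ) (Q r x : ℝ) [NeZero q],
    Lvl q w z Q → 3 ≤ r → (q : ℝ) ≤ r ^ 2 → x = r ^ 20 → (z : ℝ) ≤ r ^ 15 → Real.log x ≤ Q →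
    ∃ ψ : DirichletCharacter ℂ q, ψ ^ 2 = 1 ∧
      (∀ a : ZMod q, IsUnit a →
        ‖(q.totient : ℂ) * psiCls a 0 x - psiChar (1 : DirichletCharacter ℂ q) x -
          (open Classical in if ψ = 1 then 0 else ψ a * psiChar ψ x)‖ ≤
          C * (x * (Real.log z / Real.log x))) ∧
      (ψ ≠ 1 → ‖psiChar ψ x‖ ≤
        C * (x * (Real.log z / Real.log x)) *
          (1 + 1 / ‖dser z 0 ψ (1 + 1 / Real.log x : ℝ)‖)) := by
  classical
  obtain ⟨A, hA, H⟩ := norm_trapSum_class_sub_le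
  obtain ⟨B, hB, HB⟩ := norm_trapSum_cco_sub_psiCls_le
  obtain ⟨D, hD, HD⟩ := norm_trapSum_vco_sub_psiChar_le
  refine ⟨A + B + 2 * D, by positivity, fun w z q Q r x _ h hr hqr hx hz hxQ => ?_⟩
  have hφ := totient_pos_real h.hq
  have hL := h.one_le_log
  have hr0 : 0 < r := by linarith
  have hlr : 1 < Real.log r := by
    rw [Real.lt_log_iff_exp_lt hr0]; linarith [Real.exp_one_lt_d9]
  have hlx : Real.log x = 20 * Real.log r := by rw [hx, Real.log_pow]; norm_num
  have hx3 : 3 ≤ x := by rw [hx]; exact hr.trans (le_self_pow₀ (by linarith) (by norm_num))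
  have hx0 : 0 < x := by linarith
  have hlx0 : 0 < Real.log x := by linarith
  have hxL : x ≤ x * Real.log z := le_mul_of_one_le_right hx0.le hL
  obtain ⟨ψ, hψ, H1, H2⟩ := H w z q Q x h (by linarith) hxQ hx3
  have hdiv (v : ℂ) (M : ℝ) (hv : ‖(Real.log x : ℂ) * v‖ ≤ M) : ‖v‖ ≤ M / Real.log x := by
    rw [norm_mul, Complex.norm_real, norm_of_nonneg hlx0.le] at hv
    rw [le_div_iff₀ hlx0]; linarith
  refine ⟨ψ, hψ, fun a ha => ?_, fun hne => ?_⟩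
  · have e : (A + B + 2 * D) * (x * (Real.log z / Real.log x)) =
        ((A + B + 2 * D) * (x * Real.log z)) / Real.log x := by ring
    rw [e]
    refine hdiv _ _ ?_
    have h1 := H1 a ha
    have h2 := HB q z a r x h.hq ha hr hqr hx hz
    have h3 := HD q z 1 r x hr hqr hx hz
    have h4 := HD q z ψ r x hr hqr hx hz
    generalize trapSum (cco z a fun n => vonMangoldt n * Real.log n) x (1 / Real.log x) = V at *
    generalize trapSum (vco z 1 (1 : DirichletCharacter ℂ q)) x (1 / Real.log x) = V1 at *
    generalize trapSum (vco z 1 ψ) x (1 / Real.log x) = V2 at *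
    have key : (Real.log x : ℂ) * ((q.totient : ℂ) * psiCls a 0 x -
          psiChar (1 : DirichletCharacter ℂ q) x - (if ψ = 1 then 0 else ψ a * psiChar ψ x)) =
        (((q.totient : ℂ) * V - V1 - (if ψ = 1 then 0 else ψ a * V2)) -
          (q.totient : ℂ) * (V - ((Real.log x * psiCls a 0 x : ℝ) : ℂ))) +
          ((V1 - (Real.log x : ℂ) * psiChar (1 : DirichletCharacter ℂ q) x) +
          (if ψ = 1 then 0 else ψ a * (V2 - (Real.log x : ℂ) * psiChar ψ x))) := by
      split_ifs <;> push_cast <;> ring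
    rw [key]
    have n2 : ‖(q.totient : ℂ) * (V - ((Real.log x * psiCls a 0 x : ℝ) : ℂ))‖ ≤ B * x := by
      rw [norm_mul, Complex.norm_natCast]
      calc _ ≤ (q.totient : ℝ) * (B * (x / q.totient)) := by gcongr
        _ = _ := by field_simp
    have n4 : ‖(if ψ = 1 then 0 else ψ a * (V2 - (Real.log x : ℂ) * psiChar ψ x))‖ ≤ D * x := by
      split_ifs
      · rw [norm_zero]; positivity
      · rw [norm_mul]
        exact (mul_le_of_le_one_left (norm_nonneg _) (DirichletCharacter.norm_le_one _ _)).trans h4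
    refine (norm_add_le _ _).trans ((add_le_add ((norm_sub_le _ _).trans (add_le_add h1 n2))
      ((norm_add_le _ _).trans (add_le_add h3 n4))).trans ?_)
    have b1 : B * x ≤ B * (x * Real.log z) := by gcongr
    have b2 : D * x ≤ D * (x * Real.log z) := by gcongr
    linarith
  · have h1 := H2 hne
    have h4 := HD q z ψ r x hr hqr hx hz
    have h3 : 0 ≤ 1 / ‖dser z 0 ψ ((1 + 1 / Real.log x : ℝ) : ℂ)‖ := by positivity
    generalize 1 / ‖dser z 0 ψ ((1 + 1 / Real.log x : ℝ) : ℂ)‖ = l at *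
    have e : (A + B + 2 * D) * (x * (Real.log z / Real.log x)) * (1 + l) =
        ((A + B + 2 * D) * (x * Real.log z) * (1 + l)) / Real.log x := by ring
    rw [e]
    refine hdiv _ _ ?_
    have key := norm_sub_le (trapSum (vco z 1 ψ) x (1 / Real.log x))
      (trapSum (vco z 1 ψ) x (1 / Real.log x) - (Real.log x : ℂ) * psiChar ψ x)
    rw [sub_sub_cancel] at key
    have b2 : D * x ≤ D * (x * Real.log z) := by gcongr
    have b3 : 0 ≤ B * (x * Real.log z) := by positivity
    have b4 : 0 ≤ D * (x * Real.log z) := by positivity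
    have b5 := mul_nonneg b3 h3
    have b6 := mul_nonneg b4 h3
    linarith

lemma one_le_re_trivChar_ne_zero {s : ℂ} (hs : 1 ≤ s.re) :
    DirichletCharacter.LFunctionTrivChar₁ 1 s ≠ 0 := by
  rcases eq_or_ne s 1 with rfl | h1
  · exact DirichletCharacter.LFunctionTrivChar₁_apply_one_ne_zero 1
  · rw [DirichletCharacter.LFunctionTrivChar₁, Function.update_of_ne h1,
      DirichletCharacter.LFunctionTrivChar, DirichletCharacter.LFunction_modOne_eq]
    exact mul_ne_zero (sub_ne_zero.2 h1) (riemannZeta_ne_zero_of_one_le_re hs)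

/-- Near `s = 1`, the series `∑ Λ(n) log n n ^ (-s)` is `1 / (s - 1) ^ 2` up to a bounded error. -/
lemma norm_LSeries_logMul_vonMangoldt_sub_le : ∃ C : ℝ, 0 < C ∧ ∀ s : ℂ, 1 < s.re → s.re ≤ 2 →
    |s.im| ≤ 1 → ‖LSeries (fun n => ((vonMangoldt n * Real.log n : ℝ) : ℂ)) s - 1 / (s - 1) ^ 2‖ ≤ C := by
  obtain ⟨G, hG⟩ : ∃ G : ℂ → ℂ, G = DirichletCharacter.LFunctionTrivChar₁ 1 := ⟨_, rfl⟩
  have hd : Differentiable ℂ G := hG ▸ DirichletCharacter.differentiable_LFunctionTrivChar₁ 1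
  have hU : IsOpen {s : ℂ | G s ≠ 0} := isOpen_ne_fun hd.continuous continuous_const
  have hd' : Differentiable ℂ (deriv G) := fun s =>
    ((hd.differentiableOn (s := Set.univ)).deriv isOpen_univ s (Set.mem_univ s)).differentiableAt
      Filter.univ_mem
  have hq : DifferentiableOn ℂ (fun s => deriv G s / G s) {s : ℂ | G s ≠ 0} := fun s hs =>
    ((hd' s).div (hd s) hs).differentiableWithinAt
  have hc := (hq.deriv hU).continuousOn
  have hK : IsCompact (Set.Icc (1 : ℝ) 2 ×ℂ Set.Icc (-1 : ℝ) 1) := isCompact_Icc.reProdIm isCompact_Icc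
  obtain ⟨C, hC⟩ := hK.exists_bound_of_continuousOn (hc.mono fun s hs => by
    rw [Complex.mem_reProdIm] at hs
    rw [Set.mem_ofPred_eq, hG]
    exact one_le_re_trivChar_ne_zero hs.1.1)
  refine ⟨max C 1, by positivity, fun s h1 h2 h3 => ?_⟩
  have hO : IsOpen {s : ℂ | 1 < s.re} := isOpen_lt continuous_const Complex.continuous_re
  have hev : (fun s => deriv G s / G s) =ᶠ[nhds s]
      fun s => 1 / (s - 1) - LSeries (fun n => (vonMangoldt n : ℂ)) s := by
    filter_upwards [hO.mem_nhds h1] with w hw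
    have hw1 : w ≠ 1 := by rintro rfl; simp at hw
    have hw0 : w - 1 ≠ 0 := sub_ne_zero.2 hw1
    have hz : riemannZeta w ≠ 0 := riemannZeta_ne_zero_of_one_lt_re hw
    rw [ArithmeticFunction.LSeries_vonMangoldt_eq_deriv_riemannZeta_div hw, hG,
      DirichletCharacter.deriv_LFunctionTrivChar₁_apply_of_ne_one 1 hw1,
      DirichletCharacter.LFunctionTrivChar₁, Function.update_of_ne hw1,
      DirichletCharacter.LFunctionTrivChar, DirichletCharacter.LFunction_modOne_eq]
    field_simp
    ring
  have hs1 : s - 1 ≠ 0 := by intro h; rw [sub_eq_zero] at h; simp [h] at h1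
  have hab : LSeries.abscissaOfAbsConv (fun n => (vonMangoldt n : ℂ)) < s.re := by
    have h0 : LSeries.abscissaOfAbsConv (fun n => (vonMangoldt n : ℂ)) ≤ 1 :=
      LSeries.abscissaOfAbsConv_le_of_forall_lt_LSeriesSummable fun y hy =>
        ArithmeticFunction.LSeriesSummable_vonMangoldt (by simpa using hy)
    exact h0.trans_lt (by exact_mod_cast h1)
  have hD1 := LSeries_hasDerivAt hab
  have hD2 : HasDerivAt (fun s : ℂ => 1 / (s - 1)) (-1 / (s - 1) ^ 2) s := by
    have := ((hasDerivAt_id s).sub_const 1).fun_inv hs1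
    simpa using this
  have hD := (hD2.sub hD1).deriv
  have e1 := hev.deriv_eq
  have e2 : LSeries (fun n => ((vonMangoldt n * Real.log n : ℝ) : ℂ)) s =
      LSeries (LSeries.logMul fun n => (vonMangoldt n : ℂ)) s := by
    congr 1
    funext n
    rw [LSeries.logMul, Complex.natCast_log.symm]
    push_cast
    ring
  have e3 : LSeries (fun n => ((vonMangoldt n * Real.log n : ℝ) : ℂ)) s - 1 / (s - 1) ^ 2 =
      deriv (fun s => deriv G s / G s) s := by
    rw [e1, e2]
    refine Eq.trans ?_ hD.symm
    ring
  rw [e3]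
  refine (hC s ?_).trans (le_max_left _ _)
  rw [Complex.mem_reProdIm]
  exact ⟨⟨h1.le, h2⟩, abs_le.1 h3⟩

lemma sum_mul_two_div_pow_le (K : ℕ) : ∑ k ∈ range K, ((k : ℝ) + 1) * (1 / 2) ^ k ≤ 4 := by
  have : ∑ k ∈ range K, ((k : ℝ) + 1) * (1 / 2) ^ k = 4 - (2 * K + 4) * (1 / 2) ^ K := by
    induction K with
    | zero => norm_num
    | succ n ih => rw [sum_range_succ, ih]; push_cast; ring
  rw [this]
  have : (0 : ℝ) ≤ (2 * K + 4) * (1 / 2) ^ K := by positivity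
  linarith

/-- Prime powers of primes up to `z` contribute `O(log z ^ 2)` to `∑ Λ(n) log n / n`. -/
lemma sum_vonMangoldt_mul_log_div_not_rough_le (z N : ℕ) (hz : 1 ≤ z) :
    ∑ n ∈ Icc 1 N, (open Classical in if Rough z n then 0 else vonMangoldt n * Real.log n / n) ≤
      4 * Real.log z * (Real.log z + 6) := by
  classical
  have hg : ∀ n : ℕ, 0 ≤ vonMangoldt n * Real.log n / n := fun n =>
    div_nonneg (mul_nonneg vonMangoldt_nonneg (Real.log_natCast_nonneg n)) (by positivity)
  have h1 : ∀ n ∈ Icc 1 N, (if Rough z n then 0 else vonMangoldt n * Real.log n / n) ≤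
      ∑ p ∈ (Icc 1 z).filter Nat.Prime, ∑ k ∈ range N,
        if n = p ^ (k + 1) then vonMangoldt n * Real.log n / n else 0 := by
    intro n hn
    have hn2 (p k : ℕ) : 0 ≤ if n = p ^ (k + 1) then vonMangoldt n * Real.log n / n else 0 := by
      split_ifs
      · exact hg n
      · exact le_rfl
    have hnn : ∀ p ∈ (Icc 1 z).filter Nat.Prime, 0 ≤ ∑ k ∈ range N,
        if n = p ^ (k + 1) then vonMangoldt n * Real.log n / n else 0 :=
      fun p _ => sum_nonneg fun k _ => hn2 p k
    split_ifs with hr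
    · exact sum_nonneg hnn
    by_cases hpp : IsPrimePow n
    · obtain ⟨p, k, hp, hk, hpk⟩ := (isPrimePow_nat_iff n).1 hpp
      obtain ⟨j, rfl⟩ : ∃ j, k = j + 1 := ⟨k - 1, by omega⟩
      have hpw : p ≤ z := by
        by_contra hc
        refine hr fun l hl hlw hd => ?_
        have := (Nat.prime_dvd_prime_iff_eq hl hp).1 (hl.dvd_of_dvd_pow (hpk ▸ hd))
        omega
      have hm : p ∈ (Icc 1 z).filter Nat.Prime := mem_filter.2 ⟨mem_Icc.2 ⟨hp.one_le, hpw⟩, hp⟩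
      refine le_trans ?_ (single_le_sum hnn hm)
      have hjN : j ∈ range N := by
        have : j + 1 < p ^ (j + 1) := Nat.lt_pow_self hp.one_lt
        have := (mem_Icc.1 hn).2
        rw [mem_range]; omega
      refine le_trans ?_ (single_le_sum (fun j _ => hn2 p j) hjN)
      rw [if_pos hpk.symm]
    · rw [ArithmeticFunction.vonMangoldt_eq_zero_iff.2 hpp]
      simp
  refine (sum_le_sum h1).trans ?_
  rw [sum_comm]
  have h2 : ∀ p ∈ (Icc 1 z).filter Nat.Prime, ∑ n ∈ Icc 1 N, ∑ k ∈ range N,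
      (if n = p ^ (k + 1) then vonMangoldt n * Real.log n / n else 0) ≤
        4 * Real.log z * (vonMangoldt p / p) := by
    intro p hp
    have hp' := (mem_filter.1 hp).2
    have hpz := (mem_Icc.1 (mem_filter.1 hp).1).2
    have hp2 : (2 : ℝ) ≤ p := by exact_mod_cast hp'.two_le
    have hlp : 0 ≤ Real.log p := Real.log_natCast_nonneg p
    have hlz : Real.log p ≤ Real.log z := by
      refine Real.log_le_log (by linarith) (by exact_mod_cast hpz)
    rw [sum_comm]
    have h3 : ∀ k ∈ range N, ∑ n ∈ Icc 1 N,
        (if n = p ^ (k + 1) then vonMangoldt n * Real.log n / n else 0) ≤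
          (Real.log z * (Real.log p / p)) * (((k : ℝ) + 1) * (1 / 2) ^ k) := by
      intro k _
      rw [sum_ite_eq' (Icc 1 N) (p ^ (k + 1))]
      have e : vonMangoldt (p ^ (k + 1)) * Real.log ((p ^ (k + 1) : ℕ) : ℝ) / ((p ^ (k + 1) : ℕ) : ℝ) =
          (Real.log p * (Real.log p / p)) * (((k : ℝ) + 1) * (1 / p) ^ k) := by
        rw [ArithmeticFunction.vonMangoldt_apply_pow (Nat.succ_ne_zero k),
          ArithmeticFunction.vonMangoldt_apply_prime hp']
        push_cast
        rw [Real.log_pow]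
        push_cast
        rw [one_div, inv_pow]
        field_simp
        ring
      rw [e]
      have h4 : (Real.log p * (Real.log p / p)) * (((k : ℝ) + 1) * (1 / p) ^ k) ≤
          (Real.log z * (Real.log p / p)) * (((k : ℝ) + 1) * (1 / 2) ^ k) := by
        gcongr
      split_ifs
      · exact h4
      · exact le_trans (by positivity) h4
    refine (sum_le_sum h3).trans ?_
    rw [← mul_sum, ArithmeticFunction.vonMangoldt_apply_prime hp']
    calc _ ≤ (Real.log z * (Real.log p / p)) * 4 := by
          refine mul_le_mul_of_nonneg_left (sum_mul_two_div_pow_le N) (mul_nonneg (hlp.trans hlz) (by positivity))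
      _ = _ := by ring
  refine (sum_le_sum h2).trans ?_
  rw [← mul_sum]
  have hz0 : 0 ≤ Real.log z := Real.log_natCast_nonneg z
  refine mul_le_mul_of_nonneg_left ?_ (by positivity)
  refine le_trans ?_ (sum_vonMangoldt_div_le z hz)
  refine sum_le_sum_of_subset_of_nonneg (fun p hp => ?_) fun p _ _ =>
    div_nonneg vonMangoldt_nonneg (by positivity)
  have := mem_Icc.1 (mem_filter.1 hp).1
  exact mem_Ioc.2 ⟨by omega, this.2⟩

lemma norm_LSeries_sub_vco_le {z : ℕ} (hz : 1 ≤ z) {s : ℂ} (hs : 1 < s.re) :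
    ‖LSeries (fun n => ((vonMangoldt n * Real.log n : ℝ) : ℂ)) s -
      LSeries (vco z 1 (1 : DirichletCharacter ℂ 1)) s‖ ≤ 4 * Real.log z * (Real.log z + 6) := by
  classical
  have hf : ∀ n : ℕ, ‖((vonMangoldt n * Real.log n : ℝ) : ℂ)‖ ≤ Real.log n ^ 2 := fun n => by
    have h0 := Real.log_natCast_nonneg n
    have h2 : 0 ≤ vonMangoldt n := vonMangoldt_nonneg
    rw [Complex.norm_real, Real.norm_of_nonneg (by positivity), sq]
    exact mul_le_mul_of_nonneg_right vonMangoldt_le_log h0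
  have s1 := LSeriesSummable_of_le_log hf hs
  have s2 := LSeriesSummable_of_le_log (norm_vco_le z 1 (1 : DirichletCharacter ℂ 1)) hs
  rw [← LSeries_sub s1 s2]
  have s3 := s1.sub s2
  rw [LSeries]
  have hz0 : 0 ≤ Real.log z := Real.log_natCast_nonneg z
  refine (norm_tsum_le_tsum_norm s3.norm).trans (Real.tsum_le_of_sum_range_le (fun _ => norm_nonneg _)
    fun N => ?_)
  refine le_trans ?_ (sum_vonMangoldt_mul_log_div_not_rough_le z N hz)
  have hg : ∀ n : ℕ, 0 ≤ vonMangoldt n * Real.log n / n := fun n =>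
    div_nonneg (mul_nonneg vonMangoldt_nonneg (Real.log_natCast_nonneg n)) (by positivity)
  have hterm : ∀ n : ℕ, ‖LSeries.term ((fun n : ℕ => ((vonMangoldt n * Real.log n : ℝ) : ℂ)) -
      vco z 1 (1 : DirichletCharacter ℂ 1)) s n‖ ≤
        if Rough z n then 0 else vonMangoldt n * Real.log n / n := by
    intro n
    have e : ((fun n : ℕ => ((vonMangoldt n * Real.log n : ℝ) : ℂ)) -
        vco z 1 (1 : DirichletCharacter ℂ 1)) n =
        ((if Rough z n then 0 else vonMangoldt n * Real.log n : ℝ) : ℂ) := by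
      have h1 : (1 : DirichletCharacter ℂ 1) n = 1 := by
        rw [Subsingleton.elim (n : ZMod 1) 1, map_one]
      rw [Pi.sub_apply, vco, liftChar_apply, h1]
      split_ifs <;> simp
    rw [LSeries.norm_term_eq, e]
    rcases Nat.eq_zero_or_pos n with rfl | hn
    · simp
    rw [if_neg hn.ne']
    have hn1 : (1 : ℝ) ≤ n := by exact_mod_cast hn
    split_ifs
    · simp
    · rw [Complex.norm_real, Real.norm_of_nonneg (mul_nonneg vonMangoldt_nonneg (Real.log_natCast_nonneg n))]
      refine div_le_div_of_nonneg_left (mul_nonneg vonMangoldt_nonneg (Real.log_natCast_nonneg n)) (by linarith) ?_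
      calc (n : ℝ) = (n : ℝ) ^ (1 : ℝ) := (Real.rpow_one _).symm
        _ ≤ _ := Real.rpow_le_rpow_of_exponent_le hn1 hs.le
  calc _ ≤ ∑ n ∈ range N, (if Rough z n then 0 else vonMangoldt n * Real.log n / n) :=
        sum_le_sum fun n _ => hterm n
    _ ≤ _ := by
        have h0 : ∀ n ∈ range N, n ∉ (Icc 1 N).filter (· < N) →
            (if Rough z n then 0 else vonMangoldt n * Real.log n / n) = 0 := by
          intro n hn hn'
          have : n = 0 := by
            by_contra hc
            exact hn' (mem_filter.2 ⟨mem_Icc.2 ⟨by omega, (mem_range.1 hn).le⟩, mem_range.1 hn⟩)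
          simp [this]
        rw [← sum_subset (fun n hn => mem_range.2 (mem_filter.1 hn).2) h0]
        refine sum_le_sum_of_subset_of_nonneg (filter_subset _ _) fun n _ _ => ?_
        split_ifs
        · exact le_rfl
        · exact hg n

/-- The logarithmic second derivative of the rough zeta function minus its pole is small. -/
lemma norm_LSeries_vco_sub_pole_le : ∃ C : ℝ, 0 < C ∧ ∀ (w z : ℕ) (Q t : ℝ), Lvl 1 w z Q →
    |t| ≤ Q ^ 6 → ‖LSeries (vco z 1 (1 : DirichletCharacter ℂ 1)) (((1 + 1 / Q : ℝ) : ℂ) + t * Complex.I) -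
      1 / (((1 + 1 / Q : ℝ) : ℂ) + t * Complex.I - 1) ^ 2‖ ≤ C * Real.log z ^ 2 := by
  obtain ⟨C, hC, HC⟩ := norm_LSeries_logMul_vonMangoldt_sub_le
  obtain ⟨A, hA, HA⟩ := norm_dser_bounds
  obtain ⟨c, hc, Hc⟩ := dser_lower
  have hA0 : 0 < A := by linarith
  refine ⟨C + 28 + (2 * A / c + (2 * A / c) ^ 2 + 1), by positivity, fun w z Q t h ht => ?_⟩
  have hQ := h.hQ
  have hL := h.one_le_log
  have hL2 : 1 ≤ Real.log z ^ 2 := one_le_pow₀ hL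
  have hz : 1 ≤ z := by
    by_contra h0
    have : z = 0 := by omega
    subst this
    norm_num at hL
  have hq0 : 0 < 1 / Q := by positivity
  have hq1 : 1 / Q ≤ 1 / 2 := one_div_le_one_div_of_le (by norm_num) (by linarith)
  have hre : (((1 + 1 / Q : ℝ) : ℂ) + t * Complex.I).re = 1 + 1 / Q := by simp
  have him : (((1 + 1 / Q : ℝ) : ℂ) + t * Complex.I).im = t := by simp
  have hsub : |t| ≤ ‖((1 + 1 / Q : ℝ) : ℂ) + t * Complex.I - 1‖ := by
    have := Complex.abs_im_le_norm (((1 + 1 / Q : ℝ) : ℂ) + t * Complex.I - 1)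
    simpa using this
  have hdl := (Hc w z 1 Q (1 + 1 / Q) h le_rfl (by linarith)).1 t
  generalize ((1 + 1 / Q : ℝ) : ℂ) + t * Complex.I = s at *
  rcases le_total |t| 1 with h1 | h1
  · have b1 := HC s (by linarith) (by linarith) (by rwa [him])
    have b2 := norm_LSeries_sub_vco_le hz (s := s) (by linarith)
    have b3 : ‖LSeries (vco z 1 (1 : DirichletCharacter ℂ 1)) s - 1 / (s - 1) ^ 2‖ ≤
        C + 4 * Real.log z * (Real.log z + 6) := by
      rw [norm_sub_rev] at b2
      have := norm_add_le (LSeries (vco z 1 (1 : DirichletCharacter ℂ 1)) s -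
        LSeries (fun n => ((vonMangoldt n * Real.log n : ℝ) : ℂ)) s)
        (LSeries (fun n => ((vonMangoldt n * Real.log n : ℝ) : ℂ)) s - 1 / (s - 1) ^ 2)
      rw [sub_add_sub_cancel] at this
      linarith
    have : 0 ≤ (2 * A / c + (2 * A / c) ^ 2 + 1) * Real.log z ^ 2 := by positivity
    nlinarith
  · have hdl' := hdl h1 ht
    have hs1 : 1 ≤ ‖s - 1‖ := h1.trans hsub
    have hk : ∀ k ≤ 2, ‖dser z k (1 : DirichletCharacter ℂ 1) s‖ ≤ 2 * A * Real.log z ^ k := by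
      intro k hk
      refine (HA w z 1 Q 1 k s h hk (by rw [hre]) (by linarith) ?_).2.trans ?_
      · rw [him]; nlinarith [abs_nonneg t]
      · have h2 : 1 ≤ (Real.log z * ‖s - 1‖) ^ (k + 1) := one_le_pow₀ (one_le_mul_of_one_le_of_one_le hL hs1)
        have h3 : 1 / (Real.log z * ‖s - 1‖) ^ (k + 1) ≤ 1 := by
          rw [div_le_one (by linarith)]; exact h2
        calc _ ≤ A * Real.log z ^ k * (1 + 1) := by gcongr
          _ = _ := by ring
    rw [LSeries_vco_one z 1 (by linarith)]
    have n2 : ‖dser z 2 (1 : DirichletCharacter ℂ 1) s / dser z 0 (1 : DirichletCharacter ℂ 1) s‖ ≤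
        2 * A / c * Real.log z ^ 2 := by
      rw [norm_div]
      calc _ ≤ 2 * A * Real.log z ^ 2 / c := by
            gcongr
            exact hk 2 le_rfl
        _ = _ := by ring
    have n1 : ‖dser z 1 (1 : DirichletCharacter ℂ 1) s / dser z 0 (1 : DirichletCharacter ℂ 1) s‖ ≤
        2 * A / c * Real.log z := by
      rw [norm_div]
      have := hk 1 (by norm_num)
      rw [pow_one] at this
      calc _ ≤ 2 * A * Real.log z / c := by gcongr
        _ = _ := by ring
    have n1' : ‖(dser z 1 (1 : DirichletCharacter ℂ 1) s / dser z 0 (1 : DirichletCharacter ℂ 1) s) ^ 2‖ ≤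
        (2 * A / c) ^ 2 * Real.log z ^ 2 := by
      rw [norm_pow, ← mul_pow]
      gcongr
    have n0 : ‖1 / (s - 1) ^ 2‖ ≤ 1 := by
      rw [norm_div, norm_one, norm_pow]
      exact (div_le_one (by positivity)).2 (one_le_pow₀ hs1)
    have := norm_sub_le (dser z 2 (1 : DirichletCharacter ℂ 1) s / dser z 0 (1 : DirichletCharacter ℂ 1) s -
      (dser z 1 (1 : DirichletCharacter ℂ 1) s / dser z 0 (1 : DirichletCharacter ℂ 1) s) ^ 2) (1 / (s - 1) ^ 2)
    have := norm_sub_le (dser z 2 (1 : DirichletCharacter ℂ 1) s / dser z 0 (1 : DirichletCharacter ℂ 1) s)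
      ((dser z 1 (1 : DirichletCharacter ℂ 1) s / dser z 0 (1 : DirichletCharacter ℂ 1) s) ^ 2)
    have : 0 ≤ (C + 28) * Real.log z ^ 2 := by positivity
    nlinarith

lemma integral_mul_exp {L : ℝ} (hL : 0 ≤ L) :
    ∫ v in Set.Ioc 0 L, v * Real.exp v = (L - 1) * Real.exp L + 1 := by
  rw [← intervalIntegral.integral_of_le hL,
    intervalIntegral.integral_eq_sub_of_hasDerivAt (f := fun v => (v - 1) * Real.exp v)
      (fun v _ => ?_) ((by fun_prop : Continuous fun v : ℝ => v * Real.exp v).intervalIntegrable _ _)]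
  · simp
  · have := ((hasDerivAt_id v).sub_const 1).mul (Real.hasDerivAt_exp v)
    convert! this using 1
    simp only [id]
    ring

lemma continuous_mul_exp_trap (x δ : ℝ) :
    Continuous fun v : ℝ => v * Real.exp v * trap x δ (Real.exp v) := by
  unfold trap
  fun_prop

/-- The pole main term of the trapezoidal Perron formula. -/
lemma abs_integral_mul_exp_trap_sub_le {x δ : ℝ} (hx : 3 ≤ x) (hl : 1 ≤ Real.log x)
    (hδ : δ = 1 / Real.log x) :
    |(∫ v in Set.Ioi (0 : ℝ), v * Real.exp v * trap x δ (Real.exp v)) - x * Real.log x| ≤ 2 * x := by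
  have hx0 : 0 < x := by linarith
  have hδ0 : 0 < δ := by rw [hδ]; positivity
  have hδ1 : δ ≤ 1 := by rw [hδ]; exact (div_le_one (by linarith)).2 hl
  have hx1 : x ≤ x * (1 + δ) := by nlinarith
  have hx'0 : 0 < x * (1 + δ) := by positivity
  obtain ⟨M, hM⟩ : ∃ M, M = Real.log (x * (1 + δ)) := ⟨_, rfl⟩
  have hlM : Real.log x ≤ M := hM ▸ Real.log_le_log hx0 hx1
  have hM0 : 0 ≤ M := by linarith
  have hMu : M ≤ Real.log x + δ := by
    rw [hM, Real.log_mul hx0.ne' (by positivity)]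
    linarith [Real.log_le_sub_one_of_pos (show 0 < 1 + δ by linarith)]
  have eM : Real.exp M = x * (1 + δ) := by rw [hM, Real.exp_log hx'0]
  have hc := continuous_mul_exp_trap x δ
  have hc2 : Continuous fun v : ℝ => v * Real.exp v := by fun_prop
  have e1 : ∫ v in Set.Ioi (0 : ℝ), v * Real.exp v * trap x δ (Real.exp v) =
      ∫ v in Set.Ioc (0 : ℝ) M, v * Real.exp v * trap x δ (Real.exp v) := by
    refine setIntegral_eq_of_subset_of_forall_sdiff_eq_zero measurableSet_Ioi
      (fun v hv => hv.1) fun v hv => ?_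
    have hv' : M < v := by
      by_contra hc
      exact hv.2 ⟨hv.1, not_lt.1 hc⟩
    rw [trap_eq_zero hx0 hδ0 (by rw [← eM]; exact Real.exp_le_exp.2 hv'.le), mul_zero]
  have up : ∫ v in Set.Ioc (0 : ℝ) M, v * Real.exp v * trap x δ (Real.exp v) ≤
      ∫ v in Set.Ioc (0 : ℝ) M, v * Real.exp v := by
    refine setIntegral_mono_on hc.integrableOn_Ioc hc2.integrableOn_Ioc measurableSet_Ioc fun v hv => ?_
    exact mul_le_of_le_one_right (mul_nonneg hv.1.le (Real.exp_pos _).le) (trap_le_one hx0 hδ0 _)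
  have lo : ∫ v in Set.Ioc (0 : ℝ) (Real.log x), v * Real.exp v ≤
      ∫ v in Set.Ioc (0 : ℝ) M, v * Real.exp v * trap x δ (Real.exp v) := by
    have e2 : ∫ v in Set.Ioc (0 : ℝ) (Real.log x), v * Real.exp v =
        ∫ v in Set.Ioc (0 : ℝ) (Real.log x), v * Real.exp v * trap x δ (Real.exp v) := by
      refine setIntegral_congr_fun measurableSet_Ioc fun v hv => ?_
      have : Real.exp v ≤ x := by
        rw [← Real.exp_log hx0]; exact Real.exp_le_exp.2 hv.2
      simp only [trap_eq_one hx0 hδ0 this, mul_one]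
    rw [e2]
    refine setIntegral_mono_set hc.integrableOn_Ioc ?_
      (Set.Ioc_subset_Ioc_right hlM).eventuallyLE
    refine (ae_restrict_iff' measurableSet_Ioc).2 (Filter.Eventually.of_forall fun v hv => ?_)
    exact mul_nonneg (mul_nonneg hv.1.le (Real.exp_pos _).le) (trap_nonneg hx0 hδ0 _)
  rw [integral_mul_exp (by linarith), Real.exp_log hx0] at lo
  rw [integral_mul_exp hM0, eM] at up
  rw [e1, abs_le]
  have hδl : δ * Real.log x = 1 := by rw [hδ]; exact one_div_mul_cancel (by linarith)
  constructor
  · nlinarith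
  · have h2 : (M - 1) * (x * (1 + δ)) ≤ Real.log x * (x * (1 + δ)) := by
      refine mul_le_mul_of_nonneg_right ?_ hx'0.le
      linarith
    have h3 : Real.log x * (x * (1 + δ)) = x * Real.log x + x * (δ * Real.log x) := by ring
    rw [h3, hδl] at h2
    linarith

lemma perron_pole {σ x δ : ℝ} (hσ : 1 < σ) (hx : 0 < x) (hδ : 0 < δ) :
    Integrable (fun t : ℝ => 1 / ((σ : ℂ) + t * Complex.I - 1) ^ 2 * trapKer x δ (σ + t * Complex.I)) ∧
    ∫ t : ℝ, 1 / ((σ : ℂ) + t * Complex.I - 1) ^ 2 * trapKer x δ (σ + t * Complex.I) =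
      2 * π * ((∫ v in Set.Ioi (0 : ℝ), v * Real.exp v * trap x δ (Real.exp v) : ℝ) : ℂ) := by
  have hre (t : ℝ) : 0 < ((σ : ℂ) + t * Complex.I - 1).re := by simpa using hσ
  have hfun (t v : ℝ) : ((v * Real.exp v : ℝ) : ℂ) * Complex.exp (-((σ : ℂ) + t * Complex.I) * v) =
      ((v ^ 1 : ℝ) : ℂ) * Complex.exp (-((σ : ℂ) + t * Complex.I - 1) * v) := by
    push_cast
    rw [mul_assoc, ← Complex.exp_add, pow_one]
    congr 2
    ring
  have hval (t : ℝ) : ∫ v in Set.Ioi (0 : ℝ), ((v * Real.exp v : ℝ) : ℂ) *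
      Complex.exp (-((σ : ℂ) + t * Complex.I) * v) = 1 / ((σ : ℂ) + t * Complex.I - 1) ^ 2 := by
    simp only [hfun]
    rw [integral_pow_mul_exp_neg 1 (hre t)]
    simp
  have hi : IntegrableOn (fun v : ℝ => ((v * Real.exp v : ℝ) : ℂ) * (Real.exp (-σ * v) : ℝ)) (Set.Ioi 0) := by
    have := integrableOn_pow_mul_exp_neg 1 (hre 0)
    refine this.congr_fun (fun v _ => ?_) measurableSet_Ioi
    simp only [← hfun]
    push_cast
    simp
  have key := perron_trap (volume.restrict (Set.Ioi (0 : ℝ))) (fun v : ℝ => ((v * Real.exp v : ℝ) : ℂ))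
    id measurable_id hσ.le (by fun_prop) hi ?_ hx hδ
  · simp only [id, hval] at key
    refine ⟨key.1, key.2.trans ?_⟩
    rw [← integral_complex_ofReal]
    push_cast
    rfl
  · simp only [id, hval]
    refine Continuous.div continuous_const (by fun_prop) fun t => pow_ne_zero 2 fun h => ?_
    have := hre t
    rw [h] at this
    simp at this

lemma norm_trapKer_le_rpow {x σ : ℝ} (hx : 3 ≤ x) (hl : 1 ≤ Real.log x)
    (hσ : σ = 1 + 1 / Real.log x) (t : ℝ) :
    ‖trapKer x (1 / Real.log x) (σ + t * Complex.I)‖ ≤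
      24 * x * Real.sqrt (Real.log x) * (1 + ‖t‖ ^ 2) ^ (-(3 / 2 : ℝ) / 2) := by
  have hδ0 : 0 < 1 / Real.log x := by positivity
  have hδ1 : 1 / Real.log x ≤ 1 := (div_le_one (by linarith)).2 hl
  have k1 := norm_trapKer_le hx hδ0 hδ1 hσ t
  have k2 := norm_trapKer_le' hx hδ0 hδ1 hσ t
  have hs2 : 1 + t ^ 2 ≤ ‖(σ : ℂ) + t * Complex.I‖ ^ 2 := by
    rw [← Complex.normSq_eq_norm_sq, Complex.normSq_add_mul_I]
    have : 1 ≤ σ := by rw [hσ]; linarith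
    nlinarith
  rw [Real.norm_eq_abs, sq_abs]
  have hX : 0 < 1 + t ^ 2 := by positivity
  have hs : (1 + t ^ 2) ^ (1 / 2 : ℝ) ≤ ‖(σ : ℂ) + t * Complex.I‖ := by
    rw [← Real.sqrt_eq_rpow]
    exact Real.sqrt_le_iff.2 ⟨norm_nonneg _, hs2⟩
  refine le_of_sq_le_sq ?_ (by positivity)
  have hX1 : 0 < (1 + t ^ 2) ^ (1 / 2 : ℝ) := by positivity
  have e1 : (24 * x * Real.sqrt (Real.log x) * (1 + t ^ 2) ^ (-(3 / 2 : ℝ) / 2)) ^ 2 =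
      12 * x / (1 + t ^ 2) ^ (1 / 2 : ℝ) * (48 * x / (1 / Real.log x) * (1 + t ^ 2)⁻¹) := by
    have e2 : ((1 + t ^ 2) ^ (-(3 / 2 : ℝ) / 2)) ^ 2 = ((1 + t ^ 2) ^ (1 / 2 : ℝ))⁻¹ * (1 + t ^ 2)⁻¹ := by
      rw [← Real.rpow_natCast, ← Real.rpow_mul hX.le, ← Real.rpow_neg hX.le, ← Real.rpow_neg_one (1 + t ^ 2),
        ← Real.rpow_add hX]
      norm_num
    rw [mul_pow, mul_pow, Real.sq_sqrt (by linarith), e2]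
    field_simp
    norm_num
  rw [e1, sq]
  refine mul_le_mul (k1.trans ?_) k2 (norm_nonneg _) (by positivity)
  gcongr

lemma norm_trapSum_vco_sub_le : ∃ C : ℝ, 0 < C ∧ ∀ (w z : ℕ) (x : ℝ), Lvl 1 w z (Real.log x) → 3 ≤ x →
    ‖trapSum (vco z 1 (1 : DirichletCharacter ℂ 1)) x (1 / Real.log x) - ((x * Real.log x : ℝ) : ℂ)‖ ≤
      C * x * Real.sqrt (Real.log x) * Real.log z ^ 2 := by
  obtain ⟨A, hA, HA⟩ := norm_LSeries_crude
  obtain ⟨B, hB, HB⟩ := norm_LSeries_vco_sub_pole_le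
  have ik : Integrable fun t : ℝ => (1 + ‖t‖ ^ 2) ^ (-(3 / 2 : ℝ) / 2) :=
    integrable_rpow_neg_one_add_norm_sq (by simp; norm_num)
  obtain ⟨D, hD⟩ : ∃ D : ℝ, D = ∫ t : ℝ, (1 + ‖t‖ ^ 2) ^ (-(3 / 2 : ℝ) / 2) := ⟨_, rfl⟩
  have hD0 : 0 ≤ D := hD ▸ integral_nonneg fun t => by positivity
  refine ⟨24 * B * D + 96 * π * (A + 1) + 2, by positivity, fun w z x h hx => ?_⟩
  obtain ⟨Q, hQd⟩ : ∃ Q, Q = Real.log x := ⟨_, rfl⟩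
  have hQ := h.hQ
  have hL := h.one_le_log
  have hL2 : 1 ≤ Real.log z ^ 2 := one_le_pow₀ hL
  have hx0 : 0 < x := by linarith
  obtain ⟨σ, hσ⟩ : ∃ σ : ℝ, σ = 1 + 1 / Real.log x := ⟨_, rfl⟩
  have hδ0 : 0 < 1 / Real.log x := by positivity
  have hσ1 : 1 < σ := by rw [hσ]; linarith
  have hδ1 : 1 / Real.log x ≤ 1 := (div_le_one (by linarith)).2 (by linarith)
  obtain ⟨i1, e1⟩ := perron_LSeries two_ne_zero (norm_vco_le z 1 (1 : DirichletCharacter ℂ 1)) hσ1 hx0 hδ0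
  obtain ⟨i2, e2⟩ := perron_pole hσ1 hx0 hδ0
  have hI := abs_integral_mul_exp_trap_sub_le hx (by linarith) rfl
  have hker := norm_trapKer_le_rpow hx (by linarith) hσ
  have hB' (t : ℝ) (ht : |t| ≤ Q ^ 6) := HB w z (Real.log x) t h (hQd ▸ ht)
  have hA' (t : ℝ) := HA w z 1 (Real.log x) x (vco z 1 (1 : DirichletCharacter ℂ 1)) t h (by linarith) le_rfl
    (norm_vco_le_dco z 1)
  rw [← hσ] at hB' hA'
  obtain ⟨F, hF⟩ : ∃ F : ℝ → ℂ, F = fun t : ℝ =>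
    LSeries (vco z 1 (1 : DirichletCharacter ℂ 1)) (σ + t * Complex.I) - 1 / (σ + t * Complex.I - 1) ^ 2 :=
    ⟨_, rfl⟩
  have hFi : Integrable fun t : ℝ => F t * trapKer x (1 / Real.log x) (σ + t * Complex.I) := by
    have := i1.sub i2
    refine this.congr (Filter.Eventually.of_forall fun t => ?_)
    simp only [hF, Pi.sub_apply]
    ring
  have hre (t : ℝ) : σ - 1 ≤ ‖(σ : ℂ) + t * Complex.I - 1‖ := by
    have := Complex.re_le_norm ((σ : ℂ) + t * Complex.I - 1)
    simpa using this
  have hFe : ∫ t : ℝ, F t * trapKer x (1 / Real.log x) (σ + t * Complex.I) =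
      2 * π * (trapSum (vco z 1 (1 : DirichletCharacter ℂ 1)) x (1 / Real.log x) -
        ((∫ v in Set.Ioi (0 : ℝ), v * Real.exp v * trap x (1 / Real.log x) (Real.exp v) : ℝ) : ℂ)) := by
    rw [mul_sub, ← e1, ← e2, ← integral_sub i1 i2]
    simp only [hF, sub_mul]
  have hFcr (t : ℝ) : ‖F t‖ ≤ (A + 1) * Q ^ 4 * Real.log z := by
    have h1 : ‖1 / ((σ : ℂ) + t * Complex.I - 1) ^ 2‖ ≤ Q ^ 2 := by
      rw [norm_div, norm_one, norm_pow, div_le_iff₀ (pow_pos (lt_of_lt_of_le (by linarith) (hre t)) 2), ← mul_pow]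
      refine one_le_pow₀ ?_
      calc (1 : ℝ) = Q * (σ - 1) := by
            rw [hσ, hQd, add_sub_cancel_left]; exact (mul_one_div_cancel (by linarith)).symm
        _ ≤ _ := mul_le_mul_of_nonneg_left (hre t) (by linarith)
    have h2 : Q ^ 2 ≤ Q ^ 4 * Real.log z := by
      calc Q ^ 2 ≤ Q ^ 4 := pow_le_pow_right₀ (by linarith) (by norm_num)
        _ ≤ _ := le_mul_of_one_le_right (by positivity) hL
    have h3 := hA' t
    rw [← hQd] at h3
    rw [hF]
    have := norm_sub_le (LSeries (vco z 1 (1 : DirichletCharacter ℂ 1)) (σ + t * Complex.I))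
      (1 / ((σ : ℂ) + t * Complex.I - 1) ^ 2)
    simp only
    linarith
  have hQ16 : 16 ≤ Q := hQd ▸ hQ
  have key := norm_integral_trapKer_le hx hδ0 hδ1 hσ (T := Q ^ 6) (one_le_pow₀ (by linarith)) hFi hFcr
  have hsq0 : 1 ≤ Real.sqrt (Real.log x) := Real.one_le_sqrt.2 (by linarith)
  have tail : 96 * π * ((A + 1) * Q ^ 4 * Real.log z) * x / (1 / Real.log x * Q ^ 6) ≤
      96 * π * (A + 1) * (x * Real.sqrt (Real.log x) * Real.log z ^ 2) := by
    rw [← hQd]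
    have e : 96 * π * ((A + 1) * Q ^ 4 * Real.log z) * x / (1 / Q * Q ^ 6) =
        96 * π * (A + 1) * (x * (1 / Q) * Real.log z) := by field_simp
    rw [e]
    have : 1 / Q ≤ Real.sqrt Q := ((div_le_one (by linarith)).2 (by linarith)).trans (hQd ▸ hsq0)
    gcongr
    nlinarith
  have main : (∫ t in Set.Icc (-Q ^ 6) (Q ^ 6), ‖F t * trapKer x (1 / Real.log x) (σ + t * Complex.I)‖) ≤
      24 * B * D * (x * Real.sqrt (Real.log x) * Real.log z ^ 2) := by
    calc _ ≤ ∫ t in Set.Icc (-Q ^ 6) (Q ^ 6), (B * Real.log z ^ 2 * (24 * x * Real.sqrt (Real.log x))) *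
          (1 + ‖t‖ ^ 2) ^ (-(3 / 2 : ℝ) / 2) := by
          refine setIntegral_mono_on hFi.norm.integrableOn (ik.const_mul _).integrableOn measurableSet_Icc
            fun t ht => ?_
          rw [norm_mul, mul_assoc (B * Real.log z ^ 2)]
          refine mul_le_mul ?_ (hker t) (norm_nonneg _) (by positivity)
          rw [hF]
          exact hB' t (abs_le.2 ht)
      _ ≤ ∫ t : ℝ, (B * Real.log z ^ 2 * (24 * x * Real.sqrt (Real.log x))) *
          (1 + ‖t‖ ^ 2) ^ (-(3 / 2 : ℝ) / 2) :=
          setIntegral_le_integral (ik.const_mul _) (Filter.Eventually.of_forall fun t => by positivity)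
      _ = _ := by rw [integral_const_mul, ← hD]; ring
  rw [hFe, norm_mul] at key
  have e2 : ‖(2 * π : ℂ)‖ = 2 * π := by
    rw [norm_mul, Complex.norm_real, norm_of_nonneg Real.pi_pos.le]; simp
  rw [e2] at key
  have hxx : x ≤ x * Real.sqrt (Real.log x) * Real.log z ^ 2 := by
    rw [mul_assoc]
    exact le_mul_of_one_le_right hx0.le (one_le_mul_of_one_le_of_one_le hsq0 hL2)
  have hpi : (1 : ℝ) ≤ 2 * π := by linarith [Real.pi_gt_three]
  generalize (∫ v in Set.Ioi (0 : ℝ), v * Real.exp v * trap x (1 / Real.log x) (Real.exp v) : ℝ) = I at *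
  have h1 : ‖trapSum (vco z 1 (1 : DirichletCharacter ℂ 1)) x (1 / Real.log x) - (I : ℂ)‖ ≤
      (24 * B * D + 96 * π * (A + 1)) * (x * Real.sqrt (Real.log x) * Real.log z ^ 2) := by
    refine le_trans (le_mul_of_one_le_left (norm_nonneg _) hpi) ?_
    linarith
  have h2 : ‖(I : ℂ) - ((x * Real.log x : ℝ) : ℂ)‖ ≤ 2 * x := by
    rw [← Complex.ofReal_sub, Complex.norm_real]; exact hI
  have := norm_add_le (trapSum (vco z 1 (1 : DirichletCharacter ℂ 1)) x (1 / Real.log x) - (I : ℂ))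
    ((I : ℂ) - ((x * Real.log x : ℝ) : ℂ))
  rw [sub_add_sub_cancel] at this
  linarith

lemma exists_lvl {q : ℕ} {Q : ℝ} (hq : 1 ≤ q) (hqQ : (q : ℝ) ≤ Q) (hQ : 16 ≤ Q) :
    ∃ w z : ℕ, Lvl q w z Q ∧ (z : ℝ) ≤ Q ^ 256 := by
  obtain ⟨w, hw, h1, h2⟩ := exists_dpow_le (r := Q ^ 4) ((by linarith : (2 : ℝ) ≤ Q).trans (le_self_pow₀ (by linarith) (by norm_num)))
  refine ⟨w, w ^ 64, ⟨hq, hw, rfl, hqQ, hQ, ?_, h1⟩, ?_⟩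
  · refine (pow_le_pow_iff_left₀ (by positivity) (by positivity) two_ne_zero).1 ?_
    rw [← pow_mul]
    exact h2.le
  · push_cast
    calc (w : ℝ) ^ 64 ≤ (Q ^ 4) ^ 64 := by gcongr
      _ = _ := by rw [← pow_mul]

lemma psiChar_modOne (x : ℝ) :
    psiChar (1 : DirichletCharacter ℂ 1) x = ((∑ n ∈ Icc 1 ⌊x⌋₊, vonMangoldt n : ℝ) : ℂ) := by
  rw [psiChar, Complex.ofReal_sum]
  refine sum_congr rfl fun n _ => ?_
  rw [Subsingleton.elim (n : ZMod 1) 1, map_one, mul_one]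

/-- The prime number theorem with a power of `log x` saved. -/
theorem exists_abs_sum_vonMangoldt_sub_le : ∃ C X : ℝ, 0 < C ∧ ∀ x : ℝ, X ≤ x →
    |∑ n ∈ Icc 1 ⌊x⌋₊, vonMangoldt n - x| ≤ C * x * Real.log x ^ (-(3 / 10) : ℝ) := by
  obtain ⟨A, hA, HA⟩ := norm_trapSum_vco_sub_le
  obtain ⟨B, hB, HB⟩ := norm_trapSum_vco_sub_psiChar_le
  have hev : ∀ᶠ x : ℝ in Filter.atTop, Real.log x ^ 256 ≤ 1 * x ^ (3 / 4 : ℝ) := by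
    have h1 := (isLittleO_log_rpow_rpow_atTop 256 (show (0 : ℝ) < 3 / 4 by norm_num)).bound one_pos
    filter_upwards [h1, Filter.eventually_ge_atTop 1] with x hx hx1
    have e : Real.log x ^ (256 : ℝ) = Real.log x ^ (256 : ℕ) := by
      rw [← Real.rpow_natCast]; norm_num
    rw [e, Real.norm_of_nonneg (pow_nonneg (Real.log_nonneg hx1) _),
      Real.norm_of_nonneg (by positivity)] at hx
    exact hx
  obtain ⟨X, hX⟩ := Filter.eventually_atTop.1
    (hev.and (Filter.eventually_ge_atTop (max (Real.exp 16) (3 ^ 20))))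
  refine ⟨A * 2560 ^ 2 + B, X, by positivity, fun x hx => ?_⟩
  obtain ⟨h1, h2⟩ := hX x hx
  rw [one_mul] at h1
  have hx16 := (le_max_left _ _).trans h2
  have hx3 := (le_max_right _ _).trans h2
  have hx0 : 0 < x := lt_of_lt_of_le (by positivity) hx3
  have hQ : 16 ≤ Real.log x := (Real.le_log_iff_exp_le hx0).2 hx16
  obtain ⟨w, z, hlv, hz⟩ := exists_lvl (q := 1) (Q := Real.log x) le_rfl (by push_cast; linarith) hQ
  obtain ⟨r, hr⟩ : ∃ r : ℝ, r = x ^ (1 / 20 : ℝ) := ⟨_, rfl⟩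
  have hr0 : 0 < r := by rw [hr]; positivity
  have hr20 : r ^ 20 = x := by
    rw [hr, ← Real.rpow_natCast, ← Real.rpow_mul hx0.le]; norm_num
  have hr15 : r ^ 15 = x ^ (3 / 4 : ℝ) := by
    rw [hr, ← Real.rpow_natCast, ← Real.rpow_mul hx0.le]; norm_num
  have hr3 : 3 ≤ r := by
    refine (pow_le_pow_iff_left₀ (by norm_num) hr0.le (by norm_num : 20 ≠ 0)).1 ?_
    rw [hr20]; exact hx3
  have k1 := HA w z x hlv (by linarith)
  have k2 := HB 1 z 1 r x hr3 (by push_cast; nlinarith) hr20.symm ((hz.trans h1).trans hr15.ge)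
  rw [psiChar_modOne] at k2
  have hl := hlv.log_le
  have hlz := hlv.one_le_log
  clear hlv hz h1
  generalize Real.log x = Q at *
  generalize (∑ n ∈ Icc 1 ⌊x⌋₊, vonMangoldt n) = P at *
  have hQ0 : 0 < Q := by linarith
  have k3 : ‖(((Q * (P - x) : ℝ)) : ℂ)‖ ≤ A * x * Real.sqrt Q * Real.log z ^ 2 + B * x := by
    have := norm_sub_le (trapSum (vco z 1 (1 : DirichletCharacter ℂ 1)) x (1 / Q) - ((x * Q : ℝ) : ℂ))
      (trapSum (vco z 1 (1 : DirichletCharacter ℂ 1)) x (1 / Q) - (Q : ℂ) * (P : ℂ))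
    refine le_trans (le_of_eq ?_) (this.trans (add_le_add k1 k2))
    congr 1
    push_cast
    ring
  rw [Complex.norm_real, Real.norm_eq_abs, abs_mul, abs_of_pos hQ0] at k3
  have hlogQ : Real.log Q ≤ Q ^ (1 / 10 : ℝ) * 10 := by
    have := Real.log_le_rpow_div hQ0.le (show (0 : ℝ) < 1 / 10 by norm_num)
    linarith
  have hz2 : Real.log z ^ 2 ≤ 2560 ^ 2 * Q ^ (1 / 5 : ℝ) := by
    calc Real.log z ^ 2 ≤ (2560 * Q ^ (1 / 10 : ℝ)) ^ 2 :=
          pow_le_pow_left₀ (by linarith) (by linarith) 2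
      _ = _ := by
          rw [mul_pow, ← Real.rpow_natCast (Q ^ (1 / 10 : ℝ)), ← Real.rpow_mul hQ0.le]; norm_num
  have e1 : Real.sqrt Q * Q ^ (1 / 5 : ℝ) = Q * Q ^ (-(3 / 10) : ℝ) := by
    rw [Real.sqrt_eq_rpow, ← Real.rpow_add hQ0]
    nth_rw 2 [← Real.rpow_one Q]
    rw [← Real.rpow_add hQ0]
    norm_num
  have e2 : 1 ≤ Q * Q ^ (-(3 / 10) : ℝ) := by
    nth_rw 1 [← Real.rpow_one Q]
    rw [← Real.rpow_add hQ0]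
    exact Real.one_le_rpow (by linarith) (by norm_num)
  refine le_of_mul_le_mul_left ?_ hQ0
  calc Q * |P - x| ≤ A * x * Real.sqrt Q * (2560 ^ 2 * Q ^ (1 / 5 : ℝ)) + B * x * 1 := by
        refine k3.trans ?_
        rw [mul_one]
        gcongr
    _ = A * x * 2560 ^ 2 * (Real.sqrt Q * Q ^ (1 / 5 : ℝ)) + B * x * 1 := by ring
    _ ≤ A * x * 2560 ^ 2 * (Q * Q ^ (-(3 / 10) : ℝ)) + B * x * (Q * Q ^ (-(3 / 10) : ℝ)) := by
        rw [e1]; gcongr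
    _ = _ := by ring

lemma exp_sum_prime_le_dser_mul {q z : ℕ} {ψ : DirichletCharacter ℂ q} (hψ : ψ ^ 2 = 1) {x : ℝ}
    (hx : 1 < x) (S : Finset ℕ) (hS : ∀ p ∈ S, p.Prime ∧ z < p ∧ (p : ℝ) ≤ x ∧ p.Coprime q) :
    Real.exp ((∑ p ∈ S, (1 + (ψ p).re) / p) / 3) ≤
      ‖dser z 0 (1 : DirichletCharacter ℂ q) (1 + 1 / Real.log x : ℝ)‖ *
        ‖dser z 0 ψ (1 + 1 / Real.log x : ℝ)‖ := by
  classical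
  have hl : 0 < Real.log x := Real.log_pos hx
  obtain ⟨σ, hσ⟩ : ∃ σ : ℝ, σ = 1 + 1 / Real.log x := ⟨_, rfl⟩
  have hσ1 : 1 < σ := by rw [hσ]; have : 0 < 1 / Real.log x := by positivity
                         linarith
  have hs : 1 < (σ : ℂ).re := by simpa using hσ1
  rw [← hσ]
  have T (θ : DirichletCharacter ℂ q) := LSeriesSummable_of_le_log (norm_logco_le z θ) hs
  have T2 := (T 1).add (T ψ)
  rw [norm_dser_zero z _ hs, norm_dser_zero z _ hs, ← Real.exp_add, ← Complex.add_re,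
    ← LSeries_add (T _) (T _), Real.exp_le_exp, LSeries, Complex.re_tsum T2]
  have hco (n : ℕ) : ((logco z (1 : DirichletCharacter ℂ q) + logco z ψ) n).re =
      if Rough z n then ((1 : DirichletCharacter ℂ q) n + ψ n).re * (vonMangoldt n / Real.log n) else 0 := by
    have e : (logco z (1 : DirichletCharacter ℂ q) + logco z ψ) n =
        (liftChar z (1 : DirichletCharacter ℂ q) n + liftChar z ψ n) *
          ((vonMangoldt n / Real.log n : ℝ) : ℂ) := by
      simp only [Pi.add_apply, logco]; push_cast; ring
    rw [e, Complex.re_mul_ofReal, liftChar_apply, liftChar_apply]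
    split_ifs <;> simp
  have hnn (n : ℕ) : 0 ≤ (LSeries.term (logco z (1 : DirichletCharacter ℂ q) + logco z ψ) σ n).re := by
    rcases eq_or_ne n 0 with rfl | hn
    · simp
    rw [re_term_ofReal _ _ hn]
    refine mul_nonneg ?_ (by positivity)
    rw [hco]
    split_ifs
    · refine mul_nonneg ?_ (div_nonneg vonMangoldt_nonneg (Real.log_natCast_nonneg _))
      by_cases hu : IsUnit (n : ZMod q)
      · rw [MulChar.one_apply hu]
        rcases real_char_values hψ n with h | h | h <;> rw [h] <;> norm_num
      · rw [MulChar.map_nonunit _ hu, MulChar.map_nonunit _ hu]; simp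
    · exact le_rfl
  have hsum : Summable fun n => (LSeries.term (logco z (1 : DirichletCharacter ℂ q) + logco z ψ) σ n).re :=
    Complex.reCLM.summable T2
  refine le_trans ?_ (hsum.sum_le_tsum S fun n _ => hnn n)
  rw [sum_div]
  refine sum_le_sum fun p hp => ?_
  obtain ⟨hpp, hzp, hpx, hcop⟩ := hS p hp
  have hp2 : (2 : ℝ) ≤ p := by exact_mod_cast hpp.two_le
  have hp0 : (0 : ℝ) < p := by linarith
  have hr : Rough z p := fun l hl hlz hd => by
    have := (Nat.prime_dvd_prime_iff_eq hl hpp).1 hd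
    omega
  have hu : IsUnit (p : ZMod q) := (ZMod.isUnit_iff_coprime p q).2 hcop
  rw [re_term_ofReal _ _ hpp.ne_zero, hco, if_pos hr, MulChar.one_apply hu,
    ArithmeticFunction.vonMangoldt_apply_prime hpp, div_self (Real.log_pos (by linarith)).ne', mul_one,
    Complex.add_re, Complex.one_re]
  have h1 : 0 ≤ 1 + (ψ p).re := by
    rcases real_char_values hψ p with h | h | h <;> rw [h] <;> norm_num
  rw [div_div, div_eq_mul_inv]
  refine mul_le_mul_of_nonneg_left ?_ h1
  have e : (p : ℝ) ^ (-σ) = (p : ℝ)⁻¹ * Real.exp (-(Real.log p / Real.log x)) := by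
    rw [hσ, neg_add, Real.rpow_add hp0, Real.rpow_neg_one, Real.rpow_def_of_pos hp0]
    congr 2
    ring
  rw [e, mul_inv]
  refine mul_le_mul_of_nonneg_left ?_ (by positivity)
  have h2 : Real.log p / Real.log x ≤ 1 := (div_le_one hl).2 (Real.log_le_log hp0 hpx)
  calc (3 : ℝ)⁻¹ ≤ Real.exp (-1) := by
        rw [Real.exp_neg]
        exact inv_anti₀ (Real.exp_pos _) (by linarith [Real.exp_one_lt_d9])
    _ ≤ _ := Real.exp_le_exp.2 (by linarith)

/-- A lower bound for the exceptional `L`-value in terms of the sum of `(1 + ψ(p)) / p`. -/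
lemma exp_sum_prime_le_dser : ∃ C : ℝ, 0 < C ∧ ∀ (w z q : ℕ) (Q x : ℝ) [NeZero q]
    (ψ : DirichletCharacter ℂ q), ψ ^ 2 = 1 → Lvl q w z Q → 2 ≤ Real.log x → Real.log x ≤ Q →
    (z : ℝ) ≤ x → Real.exp ((∑ p ∈ (Icc ⌈Q⌉₊ ⌊x⌋₊).filter Nat.Prime, (1 + (ψ p).re) / p) / 3) ≤
      C * (Real.log x / Real.log z) * ‖dser z 0 ψ (1 + 1 / Real.log x : ℝ)‖ := by
  obtain ⟨A, hA, HA⟩ := norm_dser_bounds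
  refine ⟨2 * A * Real.exp 176, by positivity, fun w z q Q x _ ψ hψ h hx1 hx2 hzx => ?_⟩
  have hQ := h.hQ
  have hL := h.one_le_log
  have hlQ := h.one_le_logQ
  have hQz : Q ≤ z := by
    have h1 : Q ≤ Q ^ 2 := le_self_pow₀ (by linarith) two_ne_zero
    have h2 : (1 : ℝ) ≤ w := by nlinarith [h.hw1]
    have h3 : (w : ℝ) ≤ w ^ 64 := le_self_pow₀ h2 (by norm_num)
    rw [h.hz]
    push_cast
    linarith [h.hw1]
  have hz1 : 1 < (z : ℝ) := by linarith
  have hx0 : 1 < x := by linarith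
  have hlz : Real.log z ≤ Real.log x := Real.log_le_log (by linarith) hzx
  have hψ0 (p : ℕ) : 0 ≤ 1 + (ψ p).re ∧ 1 + (ψ p).re ≤ 2 := by
    rcases real_char_values hψ p with h | h | h <;> rw [h] <;> norm_num
  have main := exp_sum_prime_le_dser_mul (z := z) hψ hx0
    (((Icc ⌈Q⌉₊ ⌊x⌋₊).filter Nat.Prime).filter (z < ·)) fun p hp => by
      obtain ⟨h1, h2⟩ := mem_filter.1 hp
      obtain ⟨h3, h4⟩ := mem_filter.1 h1
      refine ⟨h4, h2, (Nat.le_floor_iff (by linarith)).1 (mem_Icc.1 h3).2, ?_⟩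
      refine (Nat.Prime.coprime_iff_not_dvd h4).2 fun hd => ?_
      have h5 := Nat.le_of_dvd (Nat.pos_of_ne_zero (NeZero.ne q)) hd
      have h6 : (q : ℝ) ≤ z := h.hqQ.trans hQz
      have h7 : q ≤ z := by exact_mod_cast h6
      omega
  have small : ∑ p ∈ ((Icc ⌈Q⌉₊ ⌊x⌋₊).filter Nat.Prime).filter (¬ z < ·), (1 + (ψ p).re) / p ≤ 528 := by
    calc _ ≤ ∑ p ∈ ((Icc ⌈Q⌉₊ ⌊x⌋₊).filter Nat.Prime).filter (¬ z < ·), 2 * ((1 : ℝ) / p) := by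
          refine sum_le_sum fun p _ => ?_
          rw [mul_one_div]
          exact div_le_div_of_nonneg_right (hψ0 p).2 (by positivity)
      _ ≤ 2 * ((Real.log z + 6) / Real.log Q) := by
          rw [← mul_sum]
          refine mul_le_mul_of_nonneg_left (sum_prime_inv_le Q (by linarith) z
            (by exact_mod_cast hz1.le) _ fun p hp => ?_) (by norm_num)
          obtain ⟨h1, h2⟩ := mem_filter.1 hp
          obtain ⟨h3, h4⟩ := mem_filter.1 h1
          exact ⟨h4, (Nat.ceil_le.1 (mem_Icc.1 h3).1), not_lt.1 h2⟩
      _ ≤ 528 := by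
          have : (Real.log z + 6) / Real.log Q ≤ 262 := by
            rw [div_le_iff₀ (by linarith)]
            linarith [h.log_le]
          linarith
  rw [← sum_filter_add_sum_filter_not _ (z < ·)]
  have hup : ‖dser z 0 (1 : DirichletCharacter ℂ q) (1 + 1 / Real.log x : ℝ)‖ ≤
      2 * A * (Real.log x / Real.log z) := by
    have hδ : 1 / Q ≤ 1 / Real.log x := one_div_le_one_div_of_le (by linarith) hx2
    have hδ1 : 1 / Real.log x ≤ 1 := (div_le_one (by linarith)).2 (by linarith)
    have h1 := (HA w z q Q 1 0 ((1 + 1 / Real.log x : ℝ) : ℂ) h (by norm_num)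
      (by rw [Complex.ofReal_re]; linarith) (by rw [Complex.ofReal_re]; linarith)
      (by rw [Complex.ofReal_im, abs_zero]; positivity)).2
    have e : ‖((1 + 1 / Real.log x : ℝ) : ℂ) - 1‖ = 1 / Real.log x := by
      rw [← Complex.ofReal_one, ← Complex.ofReal_sub, Complex.norm_real, add_sub_cancel_left]
      exact Real.norm_of_nonneg (by positivity)
    rw [e, pow_zero, zero_add, pow_one, mul_one] at h1
    have e2 : 1 / (Real.log z * (1 / Real.log x)) = Real.log x / Real.log z := by field_simp
    rw [e2] at h1
    have h2 : 1 ≤ Real.log x / Real.log z := (one_le_div (by linarith)).2 hlz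
    have hA0 : 0 < A := by linarith
    nlinarith
  rw [add_div, Real.exp_add]
  calc _ ≤ (‖dser z 0 (1 : DirichletCharacter ℂ q) (1 + 1 / Real.log x : ℝ)‖ *
        ‖dser z 0 ψ (1 + 1 / Real.log x : ℝ)‖) * Real.exp 176 := by
        refine mul_le_mul main (Real.exp_le_exp.2 (by linarith)) (Real.exp_pos _).le (by positivity)
    _ ≤ (2 * A * (Real.log x / Real.log z) * ‖dser z 0 ψ (1 + 1 / Real.log x : ℝ)‖) * Real.exp 176 := by
        gcongr
    _ = _ := by ring

lemma norm_psiChar_one_sub_sum_le {q : ℕ} (hq : 1 ≤ q) (x : ℝ) :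
    ‖psiChar (1 : DirichletCharacter ℂ q) x - ((∑ n ∈ Icc 1 ⌊x⌋₊, vonMangoldt n : ℝ) : ℂ)‖ ≤
      q * Real.log (⌊x⌋₊ : ℝ) := by
  classical
  refine le_trans ?_ (sum_vonMangoldt_not_rough_le q ⌊x⌋₊)
  rw [psiChar, Complex.ofReal_sum, ← sum_sub_distrib]
  refine (norm_sum_le _ _).trans (sum_le_sum fun n _ => ?_)
  have hL := vonMangoldt_nonneg (n := n)
  by_cases hn : n.Coprime q
  · rw [MulChar.one_apply ((ZMod.isUnit_iff_coprime n q).2 hn), mul_one, sub_self, norm_zero]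
    split_ifs
    · exact le_rfl
    · exact hL
  · have hr : ¬ Rough q n := fun h => by
      obtain ⟨p, hp, hpn, hpq⟩ := Nat.Prime.not_coprime_iff_dvd.1 hn
      exact h p hp (Nat.le_of_dvd hq hpq) hpn
    rw [MulChar.map_nonunit _ (mt (ZMod.isUnit_iff_coprime n q).1 hn), mul_zero, zero_sub, norm_neg,
      Complex.norm_real, Real.norm_of_nonneg hL, if_neg hr]

lemma exists_norm_psiChar_one_sub_le : ∃ C X : ℝ, 0 < C ∧ ∀ (q : ℕ) (x : ℝ), 1 ≤ q → X ≤ x →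
    (q : ℝ) ^ 10 ≤ x →
    ‖psiChar (1 : DirichletCharacter ℂ q) x - x‖ ≤ C * x * Real.log x ^ (-(3 / 10) : ℝ) := by
  obtain ⟨C, X, hC, H⟩ := exists_abs_sum_vonMangoldt_sub_le
  have hev : ∀ᶠ x : ℝ in Filter.atTop,
      Real.log x ^ (13 / 10 : ℝ) ≤ 1 * x ^ (9 / 10 : ℝ) := by
    have h1 := (isLittleO_log_rpow_rpow_atTop (13 / 10)
      (show (0 : ℝ) < 9 / 10 by norm_num)).bound one_pos
    filter_upwards [h1, Filter.eventually_ge_atTop 1] with x hx hx1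
    rwa [Real.norm_of_nonneg (rpow_nonneg (Real.log_nonneg hx1) _),
      Real.norm_of_nonneg (by positivity)] at hx
  obtain ⟨Y, hY⟩ := Filter.eventually_atTop.1 (hev.and (Filter.eventually_ge_atTop 2))
  refine ⟨C + 1, max X Y, by positivity, fun q x hq hx hqx => ?_⟩
  obtain ⟨h1, h2⟩ := hY x ((le_max_right _ _).trans hx)
  have k := H x ((le_max_left _ _).trans hx)
  have hx0 : 0 < x := by linarith
  have hl : 0 < Real.log x := Real.log_pos (by linarith)
  have hfl : 1 ≤ ⌊x⌋₊ := Nat.le_floor (by push_cast; linarith)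
  have hqr : (q : ℝ) ≤ x ^ (1 / 10 : ℝ) := by
    refine (pow_le_pow_iff_left₀ (by positivity) (by positivity) (by norm_num : 10 ≠ 0)).1 ?_
    rw [← Real.rpow_natCast (x ^ (1 / 10 : ℝ)), ← Real.rpow_mul hx0.le]
    norm_num
    exact hqx
  have k2 : (q : ℝ) * Real.log (⌊x⌋₊ : ℝ) ≤ x * Real.log x ^ (-(3 / 10) : ℝ) := by
    have e1 : Real.log x = Real.log x ^ (13 / 10 : ℝ) * Real.log x ^ (-(3 / 10) : ℝ) := by
      rw [← Real.rpow_add hl]; norm_num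
    have e2 : x = x ^ (1 / 10 : ℝ) * x ^ (9 / 10 : ℝ) := by
      rw [← Real.rpow_add hx0]; norm_num
    calc (q : ℝ) * Real.log (⌊x⌋₊ : ℝ) ≤ x ^ (1 / 10 : ℝ) * Real.log x := by
          refine mul_le_mul hqr ?_ (Real.log_natCast_nonneg _) (by positivity)
          exact Real.log_le_log (by exact_mod_cast hfl) (Nat.floor_le hx0.le)
      _ = x ^ (1 / 10 : ℝ) * (Real.log x ^ (13 / 10 : ℝ) * Real.log x ^ (-(3 / 10) : ℝ)) := by
          rw [← e1]
      _ ≤ x ^ (1 / 10 : ℝ) * (1 * x ^ (9 / 10 : ℝ) * Real.log x ^ (-(3 / 10) : ℝ)) := by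
          gcongr
      _ = _ := by rw [one_mul, ← mul_assoc, ← e2]
  have k3 := norm_psiChar_one_sub_sum_le hq x
  have k4 : ‖((∑ n ∈ Icc 1 ⌊x⌋₊, vonMangoldt n : ℝ) : ℂ) - x‖ ≤
      C * x * Real.log x ^ (-(3 / 10) : ℝ) := by
    rw [← Complex.ofReal_sub, Complex.norm_real]; exact k
  calc _ ≤ _ := norm_sub_le_norm_sub_add_norm_sub _ ((∑ n ∈ Icc 1 ⌊x⌋₊, vonMangoldt n : ℝ) : ℂ) _
    _ ≤ x * Real.log x ^ (-(3 / 10) : ℝ) + C * x * Real.log x ^ (-(3 / 10) : ℝ) :=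
        add_le_add (k3.trans k2) k4
    _ = _ := by ring

lemma log_mul_log_bounds {q : ℕ} {x : ℝ} (hq : 1 ≤ q) (hx : Real.exp 16 ≤ x)
    (hqx : (q : ℝ) ^ 10 ≤ x) :
    16 ≤ (q : ℝ) * Real.log x ∧ 1 < Real.log x / Real.log (q * Real.log x) := by
  have hx0 : 0 < x := (Real.exp_pos _).trans_le hx
  have hl : 16 ≤ Real.log x := (Real.le_log_iff_exp_le hx0).2 hx
  have hq1 : (1 : ℝ) ≤ q := by exact_mod_cast hq
  have hQ : 16 ≤ (q : ℝ) * Real.log x := by nlinarith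
  refine ⟨hQ, ?_⟩
  rw [one_lt_div (Real.log_pos (by linarith)), Real.log_mul (by positivity) (by positivity)]
  have h1 := Real.log_le_log (by positivity) hqx
  rw [Real.log_pow] at h1
  push_cast at h1
  have h2 := Real.log_le_sub_one_of_pos (show 0 < Real.log x / 2 by linarith)
  rw [Real.log_div (by positivity) two_ne_zero] at h2
  linarith [Real.log_two_lt_d9]

lemma exists_character_of_large : ∃ C X : ℝ, 0 < C ∧ ∀ (q : ℕ) (x Q u : ℝ) [NeZero q], X ≤ x →
    (q : ℝ) ^ 10 ≤ x → Q = q * Real.log x → u = Real.log x / Real.log Q → 350 ≤ u →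
    ∃ ψ : DirichletCharacter ℂ q, ψ ^ 2 = 1 ∧
      (∀ a : ZMod q, IsUnit a →
        ‖(q.totient : ℂ) * psiCls a 0 x - x -
          (open Classical in if ψ = 1 then 0 else ψ a * psiChar ψ x)‖ ≤
          C * x * u ^ (-(3 / 10) : ℝ)) ∧
      (ψ ≠ 1 → 30 * Real.log (Real.log u) <
          ∑ p ∈ (Icc ⌈Q⌉₊ ⌊x⌋₊).filter Nat.Prime, (1 + (ψ p).re) / p →
        ‖psiChar ψ x‖ ≤ C * x * (Real.log u)⁻¹) := by
  obtain ⟨A, X, hA, HA⟩ := exists_norm_psiChar_one_sub_le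
  obtain ⟨B, hB, HB⟩ := norm_psiCls_sub_le
  obtain ⟨D, hD, HD⟩ := exp_sum_prime_le_dser
  refine ⟨A + 256 * B + B * D, max X (max (Real.exp 16) (3 ^ 20)), by positivity,
    fun q x Q u _ hx hqx hQd hud hu => ?_⟩
  have hxX := (le_max_left _ _).trans hx
  have hx16 := (le_max_left _ _).trans ((le_max_right _ _).trans hx)
  have hx3 := (le_max_right _ _).trans ((le_max_right _ _).trans hx)
  have hx0 : 0 < x := lt_of_lt_of_le (by positivity) hx3
  have hl : 16 ≤ Real.log x := (Real.le_log_iff_exp_le hx0).2 hx16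
  have hq : 1 ≤ q := NeZero.one_le
  have hq1 : (1 : ℝ) ≤ q := by exact_mod_cast hq
  have hQ : 16 ≤ Q := hQd ▸ (log_mul_log_bounds hq hx16 hqx).1
  have hxQ : Real.log x ≤ Q := by rw [hQd]; nlinarith
  have hqQ : (q : ℝ) ≤ Q := by rw [hQd]; nlinarith
  have hlQ : 1 ≤ Real.log Q := by
    rw [Real.le_log_iff_exp_le (by linarith)]; linarith [Real.exp_one_lt_d9]
  have hul : Real.log x = u * Real.log Q := by rw [hud]; field_simp
  have hux : u ≤ Real.log x := by rw [hul]; nlinarith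
  obtain ⟨w, z, hlv, hz⟩ := exists_lvl hq hqQ hQ
  obtain ⟨r, hr⟩ : ∃ r : ℝ, r = x ^ (1 / 20 : ℝ) := ⟨_, rfl⟩
  have hr0 : 0 < r := by rw [hr]; positivity
  have hr20 : r ^ 20 = x := by
    rw [hr, ← Real.rpow_natCast, ← Real.rpow_mul hx0.le]; norm_num
  have hlr : Real.log x = 20 * Real.log r := by rw [← hr20, Real.log_pow]; norm_num
  have hr3 : 3 ≤ r := by
    refine (pow_le_pow_iff_left₀ (by norm_num) hr0.le (by norm_num : 20 ≠ 0)).1 ?_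
    rw [hr20]; exact hx3
  have hqr : (q : ℝ) ≤ r ^ 2 := by
    refine (pow_le_pow_iff_left₀ (by positivity) (by positivity) (by norm_num : 10 ≠ 0)).1 ?_
    rw [← pow_mul, hr20]; exact hqx
  have hzr : (z : ℝ) ≤ r ^ 15 := by
    refine hz.trans ((Real.log_le_log_iff (by positivity) (by positivity)).1 ?_)
    rw [Real.log_pow, Real.log_pow]
    push_cast
    nlinarith
  have hzx : (z : ℝ) ≤ x := hzr.trans (hr20 ▸ pow_le_pow_right₀ (by linarith) (by norm_num))
  obtain ⟨ψ, hψ, h1, h2⟩ := HB w z q Q r x hlv hr3 hqr hr20.symm hzr hxQ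
  have hlz := hlv.one_le_log
  have hratio : Real.log z / Real.log x ≤ 256 / u := by
    rw [div_le_div_iff₀ (by linarith) (by linarith), hul]
    nlinarith [hlv.log_le]
  have hlu : 1 ≤ Real.log u := by
    rw [Real.le_log_iff_exp_le (by linarith)]; linarith [Real.exp_one_lt_d9]
  have hu1 : u⁻¹ ≤ u ^ (-(3 / 10) : ℝ) := by
    rw [← Real.rpow_neg_one]
    exact Real.rpow_le_rpow_of_exponent_le (by linarith) (by norm_num)
  have hu2 : u⁻¹ ≤ (Real.log u)⁻¹ :=
    inv_anti₀ (by linarith) ((Real.log_le_sub_one_of_pos (by linarith)).trans (by linarith))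
  refine ⟨ψ, hψ, fun a ha => ?_, fun hne hM => ?_⟩
  · have k1 := h1 a ha
    have k2 := HA q x hq hxX hqx
    have k3 : Real.log x ^ (-(3 / 10) : ℝ) ≤ u ^ (-(3 / 10) : ℝ) :=
      Real.rpow_le_rpow_of_nonpos (by linarith) hux (by norm_num)
    generalize (open Classical in if ψ = 1 then 0 else ψ a * psiChar ψ x) = m at *
    have e : (q.totient : ℂ) * psiCls a 0 x - x - m =
        ((q.totient : ℂ) * psiCls a 0 x - psiChar (1 : DirichletCharacter ℂ q) x - m) +
          (psiChar (1 : DirichletCharacter ℂ q) x - x) := by ring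
    rw [e]
    have hp : 0 ≤ u ^ (-(3 / 10) : ℝ) := by positivity
    calc _ ≤ _ := norm_add_le _ _
      _ ≤ B * (x * (256 / u)) + A * x * u ^ (-(3 / 10) : ℝ) := by
          refine add_le_add (k1.trans ?_) (k2.trans ?_) <;> gcongr
      _ = 256 * B * x * u⁻¹ + A * x * u ^ (-(3 / 10) : ℝ) := by ring
      _ ≤ 256 * B * x * u ^ (-(3 / 10) : ℝ) + A * x * u ^ (-(3 / 10) : ℝ) := by gcongr
      _ ≤ _ := by
          have : 0 ≤ B * D * x * u ^ (-(3 / 10) : ℝ) := by positivity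
          linarith
  · have k1 := HD w z q Q x ψ hψ hlv (by linarith) hxQ hzx
    have k2 := h2 hne
    have hd : 0 < ‖dser z 0 ψ (1 + 1 / Real.log x : ℝ)‖ := by
      refine norm_pos_iff.2 (dser_zero_ne_zero z ψ ?_)
      rw [Complex.ofReal_re]
      have : 0 < 1 / Real.log x := by positivity
      linarith
    have k3 : Real.log u ≤ Real.exp ((∑ p ∈ (Icc ⌈Q⌉₊ ⌊x⌋₊).filter Nat.Prime,
        (1 + (ψ p).re) / p) / 3) := by
      rw [← Real.log_le_iff_le_exp (by linarith)]
      linarith [Real.log_nonneg hlu]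
    generalize ‖dser z 0 ψ (1 + 1 / Real.log x : ℝ)‖ = l at *
    have k4 := k3.trans k1
    have k5 : Real.log z / Real.log x * (1 / l) ≤ D * (Real.log u)⁻¹ := by
      rw [← div_eq_mul_inv, mul_one_div, div_div, div_le_div_iff₀ (by positivity) (by linarith)]
      calc Real.log z * Real.log u ≤ Real.log z * (D * (Real.log x / Real.log z) * l) := by gcongr
        _ = _ := by field_simp
    calc _ ≤ _ := k2
      _ = B * x * (Real.log z / Real.log x + Real.log z / Real.log x * (1 / l)) := by ring
      _ ≤ B * x * (256 * (Real.log u)⁻¹ + D * (Real.log u)⁻¹) := by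
          have : Real.log z / Real.log x ≤ 256 * (Real.log u)⁻¹ := by
            refine hratio.trans ?_
            rw [div_eq_mul_inv]
            gcongr
          gcongr
      _ ≤ _ := by
          have : 0 ≤ A * x * (Real.log u)⁻¹ := by positivity
          linarith

/-- The dichotomy, for the normalised sums `φ(q) ψ(x; q, a)`. -/
theorem psiCls_dichotomy : ∃ C : ℝ, 0 < C ∧ ∀ (q : ℕ) (x Q u : ℝ), 1 ≤ q → (q : ℝ) ^ 10 ≤ x →
    C ≤ x → Q = q * Real.log x → u = Real.log x / Real.log Q →
    1 < u ∧ ∀ a : ZMod q, IsUnit a →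
    ‖(q.totient : ℂ) * psiCls a 0 x - x‖ ≤ C * x * (Real.log u)⁻¹ ∨
    ∃ ψ : DirichletCharacter ℂ q, ψ ≠ 1 ∧ ψ ^ 2 = 1 ∧
      ∑ p ∈ (Icc ⌈Q⌉₊ ⌊x⌋₊).filter Nat.Prime, (1 + (ψ p).re) / p ≤ 30 * Real.log (Real.log u) ∧
      ‖(q.totient : ℂ) * psiCls a 0 x - x - ψ a * psiChar ψ x‖ ≤
        C * x * u ^ (-(3 / 10) : ℝ) := by
  obtain ⟨A, X, hA, HA⟩ := exists_character_of_large
  obtain ⟨B, hB, HB⟩ := psiCls_le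
  have hl350 : 0 < Real.log 350 := Real.log_pos (by norm_num)
  obtain ⟨C, hC⟩ : ∃ C, C = max (5 * A) (max ((B + 1) * Real.log 350)
    (max X (max (Real.exp 16) (3 ^ 20)))) := ⟨_, rfl⟩
  have hC1 : 5 * A ≤ C := hC ▸ le_max_left _ _
  have hC2 : (B + 1) * Real.log 350 ≤ C := hC ▸ (le_max_left _ _).trans (le_max_right _ _)
  have hC' : max X (max (Real.exp 16) (3 ^ 20)) ≤ C :=
    hC ▸ (le_max_right _ _).trans (le_max_right _ _)
  refine ⟨C, by linarith, fun q x Q u hq hqx hx hQd hud => ?_⟩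
  have hxX := (le_max_left _ _).trans (hC'.trans hx)
  have hx16 := (le_max_left _ _).trans ((le_max_right _ _).trans (hC'.trans hx))
  have hx3 := (le_max_right _ _).trans ((le_max_right _ _).trans (hC'.trans hx))
  clear hC hC' hx
  have hx0 : 0 < x := lt_of_lt_of_le (by positivity) hx3
  have hu : 1 < u := by rw [hud, hQd]; exact (log_mul_log_bounds hq hx16 hqx).2
  have hlu : 0 < Real.log u := Real.log_pos hu
  refine ⟨hu, fun a ha => ?_⟩
  have : NeZero q := ⟨by lia⟩
  have hφ := totient_pos_real hq
  rcases le_or_gt 350 u with hu350 | hu350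
  · obtain ⟨ψ, hψ, h1, h2⟩ := HA q x Q u hxX hqx hQd hud hu350
    have k1 := h1 a ha
    have hup : u ^ (-(3 / 10) : ℝ) ≤ 4 * (Real.log u)⁻¹ := by
      have h3 := Real.log_le_rpow_div (x := u) (by linarith) (show (0 : ℝ) < 3 / 10 by norm_num)
      have h4 : 0 < u ^ (3 / 10 : ℝ) := by positivity
      rw [Real.rpow_neg (by linarith), ← div_eq_mul_inv, inv_eq_one_div, div_le_div_iff₀ h4 hlu]
      linarith
    by_cases h : ψ = 1
    · rw [if_pos h, sub_zero] at k1
      left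
      calc _ ≤ _ := k1
        _ ≤ A * x * (4 * (Real.log u)⁻¹) := by gcongr
        _ = 4 * A * x * (Real.log u)⁻¹ := by ring
        _ ≤ _ := by gcongr; linarith
    · rw [if_neg h] at k1
      by_cases hM : 30 * Real.log (Real.log u) <
          ∑ p ∈ (Icc ⌈Q⌉₊ ⌊x⌋₊).filter Nat.Prime, (1 + (ψ p).re) / p
      · left
        have k2 := h2 h hM
        have k3 : ‖ψ a * psiChar ψ x‖ ≤ A * x * (Real.log u)⁻¹ := by
          rw [norm_mul]
          exact (mul_le_of_le_one_left (norm_nonneg _) (ψ.norm_le_one a)).trans k2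
        calc _ ≤ _ := norm_le_norm_sub_add _ (ψ a * psiChar ψ x)
          _ ≤ A * x * (4 * (Real.log u)⁻¹) + A * x * (Real.log u)⁻¹ :=
              add_le_add (k1.trans (by gcongr)) k3
          _ = 5 * A * x * (Real.log u)⁻¹ := by ring
          _ ≤ _ := by gcongr
      · refine Or.inr ⟨ψ, h, hψ, not_lt.1 hM, k1.trans ?_⟩
        gcongr
        linarith
  · left
    obtain ⟨r, hr⟩ : ∃ r : ℝ, r = x ^ (1 / 20 : ℝ) := ⟨_, rfl⟩
    have hr0 : 0 < r := by rw [hr]; positivity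
    have hr20 : r ^ 20 = x := by
      rw [hr, ← Real.rpow_natCast, ← Real.rpow_mul hx0.le]; norm_num
    have hr3 : 3 ≤ r := by
      refine (pow_le_pow_iff_left₀ (by norm_num) hr0.le (by norm_num : 20 ≠ 0)).1 ?_
      rw [hr20]; exact hx3
    have hqr : (q : ℝ) ≤ r ^ 2 := by
      refine (pow_le_pow_iff_left₀ (by positivity) (by positivity) (by norm_num : 10 ≠ 0)).1 ?_
      rw [← pow_mul, hr20]; exact hqx
    have k := HB q a r 0 x hq ha (by linarith) hqr
      (hr20 ▸ pow_le_pow_right₀ (by linarith) (by norm_num)) le_rfl (by rw [hr20]; linarith)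
    rw [zero_add] at k
    have hp0 : 0 ≤ psiCls a 0 x := sum_nonneg fun n _ => by
      split_ifs
      · exact vonMangoldt_nonneg
      · exact le_rfl
    have k2 : (q.totient : ℝ) * psiCls a 0 x ≤ B * x := by
      calc _ ≤ (q.totient : ℝ) * (B * (x / q.totient)) := by gcongr
        _ = _ := by field_simp
    have e : (q.totient : ℂ) * psiCls a 0 x - x = (((q.totient : ℝ) * psiCls a 0 x - x : ℝ) : ℂ) := by
      push_cast; rfl
    rw [e, Complex.norm_real, Real.norm_eq_abs, ← div_eq_mul_inv, le_div_iff₀ hlu]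
    have k3 : |(q.totient : ℝ) * psiCls a 0 x - x| ≤ (B + 1) * x := by
      have : 0 ≤ (q.totient : ℝ) * psiCls a 0 x := by positivity
      have : 0 < B * x := by positivity
      rw [abs_le]; constructor <;> linarith
    calc _ ≤ (B + 1) * x * Real.log 350 := by
          have := Real.log_le_log (by linarith) hu350.le
          gcongr
      _ = (B + 1) * Real.log 350 * x := by ring
      _ ≤ _ := by gcongr

lemma sum_filter_vonMangoldt_eq {q : ℕ} (a : ZMod q) (x : ℝ) :
    (open Classical in ∑ n ∈ (Icc 1 ⌊x⌋₊).filter (fun n : ℕ => (n : ZMod q) = a),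
      (vonMangoldt n : ℂ)) = psiCls a 0 x := by
  classical
  have eI : Icc 1 ⌊x⌋₊ = Ioc 0 ⌊x⌋₊ := by ext n; simp [Nat.succ_le_iff]
  rw [psiCls, Nat.floor_zero, eI, sum_filter, Complex.ofReal_sum]
  refine sum_congr rfl fun n _ => ?_
  split_ifs <;> simp

end ExcChar

open Complex
open scoped Classical

noncomputable section

theorem exceptional_character_dichotomy (ε : ℝ) (hε : 0 < ε) :
    ∃ C : ℝ, 0 < C ∧ ∀ q : ℕ, 1 ≤ q → ∀ x : ℝ, (q : ℝ) ^ 10 ≤ x → C ≤ x →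
    ∀ a : ℕ, Nat.Coprime a q →
      (‖(∑ n ∈ (Finset.Icc 1 ⌊x⌋₊).filter (fun n : ℕ => (n : ZMod q) = (a : ZMod q)),
              (ArithmeticFunction.vonMangoldt n : ℂ))
          - (x / (q.totient : ℝ) : ℝ)‖ ≤
        C * (x / (q.totient : ℝ)) *
          (Real.log (Real.log x / Real.log ((q : ℝ) * Real.log x)))⁻¹)
      ∨
      (∃ χ : DirichletCharacter ℂ q, χ ≠ 1 ∧ χ ^ 2 = 1 ∧
        (∑ p ∈ (Finset.Icc ⌈(q : ℝ) * Real.log x⌉₊ ⌊x⌋₊).filter Nat.Prime,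
            (1 + (χ (p : ZMod q)).re) / (p : ℝ)) ≤
          30 * Real.log (Real.log (Real.log x / Real.log ((q : ℝ) * Real.log x))) + C ∧
        ‖(∑ n ∈ (Finset.Icc 1 ⌊x⌋₊).filter (fun n : ℕ => (n : ZMod q) = (a : ZMod q)),
              (ArithmeticFunction.vonMangoldt n : ℂ))
            - (x / (q.totient : ℝ) : ℝ)
            - χ (a : ZMod q) / (q.totient : ℝ) *
                ∑ n ∈ Finset.Icc 1 ⌊x⌋₊,
                  (ArithmeticFunction.vonMangoldt n : ℂ) * χ (n : ZMod q)‖ ≤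
          C * (x / (q.totient : ℝ)) *
            (Real.log ((q : ℝ) * Real.log x) / Real.log x)
              ^ (1 - 1 / Real.sqrt 2 - ε)) := by
  obtain ⟨C, hC, H⟩ := ExcChar.psiCls_dichotomy
  refine ⟨C, hC, fun q hq x hqx hx a ha => ?_⟩
  obtain ⟨hu, h⟩ := H q x _ _ hq hqx hx rfl rfl
  have hφ := ExcChar.totient_pos_real hq
  have hφ' : (q.totient : ℂ) ≠ 0 := by exact_mod_cast hφ.ne'
  have key (w : ℂ) (B : ℝ) (hw : ‖(q.totient : ℂ) * w‖ ≤ B) : ‖w‖ ≤ B / (q.totient : ℝ) := by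
    rw [norm_mul, Complex.norm_natCast] at hw
    rwa [le_div_iff₀' hφ]
  have e := ExcChar.sum_filter_vonMangoldt_eq (a : ZMod q) x
  have hx0 : 0 < x := hC.trans_le hx
  rcases h (a : ZMod q) ((ZMod.isUnit_iff_coprime a q).2 ha) with h | ⟨χ, h1, h2, h3, h4⟩
  · left
    rw [e]
    refine (key _ (C * x * (Real.log (Real.log x / Real.log ((q : ℝ) * Real.log x)))⁻¹) ?_).trans
      (le_of_eq (by ring))
    refine (le_of_eq ?_).trans h
    congr 1
    push_cast
    field_simp
  · refine Or.inr ⟨χ, h1, h2, ?_, ?_⟩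
    · refine le_trans (le_of_eq ?_) (h3.trans (by linarith))
      congr!
    · rw [e]
      generalize hud : Real.log x / Real.log ((q : ℝ) * Real.log x) = u at *
      rw [← inv_div (Real.log x), hud, ← Real.rpow_neg_eq_inv_rpow]
      refine (key _ (C * x * u ^ (-(3 / 10) : ℝ)) ?_).trans ?_
      · refine (le_of_eq ?_).trans h4
        rw [ExcChar.psiChar]
        congr 1
        push_cast
        field_simp
      · have hs : (7 / 10 : ℝ) ≤ 1 / Real.sqrt 2 := by
          rw [div_le_div_iff₀ (by norm_num) (by positivity)]
          nlinarith [Real.sqrt_nonneg 2, Real.sq_sqrt (show (0 : ℝ) ≤ 2 by norm_num)]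
        calc _ = C * (x / (q.totient : ℝ)) * u ^ (-(3 / 10) : ℝ) := by ring
          _ ≤ _ := by
              gcongr
              · exact hu.le
              · linarith
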